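/- Stationary phase expansion of the mKdV nonlinearity: let I ⊂ (0, ∞) be an interval and u ∈ C(I, S'(ℝ)) real-valued with ‖u‖_{E(I)} < ∞. Define N[u](t,p) = ip³ ∬_{q₁+q₂+q₃=1} e^{−itp³(1−q₁³−q₂³−q₃³)} ũ(t, pq₁) ũ(t, pq₂) ũ(t, pq₃) dq₁ dq₂. Then for all t ∈ I and p > 0, N[u](t,p) = (πp³/⟨p³t⟩) [ i|ũ(t,p)|² ũ(t,p) − (1/√3) e^{−8itp³/9} ũ(t, p/3)³ ] + R[u](t,p), where |R[u](t,p)| ≲ p³ ‖u(t)‖_{E(t)}³ / ((p³t)^{5/6} ⟨p³t⟩^{1/4}). -/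

import Mathlib

open MeasureTheory Set Filter Topology

noncomputable section

namespace MKdVPaper

/-- The Japanese bracket `⟨y⟩ = √(1+y²)`. -/
def jap (y : ℝ) : ℝ := Real.sqrt (1 + y ^ 2)

/-- Truncated Fourier-type integral recovering the physical function from a profile `w`:
`(1/π) Re ∫_0^R e^{i(px + p³ t)} w(p) dp`. -/
def physPartial (w : ℝ → ℂ) (t x R : ℝ) : ℝ :=
  (1 / Real.pi) *
    (∫ p in Ioc (0 : ℝ) R, Complex.exp (Complex.I * ((p * x + p ^ 3 * t : ℝ) : ℂ)) * w p).re

/-- `u` is the physical-space function associated with the profile `w` at time `t`, i.e.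
`u(x) = (1/π) Re ∫_0^∞ e^{i(px + p³t)} w(p) dp` as an improper integral. -/
def IsPhys (w : ℝ → ℂ) (t : ℝ) (u : ℝ → ℝ) : Prop :=
  ∀ x : ℝ, Tendsto (fun R => physPartial w t x R) atTop (𝓝 (u x))

/-- Sup norm of a profile. -/
def supN (w : ℝ → ℂ) : ℝ := ⨆ p : ℝ, ‖w p‖

/-- `L²((0,∞))` norm of the derivative of the profile. -/
def dL2 (w : ℝ → ℂ) : ℝ := (eLpNorm (deriv w) 2 (volume.restrict (Ioi 0))).toReal

/-- The `E(t)` norm: `‖ũ‖_{L^∞} + t^{-1/6} ‖∂_p ũ‖_{L²((0,∞))}`. -/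
def EnormP (t : ℝ) (w : ℝ → ℂ) : ℝ := supN w + t ^ (-(1 / 6 : ℝ)) * dL2 w

/-- Membership conditions for `E(t)` on the profile side: profile of a real-valued
distribution, bounded and continuous on `(0,∞)`, with derivative in `L²((0,∞))`. -/
structure MemE (w : ℝ → ℂ) : Prop where
  symm : ∀ p : ℝ, w (-p) = starRingEnd ℂ (w p)
  cont : ContinuousOn w (Ioi 0)
  bdd : BddAbove (range fun p : ℝ => ‖w p‖)
  diff : ∀ p ∈ Ioi (0 : ℝ), DifferentiableAt ℝ w p
  derivL2 : MemLp (deriv w) 2 (volume.restrict (Ioi 0))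

/-- A space-time function of class `E(I)`: a physical function `u` together with its
profile `w(t,p) = e^{-itp³} û(t,p)`. -/
structure ESol (I : Set ℝ) where
  u : ℝ → ℝ → ℝ
  w : ℝ → ℝ → ℂ
  memE : ∀ t ∈ I, MemE (w t)
  isPhys : ∀ t ∈ I, IsPhys (w t) t (u t)
  contt : ContinuousOn (fun q : ℝ × ℝ => w q.1 q.2) (I ×ˢ Ioi 0)

/-- Finiteness of the `E(I)` norm: `sup_{t ∈ I} ‖u(t)‖_{E(t)} < ∞`. -/
def FiniteEnorm (I : Set ℝ) (sol : ESol I) : Prop :=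
  BddAbove ((fun t => EnormP t (sol.w t)) '' I)

/-- Time derivative of a test function. -/
def dt1 (φ : ℝ → ℝ → ℝ) : ℝ → ℝ → ℝ := fun t x => deriv (fun s => φ s x) t

/-- Space derivative of a test function. -/
def dx1 (φ : ℝ → ℝ → ℝ) : ℝ → ℝ → ℝ := fun t x => deriv (fun y => φ t y) x

/-- `u` is a distributional solution of `∂ₜ u + ∂ₓ³ u + ε ∂ₓ(u³) = 0` on `I × ℝ`. -/
def IsSolOn (ε : ℝ) (u : ℝ → ℝ → ℝ) (I : Set ℝ) : Prop :=
  ∀ φ : ℝ → ℝ → ℝ,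
    ContDiff ℝ (⊤ : ℕ∞) (fun q : ℝ × ℝ => φ q.1 q.2) →
    HasCompactSupport (fun q : ℝ × ℝ => φ q.1 q.2) →
    tsupport (fun q : ℝ × ℝ => φ q.1 q.2) ⊆ interior I ×ˢ univ →
    (∫ q : ℝ × ℝ,
      (u q.1 q.2 * (dt1 φ q.1 q.2 + dx1 (dx1 (dx1 φ)) q.1 q.2)
        + ε * u q.1 q.2 ^ 3 * dx1 φ q.1 q.2)) = 0

/-- Self-similar solution: `S(t,x) = t^{-1/3} V(t^{-1/3} x)`. -/
def SelfSimilar {I : Set ℝ} (S : ESol I) : Prop :=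
  ∃ V : ℝ → ℝ, ∀ t ∈ I, ∀ x : ℝ,
    S.u t x = t ^ (-(1 / 3 : ℝ)) * V (t ^ (-(1 / 3 : ℝ)) * x)

/-- The Fourier transform at time 1 recovered from the profile: `û(1,p) = e^{ip³} ũ(1,p)`. -/
def hatAtOne (w : ℝ → ℂ) : ℝ → ℂ := fun p => Complex.exp (Complex.I * ((p ^ 3 : ℝ) : ℂ)) * w p

/-- The Fourier transforms at time 1 have the same limit at frequency `0⁺`. -/
def SameZeroLimit (w₁ w₂ : ℝ → ℂ) : Prop :=
  ∃ c : ℂ, Tendsto (hatAtOne w₁) (𝓝[>] (0 : ℝ)) (𝓝 c) ∧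
    Tendsto (hatAtOne w₂) (𝓝[>] (0 : ℝ)) (𝓝 c)

/-- Truncated Airy–Fock integral. -/
def AiP (z R : ℝ) : ℂ :=
  ((1 / Real.pi : ℝ) : ℂ) *
    ∫ p in Ioc (0 : ℝ) R, Complex.exp (Complex.I * ((p * z + p ^ 3 : ℝ) : ℂ))

/-- The Airy–Fock function `Ai(z) = (1/π)∫_0^∞ e^{i(pz+p³)} dp` (improper integral). -/
def AiFock (z : ℝ) : ℂ := limUnder atTop fun R => AiP z R

end MKdVPaper
namespace MKdVPaper

/-- Truncation of the oscillatory integral defining the nonlinearity `N[u](t,p)`. -/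
def Npartial (w : ℝ → ℝ → ℂ) (t p R : ℝ) : ℂ :=
  Complex.I * ((p ^ 3 : ℝ) : ℂ) *
    ∫ q in Metric.closedBall (0 : ℝ × ℝ) R,
      Complex.exp (-(Complex.I *
          ((t * p ^ 3 * (1 - q.1 ^ 3 - q.2 ^ 3 - (1 - q.1 - q.2) ^ 3) : ℝ) : ℂ))) *
        w t (p * q.1) * w t (p * q.2) * w t (p * (1 - q.1 - q.2))

end MKdVPaper

namespace MKdVPaper

/-- The unit complex number `e^{iθ}`. -/
def cis (θ : ℝ) : ℂ := Complex.exp ((θ : ℂ) * Complex.I)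

@[simp] lemma norm_cis (θ : ℝ) : ‖cis θ‖ = 1 := Complex.norm_exp_ofReal_mul_I θ

lemma cis_add (a b : ℝ) : cis (a + b) = cis a * cis b := by
  simp [cis, add_mul, Complex.exp_add]

@[simp] lemma cis_zero : cis 0 = 1 := by simp [cis]

lemma conj_cis (a : ℝ) : starRingEnd ℂ (cis a) = cis (-a) := by
  simp [cis, ← Complex.exp_conj]

lemma continuous_cis : Continuous cis := by unfold cis; fun_prop

lemma cis_mul_neg (a : ℝ) : cis a * cis (-a) = 1 := by
  rw [← cis_add]; simp

lemma hasDerivAt_cis {ψ : ℝ → ℝ} {ψ' x : ℝ} (h : HasDerivAt ψ ψ' x) :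
    HasDerivAt (fun y => cis (ψ y)) (Complex.I * ψ' * cis (ψ x)) x := by
  have := ((h.ofReal_comp).mul_const Complex.I).cexp
  refine this.congr_deriv ?_
  change cis (ψ x) * (ψ' * Complex.I) = _
  ring

lemma continuousOn_cis {ψ : ℝ → ℝ} {s : Set ℝ} (h : ContinuousOn ψ s) :
    ContinuousOn (fun y => cis (ψ y)) s := continuous_cis.comp_continuousOn h

/-- Integration by parts against an oscillating factor. -/
theorem norm_integral_osc_le {a b : ℝ} (hab : a ≤ b) {r r' ψ ψ' : ℝ → ℝ} {w g : ℝ → ℂ}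
    {s : Set ℝ} (hs : s.Countable)
    (hr : ∀ k ∈ Icc a b, HasDerivAt r (r' k) k) (hψ : ∀ k ∈ Icc a b, HasDerivAt ψ (ψ' k) k)
    (hr' : ContinuousOn r' (Icc a b)) (hψ' : ContinuousOn ψ' (Icc a b))
    (hw : ContinuousOn w (Icc a b)) (hd : ∀ k ∈ Ioo a b \ s, HasDerivAt w (g k) k)
    (hg : IntervalIntegrable g volume a b) :
    ‖∫ k in a..b, ((r k * ψ' k : ℝ) : ℂ) * cis (ψ k) * w k‖ ≤
      |r a| * ‖w a‖ + |r b| * ‖w b‖ + ∫ k in a..b, (|r' k| * ‖w k‖ + |r k| * ‖g k‖) := by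
  have hrc : ContinuousOn r (Icc a b) := fun k hk => (hr k hk).continuousAt.continuousWithinAt
  have hψc : ContinuousOn ψ (Icc a b) := fun k hk => (hψ k hk).continuousAt.continuousWithinAt
  have hcis := continuousOn_cis hψc
  have hofReal : ∀ {f : ℝ → ℝ}, ContinuousOn f (Icc a b) →
      ContinuousOn (fun k => (f k : ℂ)) (Icc a b) := fun h =>
    Complex.continuous_ofReal.comp_continuousOn h
  have hu : uIcc a b = Icc a b := uIcc_of_le hab
  have i1 : IntervalIntegrable (fun k => ((r k * ψ' k : ℝ) : ℂ) * cis (ψ k) * w k) volume a b := by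
    apply ContinuousOn.intervalIntegrable
    rw [hu]
    exact ((hofReal (hrc.mul hψ')).mul hcis).mul hw
  have i2 : IntervalIntegrable (fun k => (r' k : ℂ) * cis (ψ k) * w k) volume a b := by
    apply ContinuousOn.intervalIntegrable
    rw [hu]
    exact ((hofReal hr').mul hcis).mul hw
  have i3 : IntervalIntegrable (fun k => (r k : ℂ) * cis (ψ k) * g k) volume a b := by
    apply hg.continuousOn_mul
    rw [hu]
    exact (hofReal hrc).mul hcis
  have key : ∫ k in a..b, (Complex.I * (((r k * ψ' k : ℝ) : ℂ) * cis (ψ k) * w k) +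
      ((r' k : ℂ) * cis (ψ k) * w k + (r k : ℂ) * cis (ψ k) * g k)) =
      (r b : ℂ) * cis (ψ b) * w b - (r a : ℂ) * cis (ψ a) * w a := by
    apply integral_eq_of_hasDerivAt_off_countable_of_le (fun k => (r k : ℂ) * cis (ψ k) * w k)
      _ hab hs (((hofReal hrc).mul hcis).mul hw)
    · intro k hk
      have hk' : k ∈ Icc a b := Ioo_subset_Icc_self hk.1
      have := (((hr k hk').ofReal_comp).mul (hasDerivAt_cis (hψ k hk'))).mul (hd k hk)
      refine this.congr_deriv ?_
      simp only [Pi.mul_apply]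
      push_cast
      ring
    · exact (i1.const_mul _).add (i2.add i3)
  rw [intervalIntegral.integral_add (i1.const_mul _) (i2.add i3),
    intervalIntegral.integral_const_mul] at key
  have e : ∫ k in a..b, ((r k * ψ' k : ℝ) : ℂ) * cis (ψ k) * w k =
      -Complex.I * ((r b : ℂ) * cis (ψ b) * w b - (r a : ℂ) * cis (ψ a) * w a -
        ∫ k in a..b, ((r' k : ℂ) * cis (ψ k) * w k + (r k : ℂ) * cis (ψ k) * g k)) := by
    rw [← key]
    ring_nf
    simp
  rw [e, norm_mul, norm_neg, Complex.norm_I, one_mul]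
  have n1 : ‖∫ k in a..b, ((r' k : ℂ) * cis (ψ k) * w k + (r k : ℂ) * cis (ψ k) * g k)‖ ≤
      ∫ k in a..b, (|r' k| * ‖w k‖ + |r k| * ‖g k‖) := by
    apply intervalIntegral.norm_integral_le_of_norm_le hab
    · refine ae_of_all _ fun k _ => ?_
      refine (norm_add_le _ _).trans (le_of_eq ?_)
      simp
    · refine IntervalIntegrable.add ?_ ?_
      · apply ContinuousOn.intervalIntegrable
        rw [hu]
        exact hr'.abs.mul hw.norm
      · apply hg.norm.continuousOn_mul
        rw [hu]
        exact hrc.abs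
  have n2 : ‖(r a : ℂ) * cis (ψ a) * w a‖ = |r a| * ‖w a‖ := by simp
  have n3 : ‖(r b : ℂ) * cis (ψ b) * w b‖ = |r b| * ‖w b‖ := by simp
  calc _ ≤ ‖(r b : ℂ) * cis (ψ b) * w b - (r a : ℂ) * cis (ψ a) * w a‖ + _ := norm_sub_le _ _
    _ ≤ _ := by
      refine (add_le_add (norm_sub_le _ _) n1).trans ?_
      rw [n2, n3]; linarith

/-- Cauchy–Schwarz for interval integrals. -/
lemma integral_mul_norm_le {a b Q G : ℝ} (hab : a ≤ b) {φ : ℝ → ℝ} {g : ℝ → ℂ}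
    (hφ : ContinuousOn φ (Icc a b))
    (hg : MemLp g 2 (volume.restrict (Icc a b)))
    (hQ0 : 0 ≤ Q) (hQ : ∫ k in a..b, φ k ^ 2 ≤ Q ^ 2) (hG0 : 0 ≤ G)
    (hG : ∫ k in a..b, ‖g k‖ ^ 2 ≤ G ^ 2) :
    ∫ k in a..b, φ k * ‖g k‖ ≤ Q * G := by
  have hI : Integrable (fun k => ‖g k‖ ^ 2) (volume.restrict (Icc a b)) := hg.integrable_norm_pow (by norm_num)
  have hgI : Integrable g (volume.restrict (Icc a b)) := hg.integrable (by norm_num)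
  have hii : IntervalIntegrable (fun k => ‖g k‖ ^ 2) volume a b :=
    (intervalIntegrable_iff_integrableOn_Icc_of_le hab).2 hI
  have hgi : IntervalIntegrable (fun k => ‖g k‖) volume a b :=
    (intervalIntegrable_iff_integrableOn_Icc_of_le hab).2 hgI.norm
  have hpi : IntervalIntegrable (fun k => φ k ^ 2) volume a b := by
    apply ContinuousOn.intervalIntegrable; rw [uIcc_of_le hab]; exact hφ.pow 2
  have hpg : IntervalIntegrable (fun k => φ k * ‖g k‖) volume a b := by
    apply hgi.continuousOn_mul; rwa [uIcc_of_le hab]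
  have key : ∀ t : ℝ, 0 < t → 2 * ∫ k in a..b, φ k * ‖g k‖ ≤ t * Q ^ 2 + t⁻¹ * G ^ 2 := by
    intro t ht
    have : ∫ k in a..b, 2 * (φ k * ‖g k‖) ≤ ∫ k in a..b, (t * φ k ^ 2 + t⁻¹ * ‖g k‖ ^ 2) := by
      apply intervalIntegral.integral_mono_on hab (hpg.const_mul 2)
        ((hpi.const_mul t).add (hii.const_mul t⁻¹))
      intro k hk
      have h1 : t * φ k ^ 2 + t⁻¹ * ‖g k‖ ^ 2 - 2 * (φ k * ‖g k‖) =
          t⁻¹ * (t * φ k - ‖g k‖) ^ 2 := by field_simp; ring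
      have h2 : 0 ≤ t⁻¹ * (t * φ k - ‖g k‖) ^ 2 := by positivity
      linarith
    rw [intervalIntegral.integral_const_mul, intervalIntegral.integral_add (hpi.const_mul t)
      (hii.const_mul t⁻¹), intervalIntegral.integral_const_mul,
      intervalIntegral.integral_const_mul] at this
    have h3 := mul_le_mul_of_nonneg_left hQ ht.le
    have h4 := mul_le_mul_of_nonneg_left hG (inv_nonneg.2 ht.le)
    linarith
  apply le_of_forall_pos_le_add
  intro ε hε
  have := key ((G + ε / (2 * (Q + 1))) / (Q + ε / (2 * (G + 1)))) (by positivity)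
  set x := ε / (2 * (Q + 1)) with hx
  set y := ε / (2 * (G + 1)) with hy
  have hx0 : 0 < x := by positivity
  have hy0 : 0 < y := by positivity
  have e1 : (G + x) / (Q + y) * Q ^ 2 ≤ (G + x) * Q := by
    rw [div_mul_eq_mul_div, div_le_iff₀ (by positivity)]
    nlinarith [mul_nonneg (mul_nonneg (add_nonneg hG0 hx0.le) hQ0) hy0.le]
  have e2 : ((G + x) / (Q + y))⁻¹ * G ^ 2 ≤ (Q + y) * G := by
    rw [inv_div, div_mul_eq_mul_div, div_le_iff₀ (by positivity)]
    nlinarith [mul_nonneg (mul_nonneg (add_nonneg hQ0 hy0.le) hG0) hx0.le]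
  have e3 : x * Q ≤ ε := by
    rw [hx, div_mul_eq_mul_div, div_le_iff₀ (by positivity)]; nlinarith
  have e4 : y * G ≤ ε := by
    rw [hy, div_mul_eq_mul_div, div_le_iff₀ (by positivity)]; nlinarith
  nlinarith

/-- The part of the derivative of a profile coming from smoothing a jump at the origin. -/
def jumpDeriv (ρ : ℝ) (c : ℂ) (k : ℝ) : ℂ := if |k| ≤ ρ then c / ρ else 0

/-- Regularized profiles: continuous, compactly supported, bounded by one, with derivative
`g + jumpDeriv ρ c`, where `g` is controlled in `L²`. -/
structure Prof (ρ N : ℝ) (c : ℂ) (w g : ℝ → ℂ) : Prop where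
  ρ_pos : 0 < ρ
  ρ_le : ρ ≤ 1 / 2
  N_ge : 1 ≤ N
  c_le : ‖c‖ ≤ 1
  cont : Continuous w
  bdd : ∀ k, ‖w k‖ ≤ 1
  supp : ∀ k, N ≤ |k| → w k = 0
  symm : ∀ k, w (-k) = starRingEnd ℂ (w k)
  der : ∃ s : Set ℝ, s.Countable ∧ ∀ k ∉ s, HasDerivAt w (g k + jumpDeriv ρ c k) k
  memLp : MemLp g 2 volume
  L2 : ∫ k, ‖g k‖ ^ 2 ≤ 4

lemma measurable_jumpDeriv (ρ : ℝ) (c : ℂ) : Measurable (jumpDeriv ρ c) := by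
  unfold jumpDeriv
  exact Measurable.ite (measurableSet_le (by fun_prop) (by fun_prop)) measurable_const
    measurable_const

lemma norm_jumpDeriv_le {ρ : ℝ} (hρ : 0 < ρ) {c : ℂ} (hc : ‖c‖ ≤ 1) (k : ℝ) :
    ‖jumpDeriv ρ c k‖ ≤ 1 / ρ := by
  unfold jumpDeriv
  split_ifs
  · rw [norm_div, Complex.norm_real, Real.norm_of_nonneg hρ.le]; gcongr
  · simp; positivity

variable {ρ N : ℝ} {c : ℂ} {w g : ℝ → ℂ}

lemma Prof.intervalIntegrable_g (h : Prof ρ N c w g) (a b : ℝ) :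
    IntervalIntegrable g volume a b := by
  rw [intervalIntegrable_iff]
  have hm := (h.memLp.restrict (uIoc a b))
  have : IsFiniteMeasure (volume.restrict (uIoc a b)) := by
    constructor; rw [Measure.restrict_apply_univ, uIoc]; exact measure_Ioc_lt_top
  exact hm.integrable (by norm_num)

lemma intervalIntegrable_jumpDeriv (hρ : 0 < ρ) (hc : ‖c‖ ≤ 1) (a b : ℝ) :
    IntervalIntegrable (jumpDeriv ρ c) volume a b := by
  apply (intervalIntegrable_const (c := 1 / ρ)).mono_fun
    (measurable_jumpDeriv ρ c).aestronglyMeasurable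
  refine ae_of_all _ fun k => (norm_jumpDeriv_le hρ hc k).trans (le_abs_self _)

lemma Prof.intervalIntegrable_deriv (h : Prof ρ N c w g) (a b : ℝ) :
    IntervalIntegrable (fun k => g k + jumpDeriv ρ c k) volume a b :=
  (h.intervalIntegrable_g a b).add (intervalIntegrable_jumpDeriv h.ρ_pos h.c_le a b)

lemma Prof.integral_sq_le (h : Prof ρ N c w g) {a b : ℝ} (hab : a ≤ b) :
    ∫ k in a..b, ‖g k‖ ^ 2 ≤ 2 ^ 2 := by
  rw [intervalIntegral.integral_of_le hab]
  refine (setIntegral_le_integral (h.memLp.integrable_norm_pow (by norm_num))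
    (ae_of_all _ fun _ => by positivity)).trans (h.L2.trans (by norm_num))

lemma integral_jumpDeriv_le (hρ : 0 < ρ) (hc : ‖c‖ ≤ 1) {a b M : ℝ} (hab : a ≤ b)
    {φ : ℝ → ℝ} (hφ : ContinuousOn φ (Icc a b))
    (hM0 : 0 ≤ M) (hM : ∀ k ∈ Icc a b, |k| ≤ ρ → φ k ≤ M) :
    ∫ k in a..b, φ k * ‖jumpDeriv ρ c k‖ ≤ 2 * M := by
  have h_int : Integrable ((Icc (-ρ) ρ).indicator (fun _ : ℝ => M / ρ)) volume := by
    rw [integrable_indicator_iff measurableSet_Icc]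
    exact integrableOn_const (by simp)
  have hle : ∫ k in a..b, φ k * ‖jumpDeriv ρ c k‖ ≤
      ∫ k in a..b, (Icc (-ρ) ρ).indicator (fun _ => M / ρ) k := by
    apply intervalIntegral.integral_mono_on hab
    · apply (intervalIntegrable_jumpDeriv hρ hc a b).norm.continuousOn_mul
      rwa [uIcc_of_le hab]
    · exact h_int.intervalIntegrable
    · intro k hk
      by_cases hkρ : |k| ≤ ρ
      · rw [indicator_of_mem (show k ∈ Icc (-ρ) ρ from abs_le.1 hkρ)]
        calc φ k * ‖jumpDeriv ρ c k‖ ≤ M * (1 / ρ) :=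
              mul_le_mul (hM k hk hkρ) (norm_jumpDeriv_le hρ hc k) (norm_nonneg _) hM0
          _ = M / ρ := by ring
      · rw [indicator_of_notMem (show k ∉ Icc (-ρ) ρ from fun hh => hkρ (abs_le.2 hh))]
        simp [jumpDeriv, hkρ]
  refine hle.trans ?_
  rw [intervalIntegral.integral_of_le hab]
  refine (setIntegral_le_integral h_int (ae_of_all _ fun k =>
    indicator_nonneg (fun _ _ => by positivity) k)).trans ?_
  rw [integral_indicator_const _ measurableSet_Icc]
  simp only [Measure.real, Real.volume_Icc, smul_eq_mul]
  rw [ENNReal.toReal_ofReal (by linarith)]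
  apply le_of_eq; field_simp; ring

/-- Weighted bound for the derivative of a profile. -/
lemma Prof.integral_weight_le (h : Prof ρ N c w g) {a b Q M : ℝ} (hab : a ≤ b) {φ : ℝ → ℝ}
    (hφ : ContinuousOn φ (Icc a b)) (h0 : ∀ k ∈ Icc a b, 0 ≤ φ k) (hQ0 : 0 ≤ Q)
    (hQ : ∫ k in a..b, φ k ^ 2 ≤ Q ^ 2) (hM0 : 0 ≤ M)
    (hM : ∀ k ∈ Icc a b, |k| ≤ ρ → φ k ≤ M) :
    ∫ k in a..b, φ k * ‖g k + jumpDeriv ρ c k‖ ≤ 2 * Q + 2 * M := by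
  have h1 := integral_mul_norm_le hab hφ (h.memLp.restrict _) hQ0 hQ (by norm_num : (0:ℝ) ≤ 2)
    (h.integral_sq_le hab)
  have h2 := integral_jumpDeriv_le h.ρ_pos h.c_le hab hφ hM0 hM
  have hφ' : ContinuousOn φ (uIcc a b) := by rwa [uIcc_of_le hab]
  have i1 := (h.intervalIntegrable_g a b).norm.continuousOn_mul hφ'
  have i2 := (intervalIntegrable_jumpDeriv h.ρ_pos h.c_le a b).norm.continuousOn_mul hφ'
  have i3 := (h.intervalIntegrable_deriv a b).norm.continuousOn_mul hφ'
  have h3 : ∫ k in a..b, φ k * ‖g k + jumpDeriv ρ c k‖ ≤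
      ∫ k in a..b, (φ k * ‖g k‖ + φ k * ‖jumpDeriv ρ c k‖) := by
    apply intervalIntegral.integral_mono_on hab i3 (i1.add i2)
    intro k hk
    rw [← mul_add]
    exact mul_le_mul_of_nonneg_left (norm_add_le _ _) (h0 k hk)
  rw [intervalIntegral.integral_add i1 i2] at h3
  linarith

/-- Oscillatory bound with a monotone amplitude `r`. -/
theorem Prof.norm_osc_le (h : Prof ρ N c w g) {a b Q : ℝ} (hab : a ≤ b) {r r' ψ ψ' : ℝ → ℝ}
    (hr : ∀ k ∈ Icc a b, HasDerivAt r (r' k) k) (hψ : ∀ k ∈ Icc a b, HasDerivAt ψ (ψ' k) k)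
    (hr' : ContinuousOn r' (Icc a b)) (hψ' : ContinuousOn ψ' (Icc a b))
    (hmono : (∀ k ∈ Icc a b, r' k ≤ 0) ∨ (∀ k ∈ Icc a b, 0 ≤ r' k)) (hQ0 : 0 ≤ Q)
    (hQ : ∫ k in a..b, r k ^ 2 ≤ Q ^ 2) :
    ‖∫ k in a..b, ((r k * ψ' k : ℝ) : ℂ) * cis (ψ k) * w k‖ ≤
      4 * (|r a| + |r b|) + 2 * Q := by
  obtain ⟨s, hs, hd⟩ := h.der
  have hrc : ContinuousOn r (Icc a b) := fun k hk => (hr k hk).continuousAt.continuousWithinAt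
  have hu : uIcc a b = Icc a b := uIcc_of_le hab
  have key := norm_integral_osc_le hab hs hr hψ hr' hψ' h.cont.continuousOn
    (fun k hk => hd k hk.2) (h.intervalIntegrable_deriv a b)
  have j1 : IntervalIntegrable r' volume a b := by
    apply ContinuousOn.intervalIntegrable; rwa [hu]
  have ftc : ∫ k in a..b, r' k = r b - r a :=
    intervalIntegral.integral_eq_sub_of_hasDerivAt (fun k hk => hr k (hu ▸ hk)) j1
  have t1 : ∫ k in a..b, |r' k| ≤ |r a| + |r b| := by
    rcases hmono with hm | hm
    · have : ∫ k in a..b, |r' k| = ∫ k in a..b, -r' k :=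
        intervalIntegral.integral_congr fun k hk => abs_of_nonpos (hm k (hu ▸ hk))
      rw [this, intervalIntegral.integral_neg, ftc]
      linarith [le_abs_self (r a), neg_abs_le (r b)]
    · have : ∫ k in a..b, |r' k| = ∫ k in a..b, r' k :=
        intervalIntegral.integral_congr fun k hk => abs_of_nonneg (hm k (hu ▸ hk))
      rw [this, ftc]
      linarith [le_abs_self (r b), neg_abs_le (r a)]
  have bd : ∀ k ∈ Icc a b, |r k| ≤ |r a| + |r b| := by
    intro k hk
    have haa : a ∈ Icc a b := ⟨le_rfl, hab⟩
    have hbb : b ∈ Icc a b := ⟨hab, le_rfl⟩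
    have hder : ∀ k ∈ interior (Icc a b), HasDerivWithinAt r (r' k) (interior (Icc a b)) k :=
      fun k hk => (hr k (interior_subset hk)).hasDerivWithinAt
    rcases hmono with hm | hm
    · have anti : AntitoneOn r (Icc a b) :=
        antitoneOn_of_hasDerivWithinAt_nonpos (convex_Icc a b) hrc hder
          (fun k hk => hm k (interior_subset hk))
      have h1 := anti haa hk hk.1
      have h2 := anti hk hbb hk.2
      rw [abs_le]
      constructor <;> linarith [le_abs_self (r a), neg_abs_le (r b), abs_nonneg (r a), abs_nonneg (r b)]
    · have anti : MonotoneOn r (Icc a b) :=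
        monotoneOn_of_hasDerivWithinAt_nonneg (convex_Icc a b) hrc hder
          (fun k hk => hm k (interior_subset hk))
      have h1 := anti haa hk hk.1
      have h2 := anti hk hbb hk.2
      rw [abs_le]
      constructor <;> linarith [le_abs_self (r b), neg_abs_le (r a), abs_nonneg (r a), abs_nonneg (r b)]
  have t2 := h.integral_weight_le hab hrc.abs (fun k _ => abs_nonneg _) hQ0
    (by simpa only [sq_abs] using hQ) (by positivity : 0 ≤ |r a| + |r b|) (fun k hk _ => bd k hk)
  have jr : IntervalIntegrable (fun k => |r' k|) volume a b := j1.abs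
  have jw : IntervalIntegrable (fun k => |r' k| * ‖w k‖) volume a b := by
    apply ContinuousOn.intervalIntegrable; rw [hu]; exact hr'.abs.mul h.cont.continuousOn.norm
  have jg : IntervalIntegrable (fun k => |r k| * ‖g k + jumpDeriv ρ c k‖) volume a b := by
    apply (h.intervalIntegrable_deriv a b).norm.continuousOn_mul; rw [hu]; exact hrc.abs
  rw [intervalIntegral.integral_add jw jg] at key
  have t3 : ∫ k in a..b, |r' k| * ‖w k‖ ≤ ∫ k in a..b, |r' k| :=
    intervalIntegral.integral_mono_on hab jw jr fun k _ =>
      mul_le_of_le_one_right (abs_nonneg _) (h.bdd k)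
  have t4 : |r a| * ‖w a‖ ≤ |r a| := mul_le_of_le_one_right (abs_nonneg _) (h.bdd _)
  have t5 : |r b| * ‖w b‖ ≤ |r b| := mul_le_of_le_one_right (abs_nonneg _) (h.bdd _)
  linarith

/-- Variant of `Prof.norm_osc_le` when `r² ≤ B |r'|`. -/
theorem Prof.norm_osc_le' (h : Prof ρ N c w g) {a b B : ℝ} (hab : a ≤ b) {r r' ψ ψ' : ℝ → ℝ}
    (hr : ∀ k ∈ Icc a b, HasDerivAt r (r' k) k) (hψ : ∀ k ∈ Icc a b, HasDerivAt ψ (ψ' k) k)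
    (hr' : ContinuousOn r' (Icc a b)) (hψ' : ContinuousOn ψ' (Icc a b)) (hB : 0 ≤ B)
    (hmono : (∀ k ∈ Icc a b, r k ^ 2 ≤ B * -r' k ∧ r' k ≤ 0) ∨
      (∀ k ∈ Icc a b, r k ^ 2 ≤ B * r' k ∧ 0 ≤ r' k)) :
    ‖∫ k in a..b, ((r k * ψ' k : ℝ) : ℂ) * cis (ψ k) * w k‖ ≤
      4 * (|r a| + |r b|) + 2 * √(B * (|r a| + |r b|)) := by
  have hrc : ContinuousOn r (Icc a b) := fun k hk => (hr k hk).continuousAt.continuousWithinAt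
  have hu : uIcc a b = Icc a b := uIcc_of_le hab
  have j1 : IntervalIntegrable r' volume a b := by
    apply ContinuousOn.intervalIntegrable; rwa [hu]
  have j2 : IntervalIntegrable (fun k => r k ^ 2) volume a b := by
    apply ContinuousOn.intervalIntegrable; rw [hu]; exact hrc.pow 2
  have ftc : ∫ k in a..b, r' k = r b - r a :=
    intervalIntegral.integral_eq_sub_of_hasDerivAt (fun k hk => hr k (hu ▸ hk)) j1
  refine h.norm_osc_le hab hr hψ hr' hψ' ?_ (Real.sqrt_nonneg _) ?_
  · exact hmono.imp (fun hh k hk => (hh k hk).2) (fun hh k hk => (hh k hk).2)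
  rw [Real.sq_sqrt (by positivity)]
  rcases hmono with hm | hm
  · calc ∫ k in a..b, r k ^ 2 ≤ ∫ k in a..b, B * -r' k :=
          intervalIntegral.integral_mono_on hab j2 (j1.neg.const_mul B) fun k hk => (hm k hk).1
      _ = B * (r a - r b) := by
          rw [intervalIntegral.integral_const_mul, intervalIntegral.integral_neg, ftc]; ring
      _ ≤ _ := by
          gcongr; linarith [le_abs_self (r a), neg_abs_le (r b)]
  · calc ∫ k in a..b, r k ^ 2 ≤ ∫ k in a..b, B * r' k :=
          intervalIntegral.integral_mono_on hab j2 (j1.const_mul B) fun k hk => (hm k hk).1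
      _ = B * (r b - r a) := by
          rw [intervalIntegral.integral_const_mul, ftc]
      _ ≤ _ := by
          gcongr; linarith [le_abs_self (r b), neg_abs_le (r a)]

end MKdVPaper

namespace MKdVPaper

open FourierTransform SchwartzMap in
/-- Plancherel's theorem for `L¹ ∩ L²`. -/
theorem fourier_memLp_two {h : ℝ → ℂ} (h1 : Integrable h) (h2 : MemLp h 2) :
    MemLp (𝓕 h) 2 ∧ eLpNorm (𝓕 h) 2 volume = eLpNorm h 2 volume := by
  have hc : Continuous (𝓕 h) := VectorFourier.fourierIntegral_continuous Real.continuous_fourierChar (by fun_prop) h1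
  set F := 𝓕 (h2.toLp h) with hF
  have hae : 𝓕 h =ᵐ[volume] F := by
    apply ae_eq_of_integral_contDiff_smul_eq hc.locallyIntegrable
    · exact (Lp.memLp F).locallyIntegrable (by norm_num)
    intro g hg hgs
    set φ : 𝓢(ℝ, ℂ) := HasCompactSupport.toSchwartzMap (f := fun x => (g x : ℂ)) (hgs.comp_left (g := ((↑) : ℝ → ℂ)) Complex.ofReal_zero) (Complex.ofRealCLM.contDiff.comp hg) with hφ
    have e1 := congrArg (fun T => T φ) (Lp.fourier_toTemperedDistribution_eq (h2.toLp h))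
    simp only [TemperedDistribution.fourier_apply, Lp.toTemperedDistribution_apply] at e1
    have hgφ : ∀ x, (g x : ℂ) = φ x := fun x => rfl
    have e2 : ∫ x, (𝓕 φ) x • (h2.toLp h) x = ∫ x, (𝓕 (φ : ℝ → ℂ)) x • h x := by
      apply integral_congr_ae
      filter_upwards [h2.coeFn_toLp] with x hx
      rw [hx]; rfl
    have e3 : ∫ x, (𝓕 (φ : ℝ → ℂ)) x • h x = ∫ x, φ x • (𝓕 h) x := by
      have := VectorFourier.integral_fourierIntegral_smul_eq_flip (L := innerₗ ℝ)
        (μ := volume) (ν := volume) Real.continuous_fourierChar (by fun_prop) φ.integrable h1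
      rwa [flip_innerₗ] at this
    have e4 : ∀ T : ℝ → ℂ, ∫ x, g x • T x = ∫ x, φ x • T x := fun T => by
      congr 1
    rw [e4, e4, ← e3, ← e2, e1]
  have hm : MemLp (𝓕 h) 2 := (memLp_congr_ae hae).2 (Lp.memLp F)
  refine ⟨hm, ?_⟩
  rw [eLpNorm_congr_ae hae, ← eLpNorm_congr_ae h2.coeFn_toLp, ← Lp.enorm_def, ← Lp.enorm_def]
  rw [← ofReal_norm, ← ofReal_norm, hF, Lp.norm_fourier_eq]

/-- The oscillatory integral `∫_{-N}^{N} e^{i(kx + k³)} h(k) dk`. -/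
def osc (N : ℝ) (h : ℝ → ℂ) (x : ℝ) : ℂ := ∫ k in (-N)..N, cis (k * x + k ^ 3) * h k

lemma continuous_phase (x : ℝ) : Continuous fun k : ℝ => cis (k * x + k ^ 3) :=
  continuous_cis.comp (by fun_prop)

lemma osc_integrable {N : ℝ} {h : ℝ → ℂ} (hh : IntervalIntegrable h volume (-N) N) (x : ℝ) :
    IntervalIntegrable (fun k => cis (k * x + k ^ 3) * h k) volume (-N) N :=
  hh.continuousOn_mul (continuous_phase x).continuousOn

lemma osc_add {N : ℝ} {h h' : ℝ → ℂ} (hh : IntervalIntegrable h volume (-N) N)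
    (hh' : IntervalIntegrable h' volume (-N) N) (x : ℝ) :
    osc N (fun k => h k + h' k) x = osc N h x + osc N h' x := by
  unfold osc
  rw [← intervalIntegral.integral_add (osc_integrable hh x) (osc_integrable hh' x)]
  simp only [mul_add]

lemma continuous_osc {N : ℝ} {h : ℝ → ℂ} (hh : IntervalIntegrable h volume (-N) N) :
    Continuous (osc N h) := by
  unfold osc
  refine intervalIntegral.continuous_of_dominated_interval (bound := fun k => ‖h k‖) ?_ ?_ ?_ ?_
  · exact fun x => (intervalIntegrable_iff.1 (osc_integrable hh x)).aestronglyMeasurable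
  · exact fun x => ae_of_all _ fun k _ => by simp
  · exact hh.norm
  · refine ae_of_all _ fun k _ => Continuous.mul ?_ continuous_const
    exact continuous_cis.comp (by fun_prop)

lemma hasDerivAt_osc {N : ℝ} {h : ℝ → ℂ} (hh : Continuous h) (x : ℝ) :
    HasDerivAt (osc N h) (osc N (fun k => Complex.I * k * h k) x) x := by
  unfold osc
  refine (intervalIntegral.hasDerivAt_integral_of_dominated_loc_of_deriv_le
    (F := fun x k => cis (k * x + k ^ 3) * h k)
    (F' := fun x k => cis (k * x + k ^ 3) * (Complex.I * k * h k))
    (bound := fun k => |k| * ‖h k‖) (univ_mem) ?_ ?_ ?_ ?_ ?_ ?_).2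
  · exact Eventually.of_forall fun y =>
      ((continuous_phase y).mul hh).aestronglyMeasurable
  · exact ((continuous_phase x).mul hh).intervalIntegrable _ _
  · exact ((continuous_phase x).mul (by fun_prop)).aestronglyMeasurable
  · exact ae_of_all _ fun k _ y _ => by simp
  · exact (by fun_prop : Continuous fun k => |k| * ‖h k‖).intervalIntegrable _ _
  · refine ae_of_all _ fun k _ y _ => ?_
    have h1 : HasDerivAt (fun y : ℝ => k * y + k ^ 3) k y := by
      simpa using ((hasDerivAt_id y).const_mul k).add_const (k ^ 3)
    refine ((hasDerivAt_cis h1).mul_const (h k)).congr_deriv ?_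
    ring

lemma conj_osc {N : ℝ} {h : ℝ → ℂ} (hs : ∀ k, h (-k) = starRingEnd ℂ (h k)) (x : ℝ) :
    starRingEnd ℂ (osc N h x) = osc N h x := by
  unfold osc
  have hconj : starRingEnd ℂ (∫ k in (-N)..N, cis (k * x + k ^ 3) * h k) =
      ∫ k in (-N)..N, starRingEnd ℂ (cis (k * x + k ^ 3) * h k) := by
    simp only [intervalIntegral, map_sub, integral_conj]
  rw [hconj]
  have := intervalIntegral.integral_comp_neg (a := -N) (b := N)
    (fun k => cis (k * x + k ^ 3) * h k)
  rw [neg_neg] at this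
  rw [← this]
  refine intervalIntegral.integral_congr fun k _ => ?_
  simp only [map_mul, conj_cis, hs]
  congr 2
  ring

variable {ρ N : ℝ} {c : ℂ} {w g : ℝ → ℂ}

/-- The Airy-type equation satisfied by `osc N w`. -/
lemma Prof.ode (h : Prof ρ N c w g) (x : ℝ) :
    3 * osc N (fun k => Complex.I * k * (Complex.I * k * w k)) x =
      x * osc N w x - Complex.I * (osc N g x + osc N (jumpDeriv ρ c) x) := by
  obtain ⟨s, hs, hd⟩ := h.der
  have hN : -N ≤ N := by linarith [h.N_ge]
  have hwN : w N = 0 := h.supp N (le_abs_self N)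
  have hwN' : w (-N) = 0 := by rw [h.symm, hwN, map_zero]
  have j1 : IntervalIntegrable (fun k => cis (k * x + k ^ 3) * w k) volume (-N) N :=
    osc_integrable (h.cont.intervalIntegrable _ _) x
  have j2 : IntervalIntegrable (fun k => cis (k * x + k ^ 3) * (Complex.I * k * (Complex.I * k * w k)))
      volume (-N) N :=
    osc_integrable (Continuous.intervalIntegrable (by have := h.cont; fun_prop) _ _) x
  have j3 := osc_integrable (h.intervalIntegrable_deriv (-N) N) x
  have key : ∫ k in (-N)..N, ((Complex.I * x * (cis (k * x + k ^ 3) * w k) -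
      3 * Complex.I * (cis (k * x + k ^ 3) * (Complex.I * k * (Complex.I * k * w k)))) +
      cis (k * x + k ^ 3) * (g k + jumpDeriv ρ c k)) = 0 := by
    rw [integral_eq_of_hasDerivAt_off_countable_of_le (fun k => cis (k * x + k ^ 3) * w k) _ hN hs
      ((continuous_phase x).mul h.cont).continuousOn ?_
      (((j1.const_mul _).sub (j2.const_mul _)).add j3)]
    · simp [hwN, hwN']
    · intro k hk
      have h1 : HasDerivAt (fun k : ℝ => k * x + k ^ 3) (x + 3 * k ^ 2) k := by
        simpa using ((hasDerivAt_id k).mul_const x).fun_add (hasDerivAt_pow 3 k)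
      refine ((hasDerivAt_cis h1).mul (hd k hk.2)).congr_deriv ?_
      push_cast
      ring_nf
      rw [show Complex.I ^ 3 = -Complex.I by rw [pow_succ, Complex.I_sq]; ring]
      ring
  rw [intervalIntegral.integral_add ((j1.const_mul _).sub (j2.const_mul _)) j3,
    intervalIntegral.integral_sub (j1.const_mul _) (j2.const_mul _),
    intervalIntegral.integral_const_mul, intervalIntegral.integral_const_mul] at key
  have e3 : ∫ k in (-N)..N, cis (k * x + k ^ 3) * (g k + jumpDeriv ρ c k) =
      osc N g x + osc N (jumpDeriv ρ c) x :=
    osc_add (h.intervalIntegrable_g _ _) (intervalIntegrable_jumpDeriv h.ρ_pos h.c_le _ _) x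
  rw [e3] at key
  change Complex.I * x * osc N w x - 3 * Complex.I * osc N _ x + _ = 0 at key
  have := congrArg (fun z => Complex.I * z) key
  simp only [mul_zero] at this
  generalize osc N (fun k : ℝ => Complex.I * k * (Complex.I * k * w k)) x = A at this ⊢
  linear_combination this + (x * osc N w x - 3 * A) * (- Complex.I_sq)

/-- Decay of the oscillatory integral of the jump part. -/
lemma Prof.norm_osc_jump_le (h : Prof ρ N c w g) (x : ℝ) :
    ‖osc N (jumpDeriv ρ c) x‖ ≤ 2 ∧ ‖osc N (jumpDeriv ρ c) x‖ * (ρ * |x|) ≤ 3 := by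
  have hρ := h.ρ_pos
  have hρN : ρ ≤ N := by linarith [h.ρ_le, h.N_ge]
  have e : osc N (jumpDeriv ρ c) x = c / ρ * ∫ k in (-ρ)..ρ, cis (k * x + k ^ 3) := by
    unfold osc
    rw [intervalIntegral.integral_of_le (by linarith), intervalIntegral.integral_of_le (by linarith),
      ← integral_const_mul]
    rw [← integral_Icc_eq_integral_Ioc, ← integral_Icc_eq_integral_Ioc]
    have : ∀ k, cis (k * x + k ^ 3) * jumpDeriv ρ c k =
        (Icc (-ρ) ρ).indicator (fun k => c / ρ * cis (k * x + k ^ 3)) k := by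
      intro k
      by_cases hk : |k| ≤ ρ
      · rw [indicator_of_mem (show k ∈ Icc (-ρ) ρ from abs_le.1 hk), jumpDeriv, if_pos hk, mul_comm]
      · rw [indicator_of_notMem (show k ∉ Icc (-ρ) ρ from fun hh => hk (abs_le.2 hh)), jumpDeriv,
          if_neg hk, mul_zero]
    simp only [this]
    rw [setIntegral_indicator measurableSet_Icc, inter_eq_self_of_subset_right]
    exact Icc_subset_Icc (by linarith) hρN
  have hcρ : ‖c / (ρ : ℂ)‖ ≤ 1 / ρ := by
    rw [norm_div, Complex.norm_real, Real.norm_of_nonneg hρ.le]; gcongr; exact h.c_le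
  constructor
  · rw [e, norm_mul]
    have h1 : ‖∫ k in (-ρ)..ρ, cis (k * x + k ^ 3)‖ ≤ 1 * |ρ - -ρ| :=
      intervalIntegral.norm_integral_le_of_norm_le_const fun k _ => by simp
    rw [abs_of_nonneg (by linarith)] at h1
    calc _ ≤ 1 / ρ * (1 * (ρ - -ρ)) := by gcongr
      _ = 2 := by field_simp; ring
  · rcases eq_or_ne x 0 with rfl | hx
    · simp
    have h2 := norm_integral_osc_le (a := -ρ) (b := ρ) (by linarith) (r := fun _ => 1 / x)
      (r' := fun _ => 0) (ψ := fun k => k * x) (ψ' := fun _ => x) (w := fun k => cis (k ^ 3))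
      (g := fun k => Complex.I * ((3 * k ^ 2 : ℝ) : ℂ) * cis (k ^ 3)) (s := ∅) countable_empty
      (fun k _ => hasDerivAt_const _ _)
      (fun k _ => by simpa using (hasDerivAt_id k).mul_const x)
      continuousOn_const continuousOn_const
      (continuous_cis.comp (by fun_prop)).continuousOn
      (fun k _ => hasDerivAt_cis (by simpa using hasDerivAt_pow 3 k))
      (Continuous.intervalIntegrable
        (by have := continuous_cis.comp (continuous_pow (M := ℝ) 3); fun_prop) _ _)
    have e2 : ∫ k in (-ρ)..ρ, ((1 / x * x : ℝ) : ℂ) * cis (k * x) * cis (k ^ 3) =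
        ∫ k in (-ρ)..ρ, cis (k * x + k ^ 3) := by
      apply intervalIntegral.integral_congr
      intro k _
      simp only [one_div, inv_mul_cancel₀ hx, Complex.ofReal_one, one_mul, cis_add]
    rw [e2] at h2
    have e4 : ∀ k : ℝ, |(0 : ℝ)| * ‖cis (k ^ 3)‖ + |1 / x| *
        ‖Complex.I * ((3 * k ^ 2 : ℝ) : ℂ) * cis (k ^ 3)‖ = |1 / x| * (3 * k ^ 2) := by
      intro k
      simp
    simp only [e4] at h2
    simp only [norm_cis] at h2
    rw [intervalIntegral.integral_const_mul, intervalIntegral.integral_const_mul, integral_pow] at h2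
    have hax : 0 < |x| := abs_pos.2 hx
    have e5 : |1 / x| * |x| = 1 := by rw [← abs_mul]; field_simp; simp
    rw [e, norm_mul]
    calc _ ≤ 1 / ρ * (|1 / x| * 1 + |1 / x| * 1 + |1 / x| *
          (3 * ((ρ ^ (2 + 1) - (-ρ) ^ (2 + 1)) / ((2 : ℕ) + 1)))) * (ρ * |x|) := by gcongr
      _ = (|1 / x| * |x|) * (2 + 2 * ρ ^ 3) := by field_simp; push_cast; ring
      _ ≤ 3 := by
        rw [e5]
        have : ρ ^ 3 ≤ (1 / 2) ^ 3 := pow_le_pow_left₀ hρ.le h.ρ_le 3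
        norm_num at this ⊢; linarith

lemma Prof.osc_L2 (h : Prof ρ N c w g) :
    MemLp (osc N g) 2 volume ∧ ∫ x, ‖osc N g x‖ ^ 2 ≤ 36 := by
  have hN : -N ≤ N := by linarith [h.N_ge]
  set G : ℝ → ℂ := (Ioc (-N) N).indicator (fun k => cis (k ^ 3) * g k) with hG
  have hcc : Continuous fun k : ℝ => cis (k ^ 3) := continuous_cis.comp (by fun_prop)
  have hG1 : Integrable G := by
    rw [hG, integrable_indicator_iff measurableSet_Ioc]
    have := (h.intervalIntegrable_g (-N) N).continuousOn_mul hcc.continuousOn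
    exact (intervalIntegrable_iff_integrableOn_Ioc_of_le hN).1 this
  have hle : ∀ k, ‖G k‖ ≤ ‖g k‖ := by
    intro k
    refine (norm_indicator_le_norm_self _ _).trans ?_
    simp
  have hG2 : MemLp G 2 := h.memLp.of_le hG1.aestronglyMeasurable (ae_of_all _ hle)
  obtain ⟨hm, hn⟩ := fourier_memLp_two hG1 hG2
  have hosc : ∀ x, osc N g x = FourierTransform.fourier G (-(1 / (2 * Real.pi)) * x) := by
    intro x
    rw [Real.fourier_real_eq_integral_exp_smul, osc, intervalIntegral.integral_of_le hN,
      ← integral_indicator measurableSet_Ioc]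
    refine integral_congr_ae (ae_of_all _ fun k => ?_)
    simp only [hG]
    by_cases hk : k ∈ Ioc (-N) N
    · rw [indicator_of_mem hk, indicator_of_mem hk, cis_add, smul_eq_mul, cis, mul_assoc]
      congr 3
      field_simp
    · rw [indicator_of_notMem hk, indicator_of_notMem hk, smul_zero]
  have hne : -(1 / (2 * Real.pi)) ≠ 0 := by
    have := Real.pi_pos; rw [neg_ne_zero]; positivity
  have hfun : osc N g = fun x => FourierTransform.fourier G (-(1 / (2 * Real.pi)) * x) :=
    funext hosc
  have hFsq : Integrable (fun y => ‖FourierTransform.fourier G y‖ ^ 2) :=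
    hm.integrable_norm_pow (by norm_num)
  have hsq : Integrable (fun x => ‖osc N g x‖ ^ 2) := by
    simp only [hosc]
    exact hFsq.comp_mul_left' hne
  refine ⟨(memLp_two_iff_integrable_sq_norm
    (continuous_osc (h.intervalIntegrable_g _ _)).aestronglyMeasurable).2 hsq, ?_⟩
  simp only [hosc]
  rw [Measure.integral_comp_mul_left (fun y => ‖FourierTransform.fourier G y‖ ^ 2)]
  have e1 : ∫ y, ‖FourierTransform.fourier G y‖ ^ 2 = ∫ y, ‖G y‖ ^ 2 := by
    have h1 := hm.eLpNorm_eq_integral_rpow_norm (by norm_num) (by norm_num)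
    have h2 := hG2.eLpNorm_eq_integral_rpow_norm (by norm_num) (by norm_num)
    rw [hn, h2] at h1
    simp only [ENNReal.toReal_ofNat, Real.rpow_ofNat] at h1
    rw [ENNReal.ofReal_eq_ofReal_iff (by positivity) (by positivity)] at h1
    rw [Real.rpow_left_inj (by positivity) (by positivity) (by norm_num)] at h1
    exact h1.symm
  have e2 : ∫ y, ‖G y‖ ^ 2 ≤ 4 := by
    refine le_trans (integral_mono (hG2.integrable_norm_pow (by norm_num))
      (h.memLp.integrable_norm_pow (by norm_num)) fun k => ?_) h.L2
    have := hle k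
    gcongr
  rw [e1]
  have e3 : |(-(1 / (2 * Real.pi)))⁻¹| = 2 * Real.pi := by
    rw [inv_neg, one_div, inv_inv, abs_neg, abs_of_pos (by positivity)]
  rw [e3, smul_eq_mul]
  have e4 : 0 ≤ ∫ y, ‖G y‖ ^ 2 := by positivity
  nlinarith [Real.pi_lt_four, Real.pi_pos, Real.pi_lt_d2]

end MKdVPaper

namespace MKdVPaper

variable {ρ N : ℝ} {c : ℂ} {w g : ℝ → ℂ}

/-- Oscillatory bound with a bounded, slowly varying amplitude `r`. -/
theorem Prof.norm_osc_le_of_bound (h : Prof ρ N c w g) {a b M M' : ℝ} (hab : a ≤ b)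
    {r r' ψ ψ' : ℝ → ℝ}
    (hr : ∀ k ∈ Icc a b, HasDerivAt r (r' k) k) (hψ : ∀ k ∈ Icc a b, HasDerivAt ψ (ψ' k) k)
    (hr' : ContinuousOn r' (Icc a b)) (hψ' : ContinuousOn ψ' (Icc a b))
    (hM : ∀ k ∈ Icc a b, |r k| ≤ M) (hM' : ∀ k ∈ Icc a b, |r' k| ≤ M') :
    ‖∫ k in a..b, ((r k * ψ' k : ℝ) : ℂ) * cis (ψ k) * w k‖ ≤
      4 * M + M' * (b - a) + 2 * (M * √(b - a)) := by
  obtain ⟨s, hs, hd⟩ := h.der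
  have hrc : ContinuousOn r (Icc a b) := fun k hk => (hr k hk).continuousAt.continuousWithinAt
  have hu : uIcc a b = Icc a b := uIcc_of_le hab
  have haa : a ∈ Icc a b := ⟨le_rfl, hab⟩
  have hbb : b ∈ Icc a b := ⟨hab, le_rfl⟩
  have hM0 : 0 ≤ M := (abs_nonneg _).trans (hM a haa)
  have hba : 0 ≤ b - a := sub_nonneg.2 hab
  have key := norm_integral_osc_le hab hs hr hψ hr' hψ' h.cont.continuousOn
    (fun k hk => hd k hk.2) (h.intervalIntegrable_deriv a b)
  have t2 := h.integral_weight_le hab hrc.abs (fun k _ => abs_nonneg _)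
    (by positivity : 0 ≤ M * √(b - a)) (by
      calc ∫ k in a..b, |r k| ^ 2 ≤ ∫ k in a..b, M ^ 2 := by
            apply intervalIntegral.integral_mono_on hab
            · apply ContinuousOn.intervalIntegrable; rw [hu]; exact hrc.abs.pow 2
            · exact intervalIntegrable_const
            · intro k hk
              exact pow_le_pow_left₀ (abs_nonneg _) (hM k hk) 2
        _ = (M * √(b - a)) ^ 2 := by
            rw [mul_pow, Real.sq_sqrt hba]; simp; ring) hM0 (fun k hk _ => hM k hk)
  have jw : IntervalIntegrable (fun k => |r' k| * ‖w k‖) volume a b := by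
    apply ContinuousOn.intervalIntegrable; rw [hu]; exact hr'.abs.mul h.cont.continuousOn.norm
  have jg : IntervalIntegrable (fun k => |r k| * ‖g k + jumpDeriv ρ c k‖) volume a b := by
    apply (h.intervalIntegrable_deriv a b).norm.continuousOn_mul; rw [hu]; exact hrc.abs
  rw [intervalIntegral.integral_add jw jg] at key
  have t3 : ∫ k in a..b, |r' k| * ‖w k‖ ≤ ∫ k in a..b, M' :=
    intervalIntegral.integral_mono_on hab jw intervalIntegrable_const fun k hk =>
      (mul_le_of_le_one_right (abs_nonneg _) (h.bdd k)).trans (hM' k hk)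
  rw [intervalIntegral.integral_const, smul_eq_mul] at t3
  have t4 : |r a| * ‖w a‖ ≤ M :=
    (mul_le_of_le_one_right (abs_nonneg _) (h.bdd _)).trans (hM a haa)
  have t5 : |r b| * ‖w b‖ ≤ M :=
    (mul_le_of_le_one_right (abs_nonneg _) (h.bdd _)).trans (hM b hbb)
  linarith

lemma hasDerivAt_phase (x k : ℝ) : HasDerivAt (fun k : ℝ => k * x + k ^ 3) (x + 3 * k ^ 2) k := by
  simpa using ((hasDerivAt_id k).mul_const x).fun_add (hasDerivAt_pow 3 k)

lemma osc_eq_of_le {N M : ℝ} {h : ℝ → ℂ} (hN : 0 ≤ N) (hM : N ≤ M) (hs : ∀ k, N ≤ |k| → h k = 0)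
    (x : ℝ) : osc N h x = osc M h x := by
  unfold osc
  rw [intervalIntegral.integral_of_le (by linarith), intervalIntegral.integral_of_le (by linarith)]
  symm
  apply setIntegral_eq_of_subset_of_forall_sdiff_eq_zero measurableSet_Ioc
  · exact Ioc_subset_Ioc (by linarith) hM
  · intro k hk
    rw [hs k, mul_zero]
    by_contra hlt
    push Not at hlt
    exact hk.2 ⟨(abs_lt.1 hlt).1, (abs_lt.1 hlt).2.le⟩

lemma norm_integral_phase_neg {h : ℝ → ℂ} (hs : ∀ k, h (-k) = starRingEnd ℂ (h k)) (x a b : ℝ) :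
    ‖∫ k in (-b)..(-a), cis (k * x + k ^ 3) * h k‖ = ‖∫ k in a..b, cis (k * x + k ^ 3) * h k‖ := by
  have := intervalIntegral.integral_comp_neg (a := a) (b := b)
    (fun k => cis (k * x + k ^ 3) * h k)
  rw [← this, ← RCLike.norm_conj]
  congr 1
  have hconj : ∀ F : ℝ → ℂ, starRingEnd ℂ (∫ k in a..b, F k) =
      ∫ k in a..b, starRingEnd ℂ (F k) := by
    intro F
    simp only [intervalIntegral, map_sub, integral_conj]
  rw [hconj]
  refine intervalIntegral.integral_congr fun k _ => ?_
  simp only [map_mul, conj_cis, hs, Complex.conj_conj]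
  congr 2
  ring

lemma norm_osc_split_le {N M a : ℝ} {h : ℝ → ℂ} (hc : Continuous h) (hN : 0 ≤ N) (hM : N ≤ M)
    (hs : ∀ k, N ≤ |k| → h k = 0) (hsym : ∀ k, h (-k) = starRingEnd ℂ (h k)) (x : ℝ) :
    ‖osc N h x‖ ≤ 2 * ‖∫ k in (0 : ℝ)..a, cis (k * x + k ^ 3) * h k‖ +
      2 * ‖∫ k in a..M, cis (k * x + k ^ 3) * h k‖ := by
  rw [osc_eq_of_le hN hM hs, osc]
  have hi : ∀ a b, IntervalIntegrable (fun k => cis (k * x + k ^ 3) * h k) volume a b := fun a b =>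
    ((continuous_phase x).mul hc).intervalIntegrable a b
  rw [← intervalIntegral.integral_add_adjacent_intervals (hi (-M) 0) (hi 0 M)]
  have e := norm_integral_phase_neg hsym x 0 M
  rw [neg_zero] at e
  have e2 : ‖∫ k in (0 : ℝ)..M, cis (k * x + k ^ 3) * h k‖ ≤
      ‖∫ k in (0 : ℝ)..a, cis (k * x + k ^ 3) * h k‖ + ‖∫ k in a..M, cis (k * x + k ^ 3) * h k‖ := by
    rw [← intervalIntegral.integral_add_adjacent_intervals (hi 0 a) (hi a M)]
    exact norm_add_le _ _
  calc _ ≤ _ := norm_add_le _ _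
    _ ≤ _ := by rw [e]; linarith

/-- Tail bound away from stationary points. -/
lemma Prof.norm_tail_le (h : Prof ρ N c w g) {a b x D : ℝ} (ha : 0 < a) (hab : a ≤ b)
    (hD : 0 < D) (hx : D ≤ x + 3 * a ^ 2) :
    ‖∫ k in a..b, cis (k * x + k ^ 3) * w k‖ ≤ 8 / D + 2 * √(1 / (3 * a * D)) := by
  have hpos : ∀ k ∈ Icc a b, D ≤ x + 3 * k ^ 2 := fun k hk => by nlinarith [hk.1]
  have hpos' : ∀ k ∈ Icc a b, 0 < x + 3 * k ^ 2 := fun k hk => hD.trans_le (hpos k hk)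
  have hd : ∀ k ∈ Icc a b, HasDerivAt (fun k : ℝ => (x + 3 * k ^ 2)⁻¹)
      (-(6 * k) / (x + 3 * k ^ 2) ^ 2) k := by
    intro k hk
    have h1 : HasDerivAt (fun k : ℝ => x + 3 * k ^ 2) (6 * k) k := by
      have := ((hasDerivAt_pow 2 k).const_mul 3).const_add x
      refine this.congr_deriv ?_
      norm_num; ring
    exact h1.inv (hpos' k hk).ne'
  have key := h.norm_osc_le' (B := 1 / (6 * a)) hab hd (fun k _ => hasDerivAt_phase x k)
    (by
      refine ContinuousOn.div (by fun_prop) (by fun_prop) fun k hk => ?_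
      have := hpos' k hk; positivity) (by fun_prop) (by positivity)
    (Or.inl fun k hk => by
      have hp := hpos' k hk
      have hk0 : 0 < k := ha.trans_le hk.1
      constructor
      · rw [inv_pow, neg_div, neg_neg, ← mul_div_assoc, inv_eq_one_div]
        gcongr
        rw [one_div, inv_mul_eq_div, le_div_iff₀ (by positivity)]
        linarith [hk.1]
      · rw [neg_div]
        have : 0 ≤ 6 * k / (x + 3 * k ^ 2) ^ 2 := by positivity
        linarith)
  have e : ∫ k in a..b, (((x + 3 * k ^ 2)⁻¹ * (x + 3 * k ^ 2) : ℝ) : ℂ) * cis (k * x + k ^ 3) * w k =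
      ∫ k in a..b, cis (k * x + k ^ 3) * w k := by
    refine intervalIntegral.integral_congr fun k hk => ?_
    rw [uIcc_of_le hab] at hk
    simp only [inv_mul_cancel₀ (hpos' k hk).ne', Complex.ofReal_one, one_mul]
  rw [e] at key
  have b1 : ∀ k ∈ Icc a b, |(x + 3 * k ^ 2)⁻¹| ≤ 1 / D := fun k hk => by
    rw [abs_of_pos (inv_pos.2 (hpos' k hk)), inv_eq_one_div]
    exact one_div_le_one_div_of_le hD (hpos k hk)
  have ba := b1 a ⟨le_rfl, hab⟩
  have bb := b1 b ⟨hab, le_rfl⟩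
  refine key.trans ?_
  have e1 : 1 / (6 * a) * (|(x + 3 * a ^ 2)⁻¹| + |(x + 3 * b ^ 2)⁻¹|) ≤ 1 / (3 * a * D) := by
    calc _ ≤ 1 / (6 * a) * (1 / D + 1 / D) := by gcongr
      _ = _ := by field_simp; norm_num
  have e2 := Real.sqrt_le_sqrt e1
  have e3 : 8 / D = 8 * (1 / D) := by ring
  rw [e3]
  linarith

/-- Tail bound away from stationary points, for the derivative. -/
lemma Prof.norm_tail_deriv_le (h : Prof ρ N c w g) {a b x : ℝ} (ha : 0 < a) (hab : a ≤ b)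
    (hx : a ^ 2 ≤ x + 3 * a ^ 2) (hx2 : x ≤ a ^ 2) :
    ‖∫ k in a..b, cis (k * x + k ^ 3) * (Complex.I * k * w k)‖ ≤ 8 / a + 2 * √(1 / a) := by
  have hpos : ∀ k ∈ Icc a b, k ^ 2 ≤ x + 3 * k ^ 2 := fun k hk => by nlinarith [hk.1]
  have hk0 : ∀ k ∈ Icc a b, 0 < k := fun k hk => ha.trans_le hk.1
  have hpos' : ∀ k ∈ Icc a b, 0 < x + 3 * k ^ 2 := fun k hk => by
    have := hk0 k hk; have := hpos k hk; nlinarith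
  have hd : ∀ k ∈ Icc a b, HasDerivAt (fun k : ℝ => k / (x + 3 * k ^ 2))
      ((x - 3 * k ^ 2) / (x + 3 * k ^ 2) ^ 2) k := by
    intro k hk
    have h1 : HasDerivAt (fun k : ℝ => x + 3 * k ^ 2) (6 * k) k := by
      have := ((hasDerivAt_pow 2 k).const_mul 3).const_add x
      refine this.congr_deriv ?_
      norm_num; ring
    refine ((hasDerivAt_id k).fun_div h1 (hpos' k hk).ne').congr_deriv ?_
    simp only [id]; ring
  have key := h.norm_osc_le' (B := 1 / 2) hab hd (fun k _ => hasDerivAt_phase x k)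
    (by
      refine ContinuousOn.div (by fun_prop) (by fun_prop) fun k hk => ?_
      have := hpos' k hk; positivity) (by fun_prop) (by positivity)
    (Or.inl fun k hk => by
      have hp := hpos' k hk
      have hk0 : 0 < k := ha.trans_le hk.1
      have hak : a ^ 2 ≤ k ^ 2 := pow_le_pow_left₀ ha.le hk.1 2
      constructor
      · rw [div_pow, ← neg_div, ← mul_div_assoc]
        gcongr
        nlinarith
      · apply div_nonpos_of_nonpos_of_nonneg <;> nlinarith)
  have e : ∫ k in a..b, ((k / (x + 3 * k ^ 2) * (x + 3 * k ^ 2) : ℝ) : ℂ) * cis (k * x + k ^ 3) * w k =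
      -Complex.I * ∫ k in a..b, cis (k * x + k ^ 3) * (Complex.I * k * w k) := by
    rw [← intervalIntegral.integral_const_mul]
    refine intervalIntegral.integral_congr fun k hk => ?_
    rw [uIcc_of_le hab] at hk
    simp only [div_mul_cancel₀ k (hpos' k hk).ne']
    linear_combination (cis (k * x + k ^ 3) * k * w k) * (Complex.I_sq)
  rw [e, norm_mul, norm_neg, Complex.norm_I, one_mul] at key
  have b1 : ∀ k ∈ Icc a b, |k / (x + 3 * k ^ 2)| ≤ 1 / a := fun k hk => by
    rw [abs_of_pos (div_pos (hk0 k hk) (hpos' k hk)), div_le_div_iff₀ (hpos' k hk) ha]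
    nlinarith [hpos k hk, hk0 k hk, hk.1]
  have ba := b1 a ⟨le_rfl, hab⟩
  have bb := b1 b ⟨hab, le_rfl⟩
  refine key.trans ?_
  have e1 : 1 / 2 * (|a / (x + 3 * a ^ 2)| + |b / (x + 3 * b ^ 2)|) ≤ 1 / a := by linarith
  have e2 := Real.sqrt_le_sqrt e1
  have e3 : 8 / a = 8 * (1 / a) := by ring
  rw [e3]
  linarith

/-- Bound for the mode `u' + iξu` away from the stationary point on the right. -/
lemma Prof.norm_mode_right_le (h : Prof ρ N c w g) {ξ η b : ℝ} (hη : 0 < η) (hb : ξ + η ≤ b) :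
    ‖∫ k in (ξ + η)..b, cis (k * (-3 * ξ ^ 2) + k ^ 3) * (Complex.I * (k + ξ) * w k)‖ ≤
      4 / η + 2 * √(1 / η) := by
  have hk0 : ∀ k ∈ Icc (ξ + η) b, 0 < k - ξ := fun k hk => by linarith [hk.1]
  have hd : ∀ k ∈ Icc (ξ + η) b, HasDerivAt (fun k : ℝ => (3 * (k - ξ))⁻¹)
      (-3 / (3 * (k - ξ)) ^ 2) k := by
    intro k hk
    have h1 : HasDerivAt (fun k : ℝ => 3 * (k - ξ)) 3 k := by
      simpa using ((hasDerivAt_id k).sub_const ξ).const_mul 3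
    have := hk0 k hk
    exact h1.inv (by positivity)
  have key := h.norm_osc_le' (B := 1 / 3) hb hd
    (fun k _ => hasDerivAt_phase (-3 * ξ ^ 2) k)
    (by
      refine ContinuousOn.div (by fun_prop) (by fun_prop) fun k hk => ?_
      have := hk0 k hk; positivity) (by fun_prop) (by positivity)
    (Or.inl fun k hk => by
      have hp := hk0 k hk
      constructor
      · apply le_of_eq; field_simp
      · apply div_nonpos_of_nonpos_of_nonneg <;> [norm_num; positivity])
  have e : ∫ k in (ξ + η)..b, (((3 * (k - ξ))⁻¹ * (-3 * ξ ^ 2 + 3 * k ^ 2) : ℝ) : ℂ) *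
      cis (k * (-3 * ξ ^ 2) + k ^ 3) * w k =
      -Complex.I * ∫ k in (ξ + η)..b, cis (k * (-3 * ξ ^ 2) + k ^ 3) * (Complex.I * (k + ξ) * w k) := by
    rw [← intervalIntegral.integral_const_mul]
    refine intervalIntegral.integral_congr fun k hk => ?_
    rw [uIcc_of_le hb] at hk
    have hp := hk0 k hk
    have e1 : (3 * (k - ξ))⁻¹ * (-3 * ξ ^ 2 + 3 * k ^ 2) = k + ξ := by field_simp; ring
    simp only [e1]
    push_cast
    linear_combination (cis (k * (-3 * ξ ^ 2) + k ^ 3) * (k + ξ) * w k) * (Complex.I_sq)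
  rw [e, norm_mul, norm_neg, Complex.norm_I, one_mul] at key
  have b1 : ∀ k ∈ Icc (ξ + η) b, |(3 * (k - ξ))⁻¹| ≤ 1 / (3 * η) := fun k hk => by
    have := hk0 k hk
    rw [abs_of_pos (by positivity), inv_eq_one_div]
    apply one_div_le_one_div_of_le (by positivity)
    linarith [hk.1]
  have ba := b1 _ ⟨le_rfl, hb⟩
  have bb := b1 b ⟨hb, le_rfl⟩
  have e3 : 1 / (3 * η) = 1 / 3 * (1 / η) := by field_simp
  have e4 : 0 < 1 / η := by positivity
  have e5 : 4 / η = 4 * (1 / η) := by ring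
  rw [e3] at ba bb
  refine key.trans ?_
  have e1 : 1 / 3 * (|(3 * (ξ + η - ξ))⁻¹| + |(3 * (b - ξ))⁻¹|) ≤ 1 / η := by linarith
  have e2 := Real.sqrt_le_sqrt e1
  rw [e5]
  linarith

/-- Bound for the mode `u' + iξu` away from the stationary point on the left. -/
lemma Prof.norm_mode_left_le (h : Prof ρ N c w g) {ξ η a : ℝ} (hη : 0 < η) (ha : a ≤ ξ - η) :
    ‖∫ k in a..(ξ - η), cis (k * (-3 * ξ ^ 2) + k ^ 3) * (Complex.I * (k + ξ) * w k)‖ ≤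
      4 / η + 2 * √(1 / η) := by
  have hk0 : ∀ k ∈ Icc a (ξ - η), 0 < ξ - k := fun k hk => by linarith [hk.2]
  have hd : ∀ k ∈ Icc a (ξ - η), HasDerivAt (fun k : ℝ => (3 * (k - ξ))⁻¹)
      (-3 / (3 * (k - ξ)) ^ 2) k := by
    intro k hk
    have h1 : HasDerivAt (fun k : ℝ => 3 * (k - ξ)) 3 k := by
      simpa using ((hasDerivAt_id k).sub_const ξ).const_mul 3
    have := hk0 k hk
    exact h1.inv (by nlinarith)
  have key := h.norm_osc_le' (B := 1 / 3) ha hd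
    (fun k _ => hasDerivAt_phase (-3 * ξ ^ 2) k)
    (by
      refine ContinuousOn.div (by fun_prop) (by fun_prop) fun k hk => ?_
      have := hk0 k hk
      have h2 : 3 * (k - ξ) ≠ 0 := by nlinarith
      positivity) (by fun_prop) (by positivity)
    (Or.inl fun k hk => by
      have hp := hk0 k hk
      have h2 : k - ξ ≠ 0 := by linarith
      constructor
      · apply le_of_eq; field_simp
      · apply div_nonpos_of_nonpos_of_nonneg <;> [norm_num; positivity])
  have e : ∫ k in a..(ξ - η), (((3 * (k - ξ))⁻¹ * (-3 * ξ ^ 2 + 3 * k ^ 2) : ℝ) : ℂ) *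
      cis (k * (-3 * ξ ^ 2) + k ^ 3) * w k =
      -Complex.I * ∫ k in a..(ξ - η), cis (k * (-3 * ξ ^ 2) + k ^ 3) * (Complex.I * (k + ξ) * w k) := by
    rw [← intervalIntegral.integral_const_mul]
    refine intervalIntegral.integral_congr fun k hk => ?_
    rw [uIcc_of_le ha] at hk
    have hp := hk0 k hk
    have h2 : k - ξ ≠ 0 := by linarith
    have e1 : (3 * (k - ξ))⁻¹ * (-3 * ξ ^ 2 + 3 * k ^ 2) = k + ξ := by field_simp; ring
    simp only [e1]
    push_cast
    linear_combination (cis (k * (-3 * ξ ^ 2) + k ^ 3) * (k + ξ) * w k) * (Complex.I_sq)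
  rw [e, norm_mul, norm_neg, Complex.norm_I, one_mul] at key
  have b1 : ∀ k ∈ Icc a (ξ - η), |(3 * (k - ξ))⁻¹| ≤ 1 / (3 * η) := fun k hk => by
    have := hk0 k hk
    rw [abs_of_neg (inv_neg''.2 (by linarith)), ← inv_neg, inv_eq_one_div]
    apply one_div_le_one_div_of_le (by positivity)
    linarith [hk.2]
  have ba := b1 _ ⟨ha, le_rfl⟩
  have bb := b1 a ⟨le_rfl, ha⟩
  have e3 : 1 / (3 * η) = 1 / 3 * (1 / η) := by field_simp
  have e4 : 0 < 1 / η := by positivity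
  have e5 : 4 / η = 4 * (1 / η) := by ring
  rw [e3] at ba bb
  refine key.trans ?_
  have e1 : 1 / 3 * (|(3 * (a - ξ))⁻¹| + |(3 * (ξ - η - ξ))⁻¹|) ≤ 1 / η := by linarith
  have e2 := Real.sqrt_le_sqrt e1
  rw [e5]
  linarith

end MKdVPaper

namespace MKdVPaper

variable {ρ N : ℝ} {c : ℂ} {w g : ℝ → ℂ}

/-- The mode `u' + iξu` at `x = -3ξ²`, as an oscillatory integral. -/
def mode (N : ℝ) (w : ℝ → ℂ) (ξ : ℝ) : ℂ :=
  osc N (fun k => Complex.I * (k + ξ) * w k) (-3 * ξ ^ 2)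

lemma mode_eq (h : Prof ρ N c w g) (ξ : ℝ) :
    mode N w ξ = osc N (fun k => Complex.I * k * w k) (-3 * ξ ^ 2) +
      Complex.I * ξ * osc N w (-3 * ξ ^ 2) := by
  have hc := h.cont
  have : ∀ x, Complex.I * ξ * osc N w x = osc N (fun k => Complex.I * ξ * w k) x := by
    intro x
    unfold osc
    rw [← intervalIntegral.integral_const_mul]
    congr 1; ext k; ring
  rw [this, ← osc_add ((by fun_prop : Continuous _).intervalIntegrable _ _)
    ((by fun_prop : Continuous _).intervalIntegrable _ _), mode]
  congr 1; ext k; ring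

lemma Prof.symm_deriv (h : Prof ρ N c w g) (k : ℝ) :
    Complex.I * ((-k : ℝ) : ℂ) * w (-k) = starRingEnd ℂ (Complex.I * k * w k) := by
  simp [h.symm]

lemma Prof.norm_mode_le (h : Prof ρ N c w g) {ξ : ℝ} (hξ : 1 ≤ ξ) :
    ‖mode N w ξ‖ ≤ 18 * √ξ := by
  have hc := h.cont
  set y := √ξ with hy
  have hy1 : 1 ≤ y := Real.one_le_sqrt.2 hξ
  have hyξ : y ^ 2 = ξ := Real.sq_sqrt (by linarith)
  set η := 1 / y with hη
  have hη0 : 0 < η := by positivity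
  have hη1 : η ≤ 1 := by rw [hη, div_le_one (by linarith)]; exact hy1
  have hN := h.N_ge
  rw [mode, osc_eq_of_le (M := N + ξ + 1) (by linarith) (by linarith)
    (fun k hk => by rw [h.supp k hk, mul_zero]), osc]
  set F : ℝ → ℂ := fun k => cis (k * (-3 * ξ ^ 2) + k ^ 3) * (Complex.I * (k + ξ) * w k) with hF
  have hFc : Continuous F := (continuous_phase _).mul (by fun_prop)
  have hi : ∀ a b, IntervalIntegrable F volume a b := fun a b => hFc.intervalIntegrable a b
  rw [← intervalIntegral.integral_add_adjacent_intervals (hi _ (ξ - η)) (hi _ _),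
    ← intervalIntegral.integral_add_adjacent_intervals (hi (ξ - η) (ξ + η)) (hi _ _)]
  have b1 : ‖∫ k in (-(N + ξ + 1))..(ξ - η), F k‖ ≤ 4 / η + 2 * √(1 / η) :=
    h.norm_mode_left_le hη0 (by linarith)
  have b2 : ‖∫ k in (ξ + η)..(N + ξ + 1), F k‖ ≤ 4 / η + 2 * √(1 / η) :=
    h.norm_mode_right_le hη0 (by linarith)
  have b3 : ‖∫ k in (ξ - η)..(ξ + η), F k‖ ≤ (3 * ξ) * |ξ + η - (ξ - η)| := by
    apply intervalIntegral.norm_integral_le_of_norm_le_const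
    intro k hk
    rw [uIoc_of_le (by linarith)] at hk
    have : ‖(k : ℂ) + ξ‖ ≤ 3 * ξ := by
      rw [← Complex.ofReal_add, Complex.norm_real, Real.norm_eq_abs, abs_le]
      constructor <;> linarith [hk.1, hk.2]
    simp only [hF, norm_mul, norm_cis, Complex.norm_I, one_mul]
    calc _ ≤ 3 * ξ * 1 := mul_le_mul this (h.bdd k) (norm_nonneg _) (by linarith)
      _ = _ := by ring
  have e1 : 1 / η = y := by rw [hη]; field_simp
  have e2 : 4 / η = 4 * y := by rw [hη]; field_simp
  have e3 : √y ≤ y := by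
    rw [Real.sqrt_le_left (by linarith)]; nlinarith
  rw [e1, e2] at b1 b2
  have e4 : (3 * ξ) * |ξ + η - (ξ - η)| = 6 * y := by
    rw [abs_of_pos (by linarith), ← hyξ, hη]; field_simp; ring
  rw [e4] at b3
  calc _ ≤ _ := norm_add_le _ _
    _ ≤ _ := add_le_add_right (norm_add_le _ _) _
    _ ≤ 18 * y := by linarith

/-- Recovering `u` and `u'` from the mode. -/
lemma Prof.of_mode (h : Prof ρ N c w g) (ξ : ℝ) :
    osc N (fun k => Complex.I * k * w k) (-3 * ξ ^ 2) =
      (mode N w ξ + starRingEnd ℂ (mode N w ξ)) / 2 ∧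
    ξ * osc N w (-3 * ξ ^ 2) = (mode N w ξ - starRingEnd ℂ (mode N w ξ)) / (2 * Complex.I) := by
  have e1 := conj_osc (N := N) h.symm (-3 * ξ ^ 2)
  have e2 := conj_osc (N := N) (h := fun k => Complex.I * k * w k)
    (fun k => h.symm_deriv k) (-3 * ξ ^ 2)
  have e3 : starRingEnd ℂ (mode N w ξ) = osc N (fun k => Complex.I * k * w k) (-3 * ξ ^ 2) -
      Complex.I * ξ * osc N w (-3 * ξ ^ 2) := by
    rw [mode_eq h, map_add, e2, map_mul, map_mul, e1, Complex.conj_I, Complex.conj_ofReal]; ring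
  rw [e3, mode_eq h]
  constructor
  · ring
  · rw [eq_div_iff (by simp)]; ring

lemma Prof.norm_le_mode (h : Prof ρ N c w g) {ξ : ℝ} (hξ : 1 ≤ ξ) :
    ‖osc N (fun k => Complex.I * k * w k) (-3 * ξ ^ 2)‖ ≤ 18 * √ξ ∧
      ξ * ‖osc N w (-3 * ξ ^ 2)‖ ≤ 18 * √ξ := by
  have hm := h.norm_mode_le hξ
  obtain ⟨e1, e2⟩ := h.of_mode ξ
  constructor
  · rw [e1, norm_div]
    have := norm_add_le (mode N w ξ) (starRingEnd ℂ (mode N w ξ))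
    rw [RCLike.norm_conj] at this
    simp only [Complex.norm_ofNat]
    linarith
  · have e3 := congrArg norm e2
    rw [norm_mul, Complex.norm_real, Real.norm_of_nonneg (by linarith)] at e3
    rw [e3, norm_div]
    have := norm_sub_le (mode N w ξ) (starRingEnd ℂ (mode N w ξ))
    rw [RCLike.norm_conj] at this
    simp only [Complex.norm_ofNat, norm_mul, Complex.norm_I, mul_one]
    linarith

lemma Prof.norm_pos_le (h : Prof ρ N c w g) {y : ℝ} (hy : 1 ≤ y) :
    ‖osc N w (y ^ 4)‖ ≤ 32 / y ^ 3 ∧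
    ‖osc N (fun k => Complex.I * k * w k) (y ^ 4)‖ ≤ 34 := by
  have hc := h.cont
  have hN := h.N_ge
  have hy0 : 0 < y := by linarith
  have hy2 : 1 ≤ y ^ 2 := one_le_pow₀ hy
  set x := y ^ 4 with hx
  have hx0 : 0 < x := by positivity
  have hpos : ∀ k : ℝ, x ≤ x + 3 * k ^ 2 := fun k => by nlinarith [sq_nonneg k]
  have hpos' : ∀ k : ℝ, 0 < x + 3 * k ^ 2 := fun k => by nlinarith [sq_nonneg k]
  have h1 : ∀ k : ℝ, HasDerivAt (fun k : ℝ => x + 3 * k ^ 2) (6 * k) k := by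
    intro k
    have := ((hasDerivAt_pow 2 k).const_mul 3).const_add x
    refine this.congr_deriv ?_
    norm_num; ring
  have hsqrt : √(y ^ 2 - 0) = y := by rw [sub_zero]; exact Real.sqrt_sq hy0.le
  constructor
  · have key := h.norm_osc_le_of_bound (a := 0) (b := y ^ 2) (M := 1 / y ^ 4) (M' := 6 / y ^ 6)
      (by positivity) (r := fun k => (x + 3 * k ^ 2)⁻¹) (fun k _ => (h1 k).inv (hpos' k).ne')
      (fun k _ => hasDerivAt_phase x k)
      (ContinuousOn.div (by fun_prop) (by fun_prop) fun k _ => by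
        have := hpos' k; positivity) (by fun_prop)
      (fun k _ => by
        rw [abs_of_pos (inv_pos.2 (hpos' k)), inv_eq_one_div]
        exact one_div_le_one_div_of_le hx0 (hpos k))
      (fun k hk => by
        rw [abs_div, abs_neg, abs_of_nonneg (by linarith [hk.1] : 0 ≤ 6 * k), abs_of_pos
          (by have := hpos' k; positivity)]
        calc 6 * k / (x + 3 * k ^ 2) ^ 2 ≤ 6 * y ^ 2 / x ^ 2 := by
              gcongr
              · exact hk.2
              · exact hpos k
          _ = 6 / y ^ 6 := by rw [hx]; field_simp)
    have e : ∫ k in (0 : ℝ)..(y ^ 2), (((x + 3 * k ^ 2)⁻¹ * (x + 3 * k ^ 2) : ℝ) : ℂ) *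
        cis (k * x + k ^ 3) * w k = ∫ k in (0 : ℝ)..(y ^ 2), cis (k * x + k ^ 3) * w k := by
      refine intervalIntegral.integral_congr fun k hk => ?_
      simp only [inv_mul_cancel₀ (hpos' k).ne', Complex.ofReal_one, one_mul]
    rw [e, hsqrt] at key
    have t := h.norm_tail_le (a := y ^ 2) (b := N + y ^ 2) (x := x) (D := 4 * y ^ 4) (by positivity)
      (by linarith) (by positivity) (by rw [hx]; ring_nf; rfl)
    have s := norm_osc_split_le (a := y ^ 2) (M := N + y ^ 2) hc (by linarith) (by linarith) h.supp
      h.symm x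
    have y34 : 1 / y ^ 4 ≤ 1 / y ^ 3 :=
      one_div_le_one_div_of_le (by positivity) (pow_le_pow_right₀ hy (by norm_num))
    have t2 : √(1 / (3 * y ^ 2 * (4 * y ^ 4))) ≤ 1 / y ^ 3 := by
      apply Real.sqrt_le_iff.2
      refine ⟨by positivity, ?_⟩
      rw [div_pow, one_pow]
      apply one_div_le_one_div_of_le (by positivity)
      nlinarith [pow_pos hy0 6]
    have e5 : 8 / (4 * y ^ 4) = 2 * (1 / y ^ 4) := by field_simp; norm_num
    have e6 : 6 / y ^ 6 * (y ^ 2 - 0) = 6 * (1 / y ^ 4) := by field_simp; ring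
    have e7 : 1 / y ^ 4 * y = 1 / y ^ 3 := by field_simp
    have e8 : 32 / y ^ 3 = 32 * (1 / y ^ 3) := by ring
    rw [e6, e7] at key
    rw [e5] at t
    rw [e8]
    linarith
  · have key := h.norm_osc_le_of_bound (a := 0) (b := y ^ 2) (M := 1 / y ^ 2) (M' := 1 / y ^ 4)
      (by positivity) (r := fun k => k / (x + 3 * k ^ 2))
      (r' := fun k => (x - 3 * k ^ 2) / (x + 3 * k ^ 2) ^ 2)
      (fun k _ => ((hasDerivAt_id k).fun_div (h1 k) (hpos' k).ne').congr_deriv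
        (by simp only [id]; ring))
      (fun k _ => hasDerivAt_phase x k)
      (ContinuousOn.div (by fun_prop) (by fun_prop) fun k _ => by
        have := hpos' k; positivity) (by fun_prop)
      (fun k hk => by
        rw [abs_of_nonneg (div_nonneg hk.1 (hpos' k).le), div_le_div_iff₀ (hpos' k) (by positivity)]
        have : k * y ^ 2 ≤ y ^ 2 * y ^ 2 := by gcongr; exact hk.2
        have := hpos k
        rw [hx] at this ⊢
        nlinarith)
      (fun k hk => by
        rw [abs_div, abs_of_pos (by have := hpos' k; positivity : 0 < (x + 3 * k ^ 2) ^ 2),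
          div_le_div_iff₀ (by have := hpos' k; positivity) (by positivity)]
        have : |x - 3 * k ^ 2| ≤ x + 3 * k ^ 2 := by
          rw [abs_le]; constructor <;> nlinarith [sq_nonneg k]
        have := hpos k
        have := hpos' k
        rw [← hx]
        calc |x - 3 * k ^ 2| * x ≤ (x + 3 * k ^ 2) * (x + 3 * k ^ 2) := by gcongr
          _ = _ := by ring)
    have e : ∫ k in (0 : ℝ)..(y ^ 2), ((k / (x + 3 * k ^ 2) * (x + 3 * k ^ 2) : ℝ) : ℂ) *
        cis (k * x + k ^ 3) * w k =
        -Complex.I * ∫ k in (0 : ℝ)..(y ^ 2), cis (k * x + k ^ 3) * (Complex.I * k * w k) := by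
      rw [← intervalIntegral.integral_const_mul]
      refine intervalIntegral.integral_congr fun k hk => ?_
      simp only [div_mul_cancel₀ k (hpos' k).ne']
      linear_combination (cis (k * x + k ^ 3) * k * w k) * (Complex.I_sq)
    rw [e, hsqrt, norm_mul, norm_neg, Complex.norm_I, one_mul] at key
    have t := h.norm_tail_deriv_le (a := y ^ 2) (b := N + y ^ 2) (x := x) (by positivity)
      (by linarith) (by rw [hx]; nlinarith [pow_pos hy0 4]) (by rw [hx]; ring_nf; rfl)
    have s := norm_osc_split_le (N := N) (a := y ^ 2) (M := N + y ^ 2) (h := fun k => Complex.I * k * w k)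
      (by fun_prop) (by linarith) (by linarith) (fun k hk => by rw [h.supp k hk, mul_zero])
      (fun k => h.symm_deriv k) x
    have q1 : 1 / y ^ 2 ≤ 1 := by rw [div_le_one (by positivity)]; exact hy2
    have q2 : √(1 / y ^ 2) ≤ 1 := Real.sqrt_le_one.2 q1
    have q3 : 1 / y ^ 4 * (y ^ 2 - 0) = 1 / y ^ 2 := by field_simp; ring
    have q4 : 1 / y ^ 2 * y ≤ 1 := by
      rw [one_div_mul_eq_div, div_le_one (by positivity)]; nlinarith
    have q5 : 8 / y ^ 2 = 8 * (1 / y ^ 2) := by ring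
    rw [q3] at key
    rw [q5] at t
    linarith

lemma Prof.norm_mid_le (h : Prof ρ N c w g) {x : ℝ} (hx : -3 ≤ x) (hx1 : x ≤ 1) :
    ‖osc N w x‖ ≤ 10 ∧ ‖osc N (fun k => Complex.I * k * w k) x‖ ≤ 20 := by
  have hc := h.cont
  have hN := h.N_ge
  constructor
  · have t := h.norm_tail_le (a := 2) (b := N + 2) (x := x) (D := 9) (by norm_num)
      (by linarith) (by norm_num) (by linarith)
    have s := norm_osc_split_le (a := 2) (M := N + 2) hc (by linarith) (by linarith) h.supp
      h.symm x
    have m : ‖∫ k in (0 : ℝ)..2, cis (k * x + k ^ 3) * w k‖ ≤ 1 * |2 - 0| := by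
      apply intervalIntegral.norm_integral_le_of_norm_le_const
      intro k _
      simpa using h.bdd k
    have q : √(1 / (3 * 2 * 9)) ≤ (1 : ℝ) := Real.sqrt_le_one.2 (by norm_num)
    norm_num at m t q ⊢
    linarith
  · have t := h.norm_tail_deriv_le (a := 2) (b := N + 2) (x := x) (by norm_num)
      (by linarith) (by linarith) (by linarith)
    have s := norm_osc_split_le (N := N) (a := 2) (M := N + 2) (h := fun k => Complex.I * k * w k)
      (by fun_prop) (by linarith) (by linarith) (fun k hk => by rw [h.supp k hk, mul_zero])
      (fun k => h.symm_deriv k) x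
    have m : ‖∫ k in (0 : ℝ)..2, cis (k * x + k ^ 3) * (Complex.I * k * w k)‖ ≤ 2 * |2 - 0| := by
      apply intervalIntegral.norm_integral_le_of_norm_le_const
      intro k hk
      rw [uIoc_of_le (by norm_num)] at hk
      simp only [norm_mul, norm_cis, Complex.norm_I, one_mul, Complex.norm_real]
      rw [Real.norm_of_nonneg hk.1.le]
      calc _ ≤ 2 * 1 := mul_le_mul hk.2 (h.bdd k) (norm_nonneg _) (by norm_num)
        _ = _ := by ring
    have q : √(1 / 2) ≤ (1 : ℝ) := Real.sqrt_le_one.2 (by norm_num)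
    norm_num at m t q ⊢
    linarith

/-- Pointwise decay of `u = osc N w` and growth of `u'`. -/
theorem Prof.pointwise (h : Prof ρ N c w g) {x Y : ℝ} (hY : 0 < Y) (hYx : Y ^ 4 = 1 + |x|) :
    ‖osc N w x‖ ≤ 40 / Y ∧ ‖osc N (fun k => Complex.I * k * w k) x‖ ≤ 40 * Y := by
  have hY1 : 1 ≤ Y := by
    by_contra hlt
    push Not at hlt
    have := pow_lt_one₀ hY.le hlt (n := 4) (by norm_num)
    linarith [abs_nonneg x]
  rcases le_total x (-3) with hx | hx
  · set ξ := √(-x / 3) with hξ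
    have hξ2 : ξ ^ 2 = -x / 3 := Real.sq_sqrt (by linarith)
    have hξ1 : 1 ≤ ξ := Real.one_le_sqrt.2 (by linarith)
    have hxx : -3 * ξ ^ 2 = x := by rw [hξ2]; ring
    obtain ⟨b1, b2⟩ := h.norm_le_mode hξ1
    rw [hxx] at b1 b2
    set s := √ξ with hs
    have hs2 : s ^ 2 = ξ := Real.sq_sqrt (by linarith)
    have hs1 : 1 ≤ s := Real.one_le_sqrt.2 hξ1
    have hYs : Y ^ 4 = 1 + 3 * s ^ 4 := by
      rw [hYx, abs_of_nonpos (by linarith), ← hxx, ← hs2]; ring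
    have hs4 : 1 ≤ s ^ 4 := one_le_pow₀ hs1
    have c1 : s ≤ Y := by
      by_contra hlt
      push Not at hlt
      have := pow_lt_pow_left₀ hlt hY.le (n := 4) (by norm_num)
      linarith
    have c2 : Y ≤ 2 * s := by
      by_contra hlt
      push Not at hlt
      have := pow_lt_pow_left₀ hlt (by positivity) (n := 4) (by norm_num)
      nlinarith
    constructor
    · rw [le_div_iff₀ hY]
      have hs0 : 0 < s := by linarith
      have b3 : s * ‖osc N w x‖ ≤ 18 := by
        rw [← hs2] at b2
        by_contra hlt
        push Not at hlt
        nlinarith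
      nlinarith [norm_nonneg (osc N w x)]
    · linarith
  rcases le_total x 1 with hx1 | hx1
  · obtain ⟨b1, b2⟩ := h.norm_mid_le hx hx1
    have c1 : Y ≤ 2 := by
      by_contra hlt
      push Not at hlt
      have := pow_lt_pow_left₀ hlt (by positivity) (n := 4) (by norm_num)
      have : |x| ≤ 3 := abs_le.2 ⟨hx, by linarith⟩
      linarith
    constructor
    · rw [le_div_iff₀ hY]
      nlinarith [norm_nonneg (osc N w x)]
    · linarith
  · set y := √(√x) with hy
    have hy4 : y ^ 4 = x := by
      rw [show y ^ 4 = (y ^ 2) ^ 2 by ring, Real.sq_sqrt (Real.sqrt_nonneg _),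
        Real.sq_sqrt (by linarith)]
    have hy1 : 1 ≤ y := Real.one_le_sqrt.2 (Real.one_le_sqrt.2 hx1)
    obtain ⟨b1, b2⟩ := h.norm_pos_le hy1
    rw [hy4] at b1 b2
    have c1 : Y ≤ 5 / 4 * y := by
      by_contra hlt
      push Not at hlt
      have := pow_lt_pow_left₀ hlt (by positivity) (n := 4) (by norm_num)
      rw [hYx, abs_of_nonneg (by linarith), mul_pow, hy4] at this
      norm_num at this
      linarith
    constructor
    · refine b1.trans ?_
      rw [div_le_div_iff₀ (by positivity) hY]
      have : y ≤ y ^ 3 := le_self_pow₀ hy1 (by norm_num)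
      linarith
    · linarith

end MKdVPaper

namespace MKdVPaper

/-- Amplitudes on `[a, b]`: bounded by `K`, with derivative bounded by `K` in `L²`. -/
structure Amp (a b K : ℝ) (β β' : ℝ → ℂ) : Prop where
  le : a ≤ b
  nonneg : 0 ≤ K
  cont : ContinuousOn β (Icc a b)
  bdd : ∀ x ∈ Icc a b, ‖β x‖ ≤ K
  der : ∃ s : Set ℝ, s.Countable ∧ ∀ x ∈ Ioo a b \ s, HasDerivAt β (β' x) x
  memLp : MemLp β' 2 (volume.restrict (Icc a b))
  L2 : ∫ x in a..b, ‖β' x‖ ^ 2 ≤ K ^ 2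

variable {a b K : ℝ} {β β' : ℝ → ℂ}

lemma MemLp_Icc_intervalIntegrable_sq (hab : a ≤ b) {f : ℝ → ℂ}
    (hf : MemLp f 2 (volume.restrict (Icc a b))) :
    IntervalIntegrable (fun x => ‖f x‖ ^ 2) volume a b := by
  rw [intervalIntegrable_iff_integrableOn_Icc_of_le hab]
  exact hf.integrable_norm_pow (by norm_num)

lemma MemLp_Icc_intervalIntegrable (hab : a ≤ b) {f : ℝ → ℂ}
    (hf : MemLp f 2 (volume.restrict (Icc a b))) :
    IntervalIntegrable f volume a b := by
  rw [intervalIntegrable_iff_integrableOn_Icc_of_le hab]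
  exact hf.integrable (by norm_num)

lemma Amp.mul {K₁ K₂ : ℝ} {β₁ β₁' β₂ β₂' : ℝ → ℂ} (h₁ : Amp a b K₁ β₁ β₁')
    (h₂ : Amp a b K₂ β₂ β₂') :
    Amp a b (2 * K₁ * K₂) (fun x => β₁ x * β₂ x) (fun x => β₁' x * β₂ x + β₁ x * β₂' x) := by
  have k1 := h₁.nonneg
  have k2 := h₂.nonneg
  have hab := h₁.le
  have m1 : MemLp (fun x => β₁' x * β₂ x) 2 (volume.restrict (Icc a b)) := by
    refine h₁.memLp.of_le_mul (c := K₂) (h₁.memLp.1.mul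
      (h₂.cont.aestronglyMeasurable measurableSet_Icc)) ?_
    refine ae_restrict_of_forall_mem measurableSet_Icc fun x hx => ?_
    rw [norm_mul, mul_comm]
    exact mul_le_mul_of_nonneg_right (h₂.bdd x hx) (norm_nonneg _)
  have m2 : MemLp (fun x => β₁ x * β₂' x) 2 (volume.restrict (Icc a b)) := by
    refine h₂.memLp.of_le_mul (c := K₁) ((h₁.cont.aestronglyMeasurable measurableSet_Icc).mul
      h₂.memLp.1) ?_
    refine ae_restrict_of_forall_mem measurableSet_Icc fun x hx => ?_
    rw [norm_mul]
    exact mul_le_mul_of_nonneg_right (h₁.bdd x hx) (norm_nonneg _)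
  refine ⟨hab, by positivity, h₁.cont.mul h₂.cont, fun x hx => ?_, ?_, m1.add m2, ?_⟩
  · rw [norm_mul]
    have := mul_le_mul (h₁.bdd x hx) (h₂.bdd x hx) (norm_nonneg _) k1
    nlinarith [mul_nonneg k1 k2]
  · obtain ⟨s₁, c₁, d₁⟩ := h₁.der
    obtain ⟨s₂, c₂, d₂⟩ := h₂.der
    refine ⟨s₁ ∪ s₂, c₁.union c₂, fun x hx => ?_⟩
    exact (d₁ x ⟨hx.1, fun h => hx.2 (Or.inl h)⟩).mul (d₂ x ⟨hx.1, fun h => hx.2 (Or.inr h)⟩)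
  · have i1 := MemLp_Icc_intervalIntegrable_sq hab h₁.memLp
    have i2 := MemLp_Icc_intervalIntegrable_sq hab h₂.memLp
    calc ∫ x in a..b, ‖β₁' x * β₂ x + β₁ x * β₂' x‖ ^ 2
        ≤ ∫ x in a..b, (2 * K₂ ^ 2 * ‖β₁' x‖ ^ 2 + 2 * K₁ ^ 2 * ‖β₂' x‖ ^ 2) := by
          refine intervalIntegral.integral_mono_on hab
            (MemLp_Icc_intervalIntegrable_sq hab (m1.add m2))
            ((i1.const_mul _).add (i2.const_mul _)) fun x hx => ?_
          have n1 : ‖β₁' x * β₂ x + β₁ x * β₂' x‖ ≤ K₂ * ‖β₁' x‖ + K₁ * ‖β₂' x‖ := by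
            refine (norm_add_le _ _).trans (add_le_add ?_ ?_)
            · rw [norm_mul, mul_comm]
              exact mul_le_mul_of_nonneg_right (h₂.bdd x hx) (norm_nonneg _)
            · rw [norm_mul]
              exact mul_le_mul_of_nonneg_right (h₁.bdd x hx) (norm_nonneg _)
          have n2 := pow_le_pow_left₀ (norm_nonneg _) n1 2
          nlinarith [sq_nonneg (K₂ * ‖β₁' x‖ - K₁ * ‖β₂' x‖)]
      _ = 2 * K₂ ^ 2 * (∫ x in a..b, ‖β₁' x‖ ^ 2) + 2 * K₁ ^ 2 * (∫ x in a..b, ‖β₂' x‖ ^ 2) := by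
          rw [intervalIntegral.integral_add (i1.const_mul _) (i2.const_mul _),
            intervalIntegral.integral_const_mul, intervalIntegral.integral_const_mul]
      _ ≤ 2 * K₂ ^ 2 * K₁ ^ 2 + 2 * K₁ ^ 2 * K₂ ^ 2 := by
          gcongr
          · exact h₁.L2
          · exact h₂.L2
      _ = _ := by ring

lemma Amp.conj (h : Amp a b K β β') :
    Amp a b K (fun x => starRingEnd ℂ (β x)) (fun x => starRingEnd ℂ (β' x)) := by
  refine ⟨h.le, h.nonneg, Complex.continuous_conj.comp_continuousOn h.cont,
    fun x hx => by simpa using h.bdd x hx, ?_, ?_, by simpa using h.L2⟩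
  · obtain ⟨s, c, d⟩ := h.der
    exact ⟨s, c, fun x hx => (d x hx).star⟩
  · exact h.memLp.star

lemma Amp.mono (h : Amp a b K β β') {a' b' K' : ℝ} (ha : a ≤ a') (hab : a' ≤ b') (hb : b' ≤ b)
    (hK : K ≤ K') : Amp a' b' K' β β' := by
  have hs : Icc a' b' ⊆ Icc a b := Icc_subset_Icc ha hb
  refine ⟨hab, h.nonneg.trans hK, h.cont.mono hs, fun x hx => (h.bdd x (hs hx)).trans hK, ?_,
    h.memLp.mono_measure (Measure.restrict_mono hs le_rfl), ?_⟩
  · obtain ⟨s, c, d⟩ := h.der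
    exact ⟨s, c, fun x hx => d x ⟨Ioo_subset_Ioo ha hb hx.1, hx.2⟩⟩
  · refine le_trans ?_ (h.L2.trans (pow_le_pow_left₀ h.nonneg hK 2))
    exact intervalIntegral.integral_mono_interval ha hab hb (ae_of_all _ fun _ => by positivity)
      (MemLp_Icc_intervalIntegrable_sq h.le h.memLp)

lemma Amp.of_bound {f f' : ℝ → ℂ} (hab : a ≤ b) (hK : 0 ≤ K)
    (hf : ∀ x ∈ Icc a b, HasDerivAt f (f' x) x) (hf' : ContinuousOn f' (Icc a b))
    (hb : ∀ x ∈ Icc a b, ‖f x‖ ≤ K) (hL : ∫ x in a..b, ‖f' x‖ ^ 2 ≤ K ^ 2) :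
    Amp a b K f f' := by
  refine ⟨hab, hK, fun x hx => (hf x hx).continuousAt.continuousWithinAt, hb,
    ⟨∅, countable_empty, fun x hx => hf x (Ioo_subset_Icc_self hx.1)⟩, ?_, hL⟩
  have hm := hf'.aestronglyMeasurable (μ := volume) measurableSet_Icc
  obtain ⟨C, hC⟩ := isCompact_Icc.exists_bound_of_continuousOn hf'
  exact MemLp.of_bound hm C (ae_restrict_of_forall_mem measurableSet_Icc hC)

/-- Hölder continuity of amplitudes. -/
lemma Amp.holder (h : Amp a b K β β') {x y : ℝ} (hx : a ≤ x) (hxy : x ≤ y) (hy : y ≤ b) :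
    ‖β y - β x‖ ≤ √(y - x) * K := by
  have h' := h.mono hx hxy hy le_rfl
  obtain ⟨s, c, d⟩ := h'.der
  have hi := MemLp_Icc_intervalIntegrable hxy h'.memLp
  have e := MeasureTheory.integral_eq_of_hasDerivAt_off_countable_of_le β β' hxy c
    h'.cont d hi
  rw [← e]
  refine (intervalIntegral.norm_integral_le_integral_norm hxy).trans ?_
  have := integral_mul_norm_le (φ := fun _ => 1) hxy continuousOn_const h'.memLp
    (Real.sqrt_nonneg (y - x)) (by simp [Real.sq_sqrt (sub_nonneg.2 hxy)]) h.nonneg h'.L2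
  simpa using this

lemma Amp.comp_add (h : Amp a b K β β') (c : ℝ) :
    Amp (a - c) (b - c) K (fun x => β (c + x)) (fun x => β' (c + x)) := by
  have hm : MapsTo (fun x => c + x) (Icc (a - c) (b - c)) (Icc a b) := fun x hx =>
    ⟨by linarith [hx.1], by linarith [hx.2]⟩
  refine ⟨by linarith [h.le], h.nonneg, h.cont.comp (by fun_prop) hm, fun x hx => h.bdd _ (hm hx),
    ?_, ?_, ?_⟩
  · obtain ⟨s, hs, d⟩ := h.der
    refine ⟨(fun x => c + x) ⁻¹' s, hs.preimage (add_right_injective c), fun x hx => ?_⟩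
    have := d (c + x) ⟨⟨by linarith [hx.1.1], by linarith [hx.1.2]⟩, hx.2⟩
    exact this.comp_const_add c x
  · have mp := (measurePreserving_add_left volume c).restrict_preimage
      (measurableSet_Icc (a := a) (b := b))
    have e : (fun x => c + x) ⁻¹' Icc a b = Icc (a - c) (b - c) := by
      ext x; simp only [mem_preimage, mem_Icc]; constructor <;> rintro ⟨h1, h2⟩ <;>
        constructor <;> linarith
    rw [e] at mp
    exact h.memLp.comp_measurePreserving mp
  · rw [intervalIntegral.integral_comp_add_left (fun x => ‖β' x‖ ^ 2) c]
    simpa using h.L2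

lemma Amp.comp_neg (h : Amp a b K β β') :
    Amp (-b) (-a) K (fun x => β (-x)) (fun x => -β' (-x)) := by
  have hm : MapsTo (fun x => -x) (Icc (-b) (-a)) (Icc a b) := fun x hx =>
    ⟨by linarith [hx.2], by linarith [hx.1]⟩
  refine ⟨by linarith [h.le], h.nonneg, h.cont.comp (by fun_prop) hm, fun x hx => h.bdd _ (hm hx),
    ?_, ?_, ?_⟩
  · obtain ⟨s, hs, d⟩ := h.der
    refine ⟨(fun x => -x) ⁻¹' s, hs.preimage neg_injective, fun x hx => ?_⟩
    have := d (-x) ⟨⟨by linarith [hx.1.2], by linarith [hx.1.1]⟩, hx.2⟩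
    have h2 := this.scomp x (hasDerivAt_neg x)
    exact h2.congr_deriv (by simp)
  · have mp := (Measure.measurePreserving_neg (volume : Measure ℝ)).restrict_preimage
      (measurableSet_Icc (a := a) (b := b))
    have e : (Neg.neg : ℝ → ℝ) ⁻¹' Icc a b = Icc (-b) (-a) := by
      ext x; simp only [mem_preimage, mem_Icc]; constructor <;> rintro ⟨h1, h2⟩ <;>
        constructor <;> linarith
    rw [e] at mp
    exact (h.memLp.comp_measurePreserving mp).neg
  · have := intervalIntegral.integral_comp_neg (a := -b) (b := -a) (fun x => ‖β' x‖ ^ 2)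
    simp only [norm_neg, neg_neg] at this ⊢
    rw [this]; exact h.L2

/-- Integration by parts against a nonvanishing amplitude. -/
lemma Amp.norm_osc_le (h : Amp a b K β β') {Q V : ℝ} {r r' ψ ψ' : ℝ → ℝ}
    (hr : ∀ k ∈ Icc a b, HasDerivAt r (r' k) k) (hψ : ∀ k ∈ Icc a b, HasDerivAt ψ (ψ' k) k)
    (hr' : ContinuousOn r' (Icc a b)) (hψ' : ContinuousOn ψ' (Icc a b))
    (hV : ∫ k in a..b, |r' k| * ‖β k‖ ≤ V)
    (hQ0 : 0 ≤ Q) (hQ : ∫ k in a..b, r k ^ 2 ≤ Q ^ 2) :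
    ‖∫ k in a..b, ((r k * ψ' k : ℝ) : ℂ) * cis (ψ k) * β k‖ ≤
      |r a| * ‖β a‖ + |r b| * ‖β b‖ + V + Q * K := by
  obtain ⟨s, hs, d⟩ := h.der
  have hrc : ContinuousOn r (Icc a b) := fun k hk => (hr k hk).continuousAt.continuousWithinAt
  have hi := MemLp_Icc_intervalIntegrable h.le h.memLp
  have key := norm_integral_osc_le h.le hs hr hψ hr' hψ' h.cont d hi
  have u := uIcc_of_le h.le
  rw [intervalIntegral.integral_add] at key
  · have q := integral_mul_norm_le (φ := fun k => |r k|) h.le hrc.abs h.memLp hQ0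
      (by simpa using hQ) h.nonneg h.L2
    linarith
  · exact (hr'.abs.mul h.cont.norm).intervalIntegrable_of_Icc h.le
  · exact hi.norm.continuousOn_mul (by rw [u]; exact hrc.abs)

end MKdVPaper

namespace MKdVPaper

variable {a b K : ℝ} {β β' : ℝ → ℂ}

lemma integral_inv_sq {a b : ℝ} (ha : 0 < a) (hab : a ≤ b) :
    ∫ z in a..b, 1 / z ^ 2 = 1 / a - 1 / b := by
  have hpos : ∀ z ∈ uIcc a b, 0 < z := fun z hz => by
    rw [uIcc_of_le hab] at hz; linarith [hz.1]
  rw [intervalIntegral.integral_eq_sub_of_hasDerivAt (f := fun z => -z⁻¹)]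
  · simp only [one_div]; ring
  · intro z hz
    have := (hasDerivAt_inv (hpos z hz).ne').neg
    exact this.congr_deriv (by simp)
  · apply ContinuousOn.intervalIntegrable
    exact continuousOn_const.div (by fun_prop) fun z hz => (pow_pos (hpos z hz) 2).ne'

lemma integral_inv_mul_sqrt {a b : ℝ} (ha : 0 < a) (hab : a ≤ b) :
    ∫ z in a..b, 1 / (z * √z) = 2 / √a - 2 / √b := by
  have hpos : ∀ z ∈ uIcc a b, 0 < z := fun z hz => by
    rw [uIcc_of_le hab] at hz; linarith [hz.1]
  rw [intervalIntegral.integral_eq_sub_of_hasDerivAt (f := fun z => -2 * (√z)⁻¹)]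
  · simp only [div_eq_mul_inv]; ring
  · intro z hz
    have hz0 := hpos z hz
    have hs := Real.sqrt_pos.2 hz0
    have := ((Real.hasDerivAt_sqrt hz0.ne').inv hs.ne').const_mul (-2)
    refine this.congr_deriv ?_
    rw [Real.sq_sqrt hz0.le]
    field_simp
  · apply ContinuousOn.intervalIntegrable
    exact continuousOn_const.div (by fun_prop)
      fun z hz => (mul_pos (hpos z hz) (Real.sqrt_pos.2 (hpos z hz))).ne'

lemma hasDerivAt_cubic_phase (μ ν z : ℝ) :
    HasDerivAt (fun z : ℝ => μ * z ^ 2 + ν * z ^ 3) (2 * μ * z + 3 * ν * z ^ 2) z := by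
  have := ((hasDerivAt_pow 2 z).const_mul μ).add ((hasDerivAt_pow 3 z).const_mul ν)
  exact this.congr_deriv (by norm_num; ring)

/-- Oscillatory integral with an amplitude vanishing at the stationary point, one side. -/
lemma Amp.norm_vanish_half_le (h : Amp 0 1 K β β') (h0 : β 0 = 0) {τ ν : ℝ} (hτ : 1 ≤ τ)
    (hν : 3 * |ν| ≤ τ ^ 4) :
    ‖∫ z in (0 : ℝ)..1, cis (τ ^ 4 * z ^ 2 + ν * z ^ 3) * β z‖ ≤ 12 * K / τ ^ 3 := by
  have hK := h.nonneg
  have hτ0 : 0 < τ := by linarith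
  set δ := 1 / τ ^ 2 with hδ
  have hδ0 : 0 < δ := by positivity
  have hδ1 : δ ≤ 1 := by rw [hδ, div_le_one (by positivity)]; exact one_le_pow₀ hτ
  have hsδ : √δ = 1 / τ := by
    rw [hδ, show 1 / τ ^ 2 = (1 / τ) ^ 2 by field_simp]; exact Real.sqrt_sq (by positivity)
  have hW : ∀ z ∈ Icc (0 : ℝ) 1, ‖β z‖ ≤ √z * K := fun z hz => by
    have := h.holder le_rfl hz.1 hz.2
    simpa [h0] using this
  have hc : ContinuousOn (fun z => cis (τ ^ 4 * z ^ 2 + ν * z ^ 3) * β z) (Icc 0 1) :=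
    (continuousOn_cis (by fun_prop)).mul h.cont
  have hi : ∀ x y, 0 ≤ x → x ≤ y → y ≤ 1 →
      IntervalIntegrable (fun z => cis (τ ^ 4 * z ^ 2 + ν * z ^ 3) * β z) volume x y :=
    fun x y h1 h2 h3 => (hc.mono (Icc_subset_Icc h1 h3)).intervalIntegrable_of_Icc h2
  rw [← intervalIntegral.integral_add_adjacent_intervals (hi 0 δ le_rfl hδ0.le hδ1)
    (hi δ 1 hδ0.le hδ1 le_rfl)]
  have b1 : ‖∫ z in (0 : ℝ)..δ, cis (τ ^ 4 * z ^ 2 + ν * z ^ 3) * β z‖ ≤ K / τ ^ 3 := by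
    have : ‖∫ z in (0 : ℝ)..δ, cis (τ ^ 4 * z ^ 2 + ν * z ^ 3) * β z‖ ≤ (1 / τ * K) * |δ - 0| := by
      apply intervalIntegral.norm_integral_le_of_norm_le_const
      intro z hz
      rw [uIoc_of_le hδ0.le] at hz
      rw [norm_mul, norm_cis, one_mul]
      refine (hW z ⟨hz.1.le, hz.2.trans hδ1⟩).trans ?_
      rw [← hsδ]
      exact mul_le_mul_of_nonneg_right (Real.sqrt_le_sqrt hz.2) hK
    refine this.trans (le_of_eq ?_)
    rw [sub_zero, abs_of_pos hδ0, hδ]; field_simp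
  set q : ℝ → ℝ := fun z => 2 * τ ^ 4 * z + 3 * ν * z ^ 2 with hq
  have hqz : ∀ z ∈ Icc δ 1, τ ^ 4 * z ≤ q z := by
    intro z hz
    have hz0 : 0 < z := by linarith [hz.1]
    have : -(3 * |ν|) ≤ 3 * ν := by linarith [neg_abs_le ν]
    have h2 : -τ ^ 4 ≤ 3 * ν * z := by
      rcases le_total 0 ν with hn | hn
      · have : 0 ≤ 3 * ν * z := by positivity
        linarith [pow_pos hτ0 4]
      · nlinarith [hz.2]
    simp only [hq]
    nlinarith
  have hq0 : ∀ z ∈ Icc δ 1, 0 < q z := fun z hz =>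
    lt_of_lt_of_le (mul_pos (by positivity) (by linarith [hz.1])) (hqz z hz)
  have hq' : ∀ z, HasDerivAt q (2 * τ ^ 4 + 6 * ν * z) z := fun z => by
    have := ((hasDerivAt_id z).const_mul (2 * τ ^ 4)).add ((hasDerivAt_pow 2 z).const_mul (3 * ν))
    exact this.congr_deriv (by norm_num; ring)
  have hqc : Continuous q := by fun_prop
  have hposI : ∀ z ∈ Icc δ 1, 0 < z := fun z hz => by linarith [hz.1]
  have b2 := (h.mono hδ0.le hδ1 le_rfl le_rfl).norm_osc_le (r := fun z => (q z)⁻¹)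
    (r' := fun z => -(2 * τ ^ 4 + 6 * ν * z) / q z ^ 2)
    (ψ := fun z => τ ^ 4 * z ^ 2 + ν * z ^ 3) (ψ' := q) (Q := 1 / τ ^ 3) (V := 8 * K / τ ^ 3)
    (fun z hz => (hq' z).inv (hq0 z hz).ne') (fun z _ => hasDerivAt_cubic_phase _ _ z)
    (ContinuousOn.div (by fun_prop) (by fun_prop) fun z hz => (pow_pos (hq0 z hz) 2).ne')
    hqc.continuousOn ?_ (by positivity) ?_
  · have e : ∫ z in δ..1, (((q z)⁻¹ * q z : ℝ) : ℂ) * cis (τ ^ 4 * z ^ 2 + ν * z ^ 3) * β z =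
        ∫ z in δ..1, cis (τ ^ 4 * z ^ 2 + ν * z ^ 3) * β z := by
      refine intervalIntegral.integral_congr fun z hz => ?_
      rw [uIcc_of_le hδ1] at hz
      simp [inv_mul_cancel₀ (hq0 z hz).ne']
    rw [e] at b2
    have c1 : |(q δ)⁻¹| * ‖β δ‖ ≤ K / τ ^ 3 := by
      have hm : δ ∈ Icc δ 1 := ⟨le_rfl, hδ1⟩
      rw [abs_of_pos (inv_pos.2 (hq0 δ hm))]
      calc (q δ)⁻¹ * ‖β δ‖ ≤ (τ ^ 4 * δ)⁻¹ * (√δ * K) := by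
            gcongr
            · exact hqz δ hm
            · exact hW δ ⟨hδ0.le, hδ1⟩
        _ = K / τ ^ 3 := by rw [hsδ, hδ]; field_simp
    have c2 : |(q 1)⁻¹| * ‖β 1‖ ≤ K / τ ^ 3 := by
      have hm : (1 : ℝ) ∈ Icc δ 1 := ⟨hδ1, le_rfl⟩
      rw [abs_of_pos (inv_pos.2 (hq0 1 hm))]
      calc (q 1)⁻¹ * ‖β 1‖ ≤ (τ ^ 4 * 1)⁻¹ * K := by
            gcongr
            · exact hqz 1 hm
            · exact h.bdd 1 ⟨zero_le_one, le_rfl⟩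
        _ = K / τ ^ 4 := by rw [mul_one, div_eq_inv_mul]
        _ ≤ K / τ ^ 3 := by
            gcongr
            norm_num
    calc _ ≤ _ := norm_add_le _ _
      _ ≤ K / τ ^ 3 + (K / τ ^ 3 + K / τ ^ 3 + 8 * K / τ ^ 3 + 1 / τ ^ 3 * K) := by
        refine add_le_add b1 (b2.trans ?_)
        gcongr
      _ = 12 * K / τ ^ 3 := by ring
  · calc ∫ z in δ..1, |-(2 * τ ^ 4 + 6 * ν * z) / q z ^ 2| * ‖β z‖
        ≤ ∫ z in δ..1, 4 * K / τ ^ 4 * (1 / (z * √z)) := by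
          refine intervalIntegral.integral_mono_on hδ1 ?_ ?_ fun z hz => ?_
          · refine ContinuousOn.intervalIntegrable_of_Icc hδ1 (ContinuousOn.mul (ContinuousOn.abs
              (ContinuousOn.div (by fun_prop) (by fun_prop) fun z hz => (pow_pos (hq0 z hz) 2).ne'))
              (h.cont.mono (Icc_subset_Icc hδ0.le le_rfl)).norm)
          · refine ContinuousOn.intervalIntegrable_of_Icc hδ1 (continuousOn_const.mul
              (continuousOn_const.div (by fun_prop)
              fun z hz => (mul_pos (hposI z hz) (Real.sqrt_pos.2 (hposI z hz))).ne'))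
          · have hz0 := hposI z hz
            have hs := Real.sqrt_pos.2 hz0
            have n1 : |-(2 * τ ^ 4 + 6 * ν * z)| ≤ 4 * τ ^ 4 := by
              rw [abs_neg]
              refine (abs_add_le _ _).trans ?_
              rw [abs_mul (6 * ν), abs_mul 6, abs_of_pos hz0, abs_of_pos (by positivity)]
              norm_num
              nlinarith [hz.2, abs_nonneg ν]
            rw [abs_div, abs_of_pos (pow_pos (hq0 z hz) 2)]
            calc _ ≤ 4 * τ ^ 4 / (τ ^ 4 * z) ^ 2 * (√z * K) := by
                  gcongr
                  · exact hqz z hz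
                  · exact hW z ⟨hz0.le, hz.2⟩
              _ = 4 * K / τ ^ 4 * (1 / (z * √z)) := by
                  have : z = √z ^ 2 := (Real.sq_sqrt hz0.le).symm
                  field_simp
                  rw [Real.sq_sqrt hz0.le]
      _ = 4 * K / τ ^ 4 * (2 / √δ - 2 / √1) := by
          rw [intervalIntegral.integral_const_mul, integral_inv_mul_sqrt hδ0 hδ1]
      _ ≤ 4 * K / τ ^ 4 * (2 * τ) := by
          gcongr
          rw [hsδ, Real.sqrt_one]
          have : 2 / (1 / τ) = 2 * τ := by field_simp
          rw [this]; linarith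
      _ = 8 * K / τ ^ 3 := by field_simp; ring
  · calc ∫ z in δ..1, ((q z)⁻¹) ^ 2 ≤ ∫ z in δ..1, 1 / τ ^ 8 * (1 / z ^ 2) := by
          refine intervalIntegral.integral_mono_on hδ1 ?_ ?_ fun z hz => ?_
          · exact ContinuousOn.intervalIntegrable_of_Icc hδ1
              ((hqc.continuousOn.inv₀ fun z hz => (hq0 z hz).ne').pow 2)
          · exact ContinuousOn.intervalIntegrable_of_Icc hδ1 (continuousOn_const.mul
              (continuousOn_const.div (by fun_prop) fun z hz => (pow_pos (hposI z hz) 2).ne'))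
          · have hz0 := hposI z hz
            calc ((q z)⁻¹) ^ 2 ≤ ((τ ^ 4 * z)⁻¹) ^ 2 := by
                  gcongr
                  · exact (inv_pos.2 (hq0 z hz)).le
                  · exact hqz z hz
              _ = _ := by field_simp
      _ = 1 / τ ^ 8 * (1 / δ - 1 / 1) := by
          rw [intervalIntegral.integral_const_mul, integral_inv_sq hδ0 hδ1]
      _ ≤ 1 / τ ^ 8 * τ ^ 2 := by
          gcongr
          rw [hδ]; norm_num
      _ = (1 / τ ^ 3) ^ 2 := by field_simp

lemma Amp.norm_vanish_le (h : Amp (-1) 1 K β β') (h0 : β 0 = 0) {τ ν : ℝ} (hτ : 1 ≤ τ)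
    (hν : 3 * |ν| ≤ τ ^ 4) :
    ‖∫ z in (-1 : ℝ)..1, cis (τ ^ 4 * z ^ 2 + ν * z ^ 3) * β z‖ ≤ 24 * K / τ ^ 3 := by
  have hc : ContinuousOn (fun z => cis (τ ^ 4 * z ^ 2 + ν * z ^ 3) * β z) (Icc (-1) 1) :=
    (continuousOn_cis (by fun_prop)).mul h.cont
  have hi : ∀ x y, -1 ≤ x → x ≤ y → y ≤ 1 →
      IntervalIntegrable (fun z => cis (τ ^ 4 * z ^ 2 + ν * z ^ 3) * β z) volume x y :=
    fun x y h1 h2 h3 => (hc.mono (Icc_subset_Icc h1 h3)).intervalIntegrable_of_Icc h2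
  rw [← intervalIntegral.integral_add_adjacent_intervals (hi (-1) 0 le_rfl (by norm_num)
    (by norm_num)) (hi 0 1 (by norm_num) (by norm_num) le_rfl)]
  have p := (h.mono (by norm_num : (-1 : ℝ) ≤ 0) zero_le_one le_rfl le_rfl).norm_vanish_half_le
    h0 hτ hν
  have hneg := h.comp_neg
  rw [neg_neg] at hneg
  have m := (hneg.mono (by norm_num : (-1 : ℝ) ≤ 0) zero_le_one le_rfl le_rfl).norm_vanish_half_le
    (by simpa using h0) hτ (ν := -ν) (by rwa [abs_neg])
  have e : ∫ z in (0 : ℝ)..1, cis (τ ^ 4 * z ^ 2 + -ν * z ^ 3) * β (-z) =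
      ∫ z in (-1 : ℝ)..0, cis (τ ^ 4 * z ^ 2 + ν * z ^ 3) * β z := by
    have := intervalIntegral.integral_comp_neg (a := 0) (b := 1)
      (fun z => cis (τ ^ 4 * z ^ 2 + ν * z ^ 3) * β z)
    rw [neg_zero] at this
    rw [← this]
    refine intervalIntegral.integral_congr fun z _ => ?_
    congr 2; ring
  rw [e] at m
  calc _ ≤ _ := norm_add_le _ _
    _ ≤ 12 * K / τ ^ 3 + 12 * K / τ ^ 3 := add_le_add m p
    _ = _ := by ring

/-- The Fresnel integral `∫ e^{iμz²} dz`. -/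
def fresnel (μ : ℝ) : ℂ := (√(Real.pi / μ) : ℝ) * cis (Real.pi / 4)

lemma cis_pi_div_four_sq : cis (Real.pi / 4) ^ 2 = Complex.I := by
  rw [pow_two, ← cis_add, cis]
  rw [show Real.pi / 4 + Real.pi / 4 = Real.pi / 2 by ring]
  push_cast
  exact Complex.exp_pi_div_two_mul_I

lemma fresnel_eq_cpow {μ : ℝ} (hμ : 0 < μ) :
    ((Real.pi : ℂ) / (-(Complex.I * μ))) ^ (1 / 2 : ℂ) = fresnel μ := by
  have e : (Real.pi : ℂ) / (-(Complex.I * μ)) = ((Real.pi / μ : ℝ) : ℂ) * Complex.I := by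
    have : (μ : ℂ) ≠ 0 := by exact_mod_cast hμ.ne'
    push_cast
    field_simp
    rw [Complex.I_sq]
  have hr : 0 < Real.pi / μ := by positivity
  have hne : ((Real.pi / μ : ℝ) : ℂ) * Complex.I ≠ 0 := by
    simp only [ne_eq, mul_eq_zero, Complex.I_ne_zero, or_false, Complex.ofReal_eq_zero]
    exact hr.ne'
  rw [e, Complex.cpow_def_of_ne_zero hne, Complex.log_ofReal_mul hr Complex.I_ne_zero,
    Complex.log_I, add_mul, Complex.exp_add, fresnel, cis]
  congr 1
  · rw [Real.sqrt_eq_rpow, Real.rpow_def_of_pos hr]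
    push_cast
    rfl
  · congr 1; push_cast; ring

end MKdVPaper

namespace MKdVPaper

variable {a b K : ℝ} {β β' : ℝ → ℂ}

lemma norm_gauss_tail_le {μ ε R : ℝ} (hμ : 0 < μ) (hε : 0 ≤ ε) (hR : 1 ≤ R) :
    ‖∫ z in (1 : ℝ)..R, cis (μ * z ^ 2) * (Real.exp (-ε * z ^ 2) : ℝ)‖ ≤ 2 / μ := by
  have hd : ∀ z, HasDerivAt (fun z : ℝ => Real.exp (-ε * z ^ 2))
      (-(2 * ε * z * Real.exp (-ε * z ^ 2))) z := fun z => by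
    have := ((hasDerivAt_pow 2 z).const_mul (-ε)).exp
    exact this.congr_deriv (by norm_num; ring)
  have hpos : ∀ z ∈ Icc 1 R, (0 : ℝ) < z := fun z hz => by linarith [hz.1]
  have key := norm_integral_osc_le hR (countable_empty (α := ℝ))
    (r := fun z => (2 * μ * z)⁻¹) (r' := fun z => -(2 * μ) / (2 * μ * z) ^ 2)
    (ψ := fun z => μ * z ^ 2) (ψ' := fun z => 2 * μ * z)
    (w := fun z => (Real.exp (-ε * z ^ 2) : ℝ))
    (g := fun z => ((-(2 * ε * z * Real.exp (-ε * z ^ 2)) : ℝ) : ℂ))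
    (fun z hz => by
      have := ((hasDerivAt_id z).const_mul (2 * μ)).inv
        (mul_pos (by positivity) (hpos z hz)).ne'
      exact this.congr_deriv (by simp))
    (fun z _ => by
      have := (hasDerivAt_pow 2 z).const_mul μ
      exact this.congr_deriv (by norm_num; ring))
    (ContinuousOn.div (by fun_prop) (by fun_prop)
      fun z hz => (pow_pos (mul_pos (by positivity) (hpos z hz)) 2).ne')
    (by fun_prop) (by fun_prop) (fun z _ => (hd z).ofReal_comp)
    ((by fun_prop : Continuous fun z : ℝ =>
      ((-(2 * ε * z * Real.exp (-ε * z ^ 2)) : ℝ) : ℂ)).intervalIntegrable _ _)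
  have e : ∫ z in (1 : ℝ)..R, (((2 * μ * z)⁻¹ * (2 * μ * z) : ℝ) : ℂ) * cis (μ * z ^ 2) *
      (Real.exp (-ε * z ^ 2) : ℝ) = ∫ z in (1 : ℝ)..R, cis (μ * z ^ 2) *
        (Real.exp (-ε * z ^ 2) : ℝ) := by
    refine intervalIntegral.integral_congr fun z hz => ?_
    rw [uIcc_of_le hR] at hz
    rw [inv_mul_cancel₀ (mul_pos (by positivity) (hpos z hz)).ne']
    simp
  rw [e] at key
  have hexp : ∀ z : ℝ, ‖((Real.exp (-ε * z ^ 2) : ℝ) : ℂ)‖ ≤ 1 := fun z => by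
    rw [Complex.norm_real, Real.norm_of_nonneg (Real.exp_pos _).le, Real.exp_le_one_iff]
    nlinarith [sq_nonneg z]
  have i2 : ∫ z in (1 : ℝ)..R, (2 * ε * z * Real.exp (-ε * z ^ 2)) ≤ 1 := by
    rw [intervalIntegral.integral_eq_sub_of_hasDerivAt (f := fun z => -Real.exp (-ε * z ^ 2))]
    · have h1 : Real.exp (-ε * 1 ^ 2) ≤ 1 := by rw [Real.exp_le_one_iff]; nlinarith
      linarith [Real.exp_pos (-ε * R ^ 2)]
    · intro z _
      exact (hd z).neg.congr_deriv (by ring)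
    · exact (by fun_prop : Continuous _).intervalIntegrable _ _
  have i1 := integral_inv_sq (a := 1) (b := R) one_pos hR
  have c1 : IntervalIntegrable (fun z : ℝ => 1 / (2 * μ) * (1 / z ^ 2)) volume 1 R :=
    ContinuousOn.intervalIntegrable_of_Icc hR (continuousOn_const.mul
      (continuousOn_const.div (by fun_prop) fun z hz => (pow_pos (hpos z hz) 2).ne'))
  have c2 : IntervalIntegrable (fun z : ℝ => 1 / (2 * μ) * (2 * ε * z * Real.exp (-ε * z ^ 2)))
      volume 1 R := (by fun_prop : Continuous _).intervalIntegrable _ _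
  have h_int : ∫ z in (1 : ℝ)..R, (|-(2 * μ) / (2 * μ * z) ^ 2| * ‖((Real.exp (-ε * z ^ 2) : ℝ) : ℂ)‖ +
      |(2 * μ * z)⁻¹| * ‖((-(2 * ε * z * Real.exp (-ε * z ^ 2)) : ℝ) : ℂ)‖) ≤ 1 / μ := by
    calc _ ≤ ∫ z in (1 : ℝ)..R, (1 / (2 * μ) * (1 / z ^ 2) +
          1 / (2 * μ) * (2 * ε * z * Real.exp (-ε * z ^ 2))) := by
          refine intervalIntegral.integral_mono_on hR ?_ (c1.add c2) fun z hz => ?_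
          · refine ContinuousOn.intervalIntegrable_of_Icc hR (ContinuousOn.add
              (ContinuousOn.mul (ContinuousOn.abs (ContinuousOn.div (by fun_prop) (by fun_prop)
                fun z hz => (pow_pos (mul_pos (by positivity) (hpos z hz)) 2).ne')) (by fun_prop))
              (ContinuousOn.mul (ContinuousOn.abs (ContinuousOn.inv₀ (by fun_prop)
                fun z hz => (mul_pos (by positivity) (hpos z hz)).ne')) (by fun_prop)))
          · have hz0 := hpos z hz
            refine add_le_add ?_ ?_
            · rw [abs_div, abs_neg, abs_of_pos (by positivity), abs_of_pos (by positivity)]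
              calc _ ≤ 2 * μ / (2 * μ * z) ^ 2 * 1 := by gcongr; exact hexp z
                _ = _ := by field_simp
            · rw [Complex.norm_real, norm_neg, Real.norm_of_nonneg (by positivity),
                abs_of_pos (by positivity)]
              gcongr
              rw [one_div]
              exact inv_anti₀ (by positivity) (le_mul_of_one_le_right (by positivity) hz.1)
      _ = 1 / (2 * μ) * (1 / 1 - 1 / R) + 1 / (2 * μ) *
            ∫ z in (1 : ℝ)..R, (2 * ε * z * Real.exp (-ε * z ^ 2)) := by
          rw [intervalIntegral.integral_add c1 c2, intervalIntegral.integral_const_mul,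
            intervalIntegral.integral_const_mul, i1]
      _ ≤ 1 / (2 * μ) * 1 + 1 / (2 * μ) * 1 := by
          gcongr
          have : 0 < 1 / R := by positivity
          linarith
      _ = 1 / μ := by field_simp; norm_num
  have d1 : |(2 * μ * 1)⁻¹| * ‖((Real.exp (-ε * 1 ^ 2) : ℝ) : ℂ)‖ ≤ 1 / (2 * μ) := by
    rw [abs_of_pos (by positivity)]
    calc _ ≤ (2 * μ * 1)⁻¹ * 1 := by gcongr; exact hexp 1
      _ = _ := by simp
  have d2 : |(2 * μ * R)⁻¹| * ‖((Real.exp (-ε * R ^ 2) : ℝ) : ℂ)‖ ≤ 1 / (2 * μ) := by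
    rw [abs_of_pos (by positivity)]
    calc _ ≤ (2 * μ * 1)⁻¹ * 1 := by gcongr; exact hexp R
      _ = _ := by simp
  refine key.trans ?_
  have : 2 / μ = 1 / (2 * μ) + 1 / (2 * μ) + 1 / μ := by field_simp; norm_num
  rw [this]
  exact add_le_add (add_le_add d1 d2) h_int

lemma norm_gauss_sub_le {μ ε : ℝ} (hμ : 0 < μ) (hε : 0 < ε) :
    ‖(∫ z in (-1 : ℝ)..1, cis (μ * z ^ 2) * (Real.exp (-ε * z ^ 2) : ℝ)) -
      ((Real.pi : ℂ) / (ε - Complex.I * μ)) ^ (1 / 2 : ℂ)‖ ≤ 4 / μ := by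
  set f : ℝ → ℂ := fun z => cis (μ * z ^ 2) * (Real.exp (-ε * z ^ 2) : ℝ) with hf
  have hfc : Continuous f := (continuous_cis.comp (by fun_prop)).mul (by fun_prop)
  have hfe : f = fun z : ℝ => Complex.exp (-(ε - Complex.I * μ) * z ^ 2) := by
    ext z
    simp only [hf, cis, Complex.ofReal_exp, ← Complex.exp_add]
    congr 1; push_cast; ring
  have hre : 0 < (ε - Complex.I * μ : ℂ).re := by simpa using hε
  have hI : Integrable f := by rw [hfe]; exact integrable_cexp_neg_mul_sq hre
  have hfull : ∫ z, f z = ((Real.pi : ℂ) / (ε - Complex.I * μ)) ^ (1 / 2 : ℂ) := by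
    rw [hfe]; exact integral_gaussian_complex hre
  have hi : ∀ a b, IntervalIntegrable f volume a b := fun a b => hfc.intervalIntegrable a b
  have hlim : Tendsto (fun R : ℝ => ∫ z in (-R)..R, f z) atTop (𝓝 (∫ z, f z)) :=
    intervalIntegral_tendsto_integral hI tendsto_neg_atTop_atBot tendsto_id
  have hb : ∀ᶠ R : ℝ in atTop, ‖(∫ z in (-1 : ℝ)..1, f z) - ∫ z in (-R)..R, f z‖ ≤ 4 / μ := by
    filter_upwards [eventually_ge_atTop (1 : ℝ)] with R hR
    have h1 := norm_gauss_tail_le hμ hε.le hR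
    have e : ∫ z in (-R)..(-1 : ℝ), f z = ∫ z in (1 : ℝ)..R, f z := by
      have := intervalIntegral.integral_comp_neg (a := 1) (b := R) f
      rw [← this]
      refine intervalIntegral.integral_congr fun z _ => ?_
      simp [hf]
    rw [← intervalIntegral.integral_add_adjacent_intervals (hi (-R) (-1)) (hi (-1) R),
      ← intervalIntegral.integral_add_adjacent_intervals (hi (-1) 1) (hi 1 R), e]
    have : (∫ z in (-1 : ℝ)..1, f z) - ((∫ z in (1 : ℝ)..R, f z) +
        ((∫ z in (-1 : ℝ)..1, f z) + ∫ z in (1 : ℝ)..R, f z)) =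
        -((∫ z in (1 : ℝ)..R, f z) + ∫ z in (1 : ℝ)..R, f z) := by ring
    rw [this, norm_neg]
    calc _ ≤ _ := norm_add_le _ _
      _ ≤ 2 / μ + 2 / μ := add_le_add h1 h1
      _ = _ := by ring
  rw [← hfull]
  exact le_of_tendsto (tendsto_const_nhds.sub hlim).norm hb

lemma norm_fresnel_sub_le {μ : ℝ} (hμ : 0 < μ) :
    ‖(∫ z in (-1 : ℝ)..1, cis (μ * z ^ 2)) - fresnel μ‖ ≤ 4 / μ := by
  have h1 : Tendsto (fun ε : ℝ => ∫ z in (-1 : ℝ)..1, cis (μ * z ^ 2) * (Real.exp (-ε * z ^ 2) : ℝ))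
      (𝓝[>] 0) (𝓝 (∫ z in (-1 : ℝ)..1, cis (μ * z ^ 2))) := by
    have hc : Continuous (fun ε : ℝ => ∫ z in (-1 : ℝ)..1,
        cis (μ * z ^ 2) * (Real.exp (-ε * z ^ 2) : ℝ)) := by
      apply intervalIntegral.continuous_parametric_intervalIntegral_of_continuous'
      exact (continuous_cis.comp (by fun_prop)).mul (by fun_prop)
    have := hc.tendsto 0
    simp only [neg_zero, zero_mul, Real.exp_zero, Complex.ofReal_one, mul_one] at this
    exact this.mono_left nhdsWithin_le_nhds
  have h2 : Tendsto (fun ε : ℝ => ((Real.pi : ℂ) / (ε - Complex.I * μ)) ^ (1 / 2 : ℂ))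
      (𝓝[>] 0) (𝓝 (fresnel μ)) := by
    have hne : ((0 : ℝ) : ℂ) - Complex.I * μ ≠ 0 := by
      simp [Complex.I_ne_zero, hμ.ne']
    have hc : ContinuousAt (fun ε : ℝ => ((Real.pi : ℂ) / (ε - Complex.I * μ))) 0 := by
      exact ContinuousAt.div₀ (f := fun _ : ℝ => (Real.pi : ℂ))
        (g := fun ε : ℝ => (ε : ℂ) - Complex.I * μ) continuousAt_const (by fun_prop) hne
    have hs : (Real.pi : ℂ) / (((0 : ℝ) : ℂ) - Complex.I * μ) ∈ Complex.slitPlane := by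
      have e : (Real.pi : ℂ) / (((0 : ℝ) : ℂ) - Complex.I * μ) =
          ((Real.pi / μ : ℝ) : ℂ) * Complex.I := by
        have : (μ : ℂ) ≠ 0 := by exact_mod_cast hμ.ne'
        push_cast
        rw [zero_sub]
        field_simp
        rw [Complex.I_sq]
      rw [e, Complex.mem_slitPlane_iff]
      right
      simpa [Real.pi_ne_zero] using hμ.ne'
    have := (hc.cpow (continuousAt_const (y := (1 / 2 : ℂ))) hs).tendsto
    rw [show ((Real.pi : ℂ) / (((0 : ℝ) : ℂ) - Complex.I * μ)) ^ (1 / 2 : ℂ) = fresnel μ by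
      rw [← fresnel_eq_cpow hμ]; simp] at this
    exact this.mono_left nhdsWithin_le_nhds
  refine le_of_tendsto (h1.sub h2).norm ?_
  filter_upwards [self_mem_nhdsWithin] with ε hε
  exact norm_gauss_sub_le hμ hε

lemma amp_cis_cubic_sub_one {ν : ℝ} (hν : |ν| ≤ 6) :
    Amp (-1) 1 26 (fun z => cis (ν * z ^ 3) - 1)
      (fun z => Complex.I * ((ν * (3 * z ^ 2) : ℝ) : ℂ) * cis (ν * z ^ 3)) := by
  have hd : ∀ z : ℝ, HasDerivAt (fun z : ℝ => ν * z ^ 3) (ν * (3 * z ^ 2)) z := fun z => by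
    have := (hasDerivAt_pow 3 z).const_mul ν
    exact this.congr_deriv (by norm_num)
  refine Amp.of_bound (by norm_num) (by norm_num)
    (fun z _ => (hasDerivAt_cis (hd z)).sub_const 1) ?_ ?_ ?_
  · exact (by fun_prop : Continuous _).continuousOn.mul (continuousOn_cis (by fun_prop))
  · intro z _
    refine (norm_sub_le _ _).trans ?_
    rw [norm_cis, norm_one]; norm_num
  · have hle : ∀ z ∈ Icc (-1 : ℝ) 1,
        ‖Complex.I * ((ν * (3 * z ^ 2) : ℝ) : ℂ) * cis (ν * z ^ 3)‖ ^ 2 ≤ 324 := by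
      intro z hz
      rw [norm_mul, norm_mul, norm_cis, Complex.norm_I, Complex.norm_real, one_mul, mul_one,
        Real.norm_eq_abs, abs_mul, abs_of_nonneg (by positivity : (0 : ℝ) ≤ 3 * z ^ 2)]
      have : z ^ 2 ≤ 1 := by nlinarith [hz.1, hz.2]
      have h2 : |ν| * (3 * z ^ 2) ≤ 18 := by nlinarith [abs_nonneg ν, sq_nonneg z]
      nlinarith [mul_nonneg (abs_nonneg ν) (by positivity : (0 : ℝ) ≤ 3 * z ^ 2)]
    refine (intervalIntegral.integral_mono_on (by norm_num) ?_
      (intervalIntegrable_const (c := (324 : ℝ))) hle).trans ?_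
    · refine ContinuousOn.intervalIntegrable (ContinuousOn.pow (ContinuousOn.norm ?_) 2)
      exact (by fun_prop : Continuous _).continuousOn.mul (continuousOn_cis (by fun_prop))
    · rw [intervalIntegral.integral_const]; norm_num

/-- Stationary phase at the origin for a cubic phase. -/
lemma Amp.stationary_phase (h : Amp (-1) 1 K β β') {τ ν : ℝ} (hτ : 1 ≤ τ) (hν6 : |ν| ≤ 6)
    (hν : 3 * |ν| ≤ τ ^ 4) :
    ‖(∫ z in (-1 : ℝ)..1, cis (τ ^ 4 * z ^ 2 + ν * z ^ 3) * β z) - β 0 * fresnel (τ ^ 4)‖ ≤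
      700 * K / τ ^ 3 := by
  have hK := h.nonneg
  have hτ0 : 0 < τ := by linarith
  have b0 : ‖β 0‖ ≤ K := h.bdd 0 (by norm_num)
  have hW : Amp (-1) 1 (2 * K) (fun z => β z - β 0) β' := by
    refine ⟨h.le, by positivity, h.cont.sub continuousOn_const, fun z hz => ?_, ?_, h.memLp,
      h.L2.trans (by nlinarith)⟩
    · linarith [norm_sub_le (β z) (β 0), h.bdd z hz]
    · obtain ⟨s, hs, d⟩ := h.der
      exact ⟨s, hs, fun z hz => (d z hz).sub_const _⟩
  have p1 := hW.norm_vanish_le (by simp) hτ hν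
  have p2 := (amp_cis_cubic_sub_one hν6).norm_vanish_le (by simp) hτ (ν := 0) (by simp; positivity)
  have p3 := norm_fresnel_sub_le (μ := τ ^ 4) (by positivity)
  have cc : Continuous fun z : ℝ => cis (τ ^ 4 * z ^ 2 + ν * z ^ 3) :=
    continuous_cis.comp (by fun_prop)
  have cq : Continuous fun z : ℝ => cis (τ ^ 4 * z ^ 2) := continuous_cis.comp (by fun_prop)
  have e1 : (∫ z in (-1 : ℝ)..1, cis (τ ^ 4 * z ^ 2 + ν * z ^ 3) * (β z - β 0)) =
      (∫ z in (-1 : ℝ)..1, cis (τ ^ 4 * z ^ 2 + ν * z ^ 3) * β z) -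
        (∫ z in (-1 : ℝ)..1, cis (τ ^ 4 * z ^ 2 + ν * z ^ 3)) * β 0 := by
    rw [← intervalIntegral.integral_mul_const, ← intervalIntegral.integral_sub]
    · refine intervalIntegral.integral_congr fun z _ => ?_
      ring
    · exact (cc.continuousOn.mul h.cont).intervalIntegrable_of_Icc (by norm_num)
    · exact (cc.mul continuous_const).intervalIntegrable _ _
  have e2 : (∫ z in (-1 : ℝ)..1, cis (τ ^ 4 * z ^ 2 + 0 * z ^ 3) * (cis (ν * z ^ 3) - 1)) =
      (∫ z in (-1 : ℝ)..1, cis (τ ^ 4 * z ^ 2 + ν * z ^ 3)) -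
        ∫ z in (-1 : ℝ)..1, cis (τ ^ 4 * z ^ 2) := by
    rw [← intervalIntegral.integral_sub (cc.intervalIntegrable _ _) (cq.intervalIntegrable _ _)]
    refine intervalIntegral.integral_congr fun z _ => ?_
    simp only [zero_mul, add_zero]
    rw [cis_add]; ring
  rw [e1] at p1
  rw [e2] at p2
  set A := ∫ z in (-1 : ℝ)..1, cis (τ ^ 4 * z ^ 2 + ν * z ^ 3) * β z
  set B := ∫ z in (-1 : ℝ)..1, cis (τ ^ 4 * z ^ 2 + ν * z ^ 3)
  set D := ∫ z in (-1 : ℝ)..1, cis (τ ^ 4 * z ^ 2)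
  have e : A - β 0 * fresnel (τ ^ 4) = (A - B * β 0) + β 0 * ((B - D) + (D - fresnel (τ ^ 4))) := by
    ring
  have p4 : 4 / τ ^ 4 ≤ 4 / τ ^ 3 := by
    gcongr
    norm_num
  rw [e]
  calc _ ≤ ‖A - B * β 0‖ + ‖β 0‖ * (‖B - D‖ + ‖D - fresnel (τ ^ 4)‖) := by
        refine (norm_add_le _ _).trans ?_
        rw [norm_mul]
        gcongr
        exact norm_add_le _ _
    _ ≤ 24 * (2 * K) / τ ^ 3 + K * (24 * 26 / τ ^ 3 + 4 / τ ^ 3) := by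
        gcongr
        exact p3.trans p4
    _ = 676 * K / τ ^ 3 := by ring
    _ ≤ 700 * K / τ ^ 3 := by gcongr; norm_num

end MKdVPaper

namespace MKdVPaper

variable {ρ N : ℝ} {c : ℂ} {w g : ℝ → ℂ}

/-- The slowly varying amplitude of the mode. -/
def alpha (N : ℝ) (w : ℝ → ℂ) (ξ : ℝ) : ℂ := cis (2 * ξ ^ 3) / (√ξ : ℝ) * mode N w ξ

/-- The forcing term `x u - 3 u''`. -/
def forcing (ρ N : ℝ) (c : ℂ) (g : ℝ → ℂ) (x : ℝ) : ℂ :=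
  Complex.I * (osc N g x + osc N (jumpDeriv ρ c) x)

/-- The derivative of `alpha`. -/
def alphaDeriv (ρ N : ℝ) (c : ℂ) (w g : ℝ → ℂ) (ξ : ℝ) : ℂ :=
  cis (2 * ξ ^ 3) / (√ξ : ℝ) * (Complex.I * osc N w (-3 * ξ ^ 2) +
    2 * ξ * forcing ρ N c g (-3 * ξ ^ 2) - mode N w ξ / (2 * ξ))

lemma Prof.continuous_forcing (h : Prof ρ N c w g) : Continuous (forcing ρ N c g) :=
  continuous_const.mul ((continuous_osc (h.intervalIntegrable_g _ _)).add
    (continuous_osc (intervalIntegrable_jumpDeriv h.ρ_pos h.c_le _ _)))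

lemma Prof.continuous_osc (h : Prof ρ N c w g) : Continuous (osc N w) :=
  MKdVPaper.continuous_osc (h.cont.intervalIntegrable _ _)

lemma Prof.hasDerivAt_osc_deriv (h : Prof ρ N c w g) (x : ℝ) :
    HasDerivAt (osc N (fun k => Complex.I * k * w k))
      ((x * osc N w x - forcing ρ N c g x) / 3) x := by
  have hc := h.cont
  have := hasDerivAt_osc (N := N) (h := fun k => Complex.I * k * w k) (by fun_prop) x
  refine this.congr_deriv ?_
  rw [eq_div_iff (by norm_num), mul_comm, h.ode x, forcing]

lemma Prof.hasDerivAt_mode (h : Prof ρ N c w g) (ξ : ℝ) :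
    HasDerivAt (mode N w) (-6 * Complex.I * ξ ^ 2 * mode N w ξ + Complex.I * osc N w (-3 * ξ ^ 2) +
      2 * ξ * forcing ρ N c g (-3 * ξ ^ 2)) ξ := by
  have hx : HasDerivAt (fun ξ : ℝ => -3 * ξ ^ 2) (-6 * ξ) ξ := by
    have := (hasDerivAt_pow 2 ξ).const_mul (-3)
    exact this.congr_deriv (by norm_num; ring)
  have d1 := (h.hasDerivAt_osc_deriv (-3 * ξ ^ 2)).scomp ξ hx
  have d2 := (hasDerivAt_osc h.cont (N := N) (-3 * ξ ^ 2)).scomp ξ hx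
  have d3 := ((hasDerivAt_id ξ).ofReal_comp.const_mul Complex.I).mul d2
  have d4 := d1.add d3
  have e : mode N w = fun ξ => osc N (fun k => Complex.I * k * w k) (-3 * ξ ^ 2) +
      Complex.I * ξ * osc N w (-3 * ξ ^ 2) := funext fun ξ => mode_eq h ξ
  rw [mode_eq h ξ, e]
  refine d4.congr_deriv ?_
  simp only [Complex.real_smul, Function.comp, id, forcing]
  push_cast
  linear_combination (6 * ξ ^ 3 * osc N w (-3 * ξ ^ 2)) * Complex.I_sq

lemma Prof.hasDerivAt_alpha (h : Prof ρ N c w g) {ξ : ℝ} (hξ : 0 < ξ) :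
    HasDerivAt (alpha N w) (alphaDeriv ρ N c w g ξ) ξ := by
  have hs := Real.sqrt_pos.2 hξ
  have hsc : ((√ξ : ℝ) : ℂ) ≠ 0 := by exact_mod_cast hs.ne'
  have hξc : (ξ : ℂ) ≠ 0 := by exact_mod_cast hξ.ne'
  have hψ : HasDerivAt (fun ξ : ℝ => 2 * ξ ^ 3) (6 * ξ ^ 2) ξ := by
    have := (hasDerivAt_pow 3 ξ).const_mul 2
    exact this.congr_deriv (by norm_num; ring)
  have d := ((hasDerivAt_cis hψ).div (Real.hasDerivAt_sqrt hξ.ne').ofReal_comp hsc).mul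
    (h.hasDerivAt_mode ξ)
  refine d.congr_deriv ?_
  rw [alphaDeriv]
  have e : ((√ξ : ℝ) : ℂ) ^ 2 = ξ := by exact_mod_cast Real.sq_sqrt hξ.le
  simp only [Pi.div_apply]
  push_cast
  rw [e]
  field_simp
  rw [e]
  field_simp
  ring

lemma Prof.norm_alpha_le (h : Prof ρ N c w g) {ξ : ℝ} (hξ : 1 ≤ ξ) : ‖alpha N w ξ‖ ≤ 18 := by
  have hs : 0 < √ξ := Real.sqrt_pos.2 (by linarith)
  rw [alpha, norm_mul, norm_div, norm_cis, Complex.norm_real, Real.norm_of_nonneg hs.le]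
  have := h.norm_mode_le hξ
  calc _ ≤ 1 / √ξ * (18 * √ξ) := by gcongr
    _ = 18 := by field_simp

lemma Prof.norm_alphaDeriv_sq_le (h : Prof ρ N c w g) {ξ ξ₀ : ℝ} (hξ₀ : 1 ≤ ξ₀) (hξ : ξ₀ ≤ ξ)
    (hρ : 1 ≤ 100 * ρ * ξ₀) :
    ‖alphaDeriv ρ N c w g ξ‖ ^ 2 ≤ (2187 + 120000 * ξ₀) * (1 / ξ ^ 2) +
      2 * (‖osc N g (-3 * ξ ^ 2)‖ ^ 2 * (6 * ξ)) := by
  have hρ0 := h.ρ_pos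
  have h1 : 1 ≤ ξ := hξ₀.trans hξ
  have h0 : 0 < ξ := by linarith
  set s := √ξ with hs
  have hs0 : 0 < s := Real.sqrt_pos.2 h0
  have hs2 : s ^ 2 = ξ := Real.sq_sqrt h0.le
  obtain ⟨-, b2⟩ := h.norm_le_mode h1
  have b3 := h.norm_mode_le h1
  have b4 := (h.norm_osc_jump_le (-3 * ξ ^ 2)).2
  set u := osc N w (-3 * ξ ^ 2)
  set f1 := osc N g (-3 * ξ ^ 2)
  set f0 := osc N (jumpDeriv ρ c) (-3 * ξ ^ 2)
  have c1 : ‖u‖ / s ≤ 18 / ξ := by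
    rw [div_le_div_iff₀ hs0 h0]; linarith
  have c2 : ‖mode N w ξ‖ / (2 * ξ) / s ≤ 9 / ξ := by
    rw [div_div, div_le_div_iff₀ (by positivity) h0]
    nlinarith
  have c3 : ‖f0‖ ≤ 100 * ξ₀ / ξ ^ 2 := by
    rw [le_div_iff₀ (by positivity)]
    rw [show |-3 * ξ ^ 2| = 3 * ξ ^ 2 by rw [abs_mul, abs_of_nonneg (sq_nonneg ξ)]; norm_num] at b4
    have : ρ * (‖f0‖ * ξ ^ 2) ≤ 1 := by linarith
    have h5 : 0 ≤ ‖f0‖ * ξ ^ 2 := by positivity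
    nlinarith
  have c4 : (2 * s * ‖f0‖) ^ 2 ≤ 40000 * ξ₀ * (1 / ξ ^ 2) := by
    calc (2 * s * ‖f0‖) ^ 2 ≤ (2 * s * (100 * ξ₀ / ξ ^ 2)) ^ 2 := by gcongr
      _ = 40000 * ξ₀ * (1 / ξ ^ 2) * (ξ₀ / ξ) := by
          rw [mul_pow, mul_pow, hs2]; field_simp; norm_num
      _ ≤ 40000 * ξ₀ * (1 / ξ ^ 2) * 1 := by
          gcongr
          rw [div_le_one h0]; exact hξ
      _ = _ := by ring
  have key : ‖alphaDeriv ρ N c w g ξ‖ ≤ 27 / ξ + 2 * s * ‖f0‖ + 2 * s * ‖f1‖ := by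
    rw [alphaDeriv, norm_mul, norm_div, norm_cis, Complex.norm_real, Real.norm_of_nonneg hs0.le]
    have n1 : ‖Complex.I * u + 2 * ξ * forcing ρ N c g (-3 * ξ ^ 2) - mode N w ξ / (2 * ξ)‖ ≤
        ‖u‖ + 2 * ξ * (‖f1‖ + ‖f0‖) + ‖mode N w ξ‖ / (2 * ξ) := by
      refine (norm_sub_le _ _).trans (add_le_add ((norm_add_le _ _).trans (add_le_add ?_ ?_)) ?_)
      · simp
      · rw [forcing, norm_mul, norm_mul, norm_mul, Complex.norm_I, one_mul, Complex.norm_real,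
          Real.norm_of_nonneg h0.le, Complex.norm_ofNat]
        gcongr
        exact norm_add_le _ _
      · rw [norm_div, norm_mul, Complex.norm_real, Real.norm_of_nonneg h0.le, Complex.norm_ofNat]
    calc _ ≤ 1 / s * (‖u‖ + 2 * ξ * (‖f1‖ + ‖f0‖) + ‖mode N w ξ‖ / (2 * ξ)) := by gcongr
      _ = ‖u‖ / s + ‖mode N w ξ‖ / (2 * ξ) / s + 2 * s * ‖f0‖ + 2 * s * ‖f1‖ := by
          rw [← hs2]; field_simp; ring
      _ ≤ 18 / ξ + 9 / ξ + 2 * s * ‖f0‖ + 2 * s * ‖f1‖ := by gcongr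
      _ = _ := by ring
  have key2 := pow_le_pow_left₀ (norm_nonneg _) key 2
  set A := 27 / ξ
  set B := 2 * s * ‖f0‖
  set D := 2 * s * ‖f1‖ with hD
  have e1 : A ^ 2 = 729 * (1 / ξ ^ 2) := by simp only [A]; field_simp; norm_num
  have e2 : D ^ 2 = 4 * ξ * ‖f1‖ ^ 2 := by rw [hD, mul_pow, mul_pow, hs2]; ring
  nlinarith [sq_nonneg (A - B), sq_nonneg (A - D), sq_nonneg (B - D)]

lemma Prof.integral_forcing_le (h : Prof ρ N c w g) {a b : ℝ} (ha : 0 ≤ a) (hab : a ≤ b) :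
    ∫ ξ in a..b, ‖osc N g (-3 * ξ ^ 2)‖ ^ 2 * (6 * ξ) ≤ 36 := by
  have hc := MKdVPaper.continuous_osc (h.intervalIntegrable_g (-N) N)
  have hx : ∀ ξ : ℝ, HasDerivAt (fun ξ : ℝ => -3 * ξ ^ 2) (-(6 * ξ)) ξ := fun ξ => by
    have := (hasDerivAt_pow 2 ξ).const_mul (-3)
    exact this.congr_deriv (by norm_num; ring)
  have e := intervalIntegral.integral_comp_mul_deriv (a := a) (b := b)
    (f := fun ξ : ℝ => -3 * ξ ^ 2) (f' := fun ξ => -(6 * ξ)) (g := fun x => ‖osc N g x‖ ^ 2)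
    (fun ξ _ => hx ξ) (by fun_prop) (by fun_prop)
  simp only [Function.comp, mul_neg, intervalIntegral.integral_neg] at e
  have hle : -3 * b ^ 2 ≤ -3 * a ^ 2 := by nlinarith
  rw [neg_eq_iff_eq_neg, ← intervalIntegral.integral_symm] at e
  rw [e, intervalIntegral.integral_of_le hle]
  exact (setIntegral_le_integral (h.osc_L2.1.integrable_norm_pow (by norm_num))
    (ae_of_all _ fun _ => by positivity)).trans h.osc_L2.2

lemma Prof.amp_alpha (h : Prof ρ N c w g) {ξ₀ Ξ : ℝ} (hξ₀ : 1 ≤ ξ₀) (hΞ : ξ₀ ≤ Ξ)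
    (hρ : 1 ≤ 100 * ρ * ξ₀) :
    Amp ξ₀ Ξ 350 (alpha N w) (alphaDeriv ρ N c w g) := by
  have hpos : ∀ ξ ∈ Icc ξ₀ Ξ, 0 < ξ := fun ξ hξ => by linarith [hξ.1]
  have hmc : Continuous (mode N w) :=
    continuous_iff_continuousAt.2 fun ξ => (h.hasDerivAt_mode ξ).continuousAt
  have hoc := h.continuous_osc
  have hfc := h.continuous_forcing
  have hgc := MKdVPaper.continuous_osc (h.intervalIntegrable_g (-N) N)
  have hcont : ContinuousOn (alphaDeriv ρ N c w g) (Icc ξ₀ Ξ) := by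
    unfold alphaDeriv
    refine ContinuousOn.mul (ContinuousOn.div (continuousOn_cis (by fun_prop)) (by fun_prop) ?_)
      (ContinuousOn.sub (by fun_prop) (ContinuousOn.div (by fun_prop) (by fun_prop) ?_))
    · intro ξ hξ
      exact_mod_cast (Real.sqrt_pos.2 (hpos ξ hξ)).ne'
    · intro ξ hξ
      have := (hpos ξ hξ).ne'
      simpa using this
  refine Amp.of_bound hΞ (by norm_num) (fun ξ hξ => h.hasDerivAt_alpha (hpos ξ hξ)) hcont
    (fun ξ hξ => (h.norm_alpha_le (hξ₀.trans hξ.1)).trans (by norm_num)) ?_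
  have c1 : IntervalIntegrable (fun ξ : ℝ => (2187 + 120000 * ξ₀) * (1 / ξ ^ 2)) volume ξ₀ Ξ :=
    ContinuousOn.intervalIntegrable_of_Icc hΞ (continuousOn_const.mul
      (continuousOn_const.div (by fun_prop) fun z hz => (pow_pos (hpos z hz) 2).ne'))
  have c2 : IntervalIntegrable (fun ξ : ℝ => 2 * (‖osc N g (-3 * ξ ^ 2)‖ ^ 2 * (6 * ξ)))
      volume ξ₀ Ξ := (by fun_prop : Continuous _).intervalIntegrable _ _
  have h0 : 0 < ξ₀ := by linarith
  have hΞ0 : 0 < Ξ := by linarith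
  calc ∫ ξ in ξ₀..Ξ, ‖alphaDeriv ρ N c w g ξ‖ ^ 2
      ≤ ∫ ξ in ξ₀..Ξ, ((2187 + 120000 * ξ₀) * (1 / ξ ^ 2) +
          2 * (‖osc N g (-3 * ξ ^ 2)‖ ^ 2 * (6 * ξ))) := by
        refine intervalIntegral.integral_mono_on hΞ
          ((hcont.norm.pow 2).intervalIntegrable_of_Icc hΞ) (c1.add c2) fun ξ hξ => ?_
        exact h.norm_alphaDeriv_sq_le hξ₀ hξ.1 hρ
    _ = (2187 + 120000 * ξ₀) * (1 / ξ₀ - 1 / Ξ) +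
          2 * ∫ ξ in ξ₀..Ξ, ‖osc N g (-3 * ξ ^ 2)‖ ^ 2 * (6 * ξ) := by
        rw [intervalIntegral.integral_add c1 c2, intervalIntegral.integral_const_mul,
          intervalIntegral.integral_const_mul, integral_inv_sq h0 hΞ]
    _ ≤ (2187 + 120000 * ξ₀) * (1 / ξ₀) + 2 * 36 := by
        gcongr
        · have : 0 < 1 / Ξ := by positivity
          linarith
        · exact h.integral_forcing_le h0.le hΞ
    _ = 2187 * (1 / ξ₀) + 120072 := by field_simp; ring
    _ ≤ 2187 * 1 + 120072 := by
        gcongr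
        rw [div_le_one h0]; exact hξ₀
    _ ≤ 350 ^ 2 := by norm_num

end MKdVPaper

namespace MKdVPaper

variable {ρ N : ℝ} {c : ℂ} {w g : ℝ → ℂ}

/-- Away from the origin a profile is an amplitude. -/
lemma Prof.amp (h : Prof ρ N c w g) {a b : ℝ} (ha : 1 ≤ a) (hab : a ≤ b) : Amp a b 2 w g := by
  refine ⟨hab, by norm_num, h.cont.continuousOn, fun x _ => (h.bdd x).trans (by norm_num), ?_,
    h.memLp.restrict _, h.integral_sq_le hab⟩
  obtain ⟨s, hs, d⟩ := h.der
  refine ⟨s, hs, fun x hx => ?_⟩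
  have hj : jumpDeriv ρ c x = 0 := by
    rw [jumpDeriv, if_neg]
    have := le_abs_self x
    have := h.ρ_le
    linarith [hx.1.1]
  simpa [hj] using d x hx.2

lemma amp_linear {ξ : ℝ} (hξ : 1 ≤ ξ) :
    Amp (-1) 1 (4 * ξ) (fun z => Complex.I * (2 * ξ + z)) (fun _ => Complex.I) := by
  refine Amp.of_bound (by norm_num) (by positivity) (fun z _ => ?_) continuousOn_const
    (fun z hz => ?_) ?_
  · have := (((hasDerivAt_id z).ofReal_comp).const_add (2 * (ξ : ℂ))).const_mul Complex.I
    simpa using this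
  · rw [norm_mul, Complex.norm_I, one_mul]
    have : (2 * (ξ : ℂ) + z) = ((2 * ξ + z : ℝ) : ℂ) := by push_cast; ring
    rw [this, Complex.norm_real, Real.norm_eq_abs, abs_le]
    constructor <;> linarith [hz.1, hz.2]
  · simp only [Complex.norm_I, intervalIntegral.integral_const, smul_eq_mul]
    nlinarith

lemma Prof.norm_alpha_sub_le (h : Prof ρ N c w g) {ξ τ : ℝ} (hξ : 2 ≤ ξ) (hτ : 1 ≤ τ)
    (hτξ : τ ^ 4 = 3 * ξ) :
    ‖alpha N w ξ - 2 * Complex.I * (√ξ : ℝ) * fresnel (3 * ξ) * w ξ‖ ≤ 7500 / τ := by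
  have hc := h.cont
  have hN := h.N_ge
  have hτ0 : 0 < τ := by linarith
  have hs : 0 < √ξ := Real.sqrt_pos.2 (by linarith)
  have hss : √ξ ^ 2 = ξ := Real.sq_sqrt (by linarith)
  have hA : Amp (-1) 1 2 (fun z => w (ξ + z)) (fun z => g (ξ + z)) := by
    have := (h.amp (a := ξ - 1) (b := ξ + 1) (by linarith) (by linarith)).comp_add ξ
    convert this using 1 <;> ring
  have key := ((amp_linear (ξ := ξ) (by linarith)).mul hA).stationary_phase hτ (ν := 1)
    (by norm_num) (by rw [abs_one]; linarith)
  set M := ∫ z in (-1 : ℝ)..1, cis (τ ^ 4 * z ^ 2 + 1 * z ^ 3) *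
    (Complex.I * (2 * ξ + z) * w (ξ + z)) with hM
  have hmode : ‖mode N w ξ - cis (-(2 * ξ ^ 3)) * M‖ ≤ 12 := by
    rw [mode, osc_eq_of_le (M := N + ξ + 1) (by linarith) (by linarith)
      (fun k hk => by rw [h.supp k hk, mul_zero]), osc]
    set F : ℝ → ℂ := fun k => cis (k * (-3 * ξ ^ 2) + k ^ 3) * (Complex.I * (k + ξ) * w k) with hF
    have hFc : Continuous F := (continuous_phase _).mul (by fun_prop)
    have hi : ∀ a b, IntervalIntegrable F volume a b := fun a b => hFc.intervalIntegrable a b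
    rw [← intervalIntegral.integral_add_adjacent_intervals (hi _ (ξ - 1)) (hi _ _),
      ← intervalIntegral.integral_add_adjacent_intervals (hi (ξ - 1) (ξ + 1)) (hi _ _)]
    have b1 : ‖∫ k in (-(N + ξ + 1))..(ξ - 1), F k‖ ≤ 4 / 1 + 2 * √(1 / 1) :=
      h.norm_mode_left_le one_pos (by linarith)
    have b2 : ‖∫ k in (ξ + 1)..(N + ξ + 1), F k‖ ≤ 4 / 1 + 2 * √(1 / 1) :=
      h.norm_mode_right_le one_pos (by linarith)
    have e : ∫ k in (ξ - 1)..(ξ + 1), F k = cis (-(2 * ξ ^ 3)) * M := by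
      rw [hM, ← intervalIntegral.integral_const_mul]
      have := intervalIntegral.integral_comp_add_left (a := -1) (b := 1) F ξ
      rw [← sub_eq_add_neg] at this
      rw [← this]
      refine intervalIntegral.integral_congr fun z _ => ?_
      simp only [hF]
      rw [← mul_assoc (cis _) (cis _), ← cis_add, hτξ]
      push_cast
      congr 2 <;> ring
    rw [e]
    rw [div_one, div_one, Real.sqrt_one] at b1 b2
    have : ∀ x y z : ℂ, x + (y + z) - y = x + z := fun x y z => by ring
    rw [this]
    linarith [norm_add_le (∫ k in (-(N + ξ + 1))..(ξ - 1), F k) (∫ k in (ξ + 1)..(N + ξ + 1), F k)]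
  have hsc : ((√ξ : ℝ) : ℂ) ≠ 0 := by exact_mod_cast hs.ne'
  have hξc : (ξ : ℂ) = ((√ξ : ℝ) : ℂ) ^ 2 := by rw [← Complex.ofReal_pow, hss]
  have e2 : alpha N w ξ - 2 * Complex.I * (√ξ : ℝ) * fresnel (3 * ξ) * w ξ =
      cis (2 * ξ ^ 3) / (√ξ : ℝ) * (mode N w ξ - cis (-(2 * ξ ^ 3)) * M) +
      1 / (√ξ : ℝ) * (M - Complex.I * (2 * ξ + (0 : ℝ)) * w (ξ + 0) * fresnel (τ ^ 4)) := by
    have := cis_mul_neg (2 * ξ ^ 3)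
    rw [alpha, hτξ, add_zero]
    have e3 : cis (2 * ξ ^ 3) / (√ξ : ℝ) * (mode N w ξ - cis (-(2 * ξ ^ 3)) * M) =
        cis (2 * ξ ^ 3) / (√ξ : ℝ) * mode N w ξ - M / (√ξ : ℝ) := by
      linear_combination -(M / (√ξ : ℝ)) * this
    rw [e3, hξc]
    field_simp
    push_cast
    ring
  rw [e2]
  refine (norm_add_le _ _).trans ?_
  rw [norm_mul, norm_mul, norm_div, norm_div, norm_cis, Complex.norm_real,
    Real.norm_of_nonneg hs.le, norm_one]
  have k2 : 700 * (2 * (4 * ξ) * 2) / τ ^ 3 = 11200 / 3 * τ := by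
    have : ξ = τ ^ 4 / 3 := by linarith
    rw [this]; field_simp; norm_num
  rw [k2] at key
  have k3 : 1 / √ξ ≤ 2 / τ ^ 2 := by
    rw [div_le_div_iff₀ hs (by positivity)]
    have : (τ ^ 2) ^ 2 ≤ (2 * √ξ) ^ 2 := by nlinarith
    have := abs_le_of_sq_le_sq this (by positivity)
    linarith [le_abs_self (τ ^ 2)]
  calc _ ≤ 2 / τ ^ 2 * 12 + 2 / τ ^ 2 * (11200 / 3 * τ) := by gcongr
    _ ≤ 2 / τ ^ 2 * (12 * τ) + 2 / τ ^ 2 * (11200 / 3 * τ) := by gcongr; linarith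
    _ ≤ 7500 / τ := by
      rw [← mul_add, le_div_iff₀ hτ0]
      field_simp
      norm_num

end MKdVPaper

namespace MKdVPaper

variable {ρ N : ℝ} {c : ℂ} {w g : ℝ → ℂ} {a b K κ n : ℝ} {β β' : ℝ → ℂ}

lemma hasDerivAt_resonance_phase (κ n ξ : ℝ) :
    HasDerivAt (fun ξ : ℝ => 3 * κ * ξ ^ 2 - 2 * n * ξ ^ 3) (6 * ξ * (κ - n * ξ)) ξ := by
  have := ((hasDerivAt_pow 2 ξ).const_mul (3 * κ)).sub ((hasDerivAt_pow 3 ξ).const_mul (2 * n))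
  exact this.congr_deriv (by norm_num; ring)

/-- Non-stationary contributions. -/
lemma Amp.norm_nonresonant_le (h : Amp a b K β β') (hn : 1 ≤ |n|)
    (hκ : ∀ ξ ∈ Icc a b, 1 ≤ |κ - n * ξ|) :
    ‖∫ ξ in a..b, (ξ : ℂ) * cis (3 * κ * ξ ^ 2 - 2 * n * ξ ^ 3) * β ξ‖ ≤ K := by
  have hab := h.le
  have hK := h.nonneg
  have hne : ∀ ξ ∈ Icc a b, κ - n * ξ ≠ 0 := fun ξ hξ => by
    have := hκ ξ hξ
    intro h0; rw [h0, abs_zero] at this; linarith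
  set r : ℝ → ℝ := fun ξ => (6 * (κ - n * ξ))⁻¹ with hr
  have dr : ∀ ξ ∈ Icc a b, HasDerivAt r (6 * n * r ξ ^ 2) ξ := fun ξ hξ => by
    have h1 : HasDerivAt (fun ξ : ℝ => 6 * (κ - n * ξ)) (-(6 * n)) ξ := by
      have := (((hasDerivAt_id ξ).const_mul n).const_sub κ).const_mul 6
      exact this.congr_deriv (by ring)
    have := h1.inv (mul_ne_zero (by norm_num) (hne ξ hξ))
    refine this.congr_deriv ?_
    simp only [hr]
    field_simp [hne ξ hξ]
  have rb : ∀ ξ ∈ Icc a b, |r ξ| ≤ 1 / 6 := fun ξ hξ => by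
    have := hκ ξ hξ
    simp only [hr]
    rw [abs_inv, abs_mul, abs_of_pos (by norm_num : (0 : ℝ) < 6), inv_eq_one_div]
    exact one_div_le_one_div_of_le (by norm_num) (by linarith)
  have rc : ContinuousOn r (Icc a b) := fun ξ hξ => (dr ξ hξ).continuousAt.continuousWithinAt
  have ri : IntervalIntegrable (fun ξ => r ξ ^ 2) volume a b :=
    (rc.pow 2).intervalIntegrable_of_Icc hab
  have ha : a ∈ Icc a b := left_mem_Icc.2 hab
  have hb : b ∈ Icc a b := right_mem_Icc.2 hab
  have e : 6 * n * ∫ ξ in a..b, r ξ ^ 2 = r b - r a := by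
    rw [← intervalIntegral.integral_const_mul]
    refine intervalIntegral.integral_eq_sub_of_hasDerivAt (fun ξ hξ => ?_) (ri.const_mul _)
    rw [uIcc_of_le hab] at hξ
    exact dr ξ hξ
  have p0 : 0 ≤ ∫ ξ in a..b, r ξ ^ 2 :=
    intervalIntegral.integral_nonneg hab fun _ _ => by positivity
  have e1 : 6 * |n| * ∫ ξ in a..b, r ξ ^ 2 ≤ 1 / 3 := by
    have h1 := congrArg abs e
    rw [abs_mul, abs_mul, abs_of_nonneg p0, abs_of_pos (by norm_num : (0 : ℝ) < 6)] at h1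
    rw [h1]
    linarith [abs_sub (r b) (r a), rb a ha, rb b hb]
  have e2 : ∫ ξ in a..b, r ξ ^ 2 ≤ (1 / 4) ^ 2 := by nlinarith
  have key := h.norm_osc_le (Q := 1 / 4) (V := 1 / 3 * K) dr
    (fun ξ _ => hasDerivAt_resonance_phase κ n ξ)
    (continuousOn_const.mul (rc.pow 2)) (by fun_prop) (by
      calc _ ≤ ∫ ξ in a..b, 6 * |n| * r ξ ^ 2 * K := by
            refine intervalIntegral.integral_mono_on hab ?_ ((ri.const_mul _).mul_const _)
              fun ξ hξ => ?_
            · exact ((continuousOn_const.mul (rc.pow 2)).abs.mul h.cont.norm).intervalIntegrable_of_Icc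
                hab
            · rw [abs_mul, abs_mul, abs_of_nonneg (sq_nonneg (r ξ)),
                abs_of_pos (by norm_num : (0 : ℝ) < 6)]
              gcongr
              exact h.bdd ξ hξ
        _ = 6 * |n| * (∫ ξ in a..b, r ξ ^ 2) * K := by
            rw [intervalIntegral.integral_mul_const, intervalIntegral.integral_const_mul]
        _ ≤ _ := by gcongr) (by norm_num) e2
  have e3 : ∫ ξ in a..b, ((r ξ * (6 * ξ * (κ - n * ξ)) : ℝ) : ℂ) *
        cis (3 * κ * ξ ^ 2 - 2 * n * ξ ^ 3) * β ξ =
      ∫ ξ in a..b, (ξ : ℂ) * cis (3 * κ * ξ ^ 2 - 2 * n * ξ ^ 3) * β ξ := by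
    refine intervalIntegral.integral_congr fun ξ hξ => ?_
    rw [uIcc_of_le hab] at hξ
    have : r ξ * (6 * ξ * (κ - n * ξ)) = ξ := by
      have := hne ξ hξ
      simp only [hr]; field_simp
    simp only [this]
  rw [e3] at key
  have b1 : |r a| * ‖β a‖ ≤ 1 / 6 * K := by
    gcongr
    · exact rb a ha
    · exact h.bdd a ha
  have b2 : |r b| * ‖β b‖ ≤ 1 / 6 * K := by
    gcongr
    · exact rb b hb
    · exact h.bdd b hb
  linarith

lemma Amp.norm_resonant_le {m τ : ℝ} (h : Amp (m - 1) (m + 1) K β β') (hm : 2 ≤ m) (hn : 1 ≤ n)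
    (hn3 : n ≤ 3) (hκ : κ = n * m) (hτ : 1 ≤ τ) (hτκ : τ ^ 4 = 3 * κ) (hκ6 : 6 ≤ κ) :
    ‖(∫ ξ in (m - 1)..(m + 1), (ξ : ℂ) * cis (3 * κ * ξ ^ 2 - 2 * n * ξ ^ 3) * β ξ) -
      m * β m * cis (n * m ^ 3) * starRingEnd ℂ (fresnel (3 * κ))‖ ≤ 2800 * m * K / τ ^ 3 := by
  have hA : Amp (-1) 1 K (fun z => β (m + z)) (fun z => β' (m + z)) := by
    have := h.comp_add m
    convert this using 1 <;> ring
  have hL : Amp (-1) 1 (2 * m) (fun z : ℝ => (m : ℂ) + z) (fun _ => 1) := by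
    refine Amp.of_bound (by norm_num) (by positivity) (fun z _ => ?_) continuousOn_const
      (fun z hz => ?_) ?_
    · simpa using ((hasDerivAt_id z).ofReal_comp).const_add (m : ℂ)
    · rw [← Complex.ofReal_add, Complex.norm_real, Real.norm_eq_abs, abs_le]
      constructor <;> linarith [hz.1, hz.2]
    · simp only [norm_one, intervalIntegral.integral_const, smul_eq_mul]
      nlinarith
  have key := (hL.mul hA).conj.stationary_phase hτ (ν := 2 * n)
    (by rw [abs_of_pos (by linarith)]; linarith) (by rw [abs_of_pos (by linarith)]; linarith)
  have e : ∫ ξ in (m - 1)..(m + 1), (ξ : ℂ) * cis (3 * κ * ξ ^ 2 - 2 * n * ξ ^ 3) * β ξ =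
      cis (n * m ^ 3) * starRingEnd ℂ (∫ z in (-1 : ℝ)..1, cis (τ ^ 4 * z ^ 2 + 2 * n * z ^ 3) *
        starRingEnd ℂ ((m + z) * β (m + z))) := by
    rw [← intervalIntegral.intervalIntegral_conj, ← intervalIntegral.integral_const_mul]
    have := intervalIntegral.integral_comp_add_left (a := -1) (b := 1)
      (fun ξ : ℝ => (ξ : ℂ) * cis (3 * κ * ξ ^ 2 - 2 * n * ξ ^ 3) * β ξ) m
    rw [← sub_eq_add_neg] at this
    rw [← this]
    refine intervalIntegral.integral_congr fun z _ => ?_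
    simp only [map_mul, conj_cis, map_add, Complex.conj_conj, Complex.conj_ofReal]
    rw [show 3 * κ * (m + z) ^ 2 - 2 * n * (m + z) ^ 3 =
      n * m ^ 3 + -(τ ^ 4 * z ^ 2 + 2 * n * z ^ 3) by rw [hτκ, hκ]; ring, cis_add]
    push_cast
    ring
  rw [e]
  set A := ∫ z in (-1 : ℝ)..1, cis (τ ^ 4 * z ^ 2 + 2 * n * z ^ 3) *
        starRingEnd ℂ ((m + z) * β (m + z))
  have e2 : cis (n * m ^ 3) * starRingEnd ℂ A -
      m * β m * cis (n * m ^ 3) * starRingEnd ℂ (fresnel (3 * κ)) =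
      cis (n * m ^ 3) * starRingEnd ℂ (A - starRingEnd ℂ ((m + (0 : ℝ)) * β (m + 0)) *
        fresnel (τ ^ 4)) := by
    rw [hτκ]
    simp only [map_sub, map_mul, Complex.conj_conj, Complex.conj_ofReal, add_zero,
      Complex.ofReal_zero]
    ring
  rw [e2, norm_mul, norm_cis, one_mul, RCLike.norm_conj]
  refine key.trans (le_of_eq ?_)
  ring

end MKdVPaper

namespace MKdVPaper

variable {ρ N : ℝ} {c : ℂ} {w g : ℝ → ℂ} {a b K κ n : ℝ} {β β' : ℝ → ℂ}

lemma cis_cube (a : ℝ) : cis a ^ 3 = cis (3 * a) := by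
  rw [show 3 * a = a + a + a by ring, cis_add, cis_add]; ring

lemma amp_inv_mul_sqrt (ha : 1 ≤ a) (hab : a ≤ b) :
    Amp a b (2 / (a * √a)) (fun ξ => ((1 / (ξ * √ξ) : ℝ) : ℂ))
      (fun ξ => ((-(3 / 2) / (ξ ^ 2 * √ξ) : ℝ) : ℂ)) := by
  have hpos : ∀ ξ ∈ Icc a b, 0 < ξ := fun ξ hξ => by linarith [hξ.1]
  have ha0 : 0 < a := by linarith
  have hsa := Real.sqrt_pos.2 ha0
  have hcont : ContinuousOn (fun ξ : ℝ => -(3 / 2) / (ξ ^ 2 * √ξ)) (Icc a b) :=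
    ContinuousOn.div (by fun_prop) (by fun_prop) fun ξ hξ => by
      have h0 := hpos ξ hξ
      have := Real.sqrt_pos.2 h0
      positivity
  refine Amp.of_bound hab (by positivity) (fun ξ hξ => ?_) ?_ (fun ξ hξ => ?_) ?_
  · have h0 := hpos ξ hξ
    have hs := Real.sqrt_pos.2 h0
    have hss : √ξ ^ 2 = ξ := Real.sq_sqrt h0.le
    have h1 := ((hasDerivAt_id ξ).mul (Real.hasDerivAt_sqrt h0.ne')).inv
      (mul_pos h0 hs).ne'
    have h2 : HasDerivAt (fun ξ : ℝ => 1 / (ξ * √ξ)) (-(3 / 2) / (ξ ^ 2 * √ξ)) ξ := by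
      have e : (fun ξ : ℝ => 1 / (ξ * √ξ)) = (id * Real.sqrt)⁻¹ := by
        ext y; simp
      rw [e]
      refine h1.congr_deriv ?_
      simp only [id, one_mul, Pi.mul_apply]
      field_simp
      rw [hss]; ring
    exact h2.ofReal_comp
  · exact Complex.continuous_ofReal.comp_continuousOn hcont
  · have h0 := hpos ξ hξ
    have hs := Real.sqrt_pos.2 h0
    rw [Complex.norm_real, Real.norm_of_nonneg (by positivity)]
    have := hξ.1
    calc 1 / (ξ * √ξ) ≤ 1 / (a * √a) := by gcongr
      _ ≤ 2 / (a * √a) := by gcongr; norm_num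
  · have i1 : IntervalIntegrable (fun ξ : ℝ => 1 / ξ ^ 2) volume a b := by
      refine ContinuousOn.intervalIntegrable_of_Icc hab
        (ContinuousOn.div (by fun_prop) (by fun_prop) fun ξ hξ => ?_)
      have h0 := hpos ξ hξ
      positivity
    calc _ ≤ ∫ ξ in a..b, 9 / 4 / a ^ 3 * (1 / ξ ^ 2) := by
          refine intervalIntegral.integral_mono_on hab ?_ (i1.const_mul _) fun ξ hξ => ?_
          · exact (((Complex.continuous_ofReal.comp_continuousOn hcont).norm).pow 2
              ).intervalIntegrable_of_Icc hab
          · have h0 := hpos ξ hξ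
            have hs := Real.sqrt_pos.2 h0
            have hss : √ξ ^ 2 = ξ := Real.sq_sqrt h0.le
            rw [Complex.norm_real, Real.norm_eq_abs, sq_abs, div_pow, mul_pow, hss]
            have := hξ.1
            calc (-(3 / 2) : ℝ) ^ 2 / ((ξ ^ 2) ^ 2 * ξ) = 9 / 4 / ξ ^ 3 * (1 / ξ ^ 2) := by
                  field_simp; norm_num
              _ ≤ _ := by gcongr
      _ = 9 / 4 / a ^ 3 * (1 / a - 1 / b) := by
          rw [intervalIntegral.integral_const_mul, integral_inv_sq ha0 hab]
      _ ≤ 9 / 4 / a ^ 3 * 1 := by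
          have : 1 / a ≤ 1 := by rw [div_le_one ha0]; exact ha
          have : 0 ≤ 1 / b := by have := ha0.trans_le hab; positivity
          gcongr
          linarith
      _ ≤ (2 / (a * √a)) ^ 2 := by
          rw [div_pow, mul_pow, Real.sq_sqrt ha0.le, mul_one, ← pow_succ]
          gcongr; norm_num

/-- The amplitude of a resonant interaction. -/
def resAmp (β : ℝ → ℂ) (ξ : ℝ) : ℂ := β ξ * ((1 / (ξ * √ξ) : ℝ) : ℂ)

/-- The contribution of one product of modes to the nonlinear interaction. -/
def resInt (κ n : ℝ) (β : ℝ → ℂ) (a b : ℝ) : ℂ :=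
  ∫ ξ in a..b, (ξ : ℂ) * cis (3 * κ * ξ ^ 2 - 2 * n * ξ ^ 3) * resAmp β ξ

lemma Prof.exists_amp (h : Prof ρ N c w g) (ha : 1 ≤ a) (hab : a ≤ b) (hρ : 1 ≤ 100 * ρ * a) :
    (∃ β', Amp a b (700000000 / (a * √a)) (resAmp fun ξ => alpha N w ξ ^ 3) β') ∧
    (∃ β', Amp a b (700000000 / (a * √a))
      (resAmp fun ξ => alpha N w ξ ^ 2 * starRingEnd ℂ (alpha N w ξ)) β') ∧
    (∃ β', Amp a b (700000000 / (a * √a))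
      (resAmp fun ξ => alpha N w ξ * starRingEnd ℂ (alpha N w ξ) ^ 2) β') ∧
    (∃ β', Amp a b (700000000 / (a * √a)) (resAmp fun ξ => starRingEnd ℂ (alpha N w ξ) ^ 3) β') := by
  have hA := h.amp_alpha ha hab hρ
  have hC := hA.conj
  have hS := amp_inv_mul_sqrt ha hab
  have ha0 : 0 < a := by linarith
  have hsa := Real.sqrt_pos.2 ha0
  have hK : 2 * (2 * (2 * 350 * 350) * 350) * (2 / (a * √a)) ≤ 700000000 / (a * √a) := by
    rw [mul_div_assoc', div_le_div_iff_of_pos_right (by positivity)]; norm_num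
  have fin : ∀ {β₁ β₁' β₂ : ℝ → ℂ}, Amp a b (2 * (2 * 350 * 350) * 350) β₁ β₁' →
      (∀ ξ, β₁ ξ = β₂ ξ) → ∃ β', Amp a b (700000000 / (a * √a)) (resAmp β₂) β' := by
    intro β₁ β₁' β₂ h1 e
    obtain rfl : β₁ = β₂ := funext e
    exact ⟨_, (h1.mul hS).mono le_rfl hab le_rfl hK⟩
  exact ⟨fin ((hA.mul hA).mul hA) fun _ => by ring, fin ((hA.mul hA).mul hC) fun ξ => by ring,
    fin ((hA.mul hC).mul hC) fun ξ => by ring, fin ((hC.mul hC).mul hC) fun ξ => by ring⟩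

lemma Prof.continuousOn_alpha (h : Prof ρ N c w g) (ha : 0 < a) :
    ContinuousOn (alpha N w) (Icc a b) := fun _ hξ =>
  (h.hasDerivAt_alpha (ha.trans_le hξ.1)).continuousAt.continuousWithinAt

/-- Decomposition of the cubic interaction over the oscillatory region into products of modes. -/
lemma Prof.integral_cube_eq (h : Prof ρ N c w g) (ha : 1 ≤ a) (hab : a ≤ b) :
    ∫ x in (-3 * b ^ 2)..(-3 * a ^ 2), osc N w x ^ 3 * cis (-(κ * x)) =
      3 * Complex.I / 4 * (resInt κ 3 (fun ξ => alpha N w ξ ^ 3) a b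
        - 3 * resInt κ 1 (fun ξ => alpha N w ξ ^ 2 * starRingEnd ℂ (alpha N w ξ)) a b
        + 3 * resInt κ (-1) (fun ξ => alpha N w ξ * starRingEnd ℂ (alpha N w ξ) ^ 2) a b
        - resInt κ (-3) (fun ξ => starRingEnd ℂ (alpha N w ξ) ^ 3) a b) := by
  have ha0 : 0 < a := by linarith
  have hc := h.continuous_osc
  have hx : ∀ ξ : ℝ, HasDerivAt (fun ξ : ℝ => -3 * ξ ^ 2) (-(6 * ξ)) ξ := fun ξ => by
    have := (hasDerivAt_pow 2 ξ).const_mul (-3)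
    exact this.congr_deriv (by norm_num; ring)
  have e := intervalIntegral.integral_deriv_smul_comp (a := a) (b := b)
    (f := fun ξ : ℝ => -3 * ξ ^ 2) (f' := fun ξ => -(6 * ξ))
    (g := fun x => osc N w x ^ 3 * cis (-(κ * x)))
    (fun ξ _ => hx ξ) (by fun_prop) ((hc.pow 3).mul (continuous_cis.comp (by fun_prop)))
  simp only [Function.comp, neg_smul, intervalIntegral.integral_neg] at e
  rw [neg_eq_iff_eq_neg, ← intervalIntegral.integral_symm] at e
  rw [← e]
  have hac := h.continuousOn_alpha (b := b) ha0
  have hcc : ContinuousOn (fun ξ => starRingEnd ℂ (alpha N w ξ)) (Icc a b) :=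
    Complex.continuous_conj.comp_continuousOn hac
  have hi : ∀ (n : ℝ) (β : ℝ → ℂ), ContinuousOn β (Icc a b) → IntervalIntegrable (fun ξ : ℝ =>
      (ξ : ℂ) * cis (3 * κ * ξ ^ 2 - 2 * n * ξ ^ 3) * resAmp β ξ) volume a b := by
    intro n β hβ
    refine ContinuousOn.intervalIntegrable_of_Icc hab ?_
    refine ContinuousOn.mul ((by fun_prop : Continuous fun ξ : ℝ => (ξ : ℂ)).continuousOn.mul
      (continuousOn_cis (by fun_prop))) (hβ.mul ?_)
    refine Complex.continuous_ofReal.comp_continuousOn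
      (ContinuousOn.div (by fun_prop) (by fun_prop) fun ξ hξ => ?_)
    have h0 : 0 < ξ := by linarith [hξ.1]
    have := Real.sqrt_pos.2 h0
    positivity
  have i1 := hi 3 (fun ξ => alpha N w ξ ^ 3) (hac.pow 3)
  have i2 := hi 1 (fun ξ => alpha N w ξ ^ 2 * starRingEnd ℂ (alpha N w ξ)) ((hac.pow 2).mul hcc)
  have i3 := hi (-1) (fun ξ => alpha N w ξ * starRingEnd ℂ (alpha N w ξ) ^ 2)
    (hac.mul (hcc.pow 2))
  have i4 := hi (-3) (fun ξ => starRingEnd ℂ (alpha N w ξ) ^ 3) (hcc.pow 3)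
  rw [resInt, resInt, resInt, resInt, ← intervalIntegral.integral_const_mul,
    ← intervalIntegral.integral_const_mul 3, ← intervalIntegral.integral_sub i1 (i2.const_mul _),
    ← intervalIntegral.integral_add (i1.sub (i2.const_mul _)) (i3.const_mul _),
    ← intervalIntegral.integral_sub ((i1.sub (i2.const_mul _)).add (i3.const_mul _)) i4,
    ← intervalIntegral.integral_const_mul]
  refine intervalIntegral.integral_congr fun ξ hξ => ?_
  rw [uIcc_of_le hab] at hξ
  have h0 : 0 < ξ := by linarith [hξ.1]
  have hs := Real.sqrt_pos.2 h0
  have hss : √ξ ^ 2 = ξ := Real.sq_sqrt h0.le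
  have hsc : ((√ξ : ℝ) : ℂ) ≠ 0 := by exact_mod_cast hs.ne'
  have hξc : (ξ : ℂ) = ((√ξ : ℝ) : ℂ) ^ 2 := by rw [← Complex.ofReal_pow, hss]
  have hm : mode N w ξ = (√ξ : ℝ) * cis (-(2 * ξ ^ 3)) * alpha N w ξ := by
    have := cis_mul_neg (2 * ξ ^ 3)
    rw [alpha]
    field_simp
    linear_combination -(mode N w ξ) * this
  have hu := (h.of_mode ξ).2
  rw [hm, map_mul, map_mul, conj_cis, Complex.conj_ofReal, neg_neg] at hu
  have hu2 : osc N w (-3 * ξ ^ 2) = (cis (-(2 * ξ ^ 3)) * alpha N w ξ -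
      cis (2 * ξ ^ 3) * starRingEnd ℂ (alpha N w ξ)) / (2 * Complex.I * (√ξ : ℝ)) := by
    rw [hξc] at hu
    rw [eq_div_iff (by simp [hsc])] at hu ⊢
    have h3 : (√ξ : ℂ) * (osc N w (-3 * ξ ^ 2) * (2 * Complex.I * (√ξ : ℝ))) =
      (√ξ : ℂ) * (cis (-(2 * ξ ^ 3)) * alpha N w ξ -
        cis (2 * ξ ^ 3) * starRingEnd ℂ (alpha N w ξ)) := by linear_combination hu
    exact mul_left_cancel₀ hsc h3
  set A := alpha N w ξ
  set B := starRingEnd ℂ A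
  have c1 : cis (3 * κ * ξ ^ 2 - 2 * 3 * ξ ^ 3) = cis (3 * κ * ξ ^ 2) * cis (-(2 * ξ ^ 3)) ^ 3 := by
    rw [cis_cube, ← cis_add]; congr 1; ring
  have c2 : cis (3 * κ * ξ ^ 2 - 2 * 1 * ξ ^ 3) = cis (3 * κ * ξ ^ 2) * cis (-(2 * ξ ^ 3)) := by
    rw [← cis_add]; congr 1; ring
  have c3 : cis (3 * κ * ξ ^ 2 - 2 * (-1) * ξ ^ 3) = cis (3 * κ * ξ ^ 2) * cis (2 * ξ ^ 3) := by
    rw [← cis_add]; congr 1; ring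
  have c4 : cis (3 * κ * ξ ^ 2 - 2 * (-3) * ξ ^ 3) = cis (3 * κ * ξ ^ 2) * cis (2 * ξ ^ 3) ^ 3 := by
    rw [cis_cube, ← cis_add]; congr 1; ring
  have c5 : cis (-(κ * (-3 * ξ ^ 2))) = cis (3 * κ * ξ ^ 2) := by congr 1; ring
  have c6 := cis_mul_neg (2 * ξ ^ 3)
  simp only [resAmp, c1, c2, c3, c4, c5, hu2]
  rw [Complex.real_smul]
  push_cast
  rw [hξc]
  set E := cis (-(2 * ξ ^ 3))
  set F := cis (2 * ξ ^ 3)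
  set P := cis (3 * κ * ξ ^ 2)
  set s := ((√ξ : ℝ) : ℂ)
  have hd : ((E * A - F * B) / (2 * Complex.I * s)) ^ 3 =
      Complex.I / 8 * ((E * A - F * B) ^ 3 / s ^ 3) := by
    rw [div_pow, mul_pow, mul_pow]
    rw [show Complex.I ^ 3 = -Complex.I by rw [pow_succ, Complex.I_sq]; ring]
    field_simp
    rw [Complex.I_sq]; ring
  rw [hd]
  field_simp
  linear_combination (-(72 * A ^ 2 * B * E * P) + 72 * A * B ^ 2 * F * P) * c6

end MKdVPaper

namespace MKdVPaper

variable {ρ N : ℝ} {c : ℂ} {w g : ℝ → ℂ} {a b K κ n : ℝ} {β β' : ℝ → ℂ}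

/-- The leading part of `alpha`. -/
def alphaLim (w : ℝ → ℂ) (ξ : ℝ) : ℂ :=
  ((2 * √(Real.pi / 3) : ℝ) : ℂ) * (Complex.I * cis (Real.pi / 4)) * w ξ

lemma sqrt_pi_div_three_le : √(Real.pi / 3) ≤ 2 := by
  rw [Real.sqrt_le_left (by norm_num)]
  have := Real.pi_le_four
  linarith

lemma Prof.norm_alphaLim_le (h : Prof ρ N c w g) (ξ : ℝ) : ‖alphaLim w ξ‖ ≤ 18 := by
  rw [alphaLim, norm_mul, norm_mul, norm_mul, norm_cis, Complex.norm_I, Complex.norm_real,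
    Real.norm_of_nonneg (by positivity)]
  have := sqrt_pi_div_three_le
  have hw := h.bdd ξ
  calc _ ≤ (2 : ℝ) * 2 * (1 * 1) * 1 := by gcongr
    _ ≤ 18 := by norm_num

lemma Prof.norm_alpha_sub_alphaLim_le (h : Prof ρ N c w g) {ξ τ : ℝ} (hξ : 2 ≤ ξ) (hτ : 1 ≤ τ)
    (hτξ : τ ^ 4 ≤ 9 * ξ) :
    ‖alpha N w ξ - alphaLim w ξ‖ ≤ 15000 / τ := by
  have hξ0 : 0 < ξ := by linarith
  set σ := (3 * ξ) ^ (1 / 4 : ℝ) with hσ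
  have hσ4 : σ ^ 4 = 3 * ξ := by
    rw [hσ, ← Real.rpow_natCast, ← Real.rpow_mul (by positivity)]; norm_num
  have hσ1 : 1 ≤ σ := Real.one_le_rpow (by linarith) (by norm_num)
  have key := h.norm_alpha_sub_le hξ hσ1 hσ4
  have e : 2 * Complex.I * (√ξ : ℝ) * fresnel (3 * ξ) * w ξ = alphaLim w ξ := by
    rw [fresnel, alphaLim]
    have : √(Real.pi / 3) = √ξ * √(Real.pi / (3 * ξ)) := by
      rw [← Real.sqrt_mul hξ0.le]; congr 1; field_simp
    rw [this]; push_cast; ring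
  rw [e] at key
  refine key.trans ?_
  rw [div_le_div_iff₀ (by linarith) (by linarith)]
  have : τ ≤ 2 * σ := by
    by_contra hh
    push Not at hh
    have : (2 * σ) ^ 4 < τ ^ 4 := pow_lt_pow_left₀ hh (by positivity) (by norm_num)
    rw [mul_pow, hσ4] at this
    linarith
  linarith

lemma norm_cube_sub_le {x y : ℂ} {M : ℝ} (hx : ‖x‖ ≤ M) (hy : ‖y‖ ≤ M) :
    ‖x ^ 3 - y ^ 3‖ ≤ 3 * M ^ 2 * ‖x - y‖ := by
  have e : x ^ 3 - y ^ 3 = (x ^ 2 + x * y + y ^ 2) * (x - y) := by ring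
  have hM : 0 ≤ M := (norm_nonneg x).trans hx
  rw [e, norm_mul]
  gcongr
  calc _ ≤ ‖x ^ 2‖ + ‖x * y‖ + ‖y ^ 2‖ := norm_add₃_le
    _ ≤ M ^ 2 + M * M + M ^ 2 := by
        rw [norm_pow, norm_mul, norm_pow]; gcongr
    _ = _ := by ring

lemma norm_sq_conj_sub_le {x y : ℂ} {M : ℝ} (hx : ‖x‖ ≤ M) (hy : ‖y‖ ≤ M) :
    ‖x ^ 2 * starRingEnd ℂ x - y ^ 2 * starRingEnd ℂ y‖ ≤ 3 * M ^ 2 * ‖x - y‖ := by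
  have e : x ^ 2 * starRingEnd ℂ x - y ^ 2 * starRingEnd ℂ y =
      (x + y) * starRingEnd ℂ x * (x - y) + y ^ 2 * starRingEnd ℂ (x - y) := by
    rw [map_sub]; ring
  have hM : 0 ≤ M := (norm_nonneg x).trans hx
  rw [e]
  refine (norm_add_le _ _).trans ?_
  rw [norm_mul, norm_mul, norm_mul, RCLike.norm_conj, RCLike.norm_conj, norm_pow]
  calc _ ≤ (M + M) * M * ‖x - y‖ + M ^ 2 * ‖x - y‖ := by
        gcongr
        exact (norm_add_le _ _).trans (add_le_add hx hy)
    _ = _ := by ring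

/-- Full contribution of one resonant interaction, with a single stationary point `m`. -/
lemma Amp.norm_resInt_sub_le {m τ : ℝ} (h : Amp a b K β β') (ha : a ≤ m - 1) (hb : m + 1 ≤ b)
    (hm : 2 ≤ m) (hn : 1 ≤ n) (hn3 : n ≤ 3) (hκ : κ = n * m) (hτ : 1 ≤ τ) (hτκ : τ ^ 4 = 3 * κ)
    (hκ6 : 6 ≤ κ) :
    ‖(∫ ξ in a..b, (ξ : ℂ) * cis (3 * κ * ξ ^ 2 - 2 * n * ξ ^ 3) * β ξ) -
      m * β m * cis (n * m ^ 3) * starRingEnd ℂ (fresnel (3 * κ))‖ ≤ 1000 * τ * K := by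
  have hK := h.nonneg
  have hτ0 : 0 < τ := by linarith
  have hc : ContinuousOn (fun ξ : ℝ => (ξ : ℂ) * cis (3 * κ * ξ ^ 2 - 2 * n * ξ ^ 3) * β ξ)
      (Icc a b) :=
    ((by fun_prop : Continuous fun ξ : ℝ => (ξ : ℂ)).continuousOn.mul
      (continuousOn_cis (by fun_prop))).mul h.cont
  have hi : ∀ x y, a ≤ x → x ≤ y → y ≤ b → IntervalIntegrable
      (fun ξ : ℝ => (ξ : ℂ) * cis (3 * κ * ξ ^ 2 - 2 * n * ξ ^ 3) * β ξ) volume x y :=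
    fun x y hx hxy hy => (hc.mono (Icc_subset_Icc hx hy)).intervalIntegrable_of_Icc hxy
  have b1 := (h.mono le_rfl ha (by linarith) le_rfl).norm_nonresonant_le (κ := κ) (n := n)
    (by rw [abs_of_pos (by linarith)]; exact hn) (fun ξ hξ => by
      rw [hκ, ← mul_sub, abs_mul, abs_of_pos (by linarith : 0 < n),
        abs_of_nonneg (by linarith [hξ.2] : 0 ≤ m - ξ)]
      nlinarith [hξ.2])
  have b2 := (h.mono (a' := m + 1) (by linarith) hb le_rfl le_rfl).norm_nonresonant_le (κ := κ)
    (n := n) (by rw [abs_of_pos (by linarith)]; exact hn) (fun ξ hξ => by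
      rw [hκ, ← mul_sub, abs_mul, abs_of_pos (by linarith : 0 < n),
        abs_of_nonpos (by linarith [hξ.1] : m - ξ ≤ 0)]
      nlinarith [hξ.1])
  have b3 := (h.mono ha (b' := m + 1) (by linarith) hb le_rfl).norm_resonant_le hm hn hn3 hκ hτ
    hτκ hκ6
  rw [← intervalIntegral.integral_add_adjacent_intervals (hi a (m - 1) le_rfl ha (by linarith))
      (hi (m - 1) b ha (by linarith) le_rfl),
    ← intervalIntegral.integral_add_adjacent_intervals (hi (m - 1) (m + 1) ha (by linarith) hb)
      (hi (m + 1) b (by linarith) hb le_rfl)]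
  have e : ∀ x y z v : ℂ, x + (y + z) - v = x + (y - v) + z := fun x y z v => by ring
  rw [e]
  have hle : 2800 * m * K / τ ^ 3 ≤ 934 * τ * K := by
    have : m ≤ τ ^ 4 / 3 := by rw [hτκ]; nlinarith
    calc _ ≤ 2800 * (τ ^ 4 / 3) * K / τ ^ 3 := by gcongr
      _ = 2800 / 3 * τ * K := by field_simp
      _ ≤ _ := by gcongr; norm_num
  have : K ≤ τ * K := by nlinarith
  refine norm_add₃_le.trans ?_
  linarith

lemma resAmp_amp_le {τ : ℝ} (hτ : 1 ≤ τ) (hτκ : τ ^ 4 = 3 * κ) :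
    700000000 / (κ / 6 * √(κ / 6)) ≤ 60000000000 / τ ^ 6 := by
  have hκ : κ / 6 = τ ^ 4 / 18 := by linarith
  have e : √(κ / 6) = τ ^ 2 / √18 := by
    rw [hκ, Real.sqrt_div' _ (by norm_num), show τ ^ 4 = (τ ^ 2) ^ 2 by ring,
      Real.sqrt_sq (by positivity)]
  have h18 : √18 ≤ 4.25 := by
    rw [Real.sqrt_le_left (by norm_num)]; norm_num
  have h18' : 0 < √18 := by positivity
  rw [e, hκ]
  have : τ ^ 4 / 18 * (τ ^ 2 / √18) = τ ^ 6 / (18 * √18) := by field_simp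
  rw [this, div_div_eq_mul_div]
  gcongr
  nlinarith

lemma Prof.norm_resInt_one_sub_le {τ : ℝ} (h : Prof ρ N c w g) (hκ : 6 ≤ κ)
    (hρ : 1 ≤ 100 * ρ * (κ / 6)) (hb : κ + 1 ≤ b) (hτ : 1 ≤ τ) (hτκ : τ ^ 4 = 3 * κ) :
    ‖resInt κ 1 (fun ξ => alpha N w ξ ^ 2 * starRingEnd ℂ (alpha N w ξ)) (κ / 6) b -
      8 * Complex.I * (Real.pi ^ 2 / (9 * κ) : ℝ) * cis (κ ^ 3) *
        (w κ ^ 2 * starRingEnd ℂ (w κ))‖ ≤ 70000000000000 / τ ^ 5 := by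
  have hκ0 : 0 < κ := by linarith
  have hτ0 : 0 < τ := by linarith
  obtain ⟨-, ⟨β', hA⟩, -⟩ := h.exists_amp (a := κ / 6) (b := b) (by linarith) (by linarith) hρ
  have k1 := hA.norm_resInt_sub_le (m := κ) (n := 1) (by linarith) hb (by linarith) le_rfl
    (by norm_num) (by ring) hτ hτκ hκ
  have k2 := norm_sq_conj_sub_le (h.norm_alpha_le (ξ := κ) (by linarith)) (h.norm_alphaLim_le κ)
  have k3 := h.norm_alpha_sub_alphaLim_le (ξ := κ) (by linarith) hτ (by linarith)
  have hs := Real.sqrt_pos.2 hκ0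
  have hss : √κ ^ 2 = κ := Real.sq_sqrt hκ0.le
  have hF : starRingEnd ℂ (fresnel (3 * κ)) =
      ((√(Real.pi / 3) / √κ : ℝ) : ℂ) * cis (-(Real.pi / 4)) := by
    rw [fresnel, map_mul, Complex.conj_ofReal, conj_cis, ← Real.sqrt_div' _ hκ0.le, div_div]
  set A := alpha N w κ
  set L := alphaLim w κ with hL
  have e1 : (κ : ℂ) * resAmp (fun ξ => alpha N w ξ ^ 2 * starRingEnd ℂ (alpha N w ξ)) κ *
      cis (1 * κ ^ 3) * starRingEnd ℂ (fresnel (3 * κ)) =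
      ((√(Real.pi / 3) / κ : ℝ) : ℂ) * (cis (κ ^ 3) * cis (-(Real.pi / 4))) *
        (A ^ 2 * starRingEnd ℂ A) := by
    have h1 : κ * (1 / (κ * √κ)) * (√(Real.pi / 3) / √κ) = √(Real.pi / 3) / κ := by
      field_simp
      rw [hss]
    rw [← h1, hF, resAmp, one_mul]
    push_cast
    ring
  have e2 : 8 * Complex.I * (Real.pi ^ 2 / (9 * κ) : ℝ) * cis (κ ^ 3) *
        (w κ ^ 2 * starRingEnd ℂ (w κ)) =
      ((√(Real.pi / 3) / κ : ℝ) : ℂ) * (cis (κ ^ 3) * cis (-(Real.pi / 4))) *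
        (L ^ 2 * starRingEnd ℂ L) := by
    rw [hL, alphaLim]
    simp only [map_mul, Complex.conj_ofReal, conj_cis, Complex.conj_I]
    have hp : Real.pi ^ 2 = 9 * √(Real.pi / 3) ^ 4 := by
      rw [show √(Real.pi / 3) ^ 4 = (√(Real.pi / 3) ^ 2) ^ 2 by ring,
        Real.sq_sqrt (by positivity)]; ring
    rw [hp]
    push_cast
    have hc := cis_mul_neg (Real.pi / 4)
    have hκc : (κ : ℂ) ≠ 0 := by exact_mod_cast hκ0.ne'
    set s := ((√(Real.pi / 3) : ℝ) : ℂ)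
    set E := cis (Real.pi / 4)
    set F := cis (-(Real.pi / 4))
    field_simp
    rw [Complex.I_sq]
    linear_combination (-(8 * s ^ 4 * cis (κ ^ 3) * w κ ^ 2 * starRingEnd ℂ (w κ)) * (E * F + 1)) * hc
  rw [e1] at k1
  rw [e2, resInt]
  have e3 : ∀ x y z : ℂ, x - y = (x - z) + (z - y) := fun x y z => by ring
  rw [e3 _ _ (((√(Real.pi / 3) / κ : ℝ) : ℂ) * (cis (κ ^ 3) * cis (-(Real.pi / 4))) *
        (A ^ 2 * starRingEnd ℂ A)), ← mul_sub]
  refine (norm_add_le _ _).trans ?_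
  rw [norm_mul, norm_mul, norm_mul, norm_cis, norm_cis, Complex.norm_real,
    Real.norm_of_nonneg (by positivity)]
  have k4 : √(Real.pi / 3) / κ ≤ 6 / τ ^ 4 := by
    rw [hτκ, div_le_div_iff₀ hκ0 (by positivity)]
    nlinarith [sqrt_pi_div_three_le]
  have k5 := resAmp_amp_le hτ hτκ
  calc _ ≤ 1000 * τ * (60000000000 / τ ^ 6) + 6 / τ ^ 4 * (1 * 1) * (3 * 18 ^ 2 * (15000 / τ)) := by
        refine add_le_add (k1.trans ?_) ?_
        · gcongr
        · gcongr
          refine k2.trans ?_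
          gcongr
    _ ≤ 70000000000000 / τ ^ 5 := by
        rw [le_div_iff₀ (by positivity)]
        field_simp
        norm_num

lemma Prof.norm_resInt_three_sub_le {τ : ℝ} (h : Prof ρ N c w g) (hκ : 6 ≤ κ)
    (hρ : 1 ≤ 100 * ρ * (κ / 6)) (hb : κ + 1 ≤ b) (hτ : 1 ≤ τ) (hτκ : τ ^ 4 = 3 * κ) :
    ‖resInt κ 3 (fun ξ => alpha N w ξ ^ 3) (κ / 6) b -
      8 * (Real.pi ^ 2 / (3 * √3 * κ) : ℝ) * cis (κ ^ 3 / 9) * w (κ / 3) ^ 3‖ ≤ 70000000000000 / τ ^ 5 := by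
  have hκ0 : 0 < κ := by linarith
  have hτ0 : 0 < τ := by linarith
  obtain ⟨⟨β', hA⟩, -, -⟩ := h.exists_amp (a := κ / 6) (b := b) (by linarith) (by linarith) hρ
  have k1 := hA.norm_resInt_sub_le (m := κ / 3) (n := 3) (by linarith) (by linarith) (by linarith)
    (by norm_num) le_rfl (by ring) hτ hτκ hκ
  have k2 := norm_cube_sub_le (h.norm_alpha_le (ξ := κ / 3) (by linarith))
    (h.norm_alphaLim_le (κ / 3))
  have k3 := h.norm_alpha_sub_alphaLim_le (ξ := κ / 3) (by linarith) hτ (by linarith)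
  have hs := Real.sqrt_pos.2 hκ0
  have hss : √κ ^ 2 = κ := Real.sq_sqrt hκ0.le
  have h3 : √3 ^ 2 = (3 : ℝ) := Real.sq_sqrt (by norm_num)
  have h3' : 0 < √(3 : ℝ) := by positivity
  have hF : starRingEnd ℂ (fresnel (3 * κ)) =
      ((√(Real.pi / 3) / √κ : ℝ) : ℂ) * cis (-(Real.pi / 4)) := by
    rw [fresnel, map_mul, Complex.conj_ofReal, conj_cis, ← Real.sqrt_div' _ hκ0.le, div_div]
  set A := alpha N w (κ / 3) with hAdef
  set L := alphaLim w (κ / 3) with hL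
  have e1 : ((κ / 3 : ℝ) : ℂ) * resAmp (fun ξ => alpha N w ξ ^ 3) (κ / 3) *
      cis (3 * (κ / 3) ^ 3) * starRingEnd ℂ (fresnel (3 * κ)) =
      ((√3 * √(Real.pi / 3) / κ : ℝ) : ℂ) * (cis (κ ^ 3 / 9) * cis (-(Real.pi / 4))) * A ^ 3 := by
    have h1 : κ / 3 * (1 / (κ / 3 * √(κ / 3))) * (√(Real.pi / 3) / √κ) =
        √3 * √(Real.pi / 3) / κ := by
      have : √(κ / 3) = √κ / √3 := Real.sqrt_div' _ (by norm_num)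
      rw [this]
      have h4 : √κ * √κ = κ := by rw [← pow_two]; exact hss
      field_simp
      rw [hss]
    rw [← h1, hF, resAmp, show 3 * (κ / 3) ^ 3 = κ ^ 3 / 9 by ring]
    push_cast
    ring
  have e2 : 8 * (Real.pi ^ 2 / (3 * √3 * κ) : ℝ) * cis (κ ^ 3 / 9) * w (κ / 3) ^ 3 =
      ((√3 * √(Real.pi / 3) / κ : ℝ) : ℂ) * (cis (κ ^ 3 / 9) * cis (-(Real.pi / 4))) * L ^ 3 := by
    rw [hL, alphaLim]
    have hp : Real.pi ^ 2 / (3 * √3 * κ) = √3 * √(Real.pi / 3) ^ 4 / κ := by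
      rw [show √(Real.pi / 3) ^ 4 = (√(Real.pi / 3) ^ 2) ^ 2 by ring,
        Real.sq_sqrt (by positivity)]
      field_simp
      rw [h3]
    rw [hp]
    push_cast
    have hc := cis_mul_neg (Real.pi / 4)
    have hc2 := cis_pi_div_four_sq
    have hκc : (κ : ℂ) ≠ 0 := by exact_mod_cast hκ0.ne'
    set s := ((√(Real.pi / 3) : ℝ) : ℂ)
    set E := cis (Real.pi / 4)
    set F := cis (-(Real.pi / 4))
    have hI : F * (Complex.I * E) ^ 3 = 1 := by
      calc F * (Complex.I * E) ^ 3 = (E * F) * (Complex.I ^ 2 * Complex.I * E ^ 2) := by ring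
        _ = 1 := by rw [hc, hc2, Complex.I_sq]; linear_combination -Complex.I_sq
    rw [mul_pow, mul_pow]
    linear_combination -(8 * (√3 : ℂ) * s ^ 4 / κ * cis (κ ^ 3 / 9) * w (κ / 3) ^ 3) * hI
  rw [e1] at k1
  rw [e2, resInt]
  have e3 : ∀ x y z : ℂ, x - y = (x - z) + (z - y) := fun x y z => by ring
  rw [e3 _ _ (((√3 * √(Real.pi / 3) / κ : ℝ) : ℂ) * (cis (κ ^ 3 / 9) * cis (-(Real.pi / 4))) *
        A ^ 3), ← mul_sub]
  refine (norm_add_le _ _).trans ?_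
  rw [norm_mul, norm_mul, norm_mul, norm_cis, norm_cis, Complex.norm_real,
    Real.norm_of_nonneg (by positivity)]
  have k4 : √3 * √(Real.pi / 3) / κ ≤ 12 / τ ^ 4 := by
    rw [hτκ, div_le_div_iff₀ hκ0 (by positivity)]
    have : √(3 : ℝ) ≤ 2 := by rw [Real.sqrt_le_left (by norm_num)]; norm_num
    have : √3 * √(Real.pi / 3) ≤ 2 * 2 := by
      gcongr
      exact sqrt_pi_div_three_le
    nlinarith
  have k5 := resAmp_amp_le hτ hτκ
  calc _ ≤ 1000 * τ * (60000000000 / τ ^ 6) + 12 / τ ^ 4 * (1 * 1) * (3 * 18 ^ 2 * (15000 / τ)) := by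
        refine add_le_add (k1.trans ?_) ?_
        · gcongr
        · gcongr
          refine k2.trans ?_
          gcongr
    _ ≤ 70000000000000 / τ ^ 5 := by
        rw [le_div_iff₀ (by positivity)]
        field_simp
        norm_num

end MKdVPaper

namespace MKdVPaper

variable {ρ N : ℝ} {c : ℂ} {w g : ℝ → ℂ} {a b K κ n : ℝ}

/-- The resonant part of the Fourier transform of `u³` at frequency `κ`. -/
def mainTerm (w : ℝ → ℂ) (κ : ℝ) : ℂ :=
  ((2 * Real.pi ^ 2 / κ : ℝ) : ℂ) * (cis (κ ^ 3) * (w κ ^ 2 * starRingEnd ℂ (w κ)) +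
    Complex.I / (√3 : ℝ) * cis (κ ^ 3 / 9) * w (κ / 3) ^ 3)

lemma norm_resonant_sum_le (x y z v : ℂ) :
    ‖3 * Complex.I / 4 * (x - 3 * y + 3 * z - v)‖ ≤ ‖x‖ + 3 * ‖y‖ + 3 * ‖z‖ + ‖v‖ := by
  rw [norm_mul, norm_div, norm_mul, Complex.norm_I]
  simp only [Complex.norm_ofNat, mul_one]
  have h1 := norm_sub_le (x - 3 * y + 3 * z) v
  have h2 := norm_add_le (x - 3 * y) (3 * z)
  have h3 := norm_sub_le x (3 * y)
  rw [norm_mul, Complex.norm_ofNat] at h2 h3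
  nlinarith [norm_nonneg (x - 3 * y + 3 * z - v)]

lemma Prof.norm_oscillatory_sub_le {τ : ℝ} (h : Prof ρ N c w g) (hκ : 6 ≤ κ)
    (hρ : 1 ≤ 100 * ρ * (κ / 6)) (hb : κ + 1 ≤ b) (hτ : 1 ≤ τ) (hτκ : τ ^ 4 = 3 * κ) :
    ‖(∫ x in (-3 * b ^ 2)..(-3 * (κ / 6) ^ 2), osc N w x ^ 3 * cis (-(κ * x))) - mainTerm w κ‖ ≤
      300000000000000 / τ ^ 5 := by
  have hκ0 : 0 < κ := by linarith
  have hτ0 : 0 < τ := by linarith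
  obtain ⟨-, -, ⟨β₁, h1⟩, ⟨β₂, h2⟩⟩ :=
    h.exists_amp (a := κ / 6) (b := b) (by linarith) (by linarith) hρ
  have k1 := h1.norm_nonresonant_le (κ := κ) (n := -1) (by norm_num) (fun ξ hξ => by
    rw [abs_of_nonneg] <;> linarith [hξ.1])
  have k2 := h2.norm_nonresonant_le (κ := κ) (n := -3) (by norm_num) (fun ξ hξ => by
    rw [abs_of_nonneg] <;> linarith [hξ.1])
  have k3 := h.norm_resInt_one_sub_le hκ hρ hb hτ hτκ
  have k4 := h.norm_resInt_three_sub_le hκ hρ hb hτ hτκ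
  rw [h.integral_cube_eq (by linarith) (by linarith)]
  have e : mainTerm w κ = 3 * Complex.I / 4 *
      (8 * (Real.pi ^ 2 / (3 * √3 * κ) : ℝ) * cis (κ ^ 3 / 9) * w (κ / 3) ^ 3
      - 3 * (8 * Complex.I * (Real.pi ^ 2 / (9 * κ) : ℝ) * cis (κ ^ 3) *
        (w κ ^ 2 * starRingEnd ℂ (w κ)))) := by
    have hκc : (κ : ℂ) ≠ 0 := by exact_mod_cast hκ0.ne'
    have h3c : ((√3 : ℝ) : ℂ) ≠ 0 := by
      have : (0 : ℝ) < √3 := by positivity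
      exact_mod_cast this.ne'
    rw [mainTerm]
    push_cast
    field_simp
    linear_combination (72 * cis (κ ^ 3) * w κ ^ 2 * starRingEnd ℂ (w κ) * (√3 : ℝ)) *
      Complex.I_sq
  have k5 := resAmp_amp_le hτ hτκ
  have k6 : (60000000000 : ℝ) / τ ^ 6 ≤ 60000000000 / τ ^ 5 := by
    gcongr
    norm_num
  rw [e, ← mul_sub]
  have e2 : ∀ x y z v p q : ℂ, x - 3 * y + 3 * z - v - (p - 3 * q) =
    (x - p) - 3 * (y - q) + 3 * z - v := fun x y z v p q => by ring
  rw [e2]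
  refine (norm_resonant_sum_le _ _ _ _).trans ?_
  rw [← resInt] at k1 k2
  calc _ ≤ 70000000000000 / τ ^ 5 + 3 * (70000000000000 / τ ^ 5) + 3 * (60000000000 / τ ^ 5) + 60000000000 / τ ^ 5 := by
        gcongr
        · exact k1.trans (k5.trans k6)
        · exact k2.trans (k5.trans k6)
    _ = 280240000000000 / τ ^ 5 := by ring
    _ ≤ _ := by gcongr; norm_num

lemma Prof.norm_oscillatory_le (h : Prof ρ N c w g) (hκ : 0 < κ) (hκ6 : κ ≤ 6)
    (hρ : 1 ≤ 100 * ρ * 12) (hb : 12 ≤ b) :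
    ‖∫ x in (-3 * b ^ 2)..(-3 * 12 ^ 2), osc N w x ^ 3 * cis (-(κ * x))‖ ≤ 6000000000 := by
  obtain ⟨⟨β₁, h1⟩, ⟨β₂, h2⟩, ⟨β₃, h3⟩, ⟨β₄, h4⟩⟩ :=
    h.exists_amp (a := 12) (b := b) (by norm_num) hb hρ
  have k1 := h1.norm_nonresonant_le (κ := κ) (n := 3) (by norm_num) (fun ξ hξ => by
    rw [abs_of_nonpos] <;> linarith [hξ.1])
  have k2 := h2.norm_nonresonant_le (κ := κ) (n := 1) (by norm_num) (fun ξ hξ => by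
    rw [abs_of_nonpos] <;> linarith [hξ.1])
  have k3 := h3.norm_nonresonant_le (κ := κ) (n := -1) (by norm_num) (fun ξ hξ => by
    rw [abs_of_nonneg] <;> linarith [hξ.1])
  have k4 := h4.norm_nonresonant_le (κ := κ) (n := -3) (by norm_num) (fun ξ hξ => by
    rw [abs_of_nonneg] <;> linarith [hξ.1])
  rw [← resInt] at k1 k2 k3 k4
  have hK : (700000000 : ℝ) / (12 * √12) ≤ 700000000 / (12 * 1) := by
    gcongr
    rw [Real.one_le_sqrt]; norm_num
  rw [h.integral_cube_eq (by norm_num) hb]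
  refine (norm_resonant_sum_le _ _ _ _).trans ?_
  norm_num at hK
  linarith

end MKdVPaper

namespace MKdVPaper

variable {ρ N : ℝ} {c : ℂ} {w g : ℝ → ℂ} {κ : ℝ}

/-- The weight `(1 + |x|)^{1/4}`. -/
def br (x : ℝ) : ℝ := √√(1 + |x|)

lemma br_pow_four (x : ℝ) : br x ^ 4 = 1 + |x| := by
  have h : (0 : ℝ) ≤ 1 + |x| := by positivity
  rw [br, show √√(1 + |x|) ^ 4 = (√√(1 + |x|) ^ 2) ^ 2 by ring,
    Real.sq_sqrt (Real.sqrt_nonneg _), Real.sq_sqrt h]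

lemma one_le_br (x : ℝ) : 1 ≤ br x := by
  rw [br, Real.one_le_sqrt, Real.one_le_sqrt]
  linarith [abs_nonneg x]

lemma br_pos (x : ℝ) : 0 < br x := zero_lt_one.trans_le (one_le_br x)

lemma continuous_br : Continuous br := by unfold br; fun_prop

lemma integrable_inv_br : Integrable fun x => 1 / br x ^ 5 := by
  have h := integrable_one_add_norm (E := ℝ) (μ := volume) (r := 5 / 4) (by simp; norm_num)
  refine h.congr (Eventually.of_forall fun x => ?_)
  have e : 1 + ‖x‖ = br x ^ (4 : ℝ) := by
    rw [Real.norm_eq_abs, ← br_pow_four]; norm_cast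
  simp only
  rw [e, ← Real.rpow_mul (br_pos x).le, one_div, ← Real.rpow_natCast, ← Real.rpow_neg (br_pos x).le]
  norm_num

/-- The integral of `(1 + |x|)^{-5/4}`. -/
def brInt : ℝ := ∫ x, 1 / br x ^ 5

lemma brInt_nonneg : 0 ≤ brInt :=
  integral_nonneg fun x => by have := br_pos x; positivity

/-- The quadratic `(κ² + 3x)(3κ² + x)` resolving the resonance function. -/
def resQ (κ x : ℝ) : ℝ := (κ ^ 2 + 3 * x) * (3 * κ ^ 2 + x)

/-- Numerator of the primitive of `u³ e^{-iκx}`. -/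
def cubicForm (κ : ℝ) (u v : ℂ) (x : ℝ) : ℂ :=
  Complex.I * κ * (7 * x + 3 * κ ^ 2) * u ^ 3 + 9 * (x + κ ^ 2) * u ^ 2 * v
    - 18 * Complex.I * κ * u * v ^ 2 - 18 * v ^ 3

/-- Approximate primitive of `u³ e^{-iκx}` for `u'' = x u / 3`. -/
def cubicPrim (N : ℝ) (w : ℝ → ℂ) (κ x : ℝ) : ℂ :=
  cis (-(κ * x)) * ((resQ κ x)⁻¹ : ℝ) *
    cubicForm κ (osc N w x) (osc N (fun k => Complex.I * k * w k) x) x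

/-- Remainder of the derivative of `cubicPrim`. -/
def cubicErr (ρ N : ℝ) (c : ℂ) (w g : ℝ → ℂ) (κ x : ℝ) : ℂ :=
  (-(10 * κ ^ 2 + 6 * x) / resQ κ x ^ 2 : ℝ) *
      cubicForm κ (osc N w x) (osc N (fun k => Complex.I * k * w k) x) x +
    ((resQ κ x)⁻¹ : ℝ) * (7 * Complex.I * κ * osc N w x ^ 3 +
      9 * osc N w x ^ 2 * osc N (fun k => Complex.I * k * w k) x) -
    ((resQ κ x)⁻¹ : ℝ) * forcing ρ N c g x * (3 * (x + κ ^ 2) * osc N w x ^ 2 -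
      12 * Complex.I * κ * osc N w x * osc N (fun k => Complex.I * k * w k) x -
      18 * osc N (fun k => Complex.I * k * w k) x ^ 2)

lemma Prof.hasDerivAt_cubicPrim (h : Prof ρ N c w g) {x : ℝ} (hQ : resQ κ x ≠ 0) :
    HasDerivAt (cubicPrim N w κ)
      (osc N w x ^ 3 * cis (-(κ * x)) + cis (-(κ * x)) * cubicErr ρ N c w g κ x) x := by
  have hu := hasDerivAt_osc (N := N) h.cont x
  have hv := h.hasDerivAt_osc_deriv x
  have hx : HasDerivAt (fun y : ℝ => (y : ℂ)) 1 x := (hasDerivAt_id x).ofReal_comp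
  have hcis : HasDerivAt (fun y => cis (-(κ * y))) (Complex.I * ((-κ : ℝ) : ℂ) * cis (-(κ * x))) x :=
    hasDerivAt_cis (((hasDerivAt_id x).const_mul κ).neg.congr_deriv (by ring))
  have hr : HasDerivAt (fun y => (((resQ κ y)⁻¹ : ℝ) : ℂ))
      ((-(10 * κ ^ 2 + 6 * x) / resQ κ x ^ 2 : ℝ) : ℂ) x := by
    refine HasDerivAt.ofReal_comp ?_
    have : HasDerivAt (resQ κ) (10 * κ ^ 2 + 6 * x) x := by
      have h1 := ((hasDerivAt_id x).const_mul 3).const_add (κ ^ 2)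
      have h2 := (hasDerivAt_id x).const_add (3 * κ ^ 2)
      refine (h1.mul h2).congr_deriv ?_
      simp; ring
    exact this.inv hQ
  have hQc : ((resQ κ x : ℝ) : ℂ) ≠ 0 := by exact_mod_cast hQ
  set u := osc N w with hu_def
  set v := osc N (fun k => Complex.I * k * w k) with hv_def
  have hS : HasDerivAt (fun y => cubicForm κ (u y) (v y) y)
      (7 * Complex.I * κ * u x ^ 3 + Complex.I * κ * (7 * x + 3 * κ ^ 2) * (3 * u x ^ 2 * v x) +
        (9 * u x ^ 2 * v x + 9 * (x + κ ^ 2) * (2 * u x * v x * v x +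
          u x ^ 2 * ((x * u x - forcing ρ N c g x) / 3)))
        - 18 * Complex.I * κ * (v x * v x ^ 2 + u x * (2 * v x * ((x * u x - forcing ρ N c g x) / 3)))
        - 18 * (3 * v x ^ 2 * ((x * u x - forcing ρ N c g x) / 3))) x := by
    have h1 := (((hx.const_mul 7).add_const (3 * (κ : ℂ) ^ 2)).const_mul (Complex.I * κ)).mul
      (hu.fun_pow 3)
    have h2 := (((hx.add_const ((κ : ℂ) ^ 2)).const_mul 9).mul (hu.fun_pow 2)).mul hv
    have h3 := (hu.const_mul (18 * Complex.I * κ)).mul (hv.fun_pow 2)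
    have h4 := (hv.fun_pow 3).const_mul 18
    refine (((h1.add h2).sub h3).sub h4).congr_deriv ?_
    simp only [Pi.mul_apply]
    push_cast
    ring
  refine ((hcis.mul hr).mul hS).congr_deriv ?_
  simp only [cubicErr, ← hu_def, ← hv_def, cubicForm, Pi.mul_apply]
  have hQe : ((resQ κ x : ℝ) : ℂ) = (κ ^ 2 + 3 * x) * (3 * κ ^ 2 + x) := by
    rw [resQ]; push_cast; ring
  push_cast
  field_simp
  rw [hQe]
  ring_nf
  simp only [Complex.I_sq]
  ring

end MKdVPaper

namespace MKdVPaper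

variable {ρ N : ℝ} {c : ℂ} {w g : ℝ → ℂ} {κ : ℝ}

lemma le_resQ {x : ℝ} (hx : -κ ^ 2 / 12 ≤ x) : (κ ^ 2 + |x|) ^ 2 / 2 ≤ resQ κ x := by
  have hκ := sq_nonneg κ
  have h1 : 9 / 13 * (κ ^ 2 + |x|) ≤ κ ^ 2 + 3 * x := by
    rcases abs_cases x with ⟨h, h'⟩ | ⟨h, h'⟩ <;> rw [h] <;> linarith
  have h2 : κ ^ 2 + |x| ≤ 3 * κ ^ 2 + x := by
    rcases abs_cases x with ⟨h, h'⟩ | ⟨h, h'⟩ <;> rw [h] <;> linarith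
  have h0 : 0 ≤ κ ^ 2 + |x| := by positivity
  rw [resQ]
  nlinarith [mul_le_mul h1 h2 h0 (by linarith)]

lemma norm_cubicForm_le {u v : ℂ} {x d Y : ℝ} (hκ : 0 ≤ κ) (hd : d ^ 2 = κ ^ 2 + |x|)
    (hκd : κ ≤ d) (hY : 1 ≤ Y) (hYd : Y ^ 2 ≤ d) (hu : ‖u‖ ≤ 40 / Y) (hv : ‖v‖ ≤ 40 * Y) :
    ‖cubicForm κ u v x‖ ≤ 3400000 * d ^ 3 / Y ^ 3 := by
  have hY0 : 0 < Y := by linarith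
  have hd0 : 0 ≤ d := hκ.trans hκd
  have hx : ‖((7 * x + 3 * κ ^ 2 : ℝ) : ℂ)‖ ≤ 7 * d ^ 2 := by
    rw [Complex.norm_real, Real.norm_eq_abs, abs_le]
    constructor <;> nlinarith [neg_abs_le x, le_abs_self x, sq_nonneg κ]
  have hx2 : ‖((x + κ ^ 2 : ℝ) : ℂ)‖ ≤ d ^ 2 := by
    rw [Complex.norm_real, Real.norm_eq_abs, abs_le]
    constructor <;> nlinarith [neg_abs_le x, le_abs_self x, sq_nonneg κ]
  have hκn : ‖(κ : ℂ)‖ ≤ d := by rwa [Complex.norm_real, Real.norm_of_nonneg hκ]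
  have e : cubicForm κ u v x = Complex.I * κ * ((7 * x + 3 * κ ^ 2 : ℝ) : ℂ) * u ^ 3 +
      9 * ((x + κ ^ 2 : ℝ) : ℂ) * u ^ 2 * v - 18 * Complex.I * κ * u * v ^ 2 - 18 * v ^ 3 := by
    rw [cubicForm]; push_cast; ring
  rw [e]
  calc _ ≤ ‖(κ : ℂ)‖ * ‖((7 * x + 3 * κ ^ 2 : ℝ) : ℂ)‖ * ‖u‖ ^ 3 +
        9 * ‖((x + κ ^ 2 : ℝ) : ℂ)‖ * ‖u‖ ^ 2 * ‖v‖ + 18 * ‖(κ : ℂ)‖ * ‖u‖ * ‖v‖ ^ 2 +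
        18 * ‖v‖ ^ 3 := by
        refine (norm_sub_le _ _).trans (add_le_add ((norm_sub_le _ _).trans
          (add_le_add ((norm_add_le _ _).trans (add_le_add ?_ ?_)) ?_)) ?_) <;>
        simp [norm_pow]
    _ ≤ d * (7 * d ^ 2) * (40 / Y) ^ 3 + 9 * d ^ 2 * (40 / Y) ^ 2 * (40 * Y) +
        18 * d * (40 / Y) * (40 * Y) ^ 2 + 18 * (40 * Y) ^ 3 := by gcongr
    _ = 64000 * (7 * d ^ 3 + 9 * (d ^ 2 * Y ^ 2) + 18 * (d * (Y ^ 2) ^ 2) + 18 * (Y ^ 2) ^ 3) /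
        Y ^ 3 := by field_simp; ring
    _ ≤ 64000 * (7 * d ^ 3 + 9 * (d ^ 2 * d) + 18 * (d * d ^ 2) + 18 * d ^ 3) / Y ^ 3 := by gcongr
    _ ≤ _ := div_le_div_of_nonneg_right (by nlinarith [pow_nonneg hd0 3]) (by positivity)

lemma norm_cubicForm_remainder_le {u v : ℂ} {d Y : ℝ} (hκ : 0 ≤ κ)
    (hκd : κ ≤ d) (hY : 1 ≤ Y) (hYd : Y ^ 2 ≤ d) (hu : ‖u‖ ≤ 40 / Y) (hv : ‖v‖ ≤ 40 * Y) :
    ‖7 * Complex.I * κ * u ^ 3 + 9 * u ^ 2 * v‖ ≤ 1100000 * d / Y ^ 3 := by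
  have hY0 : 0 < Y := by linarith
  have hd0 : 0 ≤ d := hκ.trans hκd
  have hκn : ‖(κ : ℂ)‖ ≤ d := by rwa [Complex.norm_real, Real.norm_of_nonneg hκ]
  calc _ ≤ 7 * ‖(κ : ℂ)‖ * ‖u‖ ^ 3 + 9 * ‖u‖ ^ 2 * ‖v‖ := by
        refine (norm_add_le _ _).trans (add_le_add ?_ ?_) <;> simp [norm_pow]
    _ ≤ 7 * d * (40 / Y) ^ 3 + 9 * (40 / Y) ^ 2 * (40 * Y) := by gcongr
    _ = 64000 * (7 * d + 9 * Y ^ 2) / Y ^ 3 := by field_simp; ring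
    _ ≤ 64000 * (7 * d + 9 * d) / Y ^ 3 := by gcongr
    _ ≤ _ := div_le_div_of_nonneg_right (by nlinarith) (by positivity)

lemma norm_forcingCoeff_le {u v : ℂ} {x d Y : ℝ} (hκ : 0 ≤ κ) (hd : d ^ 2 = κ ^ 2 + |x|)
    (hκd : κ ≤ d) (hY : 1 ≤ Y) (hYd : Y ^ 2 ≤ d) (hu : ‖u‖ ≤ 40 / Y) (hv : ‖v‖ ≤ 40 * Y) :
    ‖3 * (x + κ ^ 2) * u ^ 2 - 12 * Complex.I * κ * u * v - 18 * v ^ 2‖ ≤ 53000 * d ^ 2 / Y ^ 2 := by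
  have hY0 : 0 < Y := by linarith
  have hd0 : 0 ≤ d := hκ.trans hκd
  have hx2 : ‖((x + κ ^ 2 : ℝ) : ℂ)‖ ≤ d ^ 2 := by
    rw [Complex.norm_real, Real.norm_eq_abs, abs_le]
    constructor <;> nlinarith [neg_abs_le x, le_abs_self x, sq_nonneg κ]
  have hκn : ‖(κ : ℂ)‖ ≤ d := by rwa [Complex.norm_real, Real.norm_of_nonneg hκ]
  rw [show (x : ℂ) + κ ^ 2 = ((x + κ ^ 2 : ℝ) : ℂ) by push_cast; ring]
  calc _ ≤ 3 * ‖((x + κ ^ 2 : ℝ) : ℂ)‖ * ‖u‖ ^ 2 + 12 * ‖(κ : ℂ)‖ * ‖u‖ * ‖v‖ + 18 * ‖v‖ ^ 2 := by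
        refine (norm_sub_le _ _).trans (add_le_add ((norm_sub_le _ _).trans
          (add_le_add ?_ ?_)) ?_) <;> simp only [norm_mul, norm_pow, Complex.norm_I, mul_one,
            Complex.norm_ofNat, le_refl]
    _ ≤ 3 * d ^ 2 * (40 / Y) ^ 2 + 12 * d * (40 / Y) * (40 * Y) + 18 * (40 * Y) ^ 2 := by gcongr
    _ = 1600 * (3 * d ^ 2 + 12 * (d * Y ^ 2) + 18 * (Y ^ 2) ^ 2) / Y ^ 2 := by field_simp; ring
    _ ≤ 1600 * (3 * d ^ 2 + 12 * (d * d) + 18 * d ^ 2) / Y ^ 2 := by gcongr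
    _ ≤ _ := div_le_div_of_nonneg_right (by nlinarith) (by positivity)

/-- The size parameters at `x` to the right of the resonances. -/
lemma exists_scale {x : ℝ} (hκ : 1 ≤ κ) :
    ∃ d, d ^ 2 = κ ^ 2 + |x| ∧ κ ≤ d ∧ br x ^ 2 ≤ d := by
  have h0 : 0 ≤ κ ^ 2 + |x| := by positivity
  refine ⟨√(κ ^ 2 + |x|), Real.sq_sqrt h0, Real.le_sqrt_of_sq_le (by linarith [abs_nonneg x]),
    Real.le_sqrt_of_sq_le ?_⟩
  rw [← pow_mul, br_pow_four]
  nlinarith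

lemma norm_resQ_inv_le {x d : ℝ} (hx : -κ ^ 2 / 12 ≤ x) (hd0 : 0 < d)
    (hd : d ^ 2 = κ ^ 2 + |x|) : ‖(((resQ κ x)⁻¹ : ℝ) : ℂ)‖ ≤ 2 / d ^ 4 := by
  have h := le_resQ hx
  rw [← hd, ← pow_mul] at h
  have h0 : 0 < d ^ 4 / 2 := by positivity
  rw [Complex.norm_real, Real.norm_of_nonneg (inv_nonneg.2 (h0.le.trans h)),
    show 2 / d ^ 4 = (d ^ 4 / 2)⁻¹ by rw [inv_div]]
  exact inv_anti₀ h0 h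

lemma Prof.norm_cubicPrim_le (h : Prof ρ N c w g) {x d : ℝ} (hκ : 1 ≤ κ) (hx : -κ ^ 2 / 12 ≤ x)
    (hd : d ^ 2 = κ ^ 2 + |x|) (hκd : κ ≤ d) (hbd : br x ^ 2 ≤ d) :
    ‖cubicPrim N w κ x‖ ≤ 6800000 / (d * br x ^ 3) := by
  have hd0 : 0 < d := by linarith
  have hY := one_le_br x
  have hY0 := br_pos x
  obtain ⟨hu, hv⟩ := h.pointwise hY0 (br_pow_four x)
  rw [cubicPrim, norm_mul, norm_mul, norm_cis, one_mul]
  calc _ ≤ 2 / d ^ 4 * (3400000 * d ^ 3 / br x ^ 3) :=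
        mul_le_mul (norm_resQ_inv_le hx hd0 hd)
          (norm_cubicForm_le (by linarith) hd hκd hY hbd hu hv) (norm_nonneg _) (by positivity)
    _ = _ := by field_simp; norm_num

lemma Prof.norm_cubicErr_le (h : Prof ρ N c w g) {x d : ℝ} (hκ : 1 ≤ κ) (hx : -κ ^ 2 / 12 ≤ x)
    (hd : d ^ 2 = κ ^ 2 + |x|) (hκd : κ ≤ d) (hbd : br x ^ 2 ≤ d) :
    ‖cubicErr ρ N c w g κ x‖ ≤ 140000000 / (d ^ 3 * br x ^ 3) +
      110000 / (d ^ 2 * br x ^ 2) * ‖forcing ρ N c g x‖ := by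
  have hd0 : 0 < d := by linarith
  have hY := one_le_br x
  have hY0 := br_pos x
  obtain ⟨hu, hv⟩ := h.pointwise hY0 (br_pow_four x)
  have hr := norm_resQ_inv_le hx hd0 hd
  have hr' : ‖((-(10 * κ ^ 2 + 6 * x) / resQ κ x ^ 2 : ℝ) : ℂ)‖ ≤ 40 / d ^ 6 := by
    have hq : ‖((-(10 * κ ^ 2 + 6 * x) : ℝ) : ℂ)‖ ≤ 10 * d ^ 2 := by
      rw [Complex.norm_real, Real.norm_eq_abs, abs_le]
      constructor <;> nlinarith [neg_abs_le x, le_abs_self x, sq_nonneg κ]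
    rw [div_eq_mul_inv, ← inv_pow, Complex.ofReal_mul, Complex.ofReal_pow, norm_mul, norm_pow]
    calc _ ≤ 10 * d ^ 2 * (2 / d ^ 4) ^ 2 := by gcongr
      _ = _ := by field_simp; norm_num
  rw [cubicErr]
  refine (norm_sub_le _ _).trans (add_le_add ((norm_add_le _ _).trans ?_) ?_)
  · rw [norm_mul, norm_mul]
    calc _ ≤ 40 / d ^ 6 * (3400000 * d ^ 3 / br x ^ 3) + 2 / d ^ 4 * (1100000 * d / br x ^ 3) :=
          add_le_add
            (mul_le_mul hr' (norm_cubicForm_le (by linarith) hd hκd hY hbd hu hv) (norm_nonneg _)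
              (by positivity))
            (mul_le_mul hr (norm_cubicForm_remainder_le (by linarith) hκd hY hbd hu hv)
              (norm_nonneg _) (by positivity))
      _ = 138200000 / (d ^ 3 * br x ^ 3) := by field_simp; norm_num
      _ ≤ _ := by gcongr; norm_num
  · rw [norm_mul, norm_mul, mul_right_comm]
    refine mul_le_mul_of_nonneg_right ?_ (norm_nonneg _)
    calc _ ≤ 2 / d ^ 4 * (53000 * d ^ 2 / br x ^ 2) :=
          mul_le_mul hr (norm_forcingCoeff_le (by linarith) hd hκd hY hbd hu hv) (norm_nonneg _)
            (by positivity)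
      _ = 106000 / (d ^ 2 * br x ^ 2) := by field_simp; norm_num
      _ ≤ _ := by gcongr; norm_num

end MKdVPaper

namespace MKdVPaper

variable {ρ N : ℝ} {c : ℂ} {w g : ℝ → ℂ} {κ τ : ℝ}

lemma Prof.norm_jump_le_div (h : Prof ρ N c w g) (hκ : 6 ≤ κ) (hρ : 1 ≤ 100 * ρ * (κ / 6))
    (hτ : 1 ≤ τ) (hτκ : τ ^ 4 = 3 * κ) (x : ℝ) :
    ‖osc N (jumpDeriv ρ c) x‖ ≤ 17 * τ ^ 3 / br x ^ 3 := by
  obtain ⟨h1, h2⟩ := h.norm_osc_jump_le x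
  set J := ‖osc N (jumpDeriv ρ c) x‖
  have hJ : 0 ≤ J := norm_nonneg _
  have hY := br_pos x
  have hρ0 := h.ρ_pos
  have h3 : J * br x ^ 4 ≤ 17 * τ ^ 4 := by
    rw [br_pow_four, hτκ]
    have : J * |x| * 1 ≤ J * |x| * (100 * ρ * (κ / 6)) := by gcongr
    nlinarith [mul_le_mul_of_nonneg_right h2 (by linarith : 0 ≤ κ)]
  rw [le_div_iff₀ (by positivity)]
  rcases le_total (br x) τ with hle | hle
  · calc J * br x ^ 3 ≤ 2 * τ ^ 3 := by gcongr
      _ ≤ _ := by nlinarith [pow_pos (by linarith : 0 < τ) 3]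
  · have : J * br x ^ 3 * τ ≤ 17 * τ ^ 3 * τ := by
      calc J * br x ^ 3 * τ ≤ J * br x ^ 3 * br x := by gcongr
        _ = J * br x ^ 4 := by ring
        _ ≤ _ := by linarith
    exact le_of_mul_le_mul_right this (by linarith)

lemma Prof.norm_cubicErr_le_div (h : Prof ρ N c w g) (hκ : 6 ≤ κ) (hρ : 1 ≤ 100 * ρ * (κ / 6))
    (hτ : 1 ≤ τ) (hτκ : τ ^ 4 = 3 * κ) {x : ℝ} (hx : -κ ^ 2 / 12 ≤ x) :
    ‖cubicErr ρ N c w g κ x‖ ≤ 1300000000 / τ ^ 5 * (1 / br x ^ 5 + ‖osc N g x‖ ^ 2) := by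
  obtain ⟨d, hd, hκd, hbd⟩ := exists_scale (x := x) (κ := κ) (by linarith)
  have hY := br_pos x
  have hY1 := one_le_br x
  have hd0 : 0 < d := by linarith
  have hτ0 : 0 < τ := by linarith
  have hdτ : τ ^ 4 / 3 ≤ d := by rw [hτκ]; linarith
  have hdY : br x ≤ d := by nlinarith
  have hf : ‖forcing ρ N c g x‖ ≤ ‖osc N g x‖ + 17 * τ ^ 3 / br x ^ 3 := by
    rw [forcing, norm_mul, Complex.norm_I, one_mul]
    exact (norm_add_le _ _).trans (add_le_add le_rfl (h.norm_jump_le_div hκ hρ hτ hτκ x))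
  have hd2 : τ ^ 8 / 9 ≤ d ^ 2 := by
    calc τ ^ 8 / 9 = (τ ^ 4 / 3) ^ 2 := by ring
      _ ≤ _ := by gcongr
  have b1 : 1 / (d ^ 3 * br x ^ 3) ≤ 9 / (τ ^ 5 * br x ^ 5) := by
    rw [div_le_div_iff₀ (by positivity) (by positivity)]
    calc 1 * (τ ^ 5 * br x ^ 5) ≤ τ ^ 8 * (br x ^ 2 * br x ^ 3) := by
          rw [one_mul, ← pow_add]; gcongr; norm_num
      _ = 9 * ((τ ^ 8 / 9) * (br x ^ 2 * br x ^ 3)) := by ring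
      _ ≤ 9 * (d ^ 2 * (d * br x ^ 3)) := by gcongr
      _ = _ := by ring
  have b2 : 1 / (d ^ 2 * br x ^ 2) * (17 * τ ^ 3 / br x ^ 3) ≤ 153 / (τ ^ 5 * br x ^ 5) := by
    calc _ ≤ 1 / ((τ ^ 8 / 9) * br x ^ 2) * (17 * τ ^ 3 / br x ^ 3) := by gcongr
      _ = _ := by field_simp; norm_num
  have b3 : 1 / (d ^ 2 * br x ^ 2) * ‖osc N g x‖ ≤
      27 / (τ ^ 5 * br x ^ 5) + ‖osc N g x‖ ^ 2 / τ ^ 5 := by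
    set m := 1 / (d ^ 2 * br x ^ 2) with hm
    set G := ‖osc N g x‖
    have h5 : m * G ≤ τ ^ 5 * m ^ 2 + G ^ 2 / τ ^ 5 := by
      have hp : 0 < τ ^ 5 := by positivity
      have : 0 ≤ (τ ^ 5 * m - G) ^ 2 / τ ^ 5 + (τ ^ 5 * m ^ 2 + G ^ 2 / τ ^ 5) := by positivity
      have e : (τ ^ 5 * m - G) ^ 2 / τ ^ 5 = τ ^ 5 * m ^ 2 - 2 * (m * G) + G ^ 2 / τ ^ 5 := by
        field_simp; ring
      rw [e] at this
      linarith
    refine h5.trans (add_le_add ?_ le_rfl)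
    rw [hm, one_div, inv_pow, ← div_eq_mul_inv, div_le_div_iff₀ (by positivity) (by positivity)]
    calc τ ^ 5 * (τ ^ 5 * br x ^ 5) = τ ^ 10 * br x ^ 5 := by ring
      _ ≤ τ ^ 12 * br x ^ 5 := by gcongr; norm_num
      _ = 27 * (τ ^ 4 / 3 * (τ ^ 8 / 9) * br x * br x ^ 4) := by ring
      _ ≤ 27 * (d * d ^ 2 * d * br x ^ 4) := by gcongr
      _ = _ := by ring
  refine (h.norm_cubicErr_le (by linarith) hx hd hκd hbd).trans ?_
  calc _ ≤ 140000000 * (1 / (d ^ 3 * br x ^ 3)) + 110000 * (1 / (d ^ 2 * br x ^ 2)) *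
        (‖osc N g x‖ + 17 * τ ^ 3 / br x ^ 3) := by
        refine add_le_add (le_of_eq (by ring)) ?_
        rw [mul_one_div]
        gcongr
    _ = 140000000 * (1 / (d ^ 3 * br x ^ 3)) + 110000 * (1 / (d ^ 2 * br x ^ 2) * ‖osc N g x‖) +
        110000 * (1 / (d ^ 2 * br x ^ 2) * (17 * τ ^ 3 / br x ^ 3)) := by ring
    _ ≤ 140000000 * (9 / (τ ^ 5 * br x ^ 5)) +
        110000 * (27 / (τ ^ 5 * br x ^ 5) + ‖osc N g x‖ ^ 2 / τ ^ 5) +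
        110000 * (153 / (τ ^ 5 * br x ^ 5)) := by gcongr
    _ = 1279800000 / τ ^ 5 * (1 / br x ^ 5) + 110000 / τ ^ 5 * ‖osc N g x‖ ^ 2 := by
        field_simp; ring
    _ ≤ 1300000000 / τ ^ 5 * (1 / br x ^ 5) + 1300000000 / τ ^ 5 * ‖osc N g x‖ ^ 2 := by
        gcongr <;> norm_num
    _ = _ := by ring

lemma Prof.norm_cubicPrim_le_div (h : Prof ρ N c w g) (hκ : 6 ≤ κ)
    (hτ : 1 ≤ τ) (hτκ : τ ^ 4 = 3 * κ) {x : ℝ} (hx : -κ ^ 2 / 12 ≤ x) (hx' : κ ^ 2 / 12 ≤ |x|) :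
    ‖cubicPrim N w κ x‖ ≤ 82000000 / τ ^ 5 := by
  obtain ⟨d, hd, hκd, hbd⟩ := exists_scale (x := x) (κ := κ) (by linarith)
  have hY := br_pos x
  have hY1 := one_le_br x
  have hd0 : 0 < d := by linarith
  have hτ0 : 0 < τ := by linarith
  have hdτ : τ ^ 4 / 3 ≤ d := by rw [hτκ]; linarith
  have hYτ : τ ^ 2 / 4 ≤ br x := by
    refine le_of_pow_le_pow_left₀ (n := 4) (by norm_num) hY.le ?_
    rw [br_pow_four]
    have : τ ^ 8 = 9 * κ ^ 2 := by
      calc τ ^ 8 = (τ ^ 4) ^ 2 := by ring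
        _ = _ := by rw [hτκ]; ring
    nlinarith
  refine (h.norm_cubicPrim_le (by linarith) hx hd hκd hbd).trans ?_
  rw [div_le_div_iff₀ (by positivity) (by positivity)]
  have : τ ^ 5 ≤ 12 * (d * br x ^ 3) := by
    calc τ ^ 5 ≤ τ ^ 6 := by gcongr; norm_num
      _ = 12 * (τ ^ 4 / 3 * (τ ^ 2 / 4)) := by ring
      _ ≤ 12 * (d * br x ^ 3) := by
        gcongr
        exact hYτ.trans (le_self_pow₀ hY1 (by norm_num))
  nlinarith

theorem Prof.norm_nonoscillatory_le (h : Prof ρ N c w g) (hκ : 6 ≤ κ)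
    (hρ : 1 ≤ 100 * ρ * (κ / 6)) (hτ : 1 ≤ τ) (hτκ : τ ^ 4 = 3 * κ) {B : ℝ}
    (hB : κ ^ 2 / 12 ≤ B) :
    ‖∫ x in (-3 * (κ / 6) ^ 2)..B, osc N w x ^ 3 * cis (-(κ * x))‖ ≤
      1300000000 * (brInt + 37) / τ ^ 5 := by
  rw [show -3 * (κ / 6) ^ 2 = -κ ^ 2 / 12 by ring]
  have hAB : -κ ^ 2 / 12 ≤ B := by nlinarith
  have hc := h.cont
  have hoc := h.continuous_osc
  have hvc : Continuous (osc N (fun k => Complex.I * k * w k)) :=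
    MKdVPaper.continuous_osc (Continuous.intervalIntegrable (by fun_prop) _ _)
  have hfc := h.continuous_forcing
  have hcis : Continuous fun x : ℝ => cis (-(κ * x)) := continuous_cis.comp (by fun_prop)
  have hQ : ∀ x ∈ Icc (-κ ^ 2 / 12) B, resQ κ x ≠ 0 := fun x hx => by
    have := le_resQ hx.1
    have : 0 < (κ ^ 2 + |x|) ^ 2 / 2 := by positivity
    linarith
  have hQc : Continuous (resQ κ) := by unfold resQ; fun_prop
  have hE : ContinuousOn (cubicErr ρ N c w g κ) (Icc (-κ ^ 2 / 12) B) := by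
    have hr1 : ContinuousOn (fun x => (((resQ κ x)⁻¹ : ℝ) : ℂ)) (Icc (-κ ^ 2 / 12) B) :=
      Complex.continuous_ofReal.comp_continuousOn (hQc.continuousOn.inv₀ hQ)
    have hr2 : ContinuousOn (fun x => ((-(10 * κ ^ 2 + 6 * x) / resQ κ x ^ 2 : ℝ) : ℂ))
        (Icc (-κ ^ 2 / 12) B) :=
      Complex.continuous_ofReal.comp_continuousOn (ContinuousOn.div (by fun_prop)
        (hQc.continuousOn.pow 2) fun x hx => pow_ne_zero _ (hQ x hx))
    have hS : Continuous fun x => cubicForm κ (osc N w x)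
        (osc N (fun k => Complex.I * k * w k) x) x := by
      unfold cubicForm; fun_prop
    unfold cubicErr
    refine ((hr2.mul hS.continuousOn).add (hr1.mul (Continuous.continuousOn (by fun_prop)))).sub
      ((hr1.mul hfc.continuousOn).mul (Continuous.continuousOn (by fun_prop)))
  have hcE : ContinuousOn (fun x => cis (-(κ * x)) * cubicErr ρ N c w g κ x)
      (Icc (-κ ^ 2 / 12) B) := hcis.continuousOn.mul hE
  have hi1 : IntervalIntegrable (fun x => osc N w x ^ 3 * cis (-(κ * x))) volume (-κ ^ 2 / 12) B :=
    Continuous.intervalIntegrable (by fun_prop) _ _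
  have hi2 : IntervalIntegrable (fun x => cis (-(κ * x)) * cubicErr ρ N c w g κ x) volume
      (-κ ^ 2 / 12) B := hcE.intervalIntegrable_of_Icc hAB
  have hftc := intervalIntegral.integral_eq_sub_of_hasDerivAt (a := -κ ^ 2 / 12) (b := B)
    (fun x hx => h.hasDerivAt_cubicPrim (hQ x (by rwa [uIcc_of_le hAB] at hx))) (hi1.add hi2)
  rw [intervalIntegral.integral_add hi1 hi2] at hftc
  rw [eq_sub_of_add_eq hftc]
  have hP1 := h.norm_cubicPrim_le_div (x := B) hκ hτ hτκ hAB (hB.trans (le_abs_self _))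
  have hP2 := h.norm_cubicPrim_le_div (x := -κ ^ 2 / 12) hκ hτ hτκ le_rfl (by
    rw [abs_of_nonpos (by nlinarith)]; linarith)
  obtain ⟨hm, hL⟩ := h.osc_L2
  have hmi : Integrable fun x => ‖osc N g x‖ ^ 2 := hm.integrable_norm_pow (by norm_num)
  have hτ0 : 0 < τ := by linarith
  have hR : ‖∫ x in (-κ ^ 2 / 12)..B, cis (-(κ * x)) * cubicErr ρ N c w g κ x‖ ≤
      1300000000 / τ ^ 5 * (brInt + 36) := by
    have hmaj : Integrable fun x => 1300000000 / τ ^ 5 * (1 / br x ^ 5 + ‖osc N g x‖ ^ 2) :=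
      (integrable_inv_br.add hmi).const_mul _
    calc _ ≤ ∫ x in (-κ ^ 2 / 12)..B, 1300000000 / τ ^ 5 * (1 / br x ^ 5 + ‖osc N g x‖ ^ 2) := by
          refine intervalIntegral.norm_integral_le_of_norm_le hAB ?_ hmaj.intervalIntegrable
          refine Eventually.of_forall fun x hx => ?_
          rw [norm_mul, norm_cis, one_mul]
          exact h.norm_cubicErr_le_div hκ hρ hτ hτκ hx.1.le
      _ ≤ ∫ x, 1300000000 / τ ^ 5 * (1 / br x ^ 5 + ‖osc N g x‖ ^ 2) := by
          rw [intervalIntegral.integral_of_le hAB]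
          refine setIntegral_le_integral hmaj (Eventually.of_forall fun x => ?_)
          have := br_pos x
          simp only [Pi.zero_apply]
          positivity
      _ = 1300000000 / τ ^ 5 * (brInt + ∫ x, ‖osc N g x‖ ^ 2) := by
          rw [integral_const_mul, integral_add integrable_inv_br hmi, brInt]
      _ ≤ _ := by gcongr
  calc _ ≤ 82000000 / τ ^ 5 + 82000000 / τ ^ 5 + 1300000000 / τ ^ 5 * (brInt + 36) :=
        (norm_sub_le _ _).trans (add_le_add ((norm_sub_le _ _).trans (add_le_add hP1 hP2)) hR)
    _ = (164000000 + 1300000000 * (brInt + 36)) / τ ^ 5 := by ring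
    _ ≤ _ := by gcongr; linarith

end MKdVPaper

namespace MKdVPaper

variable {ρ N : ℝ} {c : ℂ} {w g : ℝ → ℂ} {κ τ : ℝ}

lemma Prof.norm_osc_right_le (h : Prof ρ N c w g) {x : ℝ} (hx : 0 ≤ x) :
    ‖osc N w x‖ ≤ 64 / br x ^ 3 := by
  have hY := br_pos x
  have hY4 := br_pow_four x
  rw [abs_of_nonneg hx] at hY4
  rcases le_total x 1 with h1 | h1
  · refine (h.pointwise hY (br_pow_four x)).1.trans ?_
    rw [div_le_div_iff₀ hY (by positivity)]
    have h2 : br x ^ 2 ≤ 3 / 2 := by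
      refine le_of_pow_le_pow_left₀ (n := 2) (by norm_num) (by norm_num) ?_
      rw [← pow_mul, hY4]
      norm_num; linarith
    nlinarith
  · set y := √√x with hy
    have hy4 : y ^ 4 = x := by
      rw [hy, show √√x ^ 4 = (√√x ^ 2) ^ 2 by ring, Real.sq_sqrt (Real.sqrt_nonneg _),
        Real.sq_sqrt hx]
    have hy1 : 1 ≤ y := by rw [hy, Real.one_le_sqrt, Real.one_le_sqrt]; exact h1
    have h2 := (h.norm_pos_le hy1).1
    rw [hy4] at h2
    refine h2.trans ?_
    rw [div_le_div_iff₀ (by positivity) (by positivity)]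
    have h3 : br x ^ 3 ≤ 2 * y ^ 3 := by
      refine le_of_pow_le_pow_left₀ (n := 4) (by norm_num) (by positivity) ?_
      calc (br x ^ 3) ^ 4 = (br x ^ 4) ^ 3 := by ring
        _ ≤ (2 * y ^ 4) ^ 3 := by rw [hY4, hy4]; gcongr; linarith
        _ = 8 * y ^ 12 := by ring
        _ ≤ 16 * y ^ 12 := by gcongr; norm_num
        _ = _ := by ring
    linarith

lemma Prof.norm_osc_le_one (h : Prof ρ N c w g) (x : ℝ) : ‖osc N w x‖ ≤ 40 / br x :=
  (h.pointwise (br_pos x) (br_pow_four x)).1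

lemma Prof.norm_osc_cube_right_le (h : Prof ρ N c w g) {x : ℝ} (hx : 0 ≤ x) :
    ‖osc N w x ^ 3 * cis (-(κ * x))‖ ≤ 262144 * (1 / br x ^ 5) := by
  have hY := br_pos x
  have hY1 := one_le_br x
  rw [norm_mul, norm_cis, mul_one, norm_pow]
  calc ‖osc N w x‖ ^ 3 ≤ (64 / br x ^ 3) ^ 3 := by gcongr; exact h.norm_osc_right_le hx
    _ = 262144 * (1 / br x ^ 9) := by field_simp; norm_num
    _ ≤ _ := by gcongr; norm_num

lemma Prof.continuous_cube (h : Prof ρ N c w g) :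
    Continuous fun x => osc N w x ^ 3 * cis (-(κ * x)) := by
  have := h.continuous_osc
  have hcis : Continuous fun x : ℝ => cis (-(κ * x)) := continuous_cis.comp (by fun_prop)
  fun_prop

lemma Prof.integrableOn_cube_Ioi_zero (h : Prof ρ N c w g) :
    IntegrableOn (fun x => osc N w x ^ 3 * cis (-(κ * x))) (Ioi 0) := by
  refine Integrable.mono' (integrable_inv_br.const_mul 262144).integrableOn
    h.continuous_cube.aestronglyMeasurable ?_
  filter_upwards [ae_restrict_mem measurableSet_Ioi] with x hx
  exact h.norm_osc_cube_right_le (le_of_lt hx)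

lemma Prof.integrableOn_cube_Ioi (h : Prof ρ N c w g) (a : ℝ) :
    IntegrableOn (fun x => osc N w x ^ 3 * cis (-(κ * x))) (Ioi a) := by
  have h1 : IntegrableOn (fun x => osc N w x ^ 3 * cis (-(κ * x))) (Icc a 0) :=
    h.continuous_cube.integrableOn_Icc
  refine (h1.union h.integrableOn_cube_Ioi_zero).mono_set fun x hx => ?_
  rcases le_or_gt x 0 with h0 | h0
  · exact Or.inl ⟨le_of_lt hx, h0⟩
  · exact Or.inr h0

theorem Prof.norm_integral_cube_sub_le (h : Prof ρ N c w g) (hκ : 6 ≤ κ)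
    (hρ : 1 ≤ 100 * ρ * (κ / 6)) (hτ : 1 ≤ τ) (hτκ : τ ^ 4 = 3 * κ) {b : ℝ} (hb : κ + 1 ≤ b) :
    ‖(∫ x in Ioi (-3 * b ^ 2), osc N w x ^ 3 * cis (-(κ * x))) - mainTerm w κ‖ ≤
      (300000000000000 + 1300000000 * (brInt + 37)) / τ ^ 5 := by
  have hlim := (intervalIntegral_tendsto_integral_Ioi (-3 * b ^ 2)
    (h.integrableOn_cube_Ioi (κ := κ) (-3 * b ^ 2)) tendsto_id).sub_const (mainTerm w κ)
  refine le_of_tendsto hlim.norm ?_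
  filter_upwards [eventually_ge_atTop (κ ^ 2 / 12)] with B hB
  have hi : ∀ a b, IntervalIntegrable (fun x => osc N w x ^ 3 * cis (-(κ * x))) volume a b :=
    fun a b => h.continuous_cube.intervalIntegrable a b
  simp only [id]
  rw [← intervalIntegral.integral_add_adjacent_intervals (hi _ (-3 * (κ / 6) ^ 2)) (hi _ B),
    add_sub_right_comm, add_div]
  exact (norm_add_le _ _).trans (add_le_add (h.norm_oscillatory_sub_le hκ hρ hb hτ hτκ)
    (h.norm_nonoscillatory_le hκ hρ hτ hτκ hB))

theorem Prof.norm_integral_cube_le (h : Prof ρ N c w g) (hκ : 0 < κ) (hκ6 : κ ≤ 6)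
    (hρ : 1 ≤ 100 * ρ * 12) {b : ℝ} (hb : 12 ≤ b) :
    ‖∫ x in Ioi (-3 * b ^ 2), osc N w x ^ 3 * cis (-(κ * x))‖ ≤
      6000000000 + 64000 * 432 + 262144 * brInt := by
  have hlim := (intervalIntegral_tendsto_integral_Ioi (-3 * b ^ 2)
    (h.integrableOn_cube_Ioi (κ := κ) (-3 * b ^ 2)) tendsto_id)
  refine le_of_tendsto hlim.norm ?_
  filter_upwards [eventually_ge_atTop 0] with B hB
  have hi : ∀ a b, IntervalIntegrable (fun x => osc N w x ^ 3 * cis (-(κ * x))) volume a b :=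
    fun a b => h.continuous_cube.intervalIntegrable a b
  simp only [id]
  rw [← intervalIntegral.integral_add_adjacent_intervals (hi _ (-3 * 12 ^ 2)) (hi _ B),
    ← intervalIntegral.integral_add_adjacent_intervals (hi (-3 * 12 ^ 2) 0) (hi _ B), ← add_assoc]
  refine (norm_add_le _ _).trans (add_le_add ((norm_add_le _ _).trans (add_le_add
    (h.norm_oscillatory_le hκ hκ6 hρ hb) ?_)) ?_)
  · refine (intervalIntegral.norm_integral_le_of_norm_le_const (C := 64000) fun x _ => ?_).trans ?_
    · rw [norm_mul, norm_cis, mul_one, norm_pow]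
      calc ‖osc N w x‖ ^ 3 ≤ (40 / 1) ^ 3 := by
            gcongr
            refine (h.norm_osc_le_one x).trans ?_
            gcongr
            exact one_le_br x
        _ = 64000 := by norm_num
    · norm_num
  · calc _ ≤ ∫ x in (0 : ℝ)..B, 262144 * (1 / br x ^ 5) := by
          refine intervalIntegral.norm_integral_le_of_norm_le hB (Eventually.of_forall
            fun x hx => h.norm_osc_cube_right_le hx.1.le)
            (integrable_inv_br.const_mul _).intervalIntegrable
      _ ≤ ∫ x, 262144 * (1 / br x ^ 5) := by
          rw [intervalIntegral.integral_of_le hB]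
          refine setIntegral_le_integral (integrable_inv_br.const_mul _)
            (Eventually.of_forall fun x => ?_)
          have := br_pos x
          simp only [Pi.zero_apply]
          positivity
      _ = _ := by rw [integral_const_mul, brInt]

end MKdVPaper

namespace MKdVPaper

variable {ρ N : ℝ} {c : ℂ} {w g : ℝ → ℂ}

/-- Bound for the low-frequency part away from stationary points. -/
lemma Prof.norm_head_le (h : Prof ρ N c w g) {a x D : ℝ} (ha : 0 < a)
    (hD : 0 < D) (hx : x + 3 * a ^ 2 ≤ -D) :
    ‖∫ k in (0 : ℝ)..a, cis (k * x + k ^ 3) * w k‖ ≤ 8 / D + 2 * √(1 / (3 * a * D)) := by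
  have hneg : ∀ k ∈ Icc 0 a, x + 3 * k ^ 2 ≤ -(D + 3 * a * (a - k)) := fun k hk => by
    nlinarith [hk.1, hk.2]
  have hD' : ∀ k ∈ Icc 0 a, D ≤ D + 3 * a * (a - k) := fun k hk => by
    nlinarith [hk.1, hk.2]
  have hne : ∀ k ∈ Icc 0 a, x + 3 * k ^ 2 ≠ 0 := fun k hk => by
    have := hneg k hk; have := hD' k hk; linarith
  have habs : ∀ k ∈ Icc 0 a, |(x + 3 * k ^ 2)⁻¹| ≤ 1 / (D + 3 * a * (a - k)) := fun k hk => by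
    have h1 := hneg k hk
    have h2 := hD' k hk
    rw [abs_inv, inv_eq_one_div, abs_of_neg (by linarith)]
    exact one_div_le_one_div_of_le (by linarith) (by linarith)
  have hd : ∀ k ∈ Icc 0 a, HasDerivAt (fun k : ℝ => (x + 3 * k ^ 2)⁻¹)
      (-(6 * k) / (x + 3 * k ^ 2) ^ 2) k := by
    intro k hk
    have h1 : HasDerivAt (fun k : ℝ => x + 3 * k ^ 2) (6 * k) k := by
      have := ((hasDerivAt_pow 2 k).const_mul 3).const_add x
      refine this.congr_deriv ?_
      norm_num; ring
    exact h1.inv (hne k hk)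
  have hQ : ∫ k in (0 : ℝ)..a, ((x + 3 * k ^ 2)⁻¹) ^ 2 ≤ √(1 / (3 * a * D)) ^ 2 := by
    rw [Real.sq_sqrt (by positivity)]
    have hdd : ∀ k ∈ uIcc 0 a, HasDerivAt (fun k : ℝ => 1 / (3 * a) * (D + 3 * a * (a - k))⁻¹)
        ((1 / (D + 3 * a * (a - k))) ^ 2) k := by
      intro k hk
      rw [uIcc_of_le ha.le] at hk
      have h2 := hD' k hk
      have h1 : HasDerivAt (fun k : ℝ => D + 3 * a * (a - k)) (-(3 * a)) k := by
        have := (((hasDerivAt_id k).const_sub a).const_mul (3 * a)).const_add D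
        exact this.congr_deriv (by ring)
      have h0 : D + 3 * a * (a - k) ≠ 0 := by linarith
      refine ((h1.inv h0).const_mul (1 / (3 * a))).congr_deriv ?_
      field_simp
    have hcont : ContinuousOn (fun k : ℝ => (1 / (D + 3 * a * (a - k))) ^ 2) (Icc 0 a) := by
      refine (ContinuousOn.div (by fun_prop) (by fun_prop) fun k hk => ?_).pow 2
      have := hD' k hk; linarith
    have hii := hcont.intervalIntegrable_of_Icc (μ := volume) ha.le
    have hcont2 : ContinuousOn (fun k : ℝ => ((x + 3 * k ^ 2)⁻¹) ^ 2) (Icc 0 a) :=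
      ((by fun_prop : Continuous fun k : ℝ => x + 3 * k ^ 2).continuousOn.inv₀ hne).pow 2
    calc _ ≤ ∫ k in (0 : ℝ)..a, (1 / (D + 3 * a * (a - k))) ^ 2 := by
          refine intervalIntegral.integral_mono_on ha.le (hcont2.intervalIntegrable_of_Icc ha.le) hii
            fun k hk => ?_
          rw [← sq_abs]
          gcongr
          exact habs k hk
      _ = 1 / (3 * a) * (D + 3 * a * (a - a))⁻¹ - 1 / (3 * a) * (D + 3 * a * (a - 0))⁻¹ :=
          intervalIntegral.integral_eq_sub_of_hasDerivAt hdd hii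
      _ ≤ 1 / (3 * a) * (D + 3 * a * (a - a))⁻¹ := by
          have : 0 ≤ 1 / (3 * a) * (D + 3 * a * (a - 0))⁻¹ := by
            rw [sub_zero]; positivity
          linarith
      _ = _ := by rw [sub_self, mul_zero, add_zero]; field_simp
  have key := h.norm_osc_le ha.le hd (fun k _ => hasDerivAt_phase x k)
    (by
      refine ContinuousOn.div (by fun_prop) (by fun_prop) fun k hk => pow_ne_zero _ (hne k hk))
    (by fun_prop)
    (Or.inl fun k hk => by
      rw [neg_div]
      have : 0 ≤ 6 * k / (x + 3 * k ^ 2) ^ 2 := by have := hk.1; positivity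
      linarith) (Real.sqrt_nonneg _) hQ
  have e : ∫ k in (0 : ℝ)..a, (((x + 3 * k ^ 2)⁻¹ * (x + 3 * k ^ 2) : ℝ) : ℂ) *
      cis (k * x + k ^ 3) * w k = ∫ k in (0 : ℝ)..a, cis (k * x + k ^ 3) * w k := by
    refine intervalIntegral.integral_congr fun k hk => ?_
    rw [uIcc_of_le ha.le] at hk
    simp only [inv_mul_cancel₀ (hne k hk), Complex.ofReal_one, one_mul]
  rw [e] at key
  have b1 : ∀ k ∈ Icc 0 a, |(x + 3 * k ^ 2)⁻¹| ≤ 1 / D := fun k hk =>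
    (habs k hk).trans (one_div_le_one_div_of_le hD (hD' k hk))
  have ba := b1 0 ⟨le_rfl, ha.le⟩
  have bb := b1 a ⟨ha.le, le_rfl⟩
  have e3 : 8 / D = 8 * (1 / D) := by ring
  rw [e3]
  linarith

lemma norm_integral_mul_cis_le {a b x : ℝ} (hab : a ≤ b) (hw : ∀ k, ‖w k‖ ≤ 1) :
    ‖∫ k in a..b, cis (k * x + k ^ 3) * w k‖ ≤ b - a := by
  refine (intervalIntegral.norm_integral_le_of_norm_le_const (C := 1) fun k _ => ?_).trans ?_
  · rw [norm_mul, norm_cis, one_mul]; exact hw k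
  · rw [one_mul, abs_of_nonneg (by linarith)]

lemma Prof.norm_head_near_le (h : Prof ρ N c w g) {x r : ℝ} (hr : 2 ≤ r)
    (hx : x ≤ -3 * (r ^ 4) ^ 2) :
    ‖∫ k in (0 : ℝ)..(r ^ 4), cis (k * x + k ^ 3) * w k‖ ≤ 6 / r ^ 2 := by
  have hr0 : 0 < r := by linarith
  have hη0 : 0 < 1 / r ^ 2 := by positivity
  have hη1 : 1 / r ^ 2 ≤ 1 := by
    rw [div_le_one (by positivity)]; nlinarith
  have hr4 : r ^ 2 ≤ r ^ 4 - 1 := by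
    have h4 : 4 ≤ r ^ 2 := by nlinarith
    nlinarith
  have ha : r ^ 2 ≤ r ^ 4 - 1 / r ^ 2 := by linarith
  have hr2 : 0 < r ^ 2 := by positivity
  have hc := h.cont
  have hi : ∀ a b, IntervalIntegrable (fun k => cis (k * x + k ^ 3) * w k) volume a b := fun a b =>
    ((continuous_phase x).mul hc).intervalIntegrable a b
  rw [← intervalIntegral.integral_add_adjacent_intervals (hi _ (r ^ 4 - 1 / r ^ 2)) (hi _ _)]
  have hη : r ^ 4 * (1 / r ^ 2) = r ^ 2 := by field_simp
  have k1 := h.norm_head_le (a := r ^ 4 - 1 / r ^ 2) (x := x) (D := 3 * r ^ 2) (by linarith)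
    (by positivity) (by nlinarith)
  have k2 := norm_integral_mul_cis_le (a := r ^ 4 - 1 / r ^ 2) (b := r ^ 4) (x := x)
    (by linarith) h.bdd
  have k3 : √(1 / (3 * (r ^ 4 - 1 / r ^ 2) * (3 * r ^ 2))) ≤ 1 / r ^ 2 := by
    refine Real.sqrt_le_sqrt (y := (1 / r ^ 2) ^ 2) ?_ |>.trans (by rw [Real.sqrt_sq hη0.le])
    rw [div_pow, one_pow]
    gcongr
    nlinarith
  refine (norm_add_le _ _).trans ((add_le_add k1 k2).trans ?_)
  have e : 8 / (3 * r ^ 2) = 8 / 3 * (1 / r ^ 2) := by field_simp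
  rw [e, show 6 / r ^ 2 = 6 * (1 / r ^ 2) by ring]
  linarith

lemma Prof.norm_tail_near_le (h : Prof ρ N c w g) {x r b : ℝ} (hr : 2 ≤ r) (hb : r ^ 4 + 1 ≤ b)
    (hx : -3 * (r ^ 4) ^ 2 ≤ x) :
    ‖∫ k in (r ^ 4)..b, cis (k * x + k ^ 3) * w k‖ ≤ 6 / r ^ 2 := by
  have hr0 : 0 < r := by linarith
  have hη0 : 0 < 1 / r ^ 2 := by positivity
  have hη1 : 1 / r ^ 2 ≤ 1 := by
    rw [div_le_one (by positivity)]; nlinarith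
  have hr2 : 0 < r ^ 2 := by positivity
  have hr4 : r ^ 2 ≤ r ^ 4 := by
    have h4 : 4 ≤ r ^ 2 := by nlinarith
    nlinarith
  have hc := h.cont
  have hi : ∀ a b, IntervalIntegrable (fun k => cis (k * x + k ^ 3) * w k) volume a b := fun a b =>
    ((continuous_phase x).mul hc).intervalIntegrable a b
  rw [← intervalIntegral.integral_add_adjacent_intervals (hi _ (r ^ 4 + 1 / r ^ 2)) (hi _ _)]
  have hη : r ^ 4 * (1 / r ^ 2) = r ^ 2 := by field_simp
  have k1 := h.norm_tail_le (a := r ^ 4 + 1 / r ^ 2) (b := b) (x := x) (D := 3 * r ^ 2)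
    (by linarith) (by linarith) (by positivity) (by nlinarith)
  have k2 := norm_integral_mul_cis_le (a := r ^ 4) (b := r ^ 4 + 1 / r ^ 2) (x := x)
    (by linarith) h.bdd
  have k3 : √(1 / (3 * (r ^ 4 + 1 / r ^ 2) * (3 * r ^ 2))) ≤ 1 / r ^ 2 := by
    refine Real.sqrt_le_sqrt (y := (1 / r ^ 2) ^ 2) ?_ |>.trans (by rw [Real.sqrt_sq hη0.le])
    rw [div_pow, one_pow]
    gcongr
    nlinarith
  refine (norm_add_le _ _).trans ((add_le_add k2 k1).trans ?_)
  have e : 8 / (3 * r ^ 2) = 8 / 3 * (1 / r ^ 2) := by field_simp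
  rw [e, show 6 / r ^ 2 = 6 * (1 / r ^ 2) by ring]
  linarith

/-- Interpolation of the near and far bounds for the truncation error. -/
lemma truncation_interpolate {e r y : ℝ} (he : 0 ≤ e) (hr : 1 ≤ r) (h1 : e ≤ 12 / r ^ 2)
    (h2 : y ≠ 0 → e ≤ 16 / |y| + 4 * √(1 / (3 * r ^ 4 * |y|))) : e ≤ 60 / (r * br y ^ 2) := by
  have hr0 : 0 < r := by linarith
  have hZ := br_pos y
  have hZ4 := br_pow_four y
  rw [le_div_iff₀ (by positivity)]
  refine le_of_pow_le_pow_left₀ (n := 2) (by norm_num) (by norm_num) ?_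
  have e1 : (e * (r * br y ^ 2)) ^ 2 = e ^ 2 * r ^ 2 * (1 + |y|) := by rw [← hZ4]; ring
  rw [e1]
  have h1' : e * r ^ 2 ≤ 12 := by rwa [le_div_iff₀ (by positivity)] at h1
  have hr1 : 1 ≤ r ^ 2 := one_le_pow₀ hr
  have he12 : e ≤ 12 := by nlinarith
  rcases le_total |y| 1 with hy | hy
  · have : e ^ 2 * r ^ 2 ≤ 144 := by nlinarith
    nlinarith [abs_nonneg y]
  · have hy0 : y ≠ 0 := by rintro rfl; simp at hy; linarith
    have hyp : 0 < |y| := abs_pos.2 hy0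
    have h3 := h2 hy0
    have hD : √(1 / (3 * r ^ 4 * |y|)) ≤ 1 / (r ^ 2 * √|y|) := by
      rw [Real.sqrt_le_left (by positivity), div_pow, one_pow, mul_pow, Real.sq_sqrt hyp.le]
      gcongr
      nlinarith [pow_pos hr0 4]
    set s := √|y| with hs
    have hs2 : s ^ 2 = |y| := Real.sq_sqrt hyp.le
    have hs1 : 1 ≤ s := by rw [hs, Real.one_le_sqrt]; exact hy
    have hs0 : 0 < s := by linarith
    have h4 : e * s ^ 2 * r ^ 2 ≤ 16 * r ^ 2 + 4 * s := by
      have h5 : e ≤ 16 / s ^ 2 + 4 * (1 / (r ^ 2 * s)) := by rw [hs2]; linarith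
      calc e * s ^ 2 * r ^ 2 ≤ (16 / s ^ 2 + 4 * (1 / (r ^ 2 * s))) * s ^ 2 * r ^ 2 := by gcongr
        _ = _ := by field_simp
    rw [← hs2]
    have h6 : e ^ 2 * r ^ 2 * s ^ 2 ≤ 400 := by
      have hp : 0 ≤ e * s * r := by positivity
      by_contra hlt
      push Not at hlt
      have h7 : 20 < e * s * r := by nlinarith
      have h8 : 20 * (s * r) < 16 * r ^ 2 + 4 * s := by
        calc 20 * (s * r) < e * s * r * (s * r) := by gcongr
          _ = e * s ^ 2 * r ^ 2 := by ring
          _ ≤ _ := h4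
      have h9 : s < r := by
        by_contra hle
        push Not at hle
        nlinarith
      nlinarith
    have h10 : e ^ 2 * r ^ 2 ≤ 144 := by nlinarith
    nlinarith

end MKdVPaper

namespace MKdVPaper

variable {ρ N : ℝ} {c : ℂ} {w g : ℝ → ℂ} {r κ : ℝ}

lemma Prof.norm_truncation_right_le (h : Prof ρ N c w g) (hr : 2 ≤ r) (hN : r ^ 4 + 1 ≤ N) {x : ℝ}
    (hx : -3 * (r ^ 4) ^ 2 < x) :
    ‖osc (r ^ 4) w x - osc N w x‖ ≤ 60 / (r * br (x + 3 * (r ^ 4) ^ 2) ^ 2) := by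
  have hc := h.cont
  have hr4 : 0 < r ^ 4 := by positivity
  have hi : ∀ a b, IntervalIntegrable (fun k => cis (k * x + k ^ 3) * w k) volume a b := fun a b =>
    ((continuous_phase x).mul hc).intervalIntegrable a b
  have hle : ‖osc (r ^ 4) w x - osc N w x‖ ≤
      2 * ‖∫ k in (r ^ 4)..N, cis (k * x + k ^ 3) * w k‖ := by
    have e : osc (r ^ 4) w x - osc N w x = -(∫ k in (-N)..(-r ^ 4), cis (k * x + k ^ 3) * w k) -
        ∫ k in (r ^ 4)..N, cis (k * x + k ^ 3) * w k := by
      rw [osc, osc, ← intervalIntegral.integral_add_adjacent_intervals (hi (-N) (-r ^ 4)) (hi _ N),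
        ← intervalIntegral.integral_add_adjacent_intervals (hi (-r ^ 4) (r ^ 4)) (hi _ N)]
      ring
    rw [e]
    refine (norm_sub_le _ _).trans ?_
    rw [norm_neg, norm_integral_phase_neg h.symm]
    linarith
  refine truncation_interpolate (norm_nonneg _) (by linarith) ?_ fun _ => ?_
  · refine hle.trans ?_
    have := h.norm_tail_near_le hr hN hx.le
    rw [show 12 / r ^ 2 = 2 * (6 / r ^ 2) by ring]
    linarith
  · refine hle.trans ?_
    have hD : 0 < x + 3 * (r ^ 4) ^ 2 := by linarith
    have := h.norm_tail_le (a := r ^ 4) (b := N) hr4 (by linarith) hD le_rfl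
    rw [abs_of_pos hD, show 16 / (x + 3 * (r ^ 4) ^ 2) = 2 * (8 / (x + 3 * (r ^ 4) ^ 2)) by ring]
    linarith

lemma Prof.norm_truncation_left_le (h : Prof ρ N c w g) (hr : 2 ≤ r) {x : ℝ}
    (hx : x ≤ -3 * (r ^ 4) ^ 2) :
    ‖osc (r ^ 4) w x‖ ≤ 60 / (r * br (x + 3 * (r ^ 4) ^ 2) ^ 2) := by
  have hc := h.cont
  have hr4 : 0 < r ^ 4 := by positivity
  have hi : ∀ a b, IntervalIntegrable (fun k => cis (k * x + k ^ 3) * w k) volume a b := fun a b =>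
    ((continuous_phase x).mul hc).intervalIntegrable a b
  have hle : ‖osc (r ^ 4) w x‖ ≤ 2 * ‖∫ k in (0 : ℝ)..(r ^ 4), cis (k * x + k ^ 3) * w k‖ := by
    rw [osc, ← intervalIntegral.integral_add_adjacent_intervals (hi (-r ^ 4) 0) (hi _ _)]
    refine (norm_add_le _ _).trans ?_
    have e := norm_integral_phase_neg h.symm x 0 (r ^ 4)
    rw [neg_zero] at e
    rw [e]
    linarith
  refine truncation_interpolate (norm_nonneg _) (by linarith) ?_ fun hy => ?_
  · refine hle.trans ?_
    have := h.norm_head_near_le hr hx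
    rw [show 12 / r ^ 2 = 2 * (6 / r ^ 2) by ring]
    linarith
  · refine hle.trans ?_
    have hD : x + 3 * (r ^ 4) ^ 2 < 0 := lt_of_le_of_ne (by linarith) hy
    have := h.norm_head_le (a := r ^ 4) (x := x) (D := |x + 3 * (r ^ 4) ^ 2|) hr4 (abs_pos.2 hy)
      (by rw [abs_of_neg hD]; linarith)
    rw [show 16 / |x + 3 * (r ^ 4) ^ 2| = 2 * (8 / |x + 3 * (r ^ 4) ^ 2|) by ring]
    linarith

/-- Majorant of the cubic truncation error. -/
def truncMaj (r x : ℝ) : ℝ :=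
  144000 / r * (1 / br x ^ 5 + 1 / br (x + 3 * (r ^ 4) ^ 2) ^ 5) + 491520 / r * (1 / br x ^ 5) +
    (Ioc (-3 * (r ^ 4) ^ 2) 0).indicator
      (fun x => 192000 / r ^ 5 * (1 / br x ^ 2 + 1 / br (x + 3 * (r ^ 4) ^ 2) ^ 2)) x

lemma one_div_mul_pow_four_le {Y Z : ℝ} (hY : 1 ≤ Y) (hZ : 1 ≤ Z) :
    1 / (Y * Z ^ 4) ≤ 1 / Y ^ 5 + 1 / Z ^ 5 := by
  have hY0 : 0 < Y := by linarith
  have hZ0 : 0 < Z := by linarith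
  rcases le_total Y Z with h | h
  · calc 1 / (Y * Z ^ 4) ≤ 1 / (Y * Y ^ 4) := by gcongr
      _ = 1 / Y ^ 5 := by ring
      _ ≤ _ := by have : 0 ≤ 1 / Z ^ 5 := by positivity
                  linarith
  · calc 1 / (Y * Z ^ 4) ≤ 1 / (Z * Z ^ 4) := by gcongr
      _ = 1 / Z ^ 5 := by ring
      _ ≤ _ := by have : 0 ≤ 1 / Y ^ 5 := by positivity
                  linarith

lemma truncMaj_indicator_nonneg (hr : 2 ≤ r) (x : ℝ) :
    0 ≤ (Ioc (-3 * (r ^ 4) ^ 2) 0).indicator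
      (fun x => 192000 / r ^ 5 * (1 / br x ^ 2 + 1 / br (x + 3 * (r ^ 4) ^ 2) ^ 2)) x := by
  refine indicator_nonneg (fun y _ => ?_) x
  have := br_pos y
  have := br_pos (y + 3 * (r ^ 4) ^ 2)
  positivity

lemma norm_sq_mul_le {u e : ℂ} {Y Z : ℝ} (hr : 2 ≤ r) (hY : 1 ≤ Y) (hZ : 1 ≤ Z)
    (hu : ‖u‖ ≤ 40 / Y) (he : ‖e‖ ≤ 60 / (r * Z ^ 2)) :
    ‖e‖ ^ 2 * ‖u‖ ≤ 144000 / r * (1 / Y ^ 5 + 1 / Z ^ 5) := by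
  have hY0 : 0 < Y := by linarith
  have hZ0 : 0 < Z := by linarith
  have hr0 : 0 < r := by linarith
  calc ‖e‖ ^ 2 * ‖u‖ ≤ (60 / (r * Z ^ 2)) ^ 2 * (40 / Y) := by gcongr
    _ = 144000 / (r * r) * (1 / (Y * Z ^ 4)) := by field_simp; norm_num
    _ ≤ 144000 / (r * 1) * (1 / Y ^ 5 + 1 / Z ^ 5) := by
        gcongr
        · linarith
        · exact one_div_mul_pow_four_le hY hZ
    _ = _ := by rw [mul_one]

lemma Prof.norm_truncation_cube_le (h : Prof ρ N c w g) (hr : 2 ≤ r) (hN : r ^ 4 + 1 ≤ N) (x : ℝ) :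
    ‖osc (r ^ 4) w x ^ 2 * osc N w x * cis (-(κ * x)) -
      (Ioi (-3 * (r ^ 4) ^ 2)).indicator (fun x => osc N w x ^ 3 * cis (-(κ * x))) x‖ ≤
      truncMaj r x := by
  have hr0 : 0 < r := by linarith
  have hY0 := br_pos x
  have hY1 := one_le_br x
  have hZ0 := br_pos (x + 3 * (r ^ 4) ^ 2)
  have hZ1 := one_le_br (x + 3 * (r ^ 4) ^ 2)
  have hu := h.norm_osc_le_one x
  have hind := truncMaj_indicator_nonneg hr x
  rcases le_or_gt x (-3 * (r ^ 4) ^ 2) with hx | hx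
  · rw [indicator_of_notMem (by simpa using hx), sub_zero, norm_mul, norm_cis, mul_one, norm_mul,
      norm_pow]
    refine (norm_sq_mul_le hr hY1 hZ1 hu (h.norm_truncation_left_le hr hx)).trans ?_
    rw [truncMaj]
    have : 0 ≤ 491520 / r * (1 / br x ^ 5) := by positivity
    linarith
  · rw [indicator_of_mem (mem_Ioi.2 hx)]
    have he := h.norm_truncation_right_le hr hN hx
    set u := osc N w x
    set v := osc (r ^ 4) w x
    have e1 : v ^ 2 * u * cis (-(κ * x)) - u ^ 3 * cis (-(κ * x)) =
        (2 * u ^ 2 * (v - u) + (v - u) ^ 2 * u) * cis (-(κ * x)) := by ring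
    rw [e1, norm_mul, norm_cis, mul_one]
    refine (norm_add_le _ _).trans ?_
    have b1 : ‖(v - u) ^ 2 * u‖ ≤
        144000 / r * (1 / br x ^ 5 + 1 / br (x + 3 * (r ^ 4) ^ 2) ^ 5) := by
      rw [norm_mul, norm_pow]
      exact norm_sq_mul_le hr hY1 hZ1 hu he
    have e2 : ‖2 * u ^ 2 * (v - u)‖ = 2 * ‖u‖ ^ 2 * ‖v - u‖ := by
      rw [norm_mul, norm_mul, norm_pow, Complex.norm_ofNat]
    rw [truncMaj, e2]
    suffices b2 : 2 * ‖u‖ ^ 2 * ‖v - u‖ ≤ 491520 / r * (1 / br x ^ 5) +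
        (Ioc (-3 * (r ^ 4) ^ 2) 0).indicator (fun x => 192000 / r ^ 5 *
          (1 / br x ^ 2 + 1 / br (x + 3 * (r ^ 4) ^ 2) ^ 2)) x by linarith
    rcases le_or_gt x 0 with h0 | h0
    · have hm : x ∈ Ioc (-3 * (r ^ 4) ^ 2) 0 := ⟨hx, h0⟩
      rw [indicator_of_mem hm]
      have hYZ : 1 / (br x ^ 2 * br (x + 3 * (r ^ 4) ^ 2) ^ 2) ≤
          1 / r ^ 4 * (1 / br x ^ 2 + 1 / br (x + 3 * (r ^ 4) ^ 2) ^ 2) := by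
        have h4 := br_pow_four x
        have h5 := br_pow_four (x + 3 * (r ^ 4) ^ 2)
        rw [abs_of_nonpos h0] at h4
        rw [abs_of_pos (by linarith)] at h5
        set Y := br x
        set Z := br (x + 3 * (r ^ 4) ^ 2)
        have h6 : r ^ 4 ≤ Y ^ 2 + Z ^ 2 := by
          refine le_of_pow_le_pow_left₀ (n := 2) (by norm_num) (by positivity) ?_
          nlinarith [mul_pos (pow_pos hY0 2) (pow_pos hZ0 2), pow_pos (pow_pos hr0 4) 2]
        rw [show 1 / r ^ 4 * (1 / Y ^ 2 + 1 / Z ^ 2) = (Y ^ 2 + Z ^ 2) / (r ^ 4 * (Y ^ 2 * Z ^ 2)) by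
          field_simp; ring, div_le_div_iff₀ (by positivity) (by positivity)]
        nlinarith [mul_pos (pow_pos hY0 2) (pow_pos hZ0 2)]
      have : 0 ≤ 491520 / r * (1 / br x ^ 5) := by positivity
      refine le_trans ?_ (le_add_of_nonneg_left this)
      calc 2 * ‖u‖ ^ 2 * ‖v - u‖ ≤
            2 * (40 / br x) ^ 2 * (60 / (r * br (x + 3 * (r ^ 4) ^ 2) ^ 2)) := by gcongr
        _ = 192000 / r * (1 / (br x ^ 2 * br (x + 3 * (r ^ 4) ^ 2) ^ 2)) := by
            field_simp; norm_num
        _ ≤ 192000 / r * (1 / r ^ 4 * (1 / br x ^ 2 + 1 / br (x + 3 * (r ^ 4) ^ 2) ^ 2)) := by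
            gcongr
        _ = _ := by field_simp
    · refine le_trans ?_ (le_add_of_nonneg_right hind)
      have hu' := h.norm_osc_right_le h0.le
      calc 2 * ‖u‖ ^ 2 * ‖v - u‖ ≤ 2 * (64 / br x ^ 3) ^ 2 * (60 / (r * 1 ^ 2)) := by
            gcongr
            refine he.trans ?_
            gcongr
        _ = 491520 / r * (1 / br x ^ 6) := by field_simp; norm_num
        _ ≤ _ := by gcongr; norm_num

end MKdVPaper

namespace MKdVPaper

variable {ρ N : ℝ} {c : ℂ} {w g : ℝ → ℂ} {r κ : ℝ}

lemma integral_inv_sqrt_one_add (X : ℝ) (hX : 0 ≤ X) :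
    ∫ x in (0 : ℝ)..X, 1 / √(1 + x) = 2 * √(1 + X) - 2 := by
  have hd : ∀ x ∈ uIcc 0 X, HasDerivAt (fun x : ℝ => 2 * √(1 + x)) (1 / √(1 + x)) x := by
    intro x hx
    rw [uIcc_of_le hX] at hx
    have h0 : (0 : ℝ) < 1 + x := by linarith [hx.1]
    refine ((((hasDerivAt_id x).const_add 1).sqrt h0.ne').const_mul 2).congr_deriv ?_
    have : 0 < √(1 + x) := Real.sqrt_pos.2 h0
    simp only [id]
    field_simp
  have hc : ContinuousOn (fun x : ℝ => 1 / √(1 + x)) (Icc 0 X) :=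
    ContinuousOn.div (by fun_prop) (by fun_prop) fun x hx =>
      (Real.sqrt_pos.2 (by linarith [hx.1])).ne'
  rw [intervalIntegral.integral_eq_sub_of_hasDerivAt hd (hc.intervalIntegrable_of_Icc hX)]
  simp

lemma br_sq (x : ℝ) : br x ^ 2 = √(1 + |x|) := by
  rw [br, Real.sq_sqrt (Real.sqrt_nonneg _)]

lemma integral_inv_br_sq_right (X : ℝ) (hX : 0 ≤ X) :
    ∫ x in (0 : ℝ)..X, 1 / br x ^ 2 = 2 * √(1 + X) - 2 := by
  rw [← integral_inv_sqrt_one_add X hX]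
  refine intervalIntegral.integral_congr fun x hx => ?_
  rw [uIcc_of_le hX] at hx
  simp only [br_sq, abs_of_nonneg hx.1]

lemma integral_inv_br_sq_left (X : ℝ) (hX : 0 ≤ X) :
    ∫ x in (-X)..0, 1 / br x ^ 2 = 2 * √(1 + X) - 2 := by
  rw [← integral_inv_br_sq_right X hX, ← neg_zero (G := ℝ),
    ← intervalIntegral.integral_comp_neg, neg_zero]
  refine intervalIntegral.integral_congr fun x _ => ?_
  simp only [br, abs_neg]

lemma continuous_inv_br_pow (n : ℕ) (a : ℝ) : Continuous fun x => 1 / br (x + a) ^ n :=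
  continuous_const.div₀ ((continuous_br.comp (by fun_prop)).pow n)
    fun x => pow_ne_zero _ (br_pos _).ne'

lemma integrable_truncMaj : Integrable (truncMaj r) := by
  have h1 := integrable_inv_br
  have h2 := integrable_inv_br.comp_add_right (3 * (r ^ 4) ^ 2)
  refine (((h1.add h2).const_mul _).add (h1.const_mul _)).add ?_
  rw [integrable_indicator_iff measurableSet_Ioc]
  have hb := continuous_inv_br_pow 2 0
  simp only [add_zero] at hb
  have hc : Continuous fun x => 192000 / r ^ 5 *
      (1 / br x ^ 2 + 1 / br (x + 3 * (r ^ 4) ^ 2) ^ 2) :=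
    continuous_const.mul (hb.add (continuous_inv_br_pow 2 _))
  exact hc.integrableOn_Ioc

lemma integral_truncMaj_le (hr : 2 ≤ r) : ∫ x, truncMaj r x ≤ 800000 * (brInt + 2) / r := by
  have hr0 : 0 < r := by linarith
  have h1 := integrable_inv_br
  have h2 := integrable_inv_br.comp_add_right (3 * (r ^ 4) ^ 2)
  have hX : 0 ≤ 3 * (r ^ 4) ^ 2 := by positivity
  have hb := continuous_inv_br_pow 2 0
  simp only [add_zero] at hb
  have hb' := continuous_inv_br_pow 2 (3 * (r ^ 4) ^ 2)
  have hc : Continuous fun x => 192000 / r ^ 5 *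
      (1 / br x ^ 2 + 1 / br (x + 3 * (r ^ 4) ^ 2) ^ 2) :=
    continuous_const.mul (hb.add hb')
  have h3 : Integrable ((Ioc (-3 * (r ^ 4) ^ 2) 0).indicator (fun x => 192000 / r ^ 5 *
      (1 / br x ^ 2 + 1 / br (x + 3 * (r ^ 4) ^ 2) ^ 2))) := by
    rw [integrable_indicator_iff measurableSet_Ioc]
    exact hc.integrableOn_Ioc
  have e2 : ∫ x, 1 / br (x + 3 * (r ^ 4) ^ 2) ^ 5 = brInt :=
    integral_add_right_eq_self (fun x => 1 / br x ^ 5) _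
  have e3 : ∫ x, (Ioc (-3 * (r ^ 4) ^ 2) 0).indicator (fun x => 192000 / r ^ 5 *
      (1 / br x ^ 2 + 1 / br (x + 3 * (r ^ 4) ^ 2) ^ 2)) x ≤ 192000 / r ^ 5 * (8 * r ^ 4) := by
    rw [integral_indicator measurableSet_Ioc, ← intervalIntegral.integral_of_le (by linarith),
      intervalIntegral.integral_const_mul, intervalIntegral.integral_add
        (hb.intervalIntegrable _ _) (hb'.intervalIntegrable _ _),
      intervalIntegral.integral_comp_add_right (fun x => 1 / br x ^ 2),
      show -3 * (r ^ 4) ^ 2 = -(3 * (r ^ 4) ^ 2) by ring, integral_inv_br_sq_left _ hX,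
      neg_add_cancel, zero_add, integral_inv_br_sq_right _ hX]
    have : √(1 + 3 * (r ^ 4) ^ 2) ≤ 2 * r ^ 4 := by
      rw [Real.sqrt_le_left (by positivity)]
      have : 1 ≤ (r ^ 4) ^ 2 := one_le_pow₀ (one_le_pow₀ (by linarith))
      nlinarith
    gcongr
    linarith
  have i1 : Integrable fun x => 144000 / r * (1 / br x ^ 5 + 1 / br (x + 3 * (r ^ 4) ^ 2) ^ 5) :=
    (h1.add h2).const_mul _
  have i2 : Integrable fun x => 491520 / r * (1 / br x ^ 5) := h1.const_mul _
  have i12 : Integrable fun x => 144000 / r * (1 / br x ^ 5 + 1 / br (x + 3 * (r ^ 4) ^ 2) ^ 5) +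
      491520 / r * (1 / br x ^ 5) := i1.add i2
  unfold truncMaj
  rw [integral_add i12 h3, integral_add i1 i2, integral_const_mul,
    integral_const_mul, integral_add h1 h2, e2, ← brInt]
  calc _ ≤ 144000 / r * (brInt + brInt) + 491520 / r * brInt + 192000 / r ^ 5 * (8 * r ^ 4) := by
        gcongr
    _ = (779520 * brInt + 1536000) / r := by field_simp; ring
    _ ≤ _ := by gcongr; linarith [brInt_nonneg]

theorem Prof.norm_truncation_integral_le (h : Prof ρ N c w g) (hr : 2 ≤ r) (hN : r ^ 4 + 1 ≤ N) :
    Integrable (fun x => osc (r ^ 4) w x ^ 2 * osc N w x * cis (-(κ * x))) ∧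
    ‖(∫ x, osc (r ^ 4) w x ^ 2 * osc N w x * cis (-(κ * x))) -
      ∫ x in Ioi (-3 * (r ^ 4) ^ 2), osc N w x ^ 3 * cis (-(κ * x))‖ ≤ 800000 * (brInt + 2) / r := by
  have hu := h.continuous_osc
  have hv : Continuous (osc (r ^ 4) w) :=
    MKdVPaper.continuous_osc (h.cont.intervalIntegrable _ _)
  have hcis : Continuous fun x : ℝ => cis (-(κ * x)) := continuous_cis.comp (by fun_prop)
  set f : ℝ → ℂ := fun x => osc (r ^ 4) w x ^ 2 * osc N w x * cis (-(κ * x)) with hf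
  set f₀ : ℝ → ℂ := (Ioi (-3 * (r ^ 4) ^ 2)).indicator
    (fun x => osc N w x ^ 3 * cis (-(κ * x))) with hf₀
  have hfc : Continuous f := by rw [hf]; fun_prop
  have i₀ : Integrable f₀ := by
    rw [hf₀, integrable_indicator_iff measurableSet_Ioi]
    exact h.integrableOn_cube_Ioi _
  have hle : ∀ x, ‖(f - f₀) x‖ ≤ truncMaj r x := fun x => h.norm_truncation_cube_le hr hN x
  have i₁ : Integrable (f - f₀) := integrable_truncMaj.mono'
    (hfc.aestronglyMeasurable.sub i₀.aestronglyMeasurable) (Eventually.of_forall hle)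
  have i : Integrable f := by simpa using i₁.add i₀
  refine ⟨i, ?_⟩
  rw [← integral_indicator measurableSet_Ioi, ← integral_sub i i₀]
  exact (norm_integral_le_of_norm_le integrable_truncMaj (Eventually.of_forall hle)).trans
    (integral_truncMaj_le hr)

end MKdVPaper

namespace MKdVPaper

variable {ρ N R κ r : ℝ} {c : ℂ} {w g : ℝ → ℂ}

/-- The phase-modulated amplitude `k ↦ e^{ik³} w(k)`. -/
def modul (w : ℝ → ℂ) (k : ℝ) : ℂ := cis (k ^ 3) * w k

lemma norm_modul (w : ℝ → ℂ) (k : ℝ) : ‖modul w k‖ = ‖w k‖ := by simp [modul]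

lemma continuous_modul (hw : Continuous w) : Continuous (modul w) :=
  (continuous_cis.comp (by fun_prop : Continuous fun k : ℝ => k ^ 3)).mul hw

lemma fourier_indicator_modul (hR : 0 ≤ R) (w : ℝ → ℂ) (ξ : ℝ) :
    FourierTransform.fourier ((Icc (-R) R).indicator (modul w)) ξ =
      osc R w (-(2 * Real.pi) * ξ) := by
  rw [Real.fourier_eq', osc, intervalIntegral.integral_of_le (by linarith),
    ← integral_Icc_eq_integral_Ioc, ← integral_indicator measurableSet_Icc]
  congr 1
  ext k
  by_cases hk : k ∈ Icc (-R) R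
  · rw [indicator_of_mem hk, indicator_of_mem hk, modul, smul_eq_mul, ← mul_assoc, cis, cis,
      ← Complex.exp_add]
    congr 2
    simp
    ring
  · rw [indicator_of_notMem hk, indicator_of_notMem hk, smul_zero]

lemma Prof.indicator_modul (h : Prof ρ N c w g) :
    (Icc (-N) N).indicator (modul w) = modul w := by
  ext k
  by_cases hk : k ∈ Icc (-N) N
  · rw [indicator_of_mem hk]
  · rw [indicator_of_notMem hk, modul, h.supp, mul_zero]
    by_contra! hlt
    exact hk ⟨(abs_lt.1 hlt).1.le, (abs_lt.1 hlt).2.le⟩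

/-- The truncated trilinear convolution as an integral over physical space. -/
theorem Prof.trilinear_eq_integral (h : Prof ρ N c w g) (hR : 0 ≤ R)
    (h_int : Integrable fun x => osc R w x ^ 2 * osc N w x) (κ : ℝ) :
    ∫ k in Icc (-R) R, ∫ l in Icc (-R) R, modul w k * modul w l * modul w (κ - k - l) =
      ((1 / (2 * Real.pi) : ℝ) : ℂ) * ∫ x, osc R w x ^ 2 * osc N w x * cis (-(κ * x)) := by
  have hπ := Real.pi_pos
  have hN0 : 0 ≤ N := by linarith [h.N_ge]
  have hF := continuous_modul h.cont
  have hFs : HasCompactSupport (modul w) := by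
    apply HasCompactSupport.intro (isCompact_Icc (a := -N) (b := N))
    intro k hk
    rw [← h.indicator_modul, indicator_of_notMem hk]
  have hFi : Integrable (modul w) := hF.integrable_of_hasCompactSupport hFs
  set f : ℝ → ℂ := (Icc (-R) R).indicator (modul w) with hf
  have hfi : Integrable f := hFi.indicator measurableSet_Icc
  have hfs : HasCompactSupport f := by
    apply HasCompactSupport.intro (isCompact_Icc (a := -R) (b := R))
    intro k hk
    rw [hf, indicator_of_notMem hk]
  set L := ContinuousLinearMap.mul ℂ ℂ with hL
  set G := MeasureTheory.convolution f (modul w) L volume with hG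
  have hGi : Integrable G := hfi.integrable_convolution L hFi
  have hGc : Continuous G := hFs.continuous_convolution_right L hfi.locallyIntegrable hF
  have hGs : HasCompactSupport G := HasCompactSupport.convolution L hfs hFs
  set H := MeasureTheory.convolution f G L volume with hH
  have hHi : Integrable H := hfi.integrable_convolution L hGi
  have hHc : Continuous H := hGs.continuous_convolution_right L hfi.locallyIntegrable hGc
  have hFour : FourierTransform.fourier H =
      fun ξ => osc R w (-(2 * Real.pi) * ξ) ^ 2 * osc N w (-(2 * Real.pi) * ξ) := by
    ext ξ
    rw [hH, Real.fourier_mul_convolution_eq hfi hGi, hG, Real.fourier_mul_convolution_eq hfi hFi,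
      hf, fourier_indicator_modul hR]
    rw [← h.indicator_modul]
    rw [fourier_indicator_modul hN0]
    ring
  have hHF : Integrable (FourierTransform.fourier H) := by
    rw [hFour]
    exact h_int.comp_mul_left' (R := -(2 * Real.pi)) (by linarith)
  have hinv := congrFun (hHc.fourierInv_fourier_eq hHi hHF) κ
  rw [hFour, Real.fourierInv_eq'] at hinv
  have e1 : H κ = ∫ k in Icc (-R) R, ∫ l in Icc (-R) R,
      modul w k * modul w l * modul w (κ - k - l) := by
    rw [hH, convolution_def, ← integral_indicator measurableSet_Icc]
    congr 1
    ext k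
    by_cases hk : k ∈ Icc (-R) R
    · rw [indicator_of_mem hk, hG, convolution_def, ← integral_indicator measurableSet_Icc, hf,
        indicator_of_mem hk]
      simp only [hL, ContinuousLinearMap.mul_apply']
      rw [← integral_const_mul]
      congr 1
      ext l
      by_cases hl : l ∈ Icc (-R) R
      · rw [indicator_of_mem hl, indicator_of_mem hl]; ring
      · rw [indicator_of_notMem hl, indicator_of_notMem hl]; ring
    · rw [indicator_of_notMem hk, hf, indicator_of_notMem hk]
      simp
  rw [← e1, ← hinv]
  have e2 := Measure.integral_comp_mul_left
    (fun x : ℝ => osc R w x ^ 2 * osc N w x * cis (-(κ * x))) (-(2 * Real.pi))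
  rw [inv_neg, abs_neg, abs_of_pos (by positivity), ← one_div, Complex.real_smul] at e2
  rw [← e2]
  congr 1
  ext ξ
  rw [smul_eq_mul, mul_comm]
  congr 1
  rw [cis]
  congr 1
  simp
  ring

end MKdVPaper

namespace MKdVPaper

variable {ρ N R κ r s A B : ℝ} {c : ℂ} {w g : ℝ → ℂ}

lemma Prof.integral_symm_weight_le (h : Prof ρ N c w g) (hs : s ≠ 0) (hA : 0 < A) (hAB : A ≤ B) :
    (∫ y in A..B, 1 / (6 * |s| * y) * ‖g (s / 2 + y) + jumpDeriv ρ c (s / 2 + y)‖) ≤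
      1 / (3 * |s| * √A) + 1 / (3 * |s| * A) ∧
    (∫ y in A..B, 1 / (6 * |s| * y) * ‖g (s / 2 - y) + jumpDeriv ρ c (s / 2 - y)‖) ≤
      1 / (3 * |s| * √A) + 1 / (3 * |s| * A) := by
  have hs' : 0 < |s| := abs_pos.2 hs
  have hsA : 0 < √A := Real.sqrt_pos.2 hA
  have hsq : √A ^ 2 = A := Real.sq_sqrt hA.le
  have hQ : ∫ y in A..B, (1 / (6 * |s| * y)) ^ 2 ≤ (1 / (6 * |s| * √A)) ^ 2 := by
    have : ∀ y : ℝ, (1 / (6 * |s| * y)) ^ 2 = (1 / (6 * |s|)) ^ 2 * (1 / y ^ 2) := by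
      intro y; rw [div_pow, div_pow, mul_pow (6 * |s|) y]; field_simp
    simp_rw [this]
    rw [intervalIntegral.integral_const_mul, integral_inv_sq hA hAB]
    have : (0:ℝ) ≤ 1 / B := by have := hA.trans_le hAB; positivity
    calc _ ≤ (1 / (6 * |s|)) ^ 2 * (1 / A) := by gcongr; linarith
      _ = (1 / (6 * |s|)) ^ 2 * (1 / √A ^ 2) := by rw [hsq]
  have e : 1 / (3 * |s| * √A) + 1 / (3 * |s| * A) =
      2 * (1 / (6 * |s| * √A)) + 2 * (1 / (6 * |s| * A)) := by field_simp; ring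
  have hM : ∀ y, A ≤ y → 1 / (6 * |s| * y) ≤ 1 / (6 * |s| * A) := by
    intro y hy; gcongr
  rw [e]
  constructor
  · have h1 := intervalIntegral.integral_comp_add_left (a := A) (b := B)
      (fun k => 1 / (6 * |s| * (k - s / 2)) * ‖g k + jumpDeriv ρ c k‖) (s / 2)
    simp only [add_sub_cancel_left] at h1
    rw [h1]
    apply h.integral_weight_le (by linarith)
    · intro k hk
      have : 0 < k - s / 2 := by linarith [hk.1]
      exact ContinuousAt.continuousWithinAt (by fun_prop (disch := positivity))
    · intro k hk
      have : 0 < k - s / 2 := by linarith [hk.1]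
      positivity
    · positivity
    · have := intervalIntegral.integral_comp_add_left (a := A) (b := B)
        (fun k => (1 / (6 * |s| * (k - s / 2))) ^ 2) (s / 2)
      simp only [add_sub_cancel_left] at this
      rw [← this]; exact hQ
    · positivity
    · intro k hk _
      exact hM _ (by linarith [hk.1])
  · have h1 := intervalIntegral.integral_comp_sub_left (a := A) (b := B)
      (fun k => 1 / (6 * |s| * (s / 2 - k)) * ‖g k + jumpDeriv ρ c k‖) (s / 2)
    simp only [sub_sub_cancel] at h1
    rw [h1]
    apply h.integral_weight_le (by linarith)
    · intro k hk
      have : 0 < s / 2 - k := by linarith [hk.2]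
      exact ContinuousAt.continuousWithinAt (by fun_prop (disch := positivity))
    · intro k hk
      have : 0 < s / 2 - k := by linarith [hk.2]
      positivity
    · positivity
    · have := intervalIntegral.integral_comp_sub_left (a := A) (b := B)
        (fun k => (1 / (6 * |s| * (s / 2 - k))) ^ 2) (s / 2)
      simp only [sub_sub_cancel] at this
      rw [← this]; exact hQ
    · positivity
    · intro k hk _
      exact hM _ (by linarith [hk.2])

lemma Prof.norm_quadratic_far_le (h : Prof ρ N c w g) (hs : s ≠ 0) (hA : 0 < A) (hAB : A ≤ B) :
    ‖∫ y in A..B, cis (3 * s * y ^ 2) * (w (s / 2 + y) * w (s / 2 - y))‖ ≤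
      2 / (|s| * A) + 1 / (|s| * √A) := by
  have hs' : 0 < |s| := abs_pos.2 hs
  have hsA : 0 < √A := Real.sqrt_pos.2 hA
  have hB : 0 < B := hA.trans_le hAB
  obtain ⟨S, hS, hd⟩ := h.der
  have hpos : ∀ y ∈ Icc A B, 0 < y := fun y hy => hA.trans_le hy.1
  have hwc := h.cont
  obtain ⟨J1, J2⟩ := h.integral_symm_weight_le hs hA hAB
  set γ : ℝ → ℂ := fun k => g k + jumpDeriv ρ c k with hγ
  have ig : ∀ a b, IntervalIntegrable γ volume a b := h.intervalIntegrable_deriv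
  have i1 : IntervalIntegrable (fun y => γ (s / 2 + y)) volume A B := by
    have := (ig (s / 2 + A) (s / 2 + B)).comp_add_left (s / 2)
    simpa using this
  have i2 : IntervalIntegrable (fun y => γ (s / 2 - y)) volume A B := by
    have := (ig (s / 2 - A) (s / 2 - B)).comp_sub_left (s / 2)
    simpa using this
  set G : ℝ → ℂ := fun y => γ (s / 2 + y) * w (s / 2 - y) - w (s / 2 + y) * γ (s / 2 - y) with hG
  have hGi : IntervalIntegrable G volume A B :=
    (i1.mul_continuousOn (by fun_prop)).sub (i2.continuousOn_mul (by fun_prop))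
  have hcount : ((fun y => s / 2 + y) ⁻¹' S ∪ (fun y => s / 2 - y) ⁻¹' S).Countable :=
    (hS.preimage (add_right_injective _)).union (hS.preimage (sub_right_injective))
  have key := norm_integral_osc_le (w := fun y => w (s / 2 + y) * w (s / 2 - y)) (g := G)
    (r := fun y => 1 / (6 * s * y)) (r' := fun y => -(1 / (6 * s * y ^ 2)))
    (ψ := fun y => 3 * s * y ^ 2) (ψ' := fun y => 6 * s * y) hAB hcount
    (by
      intro y hy
      have := hpos y hy
      have h1 := ((hasDerivAt_id y).const_mul (6 * s)).inv (by simp [hs, this.ne'])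
      refine (h1.congr_deriv ?_).congr_of_eventuallyEq (Eventually.of_forall fun z => ?_)
      · simp; field_simp
      · simp)
    (by
      intro y hy
      exact ((hasDerivAt_pow 2 y).const_mul (3 * s)).congr_deriv (by simp; ring))
    (by
      intro y hy
      have := hpos y hy
      exact ContinuousAt.continuousWithinAt (by fun_prop (disch := positivity)))
    (by fun_prop) (by fun_prop)
    (by
      intro y hy
      have hy1 : s / 2 + y ∉ S := fun hh => hy.2 (Or.inl hh)
      have hy2 : s / 2 - y ∉ S := fun hh => hy.2 (Or.inr hh)
      have d1 := (hd _ hy1).scomp y ((hasDerivAt_id y).const_add (s / 2))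
      have d2 := (hd _ hy2).scomp y ((hasDerivAt_id y).const_sub (s / 2))
      refine (d1.mul d2).congr_deriv ?_
      simp [hG, hγ]
      ring)
    hGi
  have e0 : ∫ y in A..B, cis (3 * s * y ^ 2) * (w (s / 2 + y) * w (s / 2 - y)) =
      ∫ y in A..B, ((1 / (6 * s * y) * (6 * s * y) : ℝ) : ℂ) * cis (3 * s * y ^ 2) *
        (w (s / 2 + y) * w (s / 2 - y)) := by
    refine intervalIntegral.integral_congr fun y hy => ?_
    rw [uIcc_of_le hAB] at hy
    have := hpos y hy
    have : 1 / (6 * s * y) * (6 * s * y) = 1 := by field_simp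
    rw [this]; simp
  rw [e0]
  refine key.trans ?_
  have habs : ∀ y, 0 < y → |1 / (6 * s * y)| = 1 / (6 * |s| * y) := by
    intro y hy; rw [abs_div, abs_mul, abs_mul, abs_of_pos hy]; norm_num
  have hb : ∀ y, ‖w (s / 2 + y) * w (s / 2 - y)‖ ≤ 1 := by
    intro y; rw [norm_mul]
    exact mul_le_one₀ (h.bdd _) (norm_nonneg _) (h.bdd _)
  have hφ : ContinuousOn (fun y => 1 / (6 * |s| * y)) (uIcc A B) := by
    rw [uIcc_of_le hAB]
    intro y hy
    have := hpos y hy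
    exact ContinuousAt.continuousWithinAt (by fun_prop (disch := positivity))
  have hφ2 : ContinuousOn (fun y => 1 / (6 * |s|) * (1 / y ^ 2)) (uIcc A B) := by
    rw [uIcc_of_le hAB]
    intro y hy
    have := hpos y hy
    exact ContinuousAt.continuousWithinAt (by fun_prop (disch := positivity))
  have m1 := (i1.norm.continuousOn_mul hφ)
  have m2 := (i2.norm.continuousOn_mul hφ)
  have m0 : IntervalIntegrable (fun y => 1 / (6 * |s|) * (1 / y ^ 2)) volume A B :=
    hφ2.intervalIntegrable
  have m12 : IntervalIntegrable (fun y => 1 / (6 * |s| * y) * ‖γ (s / 2 + y)‖ +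
      1 / (6 * |s| * y) * ‖γ (s / 2 - y)‖) volume A B := m1.add m2
  have hI : ∫ y in A..B, (|-(1 / (6 * s * y ^ 2))| * ‖w (s / 2 + y) * w (s / 2 - y)‖ +
      |1 / (6 * s * y)| * ‖G y‖) ≤
      ∫ y in A..B, (1 / (6 * |s|) * (1 / y ^ 2) + (1 / (6 * |s| * y) * ‖γ (s / 2 + y)‖ +
        1 / (6 * |s| * y) * ‖γ (s / 2 - y)‖)) := by
    apply intervalIntegral.integral_mono_on hAB _ (m0.add m12)
    · intro y hy
      have hy0 := hpos y hy
      rw [habs y hy0, abs_neg, abs_div, abs_mul, abs_mul]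
      have hg : ‖G y‖ ≤ ‖γ (s / 2 + y)‖ + ‖γ (s / 2 - y)‖ := by
        refine (norm_sub_le _ _).trans ?_
        rw [norm_mul, norm_mul]
        have := mul_le_of_le_one_right (norm_nonneg (γ (s / 2 + y))) (h.bdd (s / 2 - y))
        have := mul_le_of_le_one_left (norm_nonneg (γ (s / 2 - y))) (h.bdd (s / 2 + y))
        linarith
      have e1 : |(1:ℝ)| / (|6| * |s| * |y ^ 2|) = 1 / (6 * |s|) * (1 / y ^ 2) := by
        rw [abs_one, abs_of_pos (by norm_num : (0:ℝ) < 6), abs_of_pos (by positivity : 0 < y ^ 2)]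
        field_simp
      rw [e1]
      have : 0 ≤ 1 / (6 * |s| * y) := by positivity
      have h1 := mul_le_mul_of_nonneg_left hg this
      have h2 := mul_le_of_le_one_right (by positivity : 0 ≤ 1 / (6 * |s|) * (1 / y ^ 2)) (hb y)
      linarith
    · apply IntervalIntegrable.add
      · apply ContinuousOn.intervalIntegrable
        rw [uIcc_of_le hAB]
        intro y hy
        have := hpos y hy
        exact ContinuousAt.continuousWithinAt (by fun_prop (disch := positivity))
      · apply hGi.norm.continuousOn_mul
        rw [uIcc_of_le hAB]
        intro y hy
        have := hpos y hy
        exact ContinuousAt.continuousWithinAt (by fun_prop (disch := positivity))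
  rw [intervalIntegral.integral_add m0 m12, intervalIntegral.integral_add m1 m2,
    intervalIntegral.integral_const_mul, integral_inv_sq hA hAB] at hI
  have hba : 1 / (6 * |s| * B) ≤ 1 / (6 * |s| * A) := by gcongr
  have b1 := mul_le_of_le_one_right (by positivity : 0 ≤ 1 / (6 * |s| * A)) (hb A)
  have b2 := mul_le_of_le_one_right (by positivity : 0 ≤ 1 / (6 * |s| * B)) (hb B)
  have b3 : 1 / (6 * |s|) * (1 / A - 1 / B) ≤ 1 / (6 * |s| * A) := by
    calc _ ≤ 1 / (6 * |s|) * (1 / A) := by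
          gcongr; have : 0 ≤ 1 / B := by positivity
          linarith
      _ = _ := by field_simp
  rw [habs A hA, habs B hB]
  have e1 : 1 / (3 * |s| * A) = 2 * (1 / (6 * |s| * A)) := by field_simp; norm_num
  have e2 : 2 / (|s| * A) = 12 * (1 / (6 * |s| * A)) := by field_simp; norm_num
  have e3 : 1 / (|s| * √A) = 3 * (1 / (3 * |s| * √A)) := by field_simp
  have p1 : 0 ≤ 1 / (6 * |s| * A) := by positivity
  have p2 : 0 ≤ 1 / (3 * |s| * √A) := by positivity
  simp only [hγ] at hI
  rw [e1] at J1 J2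
  rw [e2, e3]
  linarith

end MKdVPaper

namespace MKdVPaper

variable {ρ N R κ r s σ A B a b : ℝ} {c : ℂ} {w g : ℝ → ℂ}

lemma Prof.norm_quadratic_half_le (h : Prof ρ N c w g) (hσ : 0 < σ) (hσs : σ ^ 4 = |s|)
    (hB : 0 ≤ B) :
    ‖∫ y in (0:ℝ)..B, cis (3 * s * y ^ 2) * (w (s / 2 + y) * w (s / 2 - y))‖ ≤
      3 / σ ^ 2 + 1 / σ ^ 3 := by
  have hs : s ≠ 0 := by
    rintro rfl
    rw [abs_zero] at hσs
    exact (pow_pos hσ 4).ne' hσs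
  have hb : ∀ y, ‖cis (3 * s * y ^ 2) * (w (s / 2 + y) * w (s / 2 - y))‖ ≤ 1 := by
    intro y; rw [norm_mul, norm_cis, one_mul, norm_mul]
    exact mul_le_one₀ (h.bdd _) (norm_nonneg _) (h.bdd _)
  have hwc := h.cont
  have hcis : Continuous fun y : ℝ => cis (3 * s * y ^ 2) := continuous_cis.comp (by fun_prop)
  have hc : Continuous fun y => cis (3 * s * y ^ 2) * (w (s / 2 + y) * w (s / 2 - y)) := by
    fun_prop
  have near : ∀ b, 0 ≤ b → b ≤ 1 / σ ^ 2 →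
      ‖∫ y in (0:ℝ)..b, cis (3 * s * y ^ 2) * (w (s / 2 + y) * w (s / 2 - y))‖ ≤ 1 / σ ^ 2 := by
    intro b hb0 hb1
    have := intervalIntegral.norm_integral_le_of_norm_le_const (a := 0) (b := b)
      (fun y _ => hb y)
    rw [sub_zero, abs_of_nonneg hb0, one_mul] at this
    exact this.trans hb1
  have p : 0 < 1 / σ ^ 2 := by positivity
  have p' : 0 < 1 / σ ^ 3 := by positivity
  have e : 3 / σ ^ 2 = 3 * (1 / σ ^ 2) := by ring
  rcases le_total B (1 / σ ^ 2) with hB1 | hB1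
  · have := near B hB hB1
    linarith
  · rw [← intervalIntegral.integral_add_adjacent_intervals (b := 1 / σ ^ 2)
      (hc.intervalIntegrable _ _) (hc.intervalIntegrable _ _)]
    refine (norm_add_le _ _).trans ?_
    have h1 := near _ p.le le_rfl
    have h2 := h.norm_quadratic_far_le hs p hB1
    have e1 : √(1 / σ ^ 2) = 1 / σ := by
      rw [show 1 / σ ^ 2 = (1 / σ) ^ 2 by rw [div_pow, one_pow], Real.sqrt_sq (by positivity)]
    have e2 : 2 / (|s| * (1 / σ ^ 2)) + 1 / (|s| * √(1 / σ ^ 2)) =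
        2 * (1 / σ ^ 2) + 1 / σ ^ 3 := by
      rw [e1, ← hσs]; field_simp
    linarith

/-- Dispersive bound for the bilinear convolution. -/
theorem Prof.norm_bilinear_le (h : Prof ρ N c w g) (hσ : 0 < σ) (hσs : σ ^ 4 = |s|) (a b : ℝ) :
    ‖∫ k in a..b, modul w k * modul w (s - k)‖ ≤ 6 / σ ^ 2 + 2 / σ ^ 3 := by
  have hwc := h.cont
  have hcis : Continuous fun y : ℝ => cis (3 * s * y ^ 2) := continuous_cis.comp (by fun_prop)
  set f : ℝ → ℂ := fun y => cis (3 * s * y ^ 2) * (w (s / 2 + y) * w (s / 2 - y)) with hf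
  have hc : Continuous f := by rw [hf]; fun_prop
  have half : ∀ B, ‖∫ y in (0:ℝ)..B, f y‖ ≤ 3 / σ ^ 2 + 1 / σ ^ 3 := by
    intro B
    rcases le_total 0 B with hB | hB
    · exact h.norm_quadratic_half_le hσ hσs hB
    · have e : ∫ y in (0:ℝ)..B, f y = -∫ y in (0:ℝ)..(-B), f y := by
        have := intervalIntegral.integral_comp_neg (a := 0) (b := B) f
        rw [neg_zero, intervalIntegral.integral_symm 0 (-B)] at this
        rw [← this]
        refine intervalIntegral.integral_congr fun y _ => ?_
        simp only [hf]
        rw [neg_sq, ← sub_eq_add_neg, sub_neg_eq_add, mul_comm (w (s / 2 + y))]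
      rw [e, norm_neg]
      exact h.norm_quadratic_half_le hσ hσs (by linarith)
  have e : ∫ k in a..b, modul w k * modul w (s - k) =
      cis (s ^ 3 / 4) * ∫ y in (a - s / 2)..(b - s / 2), f y := by
    rw [← intervalIntegral.integral_const_mul,
      ← intervalIntegral.integral_comp_sub_right (fun y => cis (s ^ 3 / 4) * f y) (s / 2)]
    refine intervalIntegral.integral_congr fun k _ => ?_
    simp only [hf, modul]
    rw [show s / 2 + (k - s / 2) = k by ring, show s / 2 - (k - s / 2) = s - k by ring,
      ← mul_assoc (cis (s ^ 3 / 4)), ← cis_add]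
    rw [show s ^ 3 / 4 + 3 * s * (k - s / 2) ^ 2 = k ^ 3 + (s - k) ^ 3 by ring, cis_add]
    ring
  rw [e, norm_mul, norm_cis, one_mul,
    ← intervalIntegral.integral_interval_sub_left (hc.intervalIntegrable 0 _)
      (hc.intervalIntegrable 0 _)]
  refine (norm_sub_le _ _).trans ((add_le_add (half _) (half _)).trans (le_of_eq ?_))
  ring

end MKdVPaper

namespace MKdVPaper

variable {ρ N R κ r s : ℝ} {a b c v f F : ℝ → ℂ} {D : ℝ → ℝ}

/-- Measurable functions bounded by `M`. -/
def BddMeas (M : ℝ) (f : ℝ → ℂ) : Prop := Measurable f ∧ ∀ k, ‖f k‖ ≤ M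

/-- The trilinear convolution over the square `[-R, R]²`. -/
def tri (R κ : ℝ) (a b c : ℝ → ℂ) : ℂ :=
  ∫ q in Icc (-R) R ×ˢ Icc (-R) R, a q.1 * b q.2 * c (κ - q.1 - q.2)

lemma integrableOn_tri {A B C : ℝ} (ha : BddMeas A a) (hb : BddMeas B b) (hc : BddMeas C c)
    (R κ : ℝ) : IntegrableOn (fun q : ℝ × ℝ => a q.1 * b q.2 * c (κ - q.1 - q.2))
      (Icc (-R) R ×ˢ Icc (-R) R) := by
  have hA : 0 ≤ A := (norm_nonneg _).trans (ha.2 0)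
  have hB : 0 ≤ B := (norm_nonneg _).trans (hb.2 0)
  have hm : Measurable fun q : ℝ × ℝ => a q.1 * b q.2 * c (κ - q.1 - q.2) := by
    have h1 : Measurable fun q : ℝ × ℝ => a q.1 := ha.1.comp measurable_fst
    have h2 : Measurable fun q : ℝ × ℝ => b q.2 := hb.1.comp measurable_snd
    have h3 : Measurable fun q : ℝ × ℝ => c (κ - q.1 - q.2) :=
      hc.1.comp (by fun_prop)
    exact (h1.mul h2).mul h3
  have hfin : volume (Icc (-R) R ×ˢ Icc (-R) R) < ⊤ :=
    (isCompact_Icc.prod isCompact_Icc).measure_lt_top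
  refine Measure.integrableOn_of_bounded (M := A * B * C) hfin.ne hm.aestronglyMeasurable
    (Eventually.of_forall fun q => ?_)
  rw [norm_mul, norm_mul]
  have := ha.2 q.1
  have := hb.2 q.2
  have := hc.2 (κ - q.1 - q.2)
  gcongr

lemma tri_eq_iterated {A B C : ℝ} (ha : BddMeas A a) (hb : BddMeas B b) (hc : BddMeas C c)
    (R κ : ℝ) : tri R κ a b c =
      ∫ k in Icc (-R) R, ∫ l in Icc (-R) R, a k * b l * c (κ - k - l) := by
  unfold tri
  rw [Measure.volume_eq_prod, setIntegral_prod]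
  exact integrableOn_tri ha hb hc R κ

lemma tri_swap (R κ : ℝ) (a b c : ℝ → ℂ) : tri R κ a b c = tri R κ b a c := by
  unfold tri
  rw [Measure.volume_eq_prod, ← setIntegral_prod_swap]
  congr 1
  ext q
  simp only [Prod.fst_swap, Prod.snd_swap]
  rw [sub_right_comm, mul_comm (a q.2)]

lemma norm_tri_left_le {M B C : ℝ} (ha : BddMeas M a) (hb : BddMeas B b) (hc : BddMeas C c)
    (hsupp : ∀ k, ρ < |k| → a k = 0) (hD0 : ∀ k, 0 ≤ D k) (hD : IntegrableOn D (Icc (-ρ) ρ))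
    (hle : ∀ k ∈ Icc (-ρ) ρ, k ≠ κ → ‖∫ l in Icc (-R) R, b l * c (κ - k - l)‖ ≤ D k) :
    ‖tri R κ a b c‖ ≤ M * ∫ k in Icc (-ρ) ρ, D k := by
  have hM : 0 ≤ M := (norm_nonneg _).trans (ha.2 0)
  rw [tri_eq_iterated ha hb hc, ← integral_const_mul,
    ← integral_indicator (s := Icc (-ρ) ρ) measurableSet_Icc]
  have hi : Integrable ((Icc (-ρ) ρ).indicator fun k => M * D k) := by
    rw [integrable_indicator_iff measurableSet_Icc]; exact hD.const_mul M
  refine (norm_integral_le_of_norm_le hi.integrableOn (f := fun k => ∫ l in Icc (-R) R,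
    a k * b l * c (κ - k - l)) ?_).trans (setIntegral_le_integral hi ?_)
  · have hne : ∀ᵐ k : ℝ, k ≠ κ := by simp [ae_iff]
    filter_upwards [ae_restrict_of_ae hne] with k hk
    have e : ∫ l in Icc (-R) R, a k * b l * c (κ - k - l) =
        a k * ∫ l in Icc (-R) R, b l * c (κ - k - l) := by
      rw [← integral_const_mul]; congr 1; ext l; ring
    rw [e, norm_mul]
    by_cases hk' : k ∈ Icc (-ρ) ρ
    · rw [indicator_of_mem hk']
      exact mul_le_mul (ha.2 k) (hle k hk' hk) (norm_nonneg _) hM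
    · rw [indicator_of_notMem hk', hsupp k, norm_zero, zero_mul]
      by_contra! hlt
      exact hk' (abs_le.1 hlt)
  · exact Eventually.of_forall fun k => indicator_nonneg (fun k _ => mul_nonneg hM (hD0 k)) k

lemma norm_integral_mul_le_right {B M : ℝ} (hb : BddMeas B b) (hc : BddMeas M c) (hρ : 0 ≤ ρ)
    (hsupp : ∀ k, ρ < |k| → c k = 0) (s R : ℝ) :
    ‖∫ l in Icc (-R) R, b l * c (s - l)‖ ≤ 2 * (B * M) * ρ := by
  have hM : 0 ≤ M := (norm_nonneg _).trans (hc.2 0)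
  have hB : 0 ≤ B := (norm_nonneg _).trans (hb.2 0)
  have hi : Integrable ((Icc (s - ρ) (s + ρ)).indicator fun _ : ℝ => B * M) := by
    rw [integrable_indicator_iff measurableSet_Icc]; exact integrableOn_const (by simp)
  refine (norm_integral_le_of_norm_le hi.integrableOn (Eventually.of_forall fun l => ?_)).trans
    ((setIntegral_le_integral hi ?_).trans (le_of_eq ?_))
  · rw [norm_mul]
    by_cases hl : l ∈ Icc (s - ρ) (s + ρ)
    · rw [indicator_of_mem hl]
      exact mul_le_mul (hb.2 l) (hc.2 _) (norm_nonneg _) hB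
    · rw [indicator_of_notMem hl, hsupp, norm_zero, mul_zero]
      by_contra! hlt
      exact hl ⟨by linarith [(abs_le.1 hlt).2], by linarith [(abs_le.1 hlt).1]⟩
  · exact Eventually.of_forall fun k => indicator_nonneg (fun k _ => mul_nonneg hB hM) k
  · rw [integral_indicator measurableSet_Icc, setIntegral_const]
    simp only [Measure.real, Real.volume_Icc, smul_eq_mul]
    rw [ENNReal.toReal_ofReal (by linarith)]
    ring

lemma norm_integral_mul_le_left {B M : ℝ} (hb : BddMeas M b) (hc : BddMeas B c) (hρ : 0 ≤ ρ)
    (hsupp : ∀ k, ρ < |k| → b k = 0) (s R : ℝ) :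
    ‖∫ l in Icc (-R) R, b l * c (s - l)‖ ≤ 2 * (M * B) * ρ := by
  have hc' : BddMeas B fun l => c (s - l) := ⟨hc.1.comp (by fun_prop), fun l => hc.2 _⟩
  have hb' : BddMeas M fun l => b (-l) := ⟨hb.1.comp (by fun_prop), fun l => hb.2 _⟩
  have := norm_integral_mul_le_right hc' hb' hρ (fun k hk => hsupp _ (by rwa [abs_neg])) 0 R
  simp only [zero_sub, neg_neg] at this
  rw [mul_comm M B]
  refine le_trans (le_of_eq ?_) this
  congr 2
  ext l
  ring

lemma norm_tri_right_le {M : ℝ} (hf : BddMeas 1 f) (hv : BddMeas M v)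
    (hsupp : ∀ k, ρ < |k| → v k = 0) (hD0 : ∀ k, 0 ≤ D k) (hD : IntegrableOn D (Icc (-ρ) ρ))
    (hle : ∀ k ∈ Icc (-ρ) ρ, k ≠ κ → ∀ x y : ℝ, ‖∫ l in x..y, f l * f (κ - k - l)‖ ≤ D k) :
    ‖tri R κ f f v‖ ≤ M * ∫ k in Icc (-ρ) ρ, D k := by
  have hM : 0 ≤ M := (norm_nonneg _).trans (hv.2 0)
  set e : ℝ → ℂ := (Icc (-R) R).indicator f with he
  have hem : Measurable e := hf.1.indicator measurableSet_Icc
  have heb : ∀ k, ‖e k‖ ≤ 1 := fun k => (norm_indicator_le_norm_self f k).trans (hf.2 k)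
  have e1 : tri R κ f f v = ∫ k, ∫ l, v l * (e k * e (κ - l - k)) := by
    rw [tri_eq_iterated hf hf hv, ← integral_indicator measurableSet_Icc]
    congr 1
    ext k
    rw [← integral_sub_left_eq_self _ volume (κ - k)]
    by_cases hk : k ∈ Icc (-R) R
    · rw [indicator_of_mem hk, ← integral_indicator measurableSet_Icc]
      congr 1
      ext l
      by_cases hl : l ∈ Icc (-R) R
      · rw [indicator_of_mem hl, he, indicator_of_mem hk,
          show κ - (κ - k - l) - k = l by ring, indicator_of_mem hl]
        ring
      · rw [indicator_of_notMem hl, he, show κ - (κ - k - l) - k = l by ring,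
          indicator_of_notMem hl]
        ring
    · rw [indicator_of_notMem hk, he, indicator_of_notMem hk]
      simp
  have hG : Integrable (Function.uncurry fun k l => v l * (e k * e (κ - l - k)))
      (volume.prod volume) := by
    have hm : Measurable (Function.uncurry fun k l => v l * (e k * e (κ - l - k))) := by
      have h1 : Measurable fun q : ℝ × ℝ => e q.1 := hem.comp measurable_fst
      have h2 : Measurable fun q : ℝ × ℝ => v q.2 := hv.1.comp measurable_snd
      have h3 : Measurable fun q : ℝ × ℝ => e (κ - q.2 - q.1) := hem.comp (by fun_prop)
      exact h2.mul (h1.mul h3)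
    have hi : Integrable ((Icc (-R) R ×ˢ Icc (-ρ) ρ).indicator fun _ : ℝ × ℝ => M)
        (volume.prod volume) := by
      rw [integrable_indicator_iff (measurableSet_Icc.prod measurableSet_Icc)]
      refine integrableOn_const ?_
      rw [← Measure.volume_eq_prod]
      exact (isCompact_Icc.prod isCompact_Icc).measure_lt_top.ne
    refine hi.mono' hm.aestronglyMeasurable (Eventually.of_forall fun q => ?_)
    rw [Function.uncurry]
    by_cases hq : q ∈ Icc (-R) R ×ˢ Icc (-ρ) ρ
    · rw [indicator_of_mem hq, norm_mul, norm_mul]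
      have := mul_le_one₀ (heb q.1) (norm_nonneg _) (heb (κ - q.2 - q.1))
      calc _ ≤ M * 1 := mul_le_mul (hv.2 _) this (by positivity) hM
        _ = M := mul_one M
    · rw [indicator_of_notMem hq]
      apply le_of_eq
      rw [norm_eq_zero]
      by_cases h1 : q.1 ∈ Icc (-R) R
      · rw [hsupp q.2, zero_mul]
        by_contra! hlt
        exact hq ⟨h1, abs_le.1 hlt⟩
      · rw [he, indicator_of_notMem h1]; ring
  rw [e1, integral_integral_swap hG, ← integral_const_mul,
    ← integral_indicator (s := Icc (-ρ) ρ) measurableSet_Icc]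
  have hi : Integrable ((Icc (-ρ) ρ).indicator fun k => M * D k) := by
    rw [integrable_indicator_iff measurableSet_Icc]; exact hD.const_mul M
  refine norm_integral_le_of_norm_le hi ?_
  have hne : ∀ᵐ k : ℝ, k ≠ κ := by simp [ae_iff]
  filter_upwards [hne] with l hl
  rw [integral_const_mul, norm_mul]
  by_cases hl' : l ∈ Icc (-ρ) ρ
  · rw [indicator_of_mem hl']
    refine mul_le_mul (hv.2 l) ?_ (norm_nonneg _) hM
    have e2 : ∫ k, e k * e (κ - l - k) =
        ∫ k in Icc (max (-R) (κ - l - R)) (min R (κ - l + R)), f k * f (κ - l - k) := by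
      rw [← integral_indicator measurableSet_Icc]
      congr 1
      ext k
      by_cases hk : k ∈ Icc (max (-R) (κ - l - R)) (min R (κ - l + R))
      · have h1 := max_le_iff.1 hk.1
        have h2 := le_min_iff.1 hk.2
        have h3 : k ∈ Icc (-R) R := ⟨h1.1, h2.1⟩
        have h4 : κ - l - k ∈ Icc (-R) R := ⟨by linarith [h2.2], by linarith [h1.2]⟩
        rw [indicator_of_mem hk, he, indicator_of_mem h3, indicator_of_mem h4]
      · rw [indicator_of_notMem hk]
        by_cases h1 : k ∈ Icc (-R) R
        · have h2 : κ - l - k ∉ Icc (-R) R := fun h2 =>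
            hk ⟨max_le h1.1 (by linarith [h2.2]), le_min h1.2 (by linarith [h2.1])⟩
          rw [he, indicator_of_notMem h2, mul_zero]
        · rw [he, indicator_of_notMem h1, zero_mul]
    rw [e2]
    rcases le_or_gt (max (-R) (κ - l - R)) (min R (κ - l + R)) with hxy | hxy
    · rw [integral_Icc_eq_integral_Ioc, ← intervalIntegral.integral_of_le hxy]
      exact hle l hl' hl _ _
    · rw [Icc_eq_empty (not_le.2 hxy)]
      simpa using hD0 l
  · rw [indicator_of_notMem hl', hsupp l, norm_zero, zero_mul]
    by_contra! hlt
    exact hl' (abs_le.1 hlt)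

/-- Perturbing the trilinear convolution near zero frequency. -/
theorem norm_tri_sub_le (hR : 0 ≤ R) (hρ : 0 ≤ ρ) (hf : BddMeas 1 f) (hv : BddMeas 2 v)
    (hF : BddMeas 1 F) (hFv : ∀ k, F k = f k + v k)
    (hsupp : ∀ k, ρ < |k| → v k = 0) (hD0 : ∀ k, 0 ≤ D k) (hD : IntegrableOn D (Icc (-ρ) ρ))
    (hle : ∀ k ∈ Icc (-ρ) ρ, k ≠ κ → ∀ x y : ℝ, ‖∫ l in x..y, f l * f (κ - k - l)‖ ≤ D k) :
    ‖tri R κ F F F - tri R κ f f f‖ ≤ 6 * (∫ k in Icc (-ρ) ρ, D k) + 48 * ρ ^ 2 := by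
  have hle' : ∀ k ∈ Icc (-ρ) ρ, k ≠ κ → ‖∫ l in Icc (-R) R, f l * f (κ - k - l)‖ ≤ D k := by
    intro k hk hk'
    rw [integral_Icc_eq_integral_Ioc, ← intervalIntegral.integral_of_le (by linarith)]
    exact hle k hk hk' _ _
  have b1 := norm_tri_left_le (R := R) hv hf hf hsupp hD0 hD hle'
  have b2 : ‖tri R κ f v f‖ ≤ 2 * ∫ k in Icc (-ρ) ρ, D k := by rw [tri_swap]; exact b1
  have b3 := norm_tri_right_le (R := R) hf hv hsupp hD0 hD hle
  have hconst : ∫ k in Icc (-ρ) ρ, 4 * ρ = 8 * ρ ^ 2 := by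
    rw [setIntegral_const]
    simp only [Measure.real, Real.volume_Icc, smul_eq_mul]
    rw [ENNReal.toReal_ofReal (by linarith)]
    ring
  have hci : IntegrableOn (fun _ : ℝ => 4 * ρ) (Icc (-ρ) ρ) := integrableOn_const (by simp)
  have c1 := norm_tri_left_le (R := R) (κ := κ) hv hv hF hsupp (fun _ => by positivity) hci
    fun k _ _ => (norm_integral_mul_le_left hv hF hρ hsupp (κ - k) R).trans (by linarith)
  have c2 := norm_tri_left_le (R := R) (κ := κ) hv hf hv hsupp (fun _ => by positivity) hci
    fun k _ _ => (norm_integral_mul_le_right hf hv hρ hsupp (κ - k) R).trans (by linarith)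
  have c3 : ‖tri R κ f v v‖ ≤ 2 * ∫ k in Icc (-ρ) ρ, 4 * ρ := by rw [tri_swap]; exact c2
  rw [hconst] at c1 c2 c3
  have i1 := integrableOn_tri hv hf hf R κ
  have i2 := integrableOn_tri hf hv hf R κ
  have i3 := integrableOn_tri hf hf hv R κ
  have i4 := integrableOn_tri hv hv hF R κ
  have i5 := integrableOn_tri hv hf hv R κ
  have i6 := integrableOn_tri hf hv hv R κ
  have i0 := integrableOn_tri hf hf hf R κ
  have e : tri R κ F F F = tri R κ f f f + (tri R κ v f f + (tri R κ f v f + (tri R κ f f v +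
      (tri R κ v v F + (tri R κ v f v + tri R κ f v v))))) := by
    have j5 := i5.add i6
    have j4 := i4.add j5
    have j3 := i3.add j4
    have j2 := i2.add j3
    have j1 := i1.add j2
    unfold tri
    rw [← integral_add' i5 i6, ← integral_add' i4 j5, ← integral_add' i3 j4,
      ← integral_add' i2 j3, ← integral_add' i1 j2, ← integral_add' i0 j1]
    congr 1
    ext q
    simp only [Pi.add_apply, hFv]
    ring
  rw [e, add_sub_cancel_left]
  refine (norm_add_le _ _).trans ?_
  refine (add_le_add le_rfl (norm_add_le _ _)).trans ?_
  refine (add_le_add le_rfl (add_le_add le_rfl (norm_add_le _ _))).trans ?_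
  refine (add_le_add le_rfl (add_le_add le_rfl (add_le_add le_rfl (norm_add_le _ _)))).trans ?_
  have := norm_add_le (tri R κ v f v) (tri R κ f v v)
  linarith

end MKdVPaper

namespace MKdVPaper

variable {ρ n k : ℝ} {W : ℝ → ℂ}

/-- Normalized profiles. -/
structure Raw (W : ℝ → ℂ) : Prop where
  symm : ∀ k, W (-k) = starRingEnd ℂ (W k)
  bdd : ∀ k, ‖W k‖ ≤ 1
  diff : ∀ k, 0 < k → DifferentiableAt ℝ W k
  int : IntegrableOn (fun k => ‖deriv W k‖ ^ 2) (Ioi 0)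
  L2 : ∫ k in Ioi 0, ‖deriv W k‖ ^ 2 ≤ 1

lemma Raw.diff' (h : Raw W) (hk : k ≠ 0) : DifferentiableAt ℝ W k := by
  rcases lt_or_gt_of_ne hk with hk | hk
  · have e : W = fun k => starRingEnd ℂ (W (-k)) := by
      ext k; rw [← h.symm, neg_neg]
    have h1 : DifferentiableAt ℝ (fun k : ℝ => W (-k)) k :=
      DifferentiableAt.comp k (h.diff (-k) (by linarith)) (by fun_prop)
    have h2 : DifferentiableAt ℝ (fun z : ℂ => starRingEnd ℂ z) (W (-k)) :=
      Complex.conjCLE.differentiableAt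
    rw [e]
    exact DifferentiableAt.comp (g := fun z : ℂ => starRingEnd ℂ z) k h2 h1
  · exact h.diff k hk

lemma Raw.measurable (h : Raw W) : Measurable W :=
  measurable_of_continuousOn_compl_singleton 0 fun _ hk =>
    (h.diff' hk).continuousAt.continuousWithinAt

lemma Raw.norm_deriv_neg (h : Raw W) (k : ℝ) : ‖deriv W (-k)‖ = ‖deriv W k‖ := by
  have h1 : deriv (fun k => W (-k)) k = -deriv W (-k) := deriv_comp_neg W k
  have e : (fun k => W (-k)) = fun k => star (W k) := by
    ext k; exact h.symm k
  rw [e, deriv.star] at h1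
  rw [← norm_neg, ← h1, norm_star]

lemma Raw.integrable_sq (h : Raw W) : Integrable fun k => ‖deriv W k‖ ^ 2 := by
  rw [← integrableOn_univ, ← Iic_union_Ioi (a := (0:ℝ)), integrableOn_union]
  refine ⟨?_, h.int⟩
  rw [integrableOn_Iic_iff_integrableOn_Iio]
  have := ((Measure.measurePreserving_neg (volume : Measure ℝ)).integrableOn_comp_preimage
    (Homeomorph.neg ℝ).measurableEmbedding).2 h.int
  simp only [Function.comp_def, h.norm_deriv_neg] at this
  simpa using this

lemma Raw.integral_sq_le (h : Raw W) : ∫ k, ‖deriv W k‖ ^ 2 ≤ 2 := by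
  have := integral_comp_abs (f := fun k => ‖deriv W k‖ ^ 2)
  have e : ∀ k, ‖deriv W |k|‖ ^ 2 = ‖deriv W k‖ ^ 2 := by
    intro k
    rcases abs_choice k with hk | hk <;> rw [hk]
    rw [h.norm_deriv_neg]
  simp only [e] at this
  rw [this]
  linarith [h.L2]

/-- Smoothing the jump at the origin on the scale `ρ` and cutting off beyond `n`. -/
def regProfile (ρ n : ℝ) (W : ℝ → ℂ) (k : ℝ) : ℂ :=
  (max 0 (min 1 (2 - |k| / n)) : ℝ) * (((W (max ρ (min n |k|))).re : ℂ) +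
    Complex.I * (max (-1) (min 1 (k / ρ)) : ℝ) * ((W (max ρ (min n |k|))).im : ℂ))

/-- The square-integrable part of the derivative of `regProfile`. -/
def regDeriv (ρ n : ℝ) (W : ℝ → ℂ) (k : ℝ) : ℂ :=
  if ρ < |k| ∧ |k| < n then deriv W k
  else if n < k ∧ k < 2 * n then -(W n / n)
  else if n < -k ∧ -k < 2 * n then W (-n) / n
  else 0

lemma regProfile_inner (hρ : 0 < ρ) (hn : ρ < n) (hk : |k| ≤ ρ) :
    regProfile ρ n W k = (W ρ).re + Complex.I * (k / ρ : ℝ) * (W ρ).im := by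
  have hn0 : 0 < n := hρ.trans hn
  have h1 : |k| / n ≤ 1 := by rw [div_le_one hn0]; linarith
  have h2 := abs_le.1 hk
  have h3 : k / ρ ≤ 1 := by rw [div_le_one hρ]; exact h2.2
  have h4 : -1 ≤ k / ρ := by rw [le_div_iff₀ hρ]; linarith
  rw [regProfile, min_eq_left (by linarith), max_eq_right zero_le_one, min_eq_right (by linarith),
    max_eq_left hk, min_eq_right h3, max_eq_right h4]
  simp

lemma Raw.regProfile_middle (h : Raw W) (hρ : 0 < ρ) (hk : ρ ≤ |k|) (hk' : |k| ≤ n) :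
    regProfile ρ n W k = W k := by
  have hn0 : 0 < n := by linarith
  have h1 : |k| / n ≤ 1 := by rw [div_le_one hn0]; linarith
  rw [regProfile, min_eq_left (by linarith), max_eq_right zero_le_one, min_eq_right hk',
    max_eq_right hk]
  rcases le_total 0 k with h0 | h0
  · rw [abs_of_nonneg h0] at *
    have h3 : 1 ≤ k / ρ := by rw [le_div_iff₀ hρ]; linarith
    rw [min_eq_left h3, max_eq_right (by norm_num)]
    rw [mul_comm Complex.I]
    simp [mul_comm Complex.I, Complex.re_add_im]
  · rw [abs_of_nonpos h0] at *
    have h3 : k / ρ ≤ -1 := by rw [div_le_iff₀ hρ]; linarith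
    rw [min_eq_right (by linarith), max_eq_left h3, h.symm]
    apply Complex.ext <;> simp

lemma regProfile_taper (hρ : 0 < ρ) (hn : ρ < n) (hk : n ≤ k) (hk' : k ≤ 2 * n) :
    regProfile ρ n W k = (2 - k / n : ℝ) * W n := by
  have hn0 : 0 < n := by linarith
  have h1 : 1 ≤ k / n := by rw [le_div_iff₀ hn0]; linarith
  have h2 : k / n ≤ 2 := by rw [div_le_iff₀ hn0]; linarith
  have h3 : 1 ≤ k / ρ := by rw [le_div_iff₀ hρ]; linarith
  rw [regProfile, abs_of_nonneg (by linarith), min_eq_right (by linarith),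
    max_eq_right (by linarith), min_eq_left hk, max_eq_right hn.le, min_eq_left h3,
    max_eq_right (by norm_num)]
  congr 1
  simp [mul_comm Complex.I, Complex.re_add_im]

lemma regProfile_neg (ρ n : ℝ) (W : ℝ → ℂ) (k : ℝ) :
    regProfile ρ n W (-k) = starRingEnd ℂ (regProfile ρ n W k) := by
  have e : max (-1) (min 1 (-k / ρ)) = -max (-1) (min 1 (k / ρ)) := by
    rw [neg_div]
    simp only [max_def, min_def]
    split_ifs <;> linarith
  rw [regProfile, regProfile, abs_neg, e]
  simp [Complex.conj_ofReal]

lemma regProfile_outer (hn : 0 < n) (hk : 2 * n ≤ |k|) : regProfile ρ n W k = 0 := by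
  have : 2 ≤ |k| / n := by rw [le_div_iff₀ hn]; linarith
  rw [regProfile, max_eq_left ((min_le_right _ _).trans (by linarith))]
  simp

lemma Raw.continuous_regProfile (h : Raw W) (hρ : 0 < ρ) : Continuous (regProfile ρ n W) := by
  have hW : Continuous fun k : ℝ => W (max ρ (min n |k|)) := by
    rw [continuous_iff_continuousAt]
    intro k
    have h1 : ContinuousAt W (max ρ (min n |k|)) :=
      (h.diff _ (hρ.trans_le (le_max_left _ _))).continuousAt
    exact ContinuousAt.comp (f := fun k : ℝ => max ρ (min n |k|)) h1 (by fun_prop)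
  have hre : Continuous fun k : ℝ => ((W (max ρ (min n |k|))).re : ℂ) :=
    Complex.continuous_ofReal.comp (Complex.continuous_re.comp hW)
  have him : Continuous fun k : ℝ => ((W (max ρ (min n |k|))).im : ℂ) :=
    Complex.continuous_ofReal.comp (Complex.continuous_im.comp hW)
  have h1 : Continuous fun k : ℝ => ((max 0 (min 1 (2 - |k| / n)) : ℝ) : ℂ) :=
    Complex.continuous_ofReal.comp
      (continuous_const.max (continuous_const.min (continuous_const.sub
        (continuous_abs.div_const n))))
  have h2 : Continuous fun k : ℝ => ((max (-1) (min 1 (k / ρ)) : ℝ) : ℂ) :=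
    Complex.continuous_ofReal.comp
      (continuous_const.max (continuous_const.min (continuous_id.div_const ρ)))
  exact h1.mul (hre.add ((continuous_const.mul h2).mul him))

lemma norm_re_add_im_le {z : ℂ} {x : ℝ} (hx : |x| ≤ 1) :
    ‖(z.re : ℂ) + Complex.I * x * (z.im : ℂ)‖ ≤ ‖z‖ := by
  have hx2 : x ^ 2 ≤ 1 := by rw [← sq_abs]; exact pow_le_one₀ (abs_nonneg x) hx
  rw [← sq_le_sq₀ (norm_nonneg _) (norm_nonneg _), ← Complex.normSq_eq_norm_sq,
    ← Complex.normSq_eq_norm_sq, Complex.normSq_apply, Complex.normSq_apply]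
  simp
  nlinarith [mul_nonneg (sub_nonneg.2 hx2) (sq_nonneg z.im)]

lemma Raw.norm_regProfile_le (h : Raw W) (k : ℝ) : ‖regProfile ρ n W k‖ ≤ 1 := by
  rw [regProfile, norm_mul, Complex.norm_real, Real.norm_of_nonneg (le_max_left _ _)]
  refine mul_le_one₀ (max_le zero_le_one (min_le_left _ _)) (norm_nonneg _) ?_
  refine (norm_re_add_im_le (abs_le.2 ⟨le_max_left _ _, ?_⟩)).trans (h.bdd _)
  exact max_le (by norm_num) (min_le_left _ _)

lemma Raw.hasDerivAt_regProfile (h : Raw W) (hρ : 0 < ρ) (hn : ρ < n)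
    (h1 : |k| ≠ ρ) (h2 : |k| ≠ n) (h3 : |k| ≠ 2 * n) :
    HasDerivAt (regProfile ρ n W)
      (regDeriv ρ n W k + jumpDeriv ρ (Complex.I * (W ρ).im) k) k := by
  have hn0 : 0 < n := hρ.trans hn
  have hca : Continuous fun k : ℝ => |k| := continuous_abs
  rcases lt_or_gt_of_ne h1 with a1 | a1
  · have ev : regProfile ρ n W =ᶠ[𝓝 k]
        fun k => (W ρ).re + Complex.I * (k / ρ : ℝ) * (W ρ).im := by
      filter_upwards [hca.continuousAt.eventually_lt_const a1] with l hl
      exact regProfile_inner hρ hn hl.le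
    have g0 : regDeriv ρ n W k = 0 := by
      rw [regDeriv, if_neg (by rintro ⟨p, _⟩; linarith),
        if_neg (by rintro ⟨p, _⟩; linarith [le_abs_self k]),
        if_neg (by rintro ⟨p, _⟩; linarith [neg_le_abs k])]
    rw [g0, zero_add, jumpDeriv, if_pos a1.le]
    refine HasDerivAt.congr_of_eventuallyEq ?_ ev
    have d := ((((hasDerivAt_id k).div_const ρ).ofReal_comp.const_mul Complex.I).mul_const
      ((W ρ).im : ℂ)).const_add ((W ρ).re : ℂ)
    refine d.congr_deriv ?_
    push_cast
    ring
  have j0 : jumpDeriv ρ (Complex.I * (W ρ).im) k = 0 := by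
    rw [jumpDeriv, if_neg (not_le.2 a1)]
  rw [j0, add_zero]
  rcases lt_or_gt_of_ne h2 with a2 | a2
  · have ev : regProfile ρ n W =ᶠ[𝓝 k] W := by
      filter_upwards [hca.continuousAt.eventually_lt_const a2,
        hca.continuousAt.eventually_const_lt a1] with l hl hl'
      exact h.regProfile_middle hρ hl'.le hl.le
    rw [regDeriv, if_pos ⟨a1, a2⟩]
    refine HasDerivAt.congr_of_eventuallyEq ?_ ev
    exact (h.diff' (abs_pos.1 (hρ.trans a1))).hasDerivAt
  rw [regDeriv, if_neg (by rintro ⟨_, p⟩; linarith)]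
  have pos : ∀ l : ℝ, n < l → l < 2 * n →
      HasDerivAt (regProfile ρ n W) (-(W n / n)) l := by
    intro l p q
    have ev : regProfile ρ n W =ᶠ[𝓝 l] fun k => ((2 - k / n : ℝ) : ℂ) * W n := by
      filter_upwards [Ioo_mem_nhds p q] with m hm
      exact regProfile_taper hρ hn hm.1.le hm.2.le
    refine HasDerivAt.congr_of_eventuallyEq ?_ ev
    have d := (((hasDerivAt_id l).div_const n).const_sub 2).ofReal_comp.mul_const (W n)
    refine d.congr_deriv ?_
    push_cast
    ring
  rcases lt_or_gt_of_ne h3 with a3 | a3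
  · rcases le_total 0 k with h0 | h0
    · rw [abs_of_nonneg h0] at a2 a3
      rw [if_pos ⟨a2, a3⟩]
      exact pos k a2 a3
    · rw [abs_of_nonpos h0] at a2 a3
      rw [if_neg (by rintro ⟨p, _⟩; linarith), if_pos ⟨a2, a3⟩]
      have e : regProfile ρ n W = fun k => star (regProfile ρ n W (-k)) := by
        ext k; rw [regProfile_neg]; exact (Complex.conj_conj _).symm
      rw [e]
      have d := ((pos (-k) a2 a3).scomp k (hasDerivAt_neg k)).star
      refine d.congr_deriv ?_
      rw [h.symm]
      simp
  · have ev : regProfile ρ n W =ᶠ[𝓝 k] fun _ => 0 := by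
      filter_upwards [hca.continuousAt.eventually_const_lt a3] with l hl
      exact regProfile_outer hn0 hl.le
    rw [if_neg (by rintro ⟨_, p⟩; rw [abs_of_pos (by linarith)] at a3; linarith),
      if_neg (by rintro ⟨_, p⟩; rw [abs_of_neg (by linarith)] at a3; linarith)]
    exact HasDerivAt.congr_of_eventuallyEq (hasDerivAt_const k 0) ev

lemma measurable_regDeriv (ρ n : ℝ) (W : ℝ → ℂ) : Measurable (regDeriv ρ n W) := by
  unfold regDeriv
  refine Measurable.ite ?_ (measurable_deriv W) (Measurable.ite ?_ measurable_const
    (Measurable.ite ?_ measurable_const measurable_const))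
  · exact ((isOpen_lt continuous_const continuous_abs).inter
      (isOpen_lt continuous_abs continuous_const)).measurableSet
  · exact ((isOpen_lt continuous_const continuous_id).inter
      (isOpen_lt continuous_id continuous_const)).measurableSet
  · exact ((isOpen_lt continuous_const continuous_neg).inter
      (isOpen_lt continuous_neg continuous_const)).measurableSet

lemma Raw.norm_regDeriv_sq_le (h : Raw W) (hn : 0 < n) (k : ℝ) :
    ‖regDeriv ρ n W k‖ ^ 2 ≤
      ‖deriv W k‖ ^ 2 + (Icc (-(2 * n)) (2 * n)).indicator (fun _ => 1 / n ^ 2) k := by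
  have hi : 0 ≤ (Icc (-(2 * n)) (2 * n)).indicator (fun _ : ℝ => 1 / n ^ 2) k :=
    indicator_nonneg (fun _ _ => by positivity) k
  have hw : ∀ l, ‖W l / n‖ ^ 2 ≤ 1 / n ^ 2 := by
    intro l
    rw [norm_div, Complex.norm_real, Real.norm_of_nonneg hn.le, div_pow]
    gcongr
    exact pow_le_one₀ (norm_nonneg _) (h.bdd l)
  have hd : 0 ≤ ‖deriv W k‖ ^ 2 := by positivity
  unfold regDeriv
  split_ifs with c1 c2 c3
  · linarith
  · rw [indicator_of_mem (by constructor <;> linarith [c2.1, c2.2]), norm_neg]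
    linarith [hw n]
  · rw [indicator_of_mem (by constructor <;> linarith [c3.1, c3.2])]
    linarith [hw (-n)]
  · rw [norm_zero]; simp only [ne_eq, OfNat.ofNat_ne_zero, not_false_eq_true, zero_pow]; linarith

theorem Raw.prof (h : Raw W) (hρ : 0 < ρ) (hρ2 : ρ ≤ 1 / 2) (hn : 2 ≤ n) :
    Prof ρ (2 * n) (Complex.I * (W ρ).im) (regProfile ρ n W) (regDeriv ρ n W) := by
  have hn0 : 0 < n := by linarith
  have hind : Integrable ((Icc (-(2 * n)) (2 * n)).indicator (fun _ : ℝ => 1 / n ^ 2)) := by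
    rw [integrable_indicator_iff measurableSet_Icc]; exact integrableOn_const (by simp)
  have hmaj := h.integrable_sq.add hind
  have hsq : Integrable fun k => ‖regDeriv ρ n W k‖ ^ 2 := by
    refine hmaj.mono' ((measurable_regDeriv ρ n W).norm.pow_const 2).aestronglyMeasurable
      (Eventually.of_forall fun k => ?_)
    rw [Real.norm_of_nonneg (by positivity)]
    exact h.norm_regDeriv_sq_le hn0 k
  refine ⟨hρ, hρ2, by linarith, ?_, h.continuous_regProfile hρ, h.norm_regProfile_le, ?_,
    regProfile_neg ρ n W, ?_, ?_, ?_⟩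
  · rw [norm_mul, Complex.norm_I, one_mul, Complex.norm_real]
    exact (Complex.abs_im_le_norm _).trans (h.bdd ρ)
  · exact fun k hk => regProfile_outer hn0 hk
  · refine ⟨{ρ, -ρ, n, -n, 2 * n, -(2 * n)}, Set.Countable.mono subset_rfl
      (Set.toFinite _).countable, fun k hk => ?_⟩
    simp only [mem_insert_iff, mem_singleton_iff, not_or] at hk
    obtain ⟨k1, k2, k3, k4, k5, k6⟩ := hk
    refine h.hasDerivAt_regProfile hρ (by linarith) ?_ ?_ ?_
    · intro e
      rcases abs_choice k with a | a
      · exact k1 (by linarith)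
      · exact k2 (by linarith)
    · intro e
      rcases abs_choice k with a | a
      · exact k3 (by linarith)
      · exact k4 (by linarith)
    · intro e
      rcases abs_choice k with a | a
      · exact k5 (by linarith)
      · exact k6 (by linarith)
  · exact (memLp_two_iff_integrable_sq_norm
      (measurable_regDeriv ρ n W).aestronglyMeasurable).2 hsq
  · refine (integral_mono hsq hmaj fun k => h.norm_regDeriv_sq_le hn0 k).trans ?_
    rw [integral_add' h.integrable_sq hind, integral_indicator measurableSet_Icc,
      setIntegral_const]
    simp only [Measure.real, Real.volume_Icc, smul_eq_mul]
    rw [ENNReal.toReal_ofReal (by linarith)]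
    have e : (2 * n - -(2 * n)) * (1 / n ^ 2) = 4 / n := by field_simp; ring
    have : 4 / n ≤ 2 := by rw [div_le_iff₀ hn0]; linarith
    rw [e]
    linarith [h.integral_sq_le]

end MKdVPaper

namespace MKdVPaper

variable {ρ N κ r τ : ℝ} {c : ℂ} {w g W : ℝ → ℂ}

lemma Prof.bddMeas_modul (h : Prof ρ N c w g) : BddMeas 1 (modul w) :=
  ⟨(continuous_modul h.cont).measurable, fun k => (norm_modul w k).trans_le (h.bdd k)⟩

lemma one_div_two_pi_le : 1 / (2 * Real.pi) ≤ 1 := by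
  rw [div_le_one (by positivity)]
  linarith [Real.pi_gt_three]

lemma Prof.tri_modul_eq (h : Prof ρ N c w g) (hr : 2 ≤ r) (hN : r ^ 4 + 1 ≤ N) :
    ∃ z : ℂ, ‖z‖ ≤ 800000 * (brInt + 2) / r ∧ tri (r ^ 4) κ (modul w) (modul w) (modul w) =
      ((1 / (2 * Real.pi) : ℝ) : ℂ) *
        ((∫ x in Ioi (-3 * (r ^ 4) ^ 2), osc N w x ^ 3 * cis (-(κ * x))) + z) := by
  have h_int : Integrable fun x => osc (r ^ 4) w x ^ 2 * osc N w x := by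
    simpa [cis_zero] using (h.norm_truncation_integral_le (κ := 0) hr hN).1
  have hm := h.bddMeas_modul
  refine ⟨_, (h.norm_truncation_integral_le (κ := κ) hr hN).2, ?_⟩
  rw [tri_eq_iterated hm hm hm, h.trilinear_eq_integral (by positivity) h_int, add_sub_cancel]

lemma Prof.norm_tri_modul_sub_le (h : Prof ρ N c w g) (hκ : 6 ≤ κ)
    (hρ : 1 ≤ 100 * ρ * (κ / 6)) (hτ : 1 ≤ τ) (hτκ : τ ^ 4 = 3 * κ) (hr : 2 ≤ r)
    (hrκ : κ + 1 ≤ r ^ 4) (hN : r ^ 4 + 1 ≤ N) :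
    ‖tri (r ^ 4) κ (modul w) (modul w) (modul w) -
      ((1 / (2 * Real.pi) : ℝ) : ℂ) * mainTerm w κ‖ ≤
      (300000000000000 + 1300000000 * (brInt + 37)) / τ ^ 5 + 800000 * (brInt + 2) / r := by
  obtain ⟨z, hz, e⟩ := h.tri_modul_eq (κ := κ) hr hN
  have h1 := h.norm_integral_cube_sub_le hκ hρ hτ hτκ hrκ
  rw [e, ← mul_sub, norm_mul, Complex.norm_real, Real.norm_of_nonneg (by positivity)]
  refine (mul_le_of_le_one_left (norm_nonneg _) one_div_two_pi_le).trans ?_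
  rw [add_sub_right_comm]
  exact (norm_add_le _ _).trans (add_le_add h1 hz)

lemma Prof.norm_tri_modul_le (h : Prof ρ N c w g) (hκ : 0 < κ) (hκ6 : κ ≤ 6)
    (hρ : 1 ≤ 100 * ρ * 12) (hr : 2 ≤ r) (hN : r ^ 4 + 1 ≤ N) :
    ‖tri (r ^ 4) κ (modul w) (modul w) (modul w)‖ ≤
      6000000000 + 64000 * 432 + 262144 * brInt + 800000 * (brInt + 2) / r := by
  obtain ⟨z, hz, e⟩ := h.tri_modul_eq (κ := κ) hr hN
  have hr4 : (2 : ℝ) ^ 4 ≤ r ^ 4 := by gcongr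
  have h1 := h.norm_integral_cube_le hκ hκ6 hρ (b := r ^ 4) (by linarith)
  rw [e, norm_mul, Complex.norm_real, Real.norm_of_nonneg (by positivity)]
  refine (mul_le_of_le_one_left (norm_nonneg _) one_div_two_pi_le).trans ?_
  exact (norm_add_le _ _).trans (add_le_add h1 hz)

/-- Replacing a profile by its regularization changes the trilinear integral only through the
bilinear integrals near the origin. -/
lemma Raw.norm_tri_sub_regProfile_le (h : Raw W) {R n : ℝ} {D : ℝ → ℝ} (hR : 0 ≤ R) (hρ : 0 < ρ)
    (hκ : 0 ≤ κ) (hn : 2 * R + κ ≤ n) (hD0 : ∀ k, 0 ≤ D k)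
    (hD : IntegrableOn D (Icc (-ρ) ρ))
    (hle : ∀ k ∈ Icc (-ρ) ρ, k ≠ κ → ∀ x y : ℝ,
      ‖∫ l in x..y, modul (regProfile ρ n W) l * modul (regProfile ρ n W) (κ - k - l)‖ ≤ D k) :
    ‖tri R κ (modul W) (modul W) (modul W) -
      tri R κ (modul (regProfile ρ n W)) (modul (regProfile ρ n W)) (modul (regProfile ρ n W))‖ ≤
      6 * (∫ k in Icc (-ρ) ρ, D k) + 48 * ρ ^ 2 := by
  set f := modul (regProfile ρ n W) with hf
  set F : ℝ → ℂ := fun k => if |k| ≤ n then modul W k else f k with hF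
  have hfc : Continuous f := continuous_modul (h.continuous_regProfile hρ)
  have hfb : BddMeas 1 f :=
    ⟨hfc.measurable, fun k => (norm_modul _ k).trans_le (h.norm_regProfile_le k)⟩
  have hWm : Measurable (modul W) := by
    have h1 : Continuous fun k : ℝ => cis (k ^ 3) := continuous_cis.comp (by fun_prop)
    exact h1.measurable.mul h.measurable
  have hFm : Measurable F :=
    Measurable.ite (isClosed_le continuous_abs continuous_const).measurableSet hWm hfc.measurable
  have hFb : BddMeas 1 F := by
    refine ⟨hFm, fun k => ?_⟩
    simp only [hF]
    split_ifs
    · rw [norm_modul]; exact h.bdd k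
    · exact hfb.2 k
  have hFW : ∀ k, |k| ≤ n → F k = modul W k := fun k hk => if_pos hk
  have e : tri R κ (modul W) (modul W) (modul W) = tri R κ F F F := by
    unfold tri
    refine setIntegral_congr_fun (measurableSet_Icc.prod measurableSet_Icc) fun q hq => ?_
    have h1 := hq.1.1
    have h2 := hq.1.2
    have h3 := hq.2.1
    have h4 := hq.2.2
    rw [hFW q.1 (abs_le.2 ⟨by linarith, by linarith⟩),
      hFW q.2 (abs_le.2 ⟨by linarith, by linarith⟩),
      hFW (κ - q.1 - q.2) (abs_le.2 ⟨by linarith, by linarith⟩)]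
  rw [e]
  refine norm_tri_sub_le (v := fun k => F k - f k) hR hρ.le hfb ⟨hFm.sub hfc.measurable,
    fun k => ?_⟩ hFb (fun k => by ring) (fun k hk => ?_) hD0 hD hle
  · exact (norm_sub_le _ _).trans (by linarith [hFb.2 k, hfb.2 k])
  · simp only [hF]
    split_ifs with hk'
    · rw [hf, modul, modul, h.regProfile_middle hρ hk.le hk', sub_self]
    · exact sub_self _

theorem Raw.norm_tri_sub_mainTerm_le (h : Raw W) (hκ : 6 ≤ κ) (hτ : 1 ≤ τ)
    (hτκ : τ ^ 4 = 3 * κ) (hr : 2 ≤ r) (hrκ : κ + 1 ≤ r ^ 4) :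
    ‖tri (r ^ 4) κ (modul W) (modul W) (modul W) -
      ((1 / (2 * Real.pi) : ℝ) : ℂ) * mainTerm W κ‖ ≤
      (300000000000000 + 1300000000 * (brInt + 37) + 1872) / τ ^ 5 + 800000 * (brInt + 2) / r := by
  have hκ0 : 0 < κ := by linarith
  have hτ0 : 0 < τ := by linarith
  set ρ : ℝ := 1 / κ with hρdef
  set n : ℝ := 2 * r ^ 4 + κ with hn
  have hr4 : (2 : ℝ) ^ 4 ≤ r ^ 4 := by gcongr
  have hρ0 : 0 < ρ := by positivity
  have hρ6 : ρ ≤ 1 / 6 := one_div_le_one_div_of_le (by norm_num) hκ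
  have hρκ : ρ * κ = 1 := by rw [hρdef]; field_simp
  have P := h.prof (n := n) hρ0 (by linarith) (by linarith)
  have h1 := P.norm_tri_modul_sub_le hκ (by linarith) hτ hτκ hr hrκ (by linarith)
  have em : mainTerm (regProfile ρ n W) κ = mainTerm W κ := by
    have m1 : regProfile ρ n W κ = W κ :=
      h.regProfile_middle hρ0 (by rw [abs_of_pos hκ0]; linarith)
        (by rw [abs_of_pos hκ0]; linarith)
    have m2 : regProfile ρ n W (κ / 3) = W (κ / 3) :=
      h.regProfile_middle hρ0 (by rw [abs_of_pos (by positivity)]; linarith)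
        (by rw [abs_of_pos (by positivity)]; linarith)
    rw [mainTerm, mainTerm, m1, m2]
  rw [em] at h1
  have h2 := h.norm_tri_sub_regProfile_le (κ := κ) (R := r ^ 4) (n := n) (ρ := ρ)
    (D := fun _ => 40 / τ ^ 2) (by positivity) hρ0 hκ0.le le_rfl (fun _ => by positivity)
    (integrableOn_const (by simp)) (fun k hk _ x y => by
      have hs : κ - 1 / 6 ≤ κ - k := by linarith [hk.2]
      have hs0 : 0 < κ - k := by linarith
      have hσ : (((κ - k) ^ (1 / 4 : ℝ)) ^ 4 : ℝ) = |κ - k| := by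
        rw [← Real.rpow_natCast, ← Real.rpow_mul hs0.le, abs_of_pos hs0]
        norm_num
      have hσ0 : 0 < (κ - k) ^ (1 / 4 : ℝ) := by positivity
      refine (P.norm_bilinear_le hσ0 hσ x y).trans ?_
      set σ := (κ - k) ^ (1 / 4 : ℝ)
      have hστ : τ / 2 ≤ σ := by
        refine le_of_pow_le_pow_left₀ (n := 4) (by norm_num) hσ0.le ?_
        rw [hσ, abs_of_pos hs0, div_pow, hτκ]
        linarith
      calc 6 / σ ^ 2 + 2 / σ ^ 3 ≤ 6 / (τ / 2) ^ 2 + 2 / (τ / 2) ^ 3 := by gcongr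
        _ = 24 / τ ^ 2 + 16 / τ ^ 2 / τ := by field_simp; ring
        _ ≤ 24 / τ ^ 2 + 16 / τ ^ 2 := add_le_add le_rfl (div_le_self (by positivity) hτ)
        _ = 40 / τ ^ 2 := by ring)
  have hI : ∫ k in Icc (-ρ) ρ, 40 / τ ^ 2 = 80 * ρ / τ ^ 2 := by
    rw [setIntegral_const, Real.volume_real_Icc_of_le (by linarith), smul_eq_mul]
    ring
  rw [hI] at h2
  have hρτ : ρ = 3 / τ ^ 4 := by rw [hτκ, hρdef]; field_simp
  have h3 : 6 * (80 * ρ / τ ^ 2) + 48 * ρ ^ 2 ≤ 1872 / τ ^ 5 := by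
    rw [hρτ]
    have a : 6 * (80 * (3 / τ ^ 4) / τ ^ 2) ≤ 1440 / τ ^ 5 := by
      rw [show 6 * (80 * (3 / τ ^ 4) / τ ^ 2) = 1440 / τ ^ 5 / τ by field_simp; norm_num]
      exact div_le_self (by positivity) hτ
    have b : 48 * (3 / τ ^ 4) ^ 2 ≤ 432 / τ ^ 5 := by
      rw [show 48 * (3 / τ ^ 4) ^ 2 = 432 / τ ^ 5 / τ ^ 3 by field_simp; norm_num]
      exact div_le_self (by positivity) (one_le_pow₀ hτ)
    calc _ ≤ 1440 / τ ^ 5 + 432 / τ ^ 5 := add_le_add a b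
      _ = _ := by ring
  refine (norm_sub_le_norm_sub_add_norm_sub _ _ _).trans ((add_le_add h2 h1).trans ?_)
  rw [add_div (300000000000000 + 1300000000 * (brInt + 37))]
  linarith

lemma integrableOn_abs_rpow_neg_three_quarters :
    IntegrableOn (fun s : ℝ => |s| ^ (-(3 / 4) : ℝ)) (Icc (-7) 7) := by
  have h1 : IntegrableOn (fun s : ℝ => |s| ^ (-(3 / 4) : ℝ)) (Ioc 0 7) := by
    have := (intervalIntegrable_iff_integrableOn_Ioc_of_le (by norm_num)).1
      (intervalIntegral.intervalIntegrable_rpow' (a := 0) (b := 7) (r := -(3 / 4)) (by norm_num))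
    refine this.congr_fun (fun s hs => ?_) measurableSet_Ioc
    simp only
    rw [abs_of_pos hs.1]
  have h2 : IntegrableOn (fun s : ℝ => |s| ^ (-(3 / 4) : ℝ)) (Ico (-7) 0) := by
    have := ((Measure.measurePreserving_neg (volume : Measure ℝ)).integrableOn_comp_preimage
      (Homeomorph.neg ℝ).measurableEmbedding).2 h1
    simpa [Function.comp_def] using this
  rw [← Icc_union_Icc_eq_Icc (b := 0) (by norm_num) (by norm_num), integrableOn_union]
  exact ⟨(integrableOn_Icc_iff_integrableOn_Ico (by simp)).2 h2,
    (integrableOn_Icc_iff_integrableOn_Ioc (by simp)).2 h1⟩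

/-- The constant in the bound for the trilinear integral at low frequency. -/
def lowConst : ℝ :=
  6000000000 + 64000 * 432 + 262144 * brInt + 6 * (∫ s in Icc (-7) 7, 14 * |s| ^ (-(3 / 4) : ℝ)) + 2

lemma lowConst_nonneg : 0 ≤ lowConst := by
  have h1 := brInt_nonneg
  have h2 : 0 ≤ ∫ s in Icc (-7 : ℝ) 7, 14 * |s| ^ (-(3 / 4) : ℝ) :=
    integral_nonneg fun s => by positivity
  unfold lowConst
  positivity

theorem Raw.norm_tri_le (h : Raw W) (hκ : 0 < κ) (hκ6 : κ ≤ 6) (hr : 2 ≤ r) :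
    ‖tri (r ^ 4) κ (modul W) (modul W) (modul W)‖ ≤ lowConst + 800000 * (brInt + 2) / r := by
  set n : ℝ := 2 * r ^ 4 + κ with hn
  have hr4 : (2 : ℝ) ^ 4 ≤ r ^ 4 := by gcongr
  have P := h.prof (ρ := 1 / 6) (n := n) (by norm_num) (by norm_num) (by linarith)
  have h1 := P.norm_tri_modul_le hκ hκ6 (by norm_num) hr (by linarith)
  have hG := integrableOn_abs_rpow_neg_three_quarters.const_mul 14
  have mp : MeasurePreserving (fun k : ℝ => κ - k) volume volume :=
    Measure.measurePreserving_sub_left volume κ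
  have me : MeasurableEmbedding (fun k : ℝ => κ - k) :=
    (Homeomorph.subLeft κ).measurableEmbedding
  have hGk := (mp.integrableOn_comp_preimage me).2 hG
  have hsub : Icc (-(1 / 6)) (1 / 6) ⊆ (fun k : ℝ => κ - k) ⁻¹' Icc (-7) 7 := by
    intro k hk
    constructor <;> simp only <;> linarith [hk.1, hk.2]
  have hI : ∫ k in Icc (-(1 / 6)) (1 / 6), 14 * |κ - k| ^ (-(3 / 4) : ℝ) ≤
      ∫ s in Icc (-7) 7, 14 * |s| ^ (-(3 / 4) : ℝ) := by
    rw [← mp.setIntegral_preimage_emb me (fun s => 14 * |s| ^ (-(3 / 4) : ℝ))]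
    refine setIntegral_mono_set hGk (Eventually.of_forall fun k => ?_) hsub.eventuallyLE
    simp only [Pi.zero_apply]
    positivity
  have h2 := h.norm_tri_sub_regProfile_le (κ := κ) (R := r ^ 4) (n := n) (ρ := 1 / 6)
    (D := fun k => 14 * |κ - k| ^ (-(3 / 4) : ℝ)) (by positivity) (by norm_num) hκ.le le_rfl
    (fun k => by positivity) (hGk.mono_set hsub) (fun k hk hkκ x y => by
      have hs0 : 0 < |κ - k| := abs_pos.2 (sub_ne_zero.2 hkκ.symm)
      have hs7 : |κ - k| ≤ 7 := abs_le.2 (hsub hk)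
      have hσ : ((|κ - k| ^ (1 / 4 : ℝ)) ^ 4 : ℝ) = |κ - k| := by
        rw [← Real.rpow_natCast, ← Real.rpow_mul hs0.le]
        norm_num
      have hσ0 : 0 < |κ - k| ^ (1 / 4 : ℝ) := by positivity
      refine (P.norm_bilinear_le hσ0 hσ x y).trans ?_
      have e : |κ - k| ^ (-(3 / 4) : ℝ) = 1 / (|κ - k| ^ (1 / 4 : ℝ)) ^ 3 := by
        rw [Real.rpow_neg hs0.le, ← Real.rpow_natCast, ← Real.rpow_mul hs0.le, one_div]
        norm_num
      rw [e]
      set σ := |κ - k| ^ (1 / 4 : ℝ)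
      have hσ2 : σ ≤ 2 := by
        refine le_of_pow_le_pow_left₀ (n := 4) (by norm_num) (by norm_num) ?_
        rw [hσ]
        linarith
      rw [show 14 * (1 / σ ^ 3) = 12 / σ ^ 3 + 2 / σ ^ 3 by ring]
      gcongr ?_ + _
      rw [div_le_div_iff₀ (by positivity) (by positivity)]
      nlinarith [sq_nonneg σ])
  have h3 := norm_le_norm_add_norm_sub' (tri (r ^ 4) κ (modul W) (modul W) (modul W))
    (tri (r ^ 4) κ (modul (regProfile (1 / 6) n W)) (modul (regProfile (1 / 6) n W))
      (modul (regProfile (1 / 6) n W)))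
  unfold lowConst
  linarith

end MKdVPaper

namespace MKdVPaper

variable {κ r τ t : ℝ} {w W : ℝ → ℂ}

lemma jap_le {y : ℝ} (hy : 0 ≤ y) : jap y ≤ 1 + y :=
  Real.sqrt_le_iff.2 ⟨by linarith, by nlinarith⟩

lemma one_le_jap (y : ℝ) : 1 ≤ jap y := Real.one_le_sqrt.2 (by nlinarith [sq_nonneg y])

lemma le_jap (y : ℝ) : y ≤ jap y := Real.le_sqrt_of_sq_le (by linarith)

/-- The resonant bracket of the expansion. -/
def resBracket (W : ℝ → ℂ) (κ : ℝ) : ℂ :=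
  Complex.I * ((‖W κ‖ : ℂ)) ^ 2 * W κ -
    ((1 / Real.sqrt 3 : ℝ) : ℂ) * cis (-(8 * κ ^ 3 / 9)) * W (κ / 3) ^ 3

lemma Raw.norm_resBracket_le (h : Raw W) (κ : ℝ) : ‖resBracket W κ‖ ≤ 2 := by
  have h3 : (1 : ℝ) / √3 ≤ 1 := by
    rw [div_le_one (by positivity)]; exact Real.one_le_sqrt.2 (by norm_num)
  have a : ‖Complex.I * ((‖W κ‖ : ℂ)) ^ 2 * W κ‖ ≤ 1 := by
    rw [norm_mul, norm_mul, norm_pow, Complex.norm_I, one_mul, Complex.norm_real, norm_norm]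
    exact mul_le_one₀ (pow_le_one₀ (norm_nonneg _) (h.bdd κ)) (norm_nonneg _) (h.bdd κ)
  have b : ‖((1 / Real.sqrt 3 : ℝ) : ℂ) * cis (-(8 * κ ^ 3 / 9)) * W (κ / 3) ^ 3‖ ≤ 1 := by
    rw [norm_mul, norm_mul, norm_pow, norm_cis, mul_one, Complex.norm_real,
      Real.norm_of_nonneg (by positivity)]
    exact mul_le_one₀ h3 (by positivity) (pow_le_one₀ (norm_nonneg _) (h.bdd _))
  exact (norm_sub_le _ _).trans (by linarith)

lemma mainTerm_eq_resBracket (hκ : 0 < κ) (W : ℝ → ℂ) :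
    Complex.I * (cis (-κ ^ 3) * (((1 / (2 * Real.pi) : ℝ) : ℂ) * mainTerm W κ)) =
      ((Real.pi / κ : ℝ) : ℂ) * resBracket W κ := by
  have e1 : cis (-κ ^ 3) * cis (κ ^ 3) = 1 := by rw [← cis_add, neg_add_cancel, cis_zero]
  have e2 : cis (-κ ^ 3) * cis (κ ^ 3 / 9) = cis (-(8 * κ ^ 3 / 9)) := by
    rw [← cis_add]; congr 1; ring
  have e3 : ((‖W κ‖ : ℂ)) ^ 2 = W κ * starRingEnd ℂ (W κ) := (Complex.mul_conj' (W κ)).symm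
  have e4 : ((1 / (2 * Real.pi) : ℝ) : ℂ) * ((2 * Real.pi ^ 2 / κ : ℝ) : ℂ) =
      ((Real.pi / κ : ℝ) : ℂ) := by
    rw [← Complex.ofReal_mul]; congr 1; field_simp
  have e5 : Complex.I / (√3 : ℝ) = Complex.I * ((1 / Real.sqrt 3 : ℝ) : ℂ) := by
    push_cast; ring
  rw [mainTerm, resBracket, e3, ← e2, ← e4, e5]
  linear_combination (((1 / (2 * Real.pi) : ℝ) : ℂ) * ((2 * Real.pi ^ 2 / κ : ℝ) : ℂ)) *
    (Complex.I * W κ ^ 2 * starRingEnd ℂ (W κ) * e1 +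
    ((1 / Real.sqrt 3 : ℝ) : ℂ) * W (κ / 3) ^ 3 * (cis (-κ ^ 3) * cis (κ ^ 3 / 9)) *
      Complex.I_sq)

lemma abs_pi_div_sub_le (hκ : 0 < κ) :
    |Real.pi / κ - Real.pi * κ ^ 2 / jap (κ ^ 3)| ≤ 4 / κ ^ 4 := by
  have h1 := one_le_jap (κ ^ 3)
  have h2 := le_jap (κ ^ 3)
  have h3 := jap_le (y := κ ^ 3) (by positivity)
  set J := jap (κ ^ 3)
  have hJ : 0 < J := by linarith
  have e : Real.pi / κ - Real.pi * κ ^ 2 / J = Real.pi * (J - κ ^ 3) / (κ * J) := by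
    field_simp
  rw [e, abs_of_nonneg (div_nonneg (mul_nonneg Real.pi_pos.le (by linarith)) (by positivity))]
  have h4 : κ * κ ^ 3 ≤ κ * J := by gcongr
  calc Real.pi * (J - κ ^ 3) / (κ * J) ≤ 4 * 1 / (κ * κ ^ 3) := by
        gcongr
        · exact Real.pi_le_four
        · linarith
    _ = 4 / κ ^ 4 := by ring

/-- The constant of the normalized expansion. -/
def expConst : ℝ :=
  2 * (300000000000000 + 1300000000 * (brInt + 37) + 1880) + 12 * (lowConst + 300) + 800000 * (brInt + 2)

lemma expConst_pos : 0 < expConst := by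
  have h1 := brInt_nonneg
  have h2 := lowConst_nonneg
  unfold expConst
  positivity

theorem Raw.norm_tri_sub_resBracket_le (h : Raw W) (hκ : 0 < κ) (hr : 2 ≤ r)
    (hrκ : κ + 1 ≤ r ^ 4) :
    ‖Complex.I * (cis (-κ ^ 3) * tri (r ^ 4) κ (modul W) (modul W) (modul W)) -
      ((Real.pi * κ ^ 2 / jap (κ ^ 3) : ℝ) : ℂ) * resBracket W κ‖ ≤
      expConst / (κ ^ (1 / 2 : ℝ) * jap (κ ^ 3) ^ (1 / 4 : ℝ)) + expConst / r := by
  have hbr := brInt_nonneg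
  have hlow := lowConst_nonneg
  have hJ1 := one_le_jap (κ ^ 3)
  have hJ2 := jap_le (y := κ ^ 3) (by positivity)
  have hJ0 : 0 < jap (κ ^ 3) := by linarith
  have hB := h.norm_resBracket_le κ
  set E := κ ^ (1 / 2 : ℝ) * jap (κ ^ 3) ^ (1 / 4 : ℝ) with hE
  have hE0 : 0 < E := by positivity
  have hr1 : 800000 * (brInt + 2) / r ≤ expConst / r := by
    gcongr
    unfold expConst
    linarith
  rcases le_total 6 κ with h6 | h6
  · set τ := (3 * κ) ^ (1 / 4 : ℝ) with hτdef
    have hτ1 : 1 ≤ τ := Real.one_le_rpow (by linarith) (by norm_num)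
    have hτ0 : 0 < τ := by linarith
    have hτκ : τ ^ 4 = 3 * κ := by
      rw [hτdef, ← Real.rpow_natCast, ← Real.rpow_mul (by positivity)]
      norm_num
    have m := h.norm_tri_sub_mainTerm_le h6 hτ1 hτκ hr hrκ
    have hEτ : E ≤ 2 * τ ^ 5 := by
      refine le_of_pow_le_pow_left₀ (n := 4) (by norm_num) (by positivity) ?_
      have a1 : (κ ^ (1 / 2 : ℝ)) ^ 4 = κ ^ 2 := by
        rw [← Real.rpow_natCast, ← Real.rpow_mul hκ.le, ← Real.rpow_natCast κ 2]
        norm_num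
      have a2 : (jap (κ ^ 3) ^ (1 / 4 : ℝ)) ^ 4 = jap (κ ^ 3) := by
        rw [← Real.rpow_natCast, ← Real.rpow_mul hJ0.le]
        norm_num
      have a3 : (1 : ℝ) ≤ κ ^ 3 := one_le_pow₀ (by linarith)
      rw [hE, mul_pow, a1, a2]
      calc κ ^ 2 * jap (κ ^ 3) ≤ κ ^ 2 * (2 * κ ^ 3) := by gcongr; linarith
        _ = 2 * κ ^ 5 := by ring
        _ ≤ 16 * (3 * κ) ^ 5 := by rw [mul_pow]; nlinarith [pow_pos hκ 5]
        _ = (2 * τ ^ 5) ^ 4 := by rw [← hτκ]; ring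
    have h4 : 8 / κ ^ 4 ≤ 8 / τ ^ 5 := by
      gcongr
      calc τ ^ 5 ≤ τ ^ 8 := pow_le_pow_right₀ hτ1 (by norm_num)
        _ = (τ ^ 4) ^ 2 := by ring
        _ = 9 * κ ^ 2 := by rw [hτκ]; ring
        _ ≤ κ ^ 2 * κ ^ 2 := by gcongr; nlinarith
        _ = κ ^ 4 := by ring
    have h5 : ‖((Real.pi / κ : ℝ) : ℂ) * resBracket W κ -
        ((Real.pi * κ ^ 2 / jap (κ ^ 3) : ℝ) : ℂ) * resBracket W κ‖ ≤ 8 / κ ^ 4 := by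
      rw [← sub_mul, ← Complex.ofReal_sub, norm_mul, Complex.norm_real, Real.norm_eq_abs]
      calc _ ≤ 4 / κ ^ 4 * 2 :=
            mul_le_mul (abs_pi_div_sub_le hκ) hB (norm_nonneg _) (by positivity)
        _ = _ := by ring
    have h6' : ‖Complex.I * (cis (-κ ^ 3) * tri (r ^ 4) κ (modul W) (modul W) (modul W)) -
        ((Real.pi / κ : ℝ) : ℂ) * resBracket W κ‖ ≤
        (300000000000000 + 1300000000 * (brInt + 37) + 1872) / τ ^ 5 + 800000 * (brInt + 2) / r := by
      rw [← mainTerm_eq_resBracket hκ, ← mul_sub, ← mul_sub, norm_mul, norm_mul, norm_cis,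
        Complex.norm_I, one_mul, one_mul]
      exact m
    have h7 : (300000000000000 + 1300000000 * (brInt + 37) + 1872) / τ ^ 5 + 8 / τ ^ 5 ≤ expConst / E := by
      rw [← add_div, div_le_div_iff₀ (by positivity) hE0]
      calc _ ≤ (300000000000000 + 1300000000 * (brInt + 37) + 1872 + 8) * (2 * τ ^ 5) := by gcongr
        _ = (2 * (300000000000000 + 1300000000 * (brInt + 37) + 1880)) * τ ^ 5 := by ring
        _ ≤ expConst * τ ^ 5 := by
          gcongr
          unfold expConst
          linarith
    refine (norm_sub_le_norm_sub_add_norm_sub _ _ _).trans ((add_le_add h6' h5).trans ?_)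
    linarith
  · have m := h.norm_tri_le hκ h6 hr
    have hκ3 : κ ^ 3 ≤ 6 ^ 3 := by gcongr
    have hE12 : E ≤ 12 := by
      have a1 : κ ^ (1 / 2 : ℝ) ≤ 3 := by
        rw [← Real.sqrt_eq_rpow]
        exact Real.sqrt_le_iff.2 ⟨by norm_num, by linarith⟩
      have a2 : jap (κ ^ 3) ^ (1 / 4 : ℝ) ≤ 4 := by
        refine le_of_pow_le_pow_left₀ (n := 4) (by norm_num) (by norm_num) ?_
        rw [← Real.rpow_natCast, ← Real.rpow_mul hJ0.le]
        norm_num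
        linarith
      calc E ≤ 3 * 4 := mul_le_mul a1 a2 (by positivity) (by norm_num)
        _ = 12 := by norm_num
    have h5 : ‖((Real.pi * κ ^ 2 / jap (κ ^ 3) : ℝ) : ℂ) * resBracket W κ‖ ≤ 300 := by
      rw [norm_mul, Complex.norm_real, Real.norm_of_nonneg (by positivity)]
      have h4 : Real.pi * κ ^ 2 / jap (κ ^ 3) ≤ 4 * 6 ^ 2 / 1 := by
        gcongr
        exact Real.pi_le_four
      calc _ ≤ 4 * 6 ^ 2 / 1 * (2 : ℝ) := mul_le_mul h4 hB (norm_nonneg _) (by norm_num)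
        _ ≤ 300 := by norm_num
    have h6' : ‖Complex.I * (cis (-κ ^ 3) * tri (r ^ 4) κ (modul W) (modul W) (modul W))‖ ≤
        lowConst + 800000 * (brInt + 2) / r := by
      rw [norm_mul, norm_mul, norm_cis, Complex.norm_I, one_mul, one_mul]
      exact m
    have h7 : lowConst + 300 ≤ expConst / E := by
      rw [le_div_iff₀ hE0]
      calc _ ≤ (lowConst + 300) * 12 := by gcongr
        _ ≤ expConst := by unfold expConst; linarith
    refine (norm_sub_le _ _).trans ((add_le_add h6' h5).trans ?_)
    linarith

end MKdVPaper

namespace MKdVPaper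

variable {κ r t p : ℝ} {w : ℝ → ℂ}

lemma MemE.norm_le_supN (h : MemE w) (k : ℝ) : ‖w k‖ ≤ supN w := le_ciSup h.bdd k

lemma dL2_nonneg (w : ℝ → ℂ) : 0 ≤ dL2 w := ENNReal.toReal_nonneg

lemma MemE.supN_le (ht : 0 < t) : supN w ≤ EnormP t w :=
  le_add_of_nonneg_right (mul_nonneg (by positivity) (dL2_nonneg w))

lemma MemE.dL2_sq (h : MemE w) : dL2 w ^ 2 = ∫ k in Ioi 0, ‖deriv w k‖ ^ 2 := by
  have h0 : 0 ≤ ∫ k in Ioi 0, ‖deriv w k‖ ^ 2 := integral_nonneg fun k => by positivity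
  rw [dL2, h.derivL2.eLpNorm_eq_integral_rpow_norm (by norm_num) (by norm_num),
    ENNReal.toReal_ofReal (by positivity), ← Real.rpow_natCast, ← Real.rpow_mul (by positivity)]
  norm_num

/-- Normalization and parabolic rescaling of a profile. -/
theorem MemE.raw (h : MemE w) {θ : ℝ} (hθ : 0 < θ) (hθt : θ ^ 3 = t) (hE : 0 < EnormP t w) :
    Raw fun k => w (θ⁻¹ * k) / (EnormP t w : ℂ) := by
  have ht : 0 < t := by rw [← hθt]; positivity
  have hdd : ∀ k, 0 < k → HasDerivAt (fun k => w (θ⁻¹ * k) / (EnormP t w : ℂ))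
      (θ⁻¹ • deriv w (θ⁻¹ * k) / (EnormP t w : ℂ)) k := by
    intro k hk
    have d := (h.diff (θ⁻¹ * k) (mem_Ioi.2 (by positivity))).hasDerivAt
    have d2 : HasDerivAt (fun k : ℝ => θ⁻¹ * k) θ⁻¹ k := by
      simpa using (hasDerivAt_id k).const_mul θ⁻¹
    exact (HasDerivAt.scomp (𝕜' := ℝ) (h := fun k : ℝ => θ⁻¹ * k) k d d2).div_const _
  have hsq : ∀ k ∈ Ioi (0 : ℝ), ‖deriv (fun k => w (θ⁻¹ * k) / (EnormP t w : ℂ)) k‖ ^ 2 =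
      (θ⁻¹ / EnormP t w) ^ 2 * ‖deriv w (θ⁻¹ * k)‖ ^ 2 := by
    intro k hk
    rw [(hdd k hk).deriv, norm_div, norm_smul, Complex.norm_real, Real.norm_of_nonneg hE.le,
      Real.norm_of_nonneg (by positivity)]
    ring
  have h_int : IntegrableOn (fun k => ‖deriv w k‖ ^ 2) (Ioi 0) := by
    exact h.derivL2.integrable_norm_pow (by norm_num)
  have h_int2 : IntegrableOn (fun k => ‖deriv w (θ⁻¹ * k)‖ ^ 2) (Ioi 0) := by
    have := (integrableOn_Ioi_comp_mul_left_iff (fun k => ‖deriv w k‖ ^ 2) 0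
      (inv_pos.2 hθ)).2 (by simpa using h_int)
    exact this
  refine ⟨fun k => ?_, fun k => ?_, fun k hk => (hdd k hk).differentiableAt, ?_, ?_⟩
  · rw [mul_neg, h.symm, map_div₀, Complex.conj_ofReal]
  · rw [norm_div, Complex.norm_real, Real.norm_of_nonneg hE.le, div_le_one hE]
    exact (h.norm_le_supN _).trans (MemE.supN_le ht)
  · exact IntegrableOn.congr_fun (h_int2.const_mul _) (fun k hk => (hsq k hk).symm)
      measurableSet_Ioi
  · rw [setIntegral_congr_fun measurableSet_Ioi hsq, integral_const_mul,
      integral_comp_mul_left_Ioi (fun k => ‖deriv w k‖ ^ 2) 0 (inv_pos.2 hθ), mul_zero,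
      ← h.dL2_sq, inv_inv, smul_eq_mul]
    have h1 : t ^ (-(1 / 6 : ℝ)) * dL2 w ≤ EnormP t w :=
      le_add_of_nonneg_left ((norm_nonneg _).trans (h.norm_le_supN 0))
    have h2 : (t ^ (-(1 / 6 : ℝ))) ^ 2 = θ⁻¹ := by
      rw [← hθt, ← Real.rpow_natCast, ← Real.rpow_natCast θ, ← Real.rpow_mul hθ.le,
        ← Real.rpow_mul hθ.le, ← Real.rpow_neg_one]
      norm_num
    have h3 : (t ^ (-(1 / 6 : ℝ)) * dL2 w) ^ 2 ≤ EnormP t w ^ 2 :=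
      pow_le_pow_left₀ (mul_nonneg (by positivity) (dL2_nonneg w)) h1 2
    rw [mul_pow, h2] at h3
    calc _ = (θ⁻¹ * dL2 w ^ 2) / EnormP t w ^ 2 := by field_simp
      _ ≤ 1 := (div_le_one (by positivity)).2 h3

lemma closedBall_zero_prod (R : ℝ) :
    Metric.closedBall (0 : ℝ × ℝ) R = Icc (-R) R ×ˢ Icc (-R) R := by
  rw [← Prod.mk_zero_zero, ← closedBall_prod_same, Real.closedBall_eq_Icc, zero_sub, zero_add]

lemma Npartial_eq_tri {w : ℝ → ℝ → ℂ} {θ E R : ℝ} (hθ : 0 < θ) (hθt : θ ^ 3 = t) (hp : 0 < p)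
    (hE : 0 < E) (hR : 0 ≤ R) {W : ℝ → ℂ} (hW : ∀ k, W k = w t (θ⁻¹ * k) / (E : ℂ)) :
    Npartial w t p R = ((p ^ 3 * E ^ 3 / (p * θ) ^ 2 : ℝ) : ℂ) *
      (Complex.I * (cis (-(p * θ) ^ 3) *
        tri (p * θ * R) (p * θ) (modul W) (modul W) (modul W))) := by
  have hκ : 0 < p * θ := by positivity
  have hEc : (E : ℂ) ≠ 0 := by exact_mod_cast hE.ne'
  have hs := Measure.setIntegral_comp_smul_of_pos (volume : Measure (ℝ × ℝ))
    (fun q : ℝ × ℝ => modul W q.1 * modul W q.2 * modul W (p * θ - q.1 - q.2))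
    (Metric.closedBall 0 R) hκ
  rw [smul_closedBall _ _ hR, smul_zero, Real.norm_of_nonneg hκ.le, closedBall_zero_prod (_ * R),
    Module.finrank_prod, Module.finrank_self] at hs
  have hpt : ∀ q : ℝ × ℝ, Complex.exp (-(Complex.I *
          ((t * p ^ 3 * (1 - q.1 ^ 3 - q.2 ^ 3 - (1 - q.1 - q.2) ^ 3) : ℝ) : ℂ))) *
        w t (p * q.1) * w t (p * q.2) * w t (p * (1 - q.1 - q.2)) =
      (E ^ 3 : ℂ) * cis (-(p * θ) ^ 3) * (modul W ((p * θ) • q).1 * modul W ((p * θ) • q).2 *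
        modul W (p * θ - ((p * θ) • q).1 - ((p * θ) • q).2)) := by
    intro q
    have hw : ∀ x, W (p * θ * x) = w t (p * x) / E := fun x => by
      rw [hW]; congr 2; field_simp
    have e3 : p * θ - p * θ * q.1 - p * θ * q.2 = p * θ * (1 - q.1 - q.2) := by ring
    have ec : Complex.exp (-(Complex.I *
          ((t * p ^ 3 * (1 - q.1 ^ 3 - q.2 ^ 3 - (1 - q.1 - q.2) ^ 3) : ℝ) : ℂ))) =
        cis (-(p * θ) ^ 3) * (cis ((p * θ * q.1) ^ 3) * cis ((p * θ * q.2) ^ 3) *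
          cis ((p * θ * (1 - q.1 - q.2)) ^ 3)) := by
      rw [← cis_add, ← cis_add, ← cis_add, cis, ← hθt]
      congr 1
      push_cast
      ring
    simp only [Prod.smul_fst, Prod.smul_snd, smul_eq_mul]
    rw [e3, modul, modul, modul, hw, hw, hw, ec]
    field_simp
  have hi : ∫ q in Metric.closedBall (0 : ℝ × ℝ) R, Complex.exp (-(Complex.I *
          ((t * p ^ 3 * (1 - q.1 ^ 3 - q.2 ^ 3 - (1 - q.1 - q.2) ^ 3) : ℝ) : ℂ))) *
        w t (p * q.1) * w t (p * q.2) * w t (p * (1 - q.1 - q.2)) =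
      (E ^ 3 : ℂ) * cis (-(p * θ) ^ 3) * ((((p * θ) ^ 2)⁻¹ : ℝ) *
        tri (p * θ * R) (p * θ) (modul W) (modul W) (modul W)) := by
    rw [integral_congr_ae (Eventually.of_forall hpt), integral_const_mul, hs, tri,
      Complex.real_smul]
  rw [Npartial, hi]
  push_cast
  field_simp

lemma resBracket_scale {θ E : ℝ} (hθ : 0 < θ) (hE : 0 < E) {W : ℝ → ℂ}
    (hW : ∀ k, W k = w (θ⁻¹ * k) / (E : ℂ)) (p : ℝ) :
    ((E ^ 3 : ℝ) : ℂ) * resBracket W (p * θ) =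
      Complex.I * ((‖w p‖ : ℂ)) ^ 2 * w p -
        ((1 / Real.sqrt 3 : ℝ) : ℂ) *
          Complex.exp (-(Complex.I * ((8 * θ ^ 3 * p ^ 3 / 9 : ℝ) : ℂ))) * w (p / 3) ^ 3 := by
  have hEc : (E : ℂ) ≠ 0 := by exact_mod_cast hE.ne'
  have h1 : W (p * θ) = w p / E := by rw [hW]; congr 2; field_simp
  have h2 : W (p * θ / 3) = w (p / 3) / E := by rw [hW]; congr 2; field_simp
  have h3 : cis (-(8 * (p * θ) ^ 3 / 9)) =
      Complex.exp (-(Complex.I * ((8 * θ ^ 3 * p ^ 3 / 9 : ℝ) : ℂ))) := by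
    rw [cis]; congr 1; push_cast; ring
  rw [resBracket, h1, h2, h3, norm_div, Complex.norm_real, Real.norm_of_nonneg hE.le]
  push_cast
  field_simp

theorem MemE.norm_limit_sub_le {w : ℝ → ℝ → ℂ} (h : MemE (w t)) (ht : 0 < t) (hp : 0 < p)
    (hE : 0 < EnormP t (w t)) {Nval : ℂ}
    (hlim : Tendsto (fun R => Npartial w t p R) atTop (𝓝 Nval)) :
    ‖Nval - ((Real.pi * p ^ 3 / jap (p ^ 3 * t) : ℝ) : ℂ) *
        (Complex.I * ((‖w t p‖ : ℂ)) ^ 2 * w t p - ((1 / Real.sqrt 3 : ℝ) : ℂ) *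
          Complex.exp (-(Complex.I * ((8 * t * p ^ 3 / 9 : ℝ) : ℂ))) * (w t (p / 3)) ^ 3)‖
      ≤ expConst * p ^ 3 * EnormP t (w t) ^ 3 /
          ((p ^ 3 * t) ^ (5 / 6 : ℝ) * jap (p ^ 3 * t) ^ (1 / 4 : ℝ)) := by
  obtain ⟨θ, hθ, hθt⟩ : ∃ θ : ℝ, 0 < θ ∧ θ ^ 3 = t := by
    refine ⟨t ^ (1 / 3 : ℝ), by positivity, ?_⟩
    rw [← Real.rpow_natCast, ← Real.rpow_mul ht.le]
    norm_num
  set E := EnormP t (w t) with hEdef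
  set W : ℝ → ℂ := fun k => w t (θ⁻¹ * k) / (E : ℂ) with hWdef
  have raw : Raw W := h.raw hθ hθt hE
  have hW : ∀ k, W k = w t (θ⁻¹ * k) / (E : ℂ) := fun _ => rfl
  set κ := p * θ with hκdef
  have hκ : 0 < κ := by positivity
  have hκ3 : p ^ 3 * t = κ ^ 3 := by rw [hκdef, mul_pow, hθt]
  have hJ0 : 0 < jap (κ ^ 3) := zero_lt_one.trans_le (one_le_jap _)
  have hbr := resBracket_scale (w := w t) hθ hE hW p
  rw [hθt] at hbr
  rw [← hbr, hκ3]
  set A := κ ^ (1 / 2 : ℝ) * jap (κ ^ 3) ^ (1 / 4 : ℝ) with hA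
  have hA0 : 0 < A := by positivity
  set r : ℝ → ℝ := fun R => (κ * R) ^ (1 / 4 : ℝ) with hr
  have hκR : Tendsto (fun R : ℝ => κ * R) atTop atTop := tendsto_id.const_mul_atTop hκ
  have hrtop : Tendsto r atTop atTop :=
    (tendsto_rpow_atTop (by norm_num : (0 : ℝ) < 1 / 4)).comp hκR
  have hrlim : Tendsto (fun R => p ^ 3 * E ^ 3 / κ ^ 2 * (expConst / A + expConst / r R)) atTop
      (𝓝 (p ^ 3 * E ^ 3 / κ ^ 2 * (expConst / A + 0))) :=
    (tendsto_const_nhds.add (hrtop.const_div_atTop expConst)).const_mul _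
  have hfin : p ^ 3 * E ^ 3 / κ ^ 2 * (expConst / A + 0) =
      expConst * p ^ 3 * E ^ 3 / ((κ ^ 3) ^ (5 / 6 : ℝ) * jap (κ ^ 3) ^ (1 / 4 : ℝ)) := by
    have e : (κ ^ 3) ^ (5 / 6 : ℝ) = κ ^ 2 * κ ^ (1 / 2 : ℝ) := by
      rw [← Real.rpow_natCast, ← Real.rpow_mul hκ.le, ← Real.rpow_natCast κ 2,
        ← Real.rpow_add hκ]
      norm_num
    rw [e, hA]
    field_simp
    ring
  rw [← hfin]
  refine le_of_tendsto_of_tendsto (hlim.sub_const _).norm hrlim ?_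
  filter_upwards [eventually_ge_atTop 0, hrtop.eventually_ge_atTop 2,
    hκR.eventually_ge_atTop (κ + 1)] with R hR hr2 hRκ
  have hr4 : r R ^ 4 = κ * R := by
    rw [hr]
    simp only
    rw [← Real.rpow_natCast, ← Real.rpow_mul (by positivity)]
    norm_num
  have main := raw.norm_tri_sub_resBracket_le hκ hr2 (by rw [hr4]; exact hRκ)
  rw [hr4] at main
  rw [Npartial_eq_tri hθ hθt hp hE hR hW]
  have e : ((Real.pi * p ^ 3 / jap (κ ^ 3) : ℝ) : ℂ) * (((E ^ 3 : ℝ) : ℂ) * resBracket W κ) =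
      ((p ^ 3 * E ^ 3 / κ ^ 2 : ℝ) : ℂ) *
        (((Real.pi * κ ^ 2 / jap (κ ^ 3) : ℝ) : ℂ) * resBracket W κ) := by
    rw [← mul_assoc, ← mul_assoc, ← Complex.ofReal_mul, ← Complex.ofReal_mul]
    congr 2
    field_simp
  rw [e, ← mul_sub, norm_mul, Complex.norm_real, Real.norm_of_nonneg (by positivity)]
  exact mul_le_mul_of_nonneg_left main (by positivity)

/-- stationary phase expansion of the mKdV nonlinearity. -/
theorem nonlinearity_expansion :
    ∃ C : ℝ, 0 < C ∧
    ∀ I : Set ℝ, I.OrdConnected → I ⊆ Ioi 0 →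
    ∀ u : ESol I, FiniteEnorm I u →
    ∀ t ∈ I, ∀ p : ℝ, 0 < p →
    ∀ Nval : ℂ, Tendsto (fun R => Npartial u.w t p R) atTop (𝓝 Nval) →
      ‖Nval -
          ((Real.pi * p ^ 3 / jap (p ^ 3 * t) : ℝ) : ℂ) *
            (Complex.I * ((‖u.w t p‖ : ℂ)) ^ 2 * u.w t p -
              ((1 / Real.sqrt 3 : ℝ) : ℂ) *
                Complex.exp (-(Complex.I * ((8 * t * p ^ 3 / 9 : ℝ) : ℂ))) *
                (u.w t (p / 3)) ^ 3)‖
        ≤ C * p ^ 3 * EnormP t (u.w t) ^ 3 /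
            ((p ^ 3 * t) ^ (5 / 6 : ℝ) * jap (p ^ 3 * t) ^ (1 / 4 : ℝ)) := by
  refine ⟨expConst, expConst_pos, fun I _ hI u _ t htI p hp Nval hlim => ?_⟩
  have ht : 0 < t := hI htI
  have h := u.memE t htI
  have hsup : supN (u.w t) ≤ EnormP t (u.w t) := MemE.supN_le ht
  have hsup0 : 0 ≤ supN (u.w t) := (norm_nonneg _).trans (h.norm_le_supN 0)
  rcases (hsup0.trans hsup).eq_or_lt with hE | hE
  · have hw : ∀ k, u.w t k = 0 := fun k =>
      norm_le_zero_iff.1 ((h.norm_le_supN k).trans (hsup.trans hE.symm.le))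
    have hN : Nval = 0 := by
      refine tendsto_nhds_unique hlim ?_
      simp [Npartial, hw]
    rw [hN, ← hE, hw, hw]
    simp
  · exact h.norm_limit_sub_le ht hp hE hlim

end MKdVPaper
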